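/- Let d = 3. Let q, r, q̄, r̄ ≥ 2 satisfy 1/q ≤ (7/6)(1/2 − 1/r) and 1/q̄ ≤ (7/6)(1/2 − 1/r̄). Then there is a constant C = C(q,r,q̄,r̄) such that for all f, g ∈ ℓ²(ℤ³) and all F ∈ L^{q̄'}_t ℓ^{r̄'}_x, the function u(t) = cos(t√(1−Δ))f + (sin(t√(1−Δ))/√(1−Δ))g + ∫₀^t (sin((t−s)√(1−Δ))/√(1−Δ))F(s) ds satisfies ‖u‖_{L^q_t ℓ^r_x} ≤ C(‖f‖_{ℓ²} + ‖g‖_{ℓ²} + ‖F‖_{L^{q̄'}_t ℓ^{r̄'}_x}). -/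

import Mathlib

open MeasureTheory Real
open scoped ENNReal

noncomputable section

/-- Dispersion relation of the discrete Klein--Gordon equation on `ℤ^d`. -/
def omegaKG (d : ℕ) (ξ : Fin d → ℝ) : ℝ :=
  Real.sqrt (1 + ∑ j : Fin d, 2 * (1 - Real.cos (ξ j)))

/-- The fundamental domain `[0, 2π]^d` of the torus. -/
def cube (d : ℕ) : Set (Fin d → ℝ) := Set.Icc 0 (fun _ => 2 * Real.pi)

/-- The convolution kernel of the Fourier multiplier on `ℤ^d` with symbol `m(ξ)`. -/
def multKernel (d : ℕ) (m : (Fin d → ℝ) → ℝ) (x : Fin d → ℤ) : ℂ :=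
  ((((2 * Real.pi) ^ d)⁻¹ : ℝ) : ℂ) *
    ∫ ξ in cube d,
      Complex.exp (Complex.I * ((∑ j : Fin d, (x j : ℝ) * ξ j : ℝ) : ℂ)) * ((m ξ : ℝ) : ℂ)

/-- The propagator `cos(t√(1−Δ))`, realized as the Fourier multiplier with symbol
`cos(t ω(ξ))`. -/
def cosProp (d : ℕ) (t : ℝ) (f : (Fin d → ℤ) → ℂ) (x : Fin d → ℤ) : ℂ :=
  ∑' y : Fin d → ℤ, multKernel d (fun ξ => Real.cos (t * omegaKG d ξ)) (x - y) * f y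

/-- The propagator `sin(t√(1−Δ))/√(1−Δ)`, realized as the Fourier multiplier with symbol
`sin(t ω(ξ))/ω(ξ)`. -/
def sinProp (d : ℕ) (t : ℝ) (f : (Fin d → ℤ) → ℂ) (x : Fin d → ℤ) : ℂ :=
  ∑' y : Fin d → ℤ, multKernel d (fun ξ => Real.sin (t * omegaKG d ξ) / omegaKG d ξ) (x - y) * f y

/-- The operator `√(1−Δ)`, realized as the Fourier multiplier with symbol `ω(ξ)`. -/
def sqrtOneSubLap (d : ℕ) (f : (Fin d → ℤ) → ℂ) (x : Fin d → ℤ) : ℂ :=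
  ∑' y : Fin d → ℤ, multKernel d (omegaKG d) (x - y) * f y

/-- The solution of the inhomogeneous discrete Klein--Gordon equation with data `(f,g)`
and forcing term `F`, given by Duhamel's formula. -/
def duhamel (d : ℕ) (t : ℝ) (f g : (Fin d → ℤ) → ℂ) (F : ℝ → (Fin d → ℤ) → ℂ)
    (x : Fin d → ℤ) : ℂ :=
  cosProp d t f x + sinProp d t g x + ∫ s in (0:ℝ)..t, sinProp d (t - s) (F s) x

/-- The `L^q` norm in time of an `ℝ≥0∞`-valued function. -/
def lqNorm (q : ℝ≥0∞) (g : ℝ → ℝ≥0∞) : ℝ≥0∞ :=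
  if q = ∞ then essSup g volume else (∫⁻ t, g t ^ q.toReal) ^ (1 / q.toReal)

/-- The mixed space-time norm `‖F‖_{L^q_t ℓ^r_x}`. -/
def mixedNorm (d : ℕ) (q r : ℝ≥0∞) (F : ℝ → (Fin d → ℤ) → ℂ) : ℝ≥0∞ :=
  lqNorm q fun t => eLpNorm (F t) r Measure.count

section

open Complex (I I_sq conj_I conj_mul' conj_ofReal continuous_conj continuous_ofReal exp_conj
  exp_im exp_re imCLM imCLM_apply measurable_ofReal norm_I norm_conj norm_real ofReal_add
  ofReal_neg ofReal_one ofReal_sum reCLM reCLM_apply real_smul)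
open ContinuousOn (intervalIntegrable_of_Icc)
open ENNReal (div_le_div_left div_top mul_ne_top mul_top ofReal ofReal_coe_nnreal
  ofReal_le_ofReal ofReal_mul ofReal_ne_top ofReal_ofNat ofReal_pow ofReal_sum_of_nonneg
  pow_le_pow_left_iff toReal_div toReal_mono toReal_ofNat toReal_one toReal_pos top_rpow_of_pos
  tsum_eq_iSup_sum)
open Filter (Eventually Tendsto atTop univ_mem)
open Finset (measurable_sum mem_range mul_sum range single_le_sum sum_comm sum_congr sum_div
  sum_eq_zero sum_le_sum sum_mul sum_nonneg sum_range_succ)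
open MeasureTheory.Measure (count pi restrict_pi_pi)
open Function (uncurry)
open Nat (cast_nonneg)
open Set (Icc Icc_subset_Icc Ici Iic Iio Ioc Ioi Ioo Ioo_subset_Icc_self indicator_of_mem
  indicator_of_notMem mem_Icc mem_Ioi uIcc uIcc_of_le uIoc_of_le univ)
open intervalIntegral (integral_add_adjacent_intervals integral_comp_add_left
  integral_comp_add_right integral_comp_sub_left integral_congr integral_deriv_smul_comp''
  integral_eq_sub_of_hasDerivAt integral_interval_sub_left integral_mono_interval
  integral_mono_on integral_of_le integral_same integral_symm)
open scoped ComplexConjugate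

/-- The unimodular exponential `e^{ix}`. -/
local notation "cis(" x ")" => Complex.exp (Complex.I * ((x : ℝ) : ℂ))

/-! ### Oscillatory integrals in one variable -/

/-- `M` bounds the integral of `e^{iΦ}` over every subinterval of `[a, b]`. -/
def OscBound (Φ : ℝ → ℝ) (a b M : ℝ) : Prop :=
  ∀ c d, a ≤ c → c ≤ d → d ≤ b → ‖∫ x in c..d, cis(Φ x)‖ ≤ M

lemma norm_exp_I_mul_real (x : ℝ) : ‖cis(x)‖ = 1 := by simp

lemma OscBound.mono {Φ : ℝ → ℝ} {a b a' b' M M' : ℝ} (h : OscBound Φ a b M)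
    (ha : a ≤ a') (hb : b' ≤ b) (hM : M ≤ M') : OscBound Φ a' b' M' :=
  fun c d hc hcd hd => (h c d (ha.trans hc) hcd (hd.trans hb)).trans hM

lemma oscBound_length (Φ : ℝ → ℝ) {a b L : ℝ} (h : b - a ≤ L) : OscBound Φ a b L := by
  intro c d hc hcd hd
  calc ‖∫ x in c..d, cis(Φ x)‖ ≤ 1 * |d - c| := by
        apply intervalIntegral.norm_integral_le_of_norm_le_const
        intro x _; exact (norm_exp_I_mul_real _).le
    _ ≤ L := by rw [abs_of_nonneg (by linarith)]; linarith

lemma continuousOn_exp_phase {Φ : ℝ → ℝ} {s : Set ℝ} (h : ContinuousOn Φ s) :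
    ContinuousOn (fun x => cis(Φ x)) s := by fun_prop

lemma OscBound.nonneg {Φ : ℝ → ℝ} {a b M : ℝ} (h : OscBound Φ a b M) (hab : a ≤ b) : 0 ≤ M :=
  (norm_nonneg _).trans (h a b le_rfl hab le_rfl)

lemma OscBound.append {Φ : ℝ → ℝ} {a b c M₁ M₂ : ℝ} (hac : a ≤ c) (hcb : c ≤ b)
    (hΦ : ContinuousOn Φ (Icc a b))
    (h₁ : OscBound Φ a c M₁) (h₂ : OscBound Φ c b M₂) : OscBound Φ a b (M₁ + M₂) := by
  intro x y hx hxy hy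
  have n₁ := h₁.nonneg hac
  have n₂ := h₂.nonneg hcb
  rcases le_total y c with hyc | hyc
  · linarith [h₁ x y hx hxy hyc]
  rcases le_total c x with hcx | hcx
  · linarith [h₂ x y hcx hxy hy]
  have ii : ∀ u v, a ≤ u → u ≤ v → v ≤ b → IntervalIntegrable
      (fun x => cis(Φ x)) volume u v := by
    intro u v hu huv hv
    refine intervalIntegrable_of_Icc huv ?_
    exact continuousOn_exp_phase (hΦ.mono (Icc_subset_Icc hu hv))
  rw [← integral_add_adjacent_intervals (ii x c hx hcx hcb) (ii c y hac hyc hy)]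
  exact (norm_add_le _ _).trans (add_le_add (h₁ x c hx hcx le_rfl) (h₂ c y le_rfl hyc hy))

lemma OscBound.neg {Φ : ℝ → ℝ} {a b M : ℝ} (h : OscBound (fun x => -Φ x) a b M) :
    OscBound Φ a b M := by
  intro c d hc hcd hd
  have := h c d hc hcd hd
  have e : ∫ x in c..d, cis(Φ x) =
      conj (∫ x in c..d, cis(-Φ x)) := by
    rw [integral_of_le hcd, integral_of_le hcd, ← integral_conj]
    congr 1; ext x
    rw [← exp_conj]; simp
  rw [e, norm_conj]
  exact this

/-- Integration by parts when the phase has no stationary point. -/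
lemma norm_integral_exp_le_of_deriv_pos {Φ Φ' Φ'' : ℝ → ℝ} {a b μ : ℝ} (hab : a ≤ b) (hμ : 0 < μ)
    (h1 : ∀ x ∈ Icc a b, HasDerivAt Φ (Φ' x) x)
    (h2 : ∀ x ∈ Icc a b, HasDerivAt Φ' (Φ'' x) x)
    (h3 : ContinuousOn Φ'' (Icc a b)) (h4 : ∀ x ∈ Icc a b, μ ≤ Φ' x) :
    ‖∫ x in a..b, cis(Φ x)‖ ≤
      2 / μ + ∫ x in a..b, |Φ'' x| / Φ' x ^ 2 := by
  have hc1 : ContinuousOn Φ (Icc a b) := fun x hx => (h1 x hx).continuousAt.continuousWithinAt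
  have hc2 : ContinuousOn Φ' (Icc a b) := fun x hx => (h2 x hx).continuousAt.continuousWithinAt
  have hpos : ∀ x ∈ Icc a b, Φ' x ≠ 0 := fun x hx => (hμ.trans_le (h4 x hx)).ne'
  set u : ℝ → ℂ := fun x => ((Φ' x)⁻¹ : ℝ)
  set u' : ℝ → ℂ := fun x => ((-(Φ'' x) / Φ' x ^ 2 : ℝ) : ℂ)
  set v : ℝ → ℂ := fun x => -I * cis(Φ x)
  set v' : ℝ → ℂ := fun x => Φ' x * cis(Φ x)
  have hu : ∀ x ∈ uIcc a b, HasDerivAt u (u' x) x := by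
    intro x hx; rw [uIcc_of_le hab] at hx
    exact ((h2 x hx).inv (hpos x hx)).ofReal_comp
  have hv : ∀ x ∈ uIcc a b, HasDerivAt v (v' x) x := by
    intro x hx; rw [uIcc_of_le hab] at hx
    have := (((h1 x hx).ofReal_comp.const_mul I).cexp).const_mul (-I)
    refine this.congr_deriv ?_
    change -I * (cis(Φ x) * (I * (Φ' x : ℂ))) =
      (Φ' x : ℂ) * cis(Φ x)
    linear_combination (-(Φ' x : ℂ) * cis(Φ x)) * I_sq
  have hcu' : ContinuousOn (fun x => -(Φ'' x) / Φ' x ^ 2) (Icc a b) :=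
    h3.neg.div (hc2.pow 2) (fun x hx => pow_ne_zero 2 (hpos x hx))
  have hu' : IntervalIntegrable u' volume a b :=
    intervalIntegrable_of_Icc hab (continuous_ofReal.comp_continuousOn hcu')
  have hv' : IntervalIntegrable v' volume a b := by
    refine intervalIntegrable_of_Icc hab ?_
    exact (continuous_ofReal.comp_continuousOn hc2).mul (continuousOn_exp_phase hc1)
  have key := intervalIntegral.integral_mul_deriv_eq_deriv_mul hu hv hu' hv'
  have e1 : ∫ x in a..b, cis(Φ x) = ∫ x in a..b, u x * v' x := by
    apply integral_congr
    intro x hx; rw [uIcc_of_le hab] at hx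
    have : (Φ' x : ℂ) ≠ 0 := by exact_mod_cast hpos x hx
    simp only [u, v']; push_cast; field_simp
  have nv : ∀ x, ‖v x‖ = 1 := fun x => by
    simp only [v, norm_mul, norm_neg, norm_I, one_mul, norm_exp_I_mul_real]
  have nu : ∀ x ∈ Icc a b, ‖u x‖ ≤ 1 / μ := by
    intro x hx
    simp only [u, norm_real, norm_inv, norm_eq_abs]
    rw [abs_of_pos (hμ.trans_le (h4 x hx)), inv_eq_one_div]
    exact one_div_le_one_div_of_le hμ (h4 x hx)
  rw [e1, key]
  have b1 : ‖u b * v b - u a * v a‖ ≤ 2 / μ := by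
    refine (norm_sub_le _ _).trans ?_
    rw [norm_mul (u b), norm_mul (u a), nv, nv, mul_one, mul_one]
    have := nu b ⟨hab, le_rfl⟩; have := nu a ⟨le_rfl, hab⟩
    calc _ ≤ 1 / μ + 1 / μ := by linarith
      _ = _ := by ring
  have b2 : ‖∫ x in a..b, u' x * v x‖ ≤ ∫ x in a..b, |Φ'' x| / Φ' x ^ 2 := by
    refine (intervalIntegral.norm_integral_le_integral_norm hab).trans (le_of_eq ?_)
    apply integral_congr
    intro x hx
    simp only [norm_mul, nv, mul_one, u', norm_real, norm_eq_abs, abs_div, abs_neg,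
      abs_pow, sq_abs]
  exact (norm_sub_le _ _).trans (add_le_add b1 b2)

/-- First derivative test: the phase derivative is monotone and bounded below. -/
lemma oscBound_of_deriv_ge {Φ Φ' Φ'' : ℝ → ℝ} {a b μ : ℝ} (hμ : 0 < μ)
    (h1 : ∀ x ∈ Icc a b, HasDerivAt Φ (Φ' x) x)
    (h2 : ∀ x ∈ Icc a b, HasDerivAt Φ' (Φ'' x) x)
    (h3 : ContinuousOn Φ'' (Icc a b)) (h4 : ∀ x ∈ Icc a b, μ ≤ Φ' x)
    (h5 : (∀ x ∈ Icc a b, 0 ≤ Φ'' x) ∨ (∀ x ∈ Icc a b, Φ'' x ≤ 0)) :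
    OscBound Φ a b (3 / μ) := by
  intro c d hc hcd hd
  have sub : Icc c d ⊆ Icc a b := Icc_subset_Icc hc hd
  have base := norm_integral_exp_le_of_deriv_pos hcd hμ (fun x hx => h1 x (sub hx))
    (fun x hx => h2 x (sub hx)) (h3.mono sub) (fun x hx => h4 x (sub hx))
  have hpos : ∀ x ∈ Icc c d, 0 < Φ' x := fun x hx => hμ.trans_le (h4 x (sub hx))
  have hc2 : ContinuousOn Φ' (Icc c d) :=
    fun x hx => (h2 x (sub hx)).continuousAt.continuousWithinAt
  have hcu' : ContinuousOn (fun x => -(Φ'' x) / Φ' x ^ 2) (Icc c d) :=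
    (h3.mono sub).neg.div (hc2.pow 2) (fun x hx => pow_ne_zero 2 (hpos x hx).ne')
  have ftc : ∫ x in c..d, -(Φ'' x) / Φ' x ^ 2 = (Φ' d)⁻¹ - (Φ' c)⁻¹ := by
    apply integral_eq_sub_of_hasDerivAt
    · intro x hx; rw [uIcc_of_le hcd] at hx
      exact (h2 x (sub hx)).inv (hpos x hx).ne'
    · exact intervalIntegrable_of_Icc hcd hcu'
  have inv_le : ∀ x ∈ Icc c d, (Φ' x)⁻¹ ≤ 1 / μ := by
    intro x hx; rw [inv_eq_one_div]; exact one_div_le_one_div_of_le hμ (h4 x (sub hx))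
  have inv_pos : ∀ x ∈ Icc c d, 0 < (Φ' x)⁻¹ := fun x hx => inv_pos.mpr (hpos x hx)
  have mc : c ∈ Icc c d := ⟨le_rfl, hcd⟩
  have md : d ∈ Icc c d := ⟨hcd, le_rfl⟩
  have : ∫ x in c..d, |Φ'' x| / Φ' x ^ 2 ≤ 1 / μ := by
    rcases h5 with h5 | h5
    · have : ∫ x in c..d, |Φ'' x| / Φ' x ^ 2 = -((Φ' d)⁻¹ - (Φ' c)⁻¹) := by
        rw [← ftc, ← intervalIntegral.integral_neg]
        apply integral_congr
        intro x hx; rw [uIcc_of_le hcd] at hx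
        simp only [abs_of_nonneg (h5 x (sub hx))]; ring
      rw [this]; linarith [inv_le c mc, inv_pos d md]
    · have : ∫ x in c..d, |Φ'' x| / Φ' x ^ 2 = ((Φ' d)⁻¹ - (Φ' c)⁻¹) := by
        rw [← ftc]
        apply integral_congr
        intro x hx; rw [uIcc_of_le hcd] at hx
        simp only [abs_of_nonpos (h5 x (sub hx))]
      rw [this]; linarith [inv_le d md, inv_pos c mc]
  calc _ ≤ 2 / μ + 1 / μ := base.trans (by linarith)
    _ = 3 / μ := by ring

/-- Second derivative test. -/
lemma oscBound_of_deriv2_ge {Φ Φ' Φ'' : ℝ → ℝ} {a b l : ℝ} (hl : 0 < l)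
    (h1 : ∀ x ∈ Icc a b, HasDerivAt Φ (Φ' x) x)
    (h2 : ∀ x ∈ Icc a b, HasDerivAt Φ' (Φ'' x) x)
    (h3 : ContinuousOn Φ'' (Icc a b)) (h4 : ∀ x ∈ Icc a b, l ≤ Φ'' x) :
    OscBound Φ a b (8 / √l) := by
  rcases lt_or_ge b a with hba | hab
  · intro c d hc hcd hd; linarith
  have hsl : 0 < √l := sqrt_pos.mpr hl
  have hss : √l * √l = l := mul_self_sqrt hl.le
  have hc1 : ContinuousOn Φ (Icc a b) := fun x hx => (h1 x hx).continuousAt.continuousWithinAt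
  have hc2 : ContinuousOn Φ' (Icc a b) := fun x hx => (h2 x hx).continuousAt.continuousWithinAt
  have slope : ∀ x ∈ Icc a b, ∀ y ∈ Icc a b, x ≤ y → l * (y - x) ≤ Φ' y - Φ' x := by
    apply Convex.mul_sub_le_image_sub_of_le_deriv (convex_Icc a b) hc2
    · intro x hx; exact (h2 x (interior_subset hx)).differentiableAt.differentiableWithinAt
    · intro x hx; rw [(h2 x (interior_subset hx)).deriv]; exact h4 x (interior_subset hx)
  obtain ⟨c, hc, hneg, hpos⟩ : ∃ c ∈ Icc a b, (c = a ∨ Φ' c ≤ 0) ∧ (c = b ∨ 0 ≤ Φ' c) := by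
    by_cases ha : 0 ≤ Φ' a
    · exact ⟨a, ⟨le_rfl, hab⟩, Or.inl rfl, Or.inr ha⟩
    by_cases hb : Φ' b ≤ 0
    · exact ⟨b, ⟨hab, le_rfl⟩, Or.inr hb, Or.inl rfl⟩
    push Not at ha hb
    obtain ⟨c, hc, h0⟩ := intermediate_value_Icc hab hc2 ⟨ha.le, hb.le⟩
    exact ⟨c, hc, Or.inr h0.le, Or.inr h0.ge⟩
  set δ := 1 / √l with hδ
  have hδ0 : 0 < δ := by positivity
  have hlδ : l * δ = √l := by
    rw [hδ, mul_one_div, div_eq_iff hsl.ne', hss]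
  -- right half
  have right : OscBound Φ c b (4 / √l) := by
    rcases le_total b (c + δ) with h | h
    · apply oscBound_length
      calc b - c ≤ δ := by linarith
        _ ≤ _ := by rw [hδ]; gcongr; norm_num
    · have hsub : Icc (c + δ) b ⊆ Icc a b := Icc_subset_Icc (by linarith [hc.1]) le_rfl
      have h0 : 0 ≤ Φ' c := hpos.resolve_left (by intro e; linarith)
      have := oscBound_of_deriv_ge hsl (fun x hx => h1 x (hsub hx)) (fun x hx => h2 x (hsub hx))
        (h3.mono hsub) (fun x hx => by
          have := slope c hc x (hsub hx) (by linarith [hx.1])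
          have : l * δ ≤ l * (x - c) := by gcongr; linarith [hx.1]
          linarith) (Or.inl fun x hx => hl.le.trans (h4 x (hsub hx)))
      have l1 : OscBound Φ c (c + δ) δ := oscBound_length _ (by linarith)
      refine (l1.append (by linarith) h (hc1.mono (Icc_subset_Icc hc.1 le_rfl)) this).mono
        le_rfl le_rfl (le_of_eq ?_)
      rw [hδ]; ring
  have left : OscBound Φ a c (4 / √l) := by
    rcases le_total (c - δ) a with h | h
    · apply oscBound_length
      calc c - a ≤ δ := by linarith
        _ ≤ _ := by rw [hδ]; gcongr; norm_num
    · have hsub : Icc a (c - δ) ⊆ Icc a b := Icc_subset_Icc le_rfl (by linarith [hc.2])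
      have h0 : Φ' c ≤ 0 := hneg.resolve_left (by intro e; linarith)
      have := OscBound.neg <| oscBound_of_deriv_ge (Φ := fun x => - Φ x) (Φ' := fun x => -Φ' x)
        (Φ'' := fun x => -Φ'' x) hsl (fun x hx => (h1 x (hsub hx)).neg)
        (fun x hx => (h2 x (hsub hx)).neg)
        (h3.mono hsub).neg (fun x hx => by
          have := slope x (hsub hx) c hc (by linarith [hx.2])
          have : l * δ ≤ l * (c - x) := by gcongr; linarith [hx.2]
          linarith) (Or.inr fun x hx => by simpa using hl.le.trans (h4 x (hsub hx)))
      have l1 : OscBound Φ (c - δ) c δ := oscBound_length _ (by linarith)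
      refine (this.append h (by linarith) (hc1.mono (Icc_subset_Icc le_rfl hc.2)) l1).mono
        le_rfl le_rfl (le_of_eq ?_)
      rw [hδ]; ring
  refine (left.append hc.1 hc.2 hc1 right).mono le_rfl le_rfl (le_of_eq ?_)
  ring

/-- Second derivative test, with a second derivative that does not change sign. -/
lemma oscBound_of_abs_deriv2_ge {Φ Φ' Φ'' : ℝ → ℝ} {a b l : ℝ} (hl : 0 < l)
    (h1 : ∀ x ∈ Icc a b, HasDerivAt Φ (Φ' x) x)
    (h2 : ∀ x ∈ Icc a b, HasDerivAt Φ' (Φ'' x) x)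
    (h3 : ContinuousOn Φ'' (Icc a b)) (h4 : ∀ x ∈ Icc a b, l ≤ |Φ'' x|) :
    OscBound Φ a b (8 / √l) := by
  by_cases hs : ∀ x ∈ Icc a b, 0 ≤ Φ'' x
  · exact oscBound_of_deriv2_ge hl h1 h2 h3 fun x hx => by
      simpa [abs_of_nonneg (hs x hx)] using h4 x hx
  push Not at hs
  obtain ⟨x₀, hx₀, hneg⟩ := hs
  have hall : ∀ x ∈ Icc a b, Φ'' x ≤ 0 := by
    intro x hx
    by_contra hcon
    push Not at hcon
    have : (0 : ℝ) ∈ (Icc a b).image Φ'' :=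
      (isPreconnected_Icc.image Φ'' h3).ordConnected.out ⟨x₀, hx₀, rfl⟩ ⟨x, hx, rfl⟩
        ⟨hneg.le, hcon.le⟩
    obtain ⟨z, hz, hz0⟩ := this
    have := h4 z hz
    rw [hz0, abs_zero] at this
    linarith
  apply OscBound.neg
  exact oscBound_of_deriv2_ge (Φ' := fun x => -Φ' x) (Φ'' := fun x => -Φ'' x) hl
    (fun x hx => (h1 x hx).neg) (fun x hx => (h2 x hx).neg) h3.neg
    fun x hx => by simpa [abs_of_nonpos (hall x hx)] using h4 x hx

/-- A complex amplitude with bounded size and variation. -/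
structure BVAmp (G G' : ℝ → ℂ) (a b A : ℝ) : Prop where
  deriv : ∀ x ∈ Set.Icc a b, HasDerivAt G (G' x) x
  cont : ContinuousOn G' (Set.Icc a b)
  bound : ∀ x ∈ Set.Icc a b, ‖G x‖ ≤ A
  var : ∫ x in a..b, ‖G' x‖ ≤ A

lemma BVAmp.continuousOn {G G' : ℝ → ℂ} {a b A : ℝ} (h : BVAmp G G' a b A) :
    ContinuousOn G (Icc a b) :=
  fun x hx => (h.deriv x hx).continuousAt.continuousWithinAt

lemma BVAmp.nonneg {G G' : ℝ → ℂ} {a b A : ℝ} (h : BVAmp G G' a b A) (hab : a ≤ b) : 0 ≤ A :=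
  (norm_nonneg _).trans (h.bound a ⟨le_rfl, hab⟩)

lemma BVAmp.weaken {G G' : ℝ → ℂ} {a b A a' b' A' : ℝ} (h : BVAmp G G' a b A)
    (ha : a ≤ a') (hb : b' ≤ b) (hab : a' ≤ b') (hA : A ≤ A') : BVAmp G G' a' b' A' := by
  have sub : Icc a' b' ⊆ Icc a b := Icc_subset_Icc ha hb
  refine ⟨fun x hx => h.deriv x (sub hx), h.cont.mono sub, fun x hx =>
      (h.bound x (sub hx)).trans hA,
    le_trans ?_ (h.var.trans hA)⟩
  apply integral_mono_interval ha hab hb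
  · exact .of_forall fun x => norm_nonneg _
  · exact intervalIntegrable_of_Icc (ha.trans (hab.trans hb)) h.cont.norm

lemma BVAmp.mul {G G' K K' : ℝ → ℂ} {a b A B : ℝ} (hab : a ≤ b) (hG : BVAmp G G' a b A)
    (hK : BVAmp K K' a b B) :
    BVAmp (fun x => G x * K x) (fun x => G' x * K x + G x * K' x) a b (2 * A * B) := by
  have hA := hG.nonneg hab
  have hB := hK.nonneg hab
  refine ⟨fun x hx => (hG.deriv x hx).mul (hK.deriv x hx),
    (hG.cont.mul hK.continuousOn).add (hG.continuousOn.mul hK.cont), fun x hx => ?_, ?_⟩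
  · rw [norm_mul]
    have := mul_le_mul (hG.bound x hx) (hK.bound x hx) (norm_nonneg _) hA
    nlinarith [mul_nonneg hA hB]
  · have i1 : IntervalIntegrable (fun x => ‖G' x‖) volume a b :=
      intervalIntegrable_of_Icc hab hG.cont.norm
    have i2 : IntervalIntegrable (fun x => ‖K' x‖) volume a b :=
      intervalIntegrable_of_Icc hab hK.cont.norm
    calc ∫ x in a..b, ‖G' x * K x + G x * K' x‖ ≤ ∫ x in a..b, (‖G' x‖ * B + A * ‖K' x‖) := by
          apply integral_mono_on hab
          · exact intervalIntegrable_of_Icc hab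
                (((hG.cont.mul hK.continuousOn).add (hG.continuousOn.mul hK.cont)).norm)
          · exact (i1.mul_const B).add (i2.const_mul A)
          · intro x hx
            refine (norm_add_le _ _).trans ?_
            rw [norm_mul, norm_mul]
            exact add_le_add (mul_le_mul_of_nonneg_left (hK.bound x hx) (norm_nonneg _))
              (mul_le_mul_of_nonneg_right (hG.bound x hx) (norm_nonneg _))
      _ = (∫ x in a..b, ‖G' x‖) * B + A * ∫ x in a..b, ‖K' x‖ := by simp_all
      _ ≤ A * B + A * B := add_le_add (mul_le_mul_of_nonneg_right hG.var hB)
          (mul_le_mul_of_nonneg_left hK.var hA)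
      _ = 2 * A * B := by ring

/-- Monotone positive amplitudes. -/
lemma BVAmp.of_antitone {G G' : ℝ → ℝ} {a b : ℝ} (hab : a ≤ b)
    (h1 : ∀ x ∈ Icc a b, HasDerivAt G (G' x) x) (h2 : ContinuousOn G' (Icc a b))
    (h3 : ∀ x ∈ Icc a b, G' x ≤ 0) (h4 : ∀ x ∈ Icc a b, 0 ≤ G x) :
    BVAmp (fun x => (G x : ℂ)) (fun x => (G' x : ℂ)) a b (G a) := by
  have anti : AntitoneOn G (Icc a b) := by
    apply antitoneOn_of_deriv_nonpos (convex_Icc a b)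
    · exact fun x hx => (h1 x hx).continuousAt.continuousWithinAt
    · exact fun x hx => (h1 x (interior_subset hx)).differentiableAt.differentiableWithinAt
    · intro x hx; rw [(h1 x (interior_subset hx)).deriv]; exact h3 x (interior_subset hx)
  refine ⟨fun x hx => (h1 x hx).ofReal_comp, continuous_ofReal.comp_continuousOn h2,
    fun x hx => ?_, ?_⟩
  · rw [norm_real, norm_eq_abs, abs_of_nonneg (h4 x hx)]
    exact anti ⟨le_rfl, hab⟩ hx hx.1
  · have e : ∫ x in a..b, ‖(G' x : ℂ)‖ = -∫ x in a..b, G' x := by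
      rw [← intervalIntegral.integral_neg]
      apply integral_congr
      intro x hx; rw [uIcc_of_le hab] at hx
      simp only [norm_real, norm_eq_abs, abs_of_nonpos (h3 x hx)]
    rw [e, integral_eq_sub_of_hasDerivAt
      (fun x hx => h1 x (by rwa [uIcc_of_le hab] at hx))
      (intervalIntegrable_of_Icc hab h2)]
    linarith [h4 b ⟨hab, le_rfl⟩]

/-- An amplitude of bounded variation costs only a factor. -/
lemma OscBound.amp {Φ : ℝ → ℝ} {G G' : ℝ → ℂ} {a b M A : ℝ} (hab : a ≤ b)
    (hΦ : ContinuousOn Φ (Icc a b)) (h : OscBound Φ a b M) (hG : BVAmp G G' a b A) :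
    ‖∫ x in a..b, cis(Φ x) * G x‖ ≤ 2 * M * A := by
  have hM := h.nonneg hab
  have hA := hG.nonneg hab
  -- extend the phase to a continuous function
  set ψ : ℝ → ℂ := Set.IccExtend hab (fun x : Icc a b => cis(Φ x))
  have hψ : Continuous ψ := by
    apply Continuous.Icc_extend'
    exact continuousOn_iff_continuous_domRestrict.mp (continuousOn_exp_phase hΦ)
  have hψe : ∀ x ∈ Icc a b, ψ x = cis(Φ x) := fun x hx =>
    Set.IccExtend_of_mem hab _ hx
  set F : ℝ → ℂ := fun x => ∫ y in a..x, ψ y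
  have hF : ∀ x, HasDerivAt F (ψ x) x := fun x => hψ.integral_hasStrictDerivAt a x |>.hasDerivAt
  have hFb : ∀ x ∈ Icc a b, ‖F x‖ ≤ M := by
    intro x hx
    have : F x = ∫ y in a..x, cis(Φ y) := by
      apply integral_congr
      intro y hy; rw [uIcc_of_le hx.1] at hy
      exact hψe y ⟨hy.1, hy.2.trans hx.2⟩
    rw [this]; exact h a x le_rfl hx.1 hx.2
  have e : ∫ x in a..b, cis(Φ x) * G x = ∫ x in a..b, ψ x * G x := by
    apply integral_congr
    intro y hy; simp_all
  have hFc : Continuous F := continuous_iff_continuousAt.mpr fun x => (hF x).continuousAt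
  have parts := intervalIntegral.integral_deriv_mul_eq_sub (a := a) (b := b)
    (u := F) (v := G) (u' := ψ) (v' := G')
    (fun x _ => hF x) (fun x hx => hG.deriv x (by rwa [uIcc_of_le hab] at hx))
    (hψ.intervalIntegrable a b)
    (intervalIntegrable_of_Icc hab hG.cont)
  have i1 : IntervalIntegrable (fun x => ψ x * G x) volume a b :=
    intervalIntegrable_of_Icc hab (hψ.continuousOn.mul hG.continuousOn)
  have i2 : IntervalIntegrable (fun x => F x * G' x) volume a b :=
    intervalIntegrable_of_Icc hab (hFc.continuousOn.mul hG.cont)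
  rw [intervalIntegral.integral_add i1 i2] at parts
  have hFa : F a = 0 := integral_same
  rw [hFa, zero_mul, sub_zero] at parts
  rw [e, eq_sub_of_add_eq parts]
  have mb : b ∈ Icc a b := ⟨hab, le_rfl⟩
  have b1 : ‖F b * G b‖ ≤ M * A := by
    rw [norm_mul]; exact mul_le_mul (hFb b mb) (hG.bound b mb) (norm_nonneg _) hM
  have b2 : ‖∫ x in a..b, F x * G' x‖ ≤ M * A := by
    calc ‖∫ x in a..b, F x * G' x‖ ≤ ∫ x in a..b, ‖F x * G' x‖ :=
          intervalIntegral.norm_integral_le_integral_norm hab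
      _ ≤ ∫ x in a..b, M * ‖G' x‖ := by
          apply integral_mono_on hab i2.norm
          · exact intervalIntegrable_of_Icc hab (continuousOn_const.mul hG.cont.norm)
          · intro x hx; rw [norm_mul]
            exact mul_le_mul_of_nonneg_right (hFb x hx) (norm_nonneg _)
      _ = M * ∫ x in a..b, ‖G' x‖ := intervalIntegral.integral_const_mul _ _
      _ ≤ M * A := mul_le_mul_of_nonneg_left hG.var hM
  calc _ ≤ ‖F b * G b‖ + ‖∫ x in a..b, F x * G' x‖ := norm_sub_le _ _
    _ ≤ 2 * M * A := by linarith

/-! ### Bessel functions of integer order -/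

/-- The Bessel function `J_n`, by its integral representation. -/
def besselJ (n : ℕ) (s : ℝ) : ℝ := π⁻¹ * ∫ θ in (0:ℝ)..π, cos (n * θ - s * sin θ)

/-- The derivative of `besselJ`. -/
def besselJ' (n : ℕ) (s : ℝ) : ℝ :=
  π⁻¹ * ∫ θ in (0:ℝ)..π, sin (n * θ - s * sin θ) * sin θ

/-- The second derivative of `besselJ`. -/
def besselJ'' (n : ℕ) (s : ℝ) : ℝ :=
  π⁻¹ * ∫ θ in (0:ℝ)..π, -cos (n * θ - s * sin θ) * sin θ ^ 2

lemma hasDerivAt_besselJ (n : ℕ) (s : ℝ) : HasDerivAt (besselJ n) (besselJ' n s) s := by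
  apply HasDerivAt.const_mul
  refine (intervalIntegral.hasDerivAt_integral_of_dominated_loc_of_deriv_le (bound := fun _ => 1)
    (F := fun s θ => cos (n * θ - s * sin θ))
    (F' := fun s θ => sin (n * θ - s * sin θ) * sin θ)
    (s := univ) univ_mem ?_ ?_ ?_ ?_ ?_ ?_).2
  · exact .of_forall fun x => Continuous.aestronglyMeasurable (by fun_prop)
  · exact Continuous.intervalIntegrable (by fun_prop) _ _
  · exact Continuous.aestronglyMeasurable (by fun_prop)
  · refine .of_forall fun θ _ x _ => ?_
    rw [norm_eq_abs, abs_mul]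
    exact mul_le_one₀ (abs_sin_le_one _) (abs_nonneg _) (abs_sin_le_one _)
  · exact intervalIntegrable_const
  · refine .of_forall fun θ _ x _ => ?_
    have := (((hasDerivAt_id x).mul_const (sin θ)).const_sub (n * θ)).cos
    refine this.congr_deriv ?_
    simp

lemma hasDerivAt_besselJ' (n : ℕ) (s : ℝ) : HasDerivAt (besselJ' n) (besselJ'' n s) s := by
  apply HasDerivAt.const_mul
  refine (intervalIntegral.hasDerivAt_integral_of_dominated_loc_of_deriv_le (bound := fun _ => 1)
    (F := fun s θ => sin (n * θ - s * sin θ) * sin θ)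
    (F' := fun s θ => -cos (n * θ - s * sin θ) * sin θ ^ 2)
    (s := univ) univ_mem ?_ ?_ ?_ ?_ ?_ ?_).2
  · exact .of_forall fun x => Continuous.aestronglyMeasurable (by fun_prop)
  · exact Continuous.intervalIntegrable (by fun_prop) _ _
  · exact Continuous.aestronglyMeasurable (by fun_prop)
  · refine .of_forall fun θ _ x _ => ?_
    rw [norm_eq_abs, abs_mul, abs_neg, abs_pow]
    exact mul_le_one₀ (abs_cos_le_one _) (by positivity)
      (pow_le_one₀ (abs_nonneg _) (abs_sin_le_one _))
  · exact intervalIntegrable_const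
  · refine .of_forall fun θ _ x _ => ?_
    have := ((((hasDerivAt_id x).mul_const (sin θ)).const_sub (n * θ)).sin).mul_const
      (sin θ)
    refine this.congr_deriv ?_
    simp only [id]; ring

lemma continuous_besselJ (n : ℕ) : Continuous (besselJ n) :=
  continuous_iff_continuousAt.mpr fun s => (hasDerivAt_besselJ n s).continuousAt

lemma continuous_besselJ' (n : ℕ) : Continuous (besselJ' n) :=
  continuous_iff_continuousAt.mpr fun s => (hasDerivAt_besselJ' n s).continuousAt

/-- Bessel's equation. -/
lemma bessel_ode (n : ℕ) (s : ℝ) :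
    s ^ 2 * besselJ'' n s + s * besselJ' n s + (s ^ 2 - n ^ 2) * besselJ n s = 0 := by
  have h : ∀ θ : ℝ, HasDerivAt (fun θ => -((n + s * cos θ) * sin (n * θ - s * sin θ)))
      (s ^ 2 * (-cos (n * θ - s * sin θ) * sin θ ^ 2)
        + s * (sin (n * θ - s * sin θ) * sin θ)
        + (s ^ 2 - n ^ 2) * cos (n * θ - s * sin θ)) θ := by
    intro θ
    have h1 : HasDerivAt (fun θ : ℝ => n + s * cos θ) (s * -sin θ) θ :=
      ((hasDerivAt_cos θ).const_mul s).const_add _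
    have h2 : HasDerivAt (fun θ : ℝ => n * θ - s * sin θ) (n * 1 - s * cos θ) θ :=
      ((hasDerivAt_id θ).const_mul (n : ℝ)).sub ((hasDerivAt_sin θ).const_mul s)
    refine ((h1.mul h2.sin).neg).congr_deriv ?_
    linear_combination (cos (n * θ - s * sin θ) * s ^ 2) * sin_sq_add_cos_sq θ
  have key := integral_eq_sub_of_hasDerivAt (a := 0) (b := π) (fun θ _ => h θ)
    (Continuous.intervalIntegrable (by fun_prop) _ _)
  rw [intervalIntegral.integral_add (Continuous.intervalIntegrable (by fun_prop) _ _)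
    (Continuous.intervalIntegrable (by fun_prop) _ _),
    intervalIntegral.integral_add (Continuous.intervalIntegrable (by fun_prop) _ _)
    (Continuous.intervalIntegrable (by fun_prop) _ _), intervalIntegral.integral_const_mul,
    intervalIntegral.integral_const_mul, intervalIntegral.integral_const_mul] at key
  simp only [sin_pi, mul_zero, sub_zero, sin_zero, sin_nat_mul_pi, neg_zero] at key
  simp only [besselJ, besselJ', besselJ'']
  linear_combination π⁻¹ * key

lemma besselPhase_deriv (n : ℕ) (s θ : ℝ) :
    HasDerivAt (fun θ : ℝ => n * θ - s * sin θ) (n - s * cos θ) θ := by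
  have h2 : HasDerivAt (fun θ : ℝ => n * θ - s * sin θ) (n * 1 - s * cos θ) θ :=
    ((hasDerivAt_id θ).const_mul (n : ℝ)).sub ((hasDerivAt_sin θ).const_mul s)
  simpa using h2

lemma besselPhase_deriv2 (n : ℕ) (s θ : ℝ) :
    HasDerivAt (fun θ : ℝ => n - s * cos θ) (s * sin θ) θ := by
  have h2 := ((hasDerivAt_cos θ).const_mul s).const_sub (n : ℝ)
  refine h2.congr_deriv ?_
  ring

lemma re_integral_exp (Φ G : ℝ → ℝ) (hΦ : Continuous Φ) (hG : Continuous G) (a b : ℝ) :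
    |∫ x in a..b, cos (Φ x) * G x| ≤
      ‖∫ x in a..b, cis(Φ x) * G x‖ := by
  have hi : IntervalIntegrable (fun x => cis(Φ x) * G x) volume a b :=
    Continuous.intervalIntegrable (by fun_prop) _ _
  have := reCLM.intervalIntegral_comp_comm hi
  have e : ∀ x, reCLM (cis(Φ x) * G x) =
      cos (Φ x) * G x := by
    intro x
    rw [mul_comm I, reCLM_apply, Complex.re_mul_ofReal, Complex.exp_ofReal_mul_I_re]
  simp only [e] at this
  rw [this]
  exact Complex.abs_re_le_norm _

lemma im_integral_exp (Φ G : ℝ → ℝ) (hΦ : Continuous Φ) (hG : Continuous G) (a b : ℝ) :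
    |∫ x in a..b, sin (Φ x) * G x| ≤
      ‖∫ x in a..b, cis(Φ x) * G x‖ := by
  have hi : IntervalIntegrable (fun x => cis(Φ x) * G x) volume a b :=
    Continuous.intervalIntegrable (by fun_prop) _ _
  have := imCLM.intervalIntegral_comp_comm hi
  have e : ∀ x, imCLM (cis(Φ x) * G x) =
      sin (Φ x) * G x := by
    intro x
    rw [mul_comm I, imCLM_apply, Complex.im_mul_ofReal, Complex.exp_ofReal_mul_I_im]
  simp only [e] at this
  rw [this]
  exact Complex.abs_im_le_norm _

lemma abs_besselJ_le_of_osc {n : ℕ} {s M : ℝ}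
    (h : OscBound (fun θ : ℝ => n * θ - s * sin θ) 0 π M) : |besselJ n s| ≤ π⁻¹ * M := by
  rw [besselJ, abs_mul, abs_of_pos (inv_pos.mpr pi_pos)]
  gcongr
  have := re_integral_exp (fun θ : ℝ => n * θ - s * sin θ) (fun _ => 1) (by fun_prop)
    (by fun_prop) 0 π
  simp only [mul_one, ofReal_one] at this
  exact this.trans (h 0 π le_rfl pi_pos.le le_rfl)

lemma abs_besselJ'_le_of_osc {n : ℕ} {s M : ℝ}
    (h : OscBound (fun θ : ℝ => n * θ - s * sin θ) 0 π M) : |besselJ' n s| ≤ 8 * (π⁻¹ * M) := by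
  rw [besselJ', abs_mul, abs_of_pos (inv_pos.mpr pi_pos)]
  have h1 := im_integral_exp (fun θ : ℝ => n * θ - s * sin θ) sin (by fun_prop)
    (by fun_prop) 0 π
  have hA : BVAmp (fun x => (sin x : ℂ)) (fun x => (cos x : ℂ)) 0 π 4 := by
    refine ⟨fun x _ => (hasDerivAt_sin x).ofReal_comp, by fun_prop, fun x _ => ?_, ?_⟩
    · rw [norm_real]; exact (abs_sin_le_one x).trans (by norm_num)
    · calc ∫ x in (0:ℝ)..π, ‖(cos x : ℂ)‖ ≤ ∫ x in (0:ℝ)..π, (1 : ℝ) := by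
            apply integral_mono_on pi_pos.le
            · exact Continuous.intervalIntegrable (by fun_prop) _ _
            · exact intervalIntegrable_const
            · intro x _; rw [norm_real]; exact abs_cos_le_one x
        _ ≤ 4 := by simpa using pi_le_four
  have h2 := h.amp pi_pos.le (by fun_prop) hA
  calc _ ≤ π⁻¹ * (2 * M * 4) := by gcongr; exact h1.trans h2
    _ = _ := by ring

/-- Uniform decay of Bessel functions. -/
lemma abs_besselJ_le_third (n : ℕ) {s : ℝ} (hs : 1 ≤ s) :
    |besselJ n s| ≤ 6 * s ^ (-(1/3) : ℝ) := by
  have hs0 : 0 < s := by linarith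
  set δ := s ^ (-(1/3) : ℝ) with hδ
  have hδ0 : 0 < δ := rpow_pos_of_pos hs0 _
  have hδ1 : δ ≤ 1 := rpow_le_one_of_one_le_of_nonpos hs (by norm_num)
  have hsδ : s * δ * δ ^ 2 = 1 := by
    rw [hδ, ← rpow_natCast, ← rpow_mul hs0.le, mul_assoc, ← rpow_add hs0]
    nth_rewrite 1 [← rpow_one s]
    rw [← rpow_add hs0]; norm_num
  have hpi := pi_gt_three
  have hpi4 := pi_le_four
  have mid : OscBound (fun θ : ℝ => n * θ - s * sin θ) δ (π - δ) (8 / √(s * (δ / 2))) := by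
    apply oscBound_of_deriv2_ge (by positivity) (fun x _ => besselPhase_deriv n s x)
      (fun x _ => besselPhase_deriv2 n s x) (by fun_prop)
    intro x hx
    gcongr
    have hsin : ∀ y, 0 ≤ y → y ≤ π / 2 → δ ≤ y → δ / 2 ≤ sin y := by
      intro y h0 h1 h2
      have := mul_le_sin h0 h1
      have h3 : 1 / 2 ≤ 2 / π := by rw [div_le_div_iff₀ (by norm_num) (by linarith)]; linarith
      have : 1 / 2 * y ≤ 2 / π * y := by gcongr
      linarith
    rcases le_total x (π / 2) with h | h
    · exact hsin x (by linarith [hx.1]) h hx.1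
    · rw [← sin_pi_sub]; exact hsin (π - x) (by linarith [hx.2]) (by linarith) (by linarith [hx.2])
  have e : 8 / √(s * (δ / 2)) ≤ 12 * δ := by
    have h1 : s * (δ / 2) = 1 / (2 * δ ^ 2) := by
      rw [eq_div_iff (by positivity)]; linear_combination hsδ
    have h2 : 2 / (3 * δ) ≤ √(s * (δ / 2)) := by
      apply le_sqrt_of_sq_le
      rw [h1, div_pow, div_le_div_iff₀ (by positivity) (by positivity)]
      nlinarith [sq_nonneg δ]
    rw [div_le_iff₀ (by positivity)]
    calc (8 : ℝ) = 12 * δ * (2 / (3 * δ)) := by field_simp; norm_num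
      _ ≤ _ := by gcongr
  have hc : Continuous (fun θ : ℝ => n * θ - s * sin θ) := by fun_prop
  have l := oscBound_length (fun θ : ℝ => n * θ - s * sin θ) (a := 0) (b := δ) (L := δ) (by simp)
  have r := oscBound_length (fun θ : ℝ => n * θ - s * sin θ) (a := π - δ) (b := π) (L := δ)
    (by simp)
  have all := (l.append hδ0.le (by linarith) hc.continuousOn mid).append (by linarith) (by linarith)
    hc.continuousOn r
  have := abs_besselJ_le_of_osc (all.mono le_rfl le_rfl (show _ ≤ 14 * δ by linarith))
  refine this.trans ?_
  have : π⁻¹ ≤ 1 / 3 := by rw [inv_eq_one_div]; gcongr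
  calc π⁻¹ * (14 * δ) ≤ 1 / 3 * (14 * δ) := by gcongr
    _ ≤ 6 * δ := by linarith

lemma besselPhase_osc {n : ℕ} {s : ℝ} (hs : 1 ≤ s) (hn : 2 * (n : ℝ) ≤ s) :
    OscBound (fun θ : ℝ => n * θ - s * sin θ) 0 π (45 / √s) := by
  have hs0 : 0 < s := by linarith
  have hpi := pi_gt_three
  have hpi4 := pi_le_four
  have hc : Continuous (fun θ : ℝ => n * θ - s * sin θ) := by fun_prop
  have h2 : (1.4 : ℝ) ≤ √2 := by apply le_sqrt_of_sq_le; norm_num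
  have mid : OscBound (fun θ : ℝ => n * θ - s * sin θ) (π / 4) (π - π / 4)
      (8 / √(s * (1 / 2))) := by
    apply oscBound_of_deriv2_ge (by positivity) (fun x _ => besselPhase_deriv n s x)
      (fun x _ => besselPhase_deriv2 n s x) (by fun_prop)
    intro x hx
    gcongr
    have hsin : ∀ y, π / 4 ≤ y → y ≤ π / 2 → 1 / 2 ≤ sin y := by
      intro y h0 h1
      have := sin_le_sin_of_le_of_le_pi_div_two (by linarith) h1 h0
      rw [sin_pi_div_four] at this; linarith
    rcases le_total x (π / 2) with h | h
    · exact hsin x hx.1 h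
    · rw [← sin_pi_sub]; exact hsin (π - x) (by linarith [hx.2]) (by linarith)
  have left : OscBound (fun θ : ℝ => n * θ - s * sin θ) 0 (π / 4) (3 / (s / 5)) := by
    apply OscBound.neg
    apply oscBound_of_deriv_ge (by positivity) (fun x _ => (besselPhase_deriv n s x).neg)
      (fun x _ => (besselPhase_deriv2 n s x).neg) (by fun_prop)
    · intro x hx
      have := cos_le_cos_of_nonneg_of_le_pi hx.1 (by linarith) hx.2
      rw [cos_pi_div_four] at this
      nlinarith
    · right; intro x hx
      have := sin_nonneg_of_nonneg_of_le_pi hx.1 (by linarith [hx.2])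
      simp only [Left.neg_nonpos_iff]; positivity
  have right : OscBound (fun θ : ℝ => n * θ - s * sin θ) (π - π / 4) π (3 / (s / 5)) := by
    apply oscBound_of_deriv_ge (by positivity) (fun x _ => besselPhase_deriv n s x)
      (fun x _ => besselPhase_deriv2 n s x) (by fun_prop)
    · intro x hx
      have := cos_le_cos_of_nonneg_of_le_pi (x := π - x) (y := π / 4) (by linarith [hx.2])
        (by linarith) (by linarith [hx.1])
      rw [cos_pi_div_four, cos_pi_sub] at this
      nlinarith
    · left; intro x hx
      have := sin_nonneg_of_nonneg_of_le_pi (x := x) (by linarith [hx.1]) hx.2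
      positivity
  have all := (left.append (by linarith) (by linarith) hc.continuousOn mid).append (by linarith)
    (by linarith) hc.continuousOn right
  refine all.mono le_rfl le_rfl ?_
  have hss : 1 ≤ √s := one_le_sqrt.mpr hs
  have e1 : 3 / (s / 5) ≤ 15 / √s := by
    rw [div_div_eq_mul_div]
    have : √s ≤ s := by nlinarith [mul_self_sqrt hs0.le]
    bound
  have e2 : 8 / √(s * (1 / 2)) ≤ 10 / √s * (6 / 5) := by
    have : √s * (7/10) ≤ √(s * (1/2)) := by
      apply le_sqrt_of_sq_le
      rw [mul_pow, sq_sqrt hs0.le]; nlinarith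
    calc 8 / √(s * (1 / 2)) ≤ 8 / (√s * (7/10)) := by gcongr
      _ = (8 / (7/10)) / √s := by field_simp
      _ ≤ 12 / √s := by gcongr; norm_num
      _ = _ := by ring
  have : 0 < √s := by positivity
  have : 45 / √s = 15 / √s + 10 / √s * (6/5) + 15 / √s + 3 / √s := by ring
  have : 0 ≤ 3 / √s := by positivity
  linarith

lemma abs_besselJ_le_half {n : ℕ} {s : ℝ} (hs : 1 ≤ s) (hn : 2 * (n : ℝ) ≤ s) :
    |besselJ n s| ≤ 15 / √s := by
  have := abs_besselJ_le_of_osc (besselPhase_osc hs hn)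
  have h3 : π⁻¹ ≤ 1 / 3 := by rw [inv_eq_one_div]; gcongr; exact pi_gt_three.le
  calc _ ≤ π⁻¹ * (45 / √s) := this
    _ ≤ 1 / 3 * (45 / √s) := by gcongr
    _ = (45 / 3) / √s := by ring
    _ ≤ _ := by gcongr; norm_num

lemma abs_besselJ'_le_half {n : ℕ} {s : ℝ} (hs : 1 ≤ s) (hn : 2 * (n : ℝ) ≤ s) :
    |besselJ' n s| ≤ 120 / √s := by
  have := abs_besselJ'_le_of_osc (besselPhase_osc hs hn)
  have h3 : π⁻¹ ≤ 1 / 3 := by rw [inv_eq_one_div]; gcongr; exact pi_gt_three.le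
  calc _ ≤ 8 * (π⁻¹ * (45 / √s)) := this
    _ ≤ 8 * (1 / 3 * (45 / √s)) := by gcongr
    _ = (360 / 3) / √s := by ring
    _ ≤ _ := by gcongr; norm_num

/-- Width of the transition region of `J_n`. -/
def besselWidth (n : ℕ) : ℝ := max 1 ((n : ℝ) ^ (1/3 : ℝ))

lemma one_le_besselWidth (n : ℕ) : 1 ≤ besselWidth n := le_max_left _ _

lemma besselWidth_pos (n : ℕ) : 0 < besselWidth n := zero_lt_one.trans_le (one_le_besselWidth n)

lemma besselWidth_cube (n : ℕ) (hn : 1 ≤ n) : besselWidth n ^ 3 = n := by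
  have h1 : (1 : ℝ) ≤ n := by exact_mod_cast hn
  rw [besselWidth, max_eq_right (one_le_rpow h1 (by norm_num)), ← rpow_natCast,
    ← rpow_mul (by positivity)]
  norm_num

lemma abs_besselJ_le_one (n : ℕ) (s : ℝ) : |besselJ n s| ≤ 1 := by
  have := abs_besselJ_le_of_osc (oscBound_length (fun θ : ℝ => n * θ - s * sin θ)
    (a := 0) (b := π) (L := π) (by simp))
  rwa [inv_mul_cancel₀ pi_ne_zero] at this

lemma abs_besselJ'_transition (n : ℕ) (hn : 1 ≤ n) :
    (n : ℝ) * |besselJ' n n| ≤ 4 * besselWidth n := by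
  set b := besselWidth n with hb
  have hb3 : b ^ 3 = n := besselWidth_cube n hn
  have hb1 : 1 ≤ b := one_le_besselWidth n
  have hb0 : 0 < b := by linarith
  set δ := 1 / b with hδ
  have hδ0 : 0 < δ := by positivity
  have hδ1 : δ ≤ 1 := by rw [hδ, div_le_one hb0]; exact hb1
  have hpi := pi_gt_three
  have hpi4 := pi_lt_d2
  have n0 : (0 : ℝ) < n := by rw [← hb3]; positivity
  set φ : ℝ → ℝ := fun θ => n * θ - n * sin θ with hφ
  have hcos : ∀ θ ∈ Icc δ π, 0 < 1 - cos θ := by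
    intro θ hθ
    have := cos_lt_cos_of_nonneg_of_le_pi le_rfl hθ.2 (hδ0.trans_le hθ.1)
    rw [cos_zero] at this; linarith
  set g : ℝ → ℝ := fun θ => sin θ / (1 - cos θ) with hg
  have hgd : ∀ θ ∈ Icc δ π, HasDerivAt g (-(1 / (1 - cos θ))) θ := by
    intro θ hθ
    have h0 := (hcos θ hθ).ne'
    have := (hasDerivAt_sin θ).div ((hasDerivAt_cos θ).const_sub 1) h0
    refine this.congr_deriv ?_
    rw [div_eq_iff (pow_ne_zero 2 h0)]
    field_simp
    linear_combination -sin_sq_add_cos_sq θ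
  have hδpi : δ ≤ π := by linarith
  have cg' : ContinuousOn (fun θ => -(1 / (1 - cos θ))) (Icc δ π) :=
    (continuousOn_const.div (by fun_prop) fun θ hθ => (hcos θ hθ).ne').neg
  have ig' : IntervalIntegrable (fun θ => -(1 / (1 - cos θ))) volume δ π := by
    exact intervalIntegrable_of_Icc hδpi ‹_›
  have hgδ : g δ ≤ 5 / δ := by
    have h1 := cos_le_one_sub_mul_cos_sq (x := δ) (by rw [abs_of_pos hδ0]; linarith)
    have h2 : sin δ ≤ δ := sin_le hδ0.le
    have h3 : 1 / 5 ≤ 2 / π ^ 2 := by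
      rw [div_le_div_iff₀ (by norm_num) (by positivity)]; nlinarith
    have h4 : 1 / 5 * δ ^ 2 ≤ 1 - cos δ := by
      have : 1 / 5 * δ ^ 2 ≤ 2 / π ^ 2 * δ ^ 2 := by gcongr
      linarith
    simp only [hg]
    calc sin δ / (1 - cos δ) ≤ δ / (1 / 5 * δ ^ 2) := by gcongr
      _ = 5 / δ := by field_simp
  have hgpi : g π = 0 := by simp [hg]
  have parts := intervalIntegral.integral_deriv_mul_eq_sub (a := δ) (b := π)
    (u := fun θ => -cos (φ θ)) (u' := fun θ => sin (φ θ) * (n - n * cos θ))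
    (v := g) (v' := fun θ => -(1 / (1 - cos θ)))
    (fun θ _ => by
      have := (besselPhase_deriv n n θ).cos.neg
      refine this.congr_deriv ?_
      simp only [hφ]; ring)
    (fun θ hθ => hgd θ (by rwa [uIcc_of_le hδpi] at hθ))
    (Continuous.intervalIntegrable (by fun_prop) _ _) ig'
  have e1 : ∫ θ in δ..π, (sin (φ θ) * (n - n * cos θ) * g θ +
      -cos (φ θ) * -(1 / (1 - cos θ))) =
      n * (∫ θ in δ..π, sin (φ θ) * sin θ) +
        ∫ θ in δ..π, cos (φ θ) * (1 / (1 - cos θ)) := by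
    rw [← intervalIntegral.integral_const_mul, ← intervalIntegral.integral_add
      (Continuous.intervalIntegrable (by fun_prop) _ _)]
    · apply integral_congr
      intro θ hθ; rw [uIcc_of_le hδpi] at hθ
      have h0 := (hcos θ hθ).ne'
      simp only [hg]; field_simp
    · refine intervalIntegrable_of_Icc hδpi ?_
      exact (by fun_prop : Continuous fun θ => cos (φ θ)).continuousOn.mul
        (continuousOn_const.div (by fun_prop) fun θ hθ => (hcos θ hθ).ne')
  rw [e1, hgpi] at parts
  have e2 : |∫ θ in δ..π, cos (φ θ) * (1 / (1 - cos θ))| ≤ g δ := by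
    have ftc := integral_eq_sub_of_hasDerivAt (a := δ) (b := π)
      (fun θ hθ => hgd θ (by rwa [uIcc_of_le hδpi] at hθ)) ig'
    rw [hgpi, intervalIntegral.integral_neg] at ftc
    rw [← norm_eq_abs]
    refine (intervalIntegral.norm_integral_le_integral_norm hδpi).trans ?_
    have : g δ = ∫ θ in δ..π, 1 / (1 - cos θ) := by linarith
    rw [this]
    apply integral_mono_on hδpi
    · refine intervalIntegrable_of_Icc hδpi ?_
      exact ((by fun_prop : Continuous fun θ => cos (φ θ)).continuousOn.mul
        (continuousOn_const.div (by fun_prop) fun θ hθ => (hcos θ hθ).ne')).norm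
    · convert ig'.neg using 1; ext θ; simp
    · intro θ hθ
      have h0 := hcos θ hθ
      rw [norm_mul, norm_eq_abs, norm_eq_abs, abs_of_pos (by positivity : 0 < 1 / (1 - cos θ))]
      exact mul_le_of_le_one_left (by positivity) (abs_cos_le_one _)
  have g0 : 0 ≤ g δ := (abs_nonneg _).trans e2
  have e3 : |n * ∫ θ in δ..π, sin (φ θ) * sin θ| ≤ 2 * g δ := by
    have : n * ∫ θ in δ..π, sin (φ θ) * sin θ = cos (φ δ) * g δ -
      ∫ θ in δ..π, cos (φ θ) * (1 / (1 - cos θ)) := by linear_combination parts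
    rw [this]
    refine (abs_sub _ _).trans ?_
    have : |cos (φ δ) * g δ| ≤ g δ := by
      rw [abs_mul, abs_of_nonneg g0]; exact mul_le_of_le_one_left g0 (abs_cos_le_one _)
    linarith
  have e4 : |∫ θ in (0:ℝ)..δ, sin (φ θ) * sin θ| ≤ δ ^ 2 := by
    have := intervalIntegral.norm_integral_le_of_norm_le_const (a := 0) (b := δ) (C := δ)
      (f := fun θ => sin (φ θ) * sin θ) (by
        intro θ hθ
        rw [uIoc_of_le hδ0.le] at hθ
        rw [norm_mul, norm_eq_abs, norm_eq_abs]
        have h1 : |sin θ| ≤ δ := by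
          rw [abs_of_nonneg (sin_nonneg_of_nonneg_of_le_pi hθ.1.le (by linarith [hθ.2]))]
          exact (sin_le hθ.1.le).trans hθ.2
        have h2 := abs_sin_le_one (φ θ)
        nlinarith [abs_nonneg (sin θ), abs_nonneg (sin (φ θ))])
    rw [sub_zero, abs_of_pos hδ0, norm_eq_abs] at this
    linarith
  have split : ∫ θ in (0:ℝ)..π, sin (φ θ) * sin θ = (∫ θ in (0:ℝ)..δ, sin (φ θ) * sin θ)
      + ∫ θ in δ..π, sin (φ θ) * sin θ :=
    (integral_add_adjacent_intervals
      (Continuous.intervalIntegrable (by fun_prop) _ _)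
      (Continuous.intervalIntegrable (by fun_prop) _ _)).symm
  have e5 : (n : ℝ) * |∫ θ in (0:ℝ)..π, sin (φ θ) * sin θ| ≤ 11 * b := by
    rw [abs_mul, abs_of_pos n0] at e3
    have hnδ : (n : ℝ) * δ ^ 2 = b := by rw [← hb3, hδ]; field_simp
    have h5 : 5 / δ = 5 * b := by rw [hδ]; field_simp
    calc _ ≤ n * (|∫ θ in (0:ℝ)..δ, sin (φ θ) * sin θ| +
          |∫ θ in δ..π, sin (φ θ) * sin θ|) := by
          rw [split]; gcongr; exact abs_add_le _ _
      _ ≤ n * δ ^ 2 + 2 * g δ := by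
          rw [mul_add]; gcongr
      _ ≤ 11 * b := by rw [hnδ]; linarith
  rw [besselJ', abs_mul, abs_of_pos (inv_pos.mpr pi_pos)]
  have h3 : π⁻¹ ≤ 1 / 3 := by rw [inv_eq_one_div]; gcongr
  calc _ = π⁻¹ * ((n : ℝ) * |∫ θ in (0:ℝ)..π, sin (φ θ) * sin θ|) := by
        simp only [hφ]; ring
    _ ≤ 1 / 3 * (11 * b) := by gcongr
    _ ≤ 4 * b := by linarith

lemma monotoneOn_Icc_of_deriv {f f' : ℝ → ℝ} {a b : ℝ} (hc : ContinuousOn f (Icc a b))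
    (h : ∀ x ∈ Ioo a b, HasDerivAt f (f' x) x) (h' : ∀ x ∈ Ioo a b, 0 ≤ f' x) :
    MonotoneOn f (Icc a b) := by
  apply monotoneOn_of_deriv_nonneg (convex_Icc a b) hc
  · intro x hx; rw [interior_Icc] at hx
    exact (h x hx).differentiableAt.differentiableWithinAt
  · intro x hx; rw [interior_Icc] at hx
    rw [(h x hx).deriv]; exact h' x hx

/-- Up to the transition point `J_n` does not change sign. -/
lemma besselJ_sign (n : ℕ) : ∃ σ : ℝ, |σ| = 1 ∧ ∀ s ∈ Icc (0:ℝ) n, 0 ≤ σ * besselJ n s := by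
  have m1 : MonotoneOn (fun s => s * besselJ n s * besselJ' n s) (Icc (0:ℝ) n) := by
    apply monotoneOn_Icc_of_deriv
        (f' := fun s => (1 * besselJ n s + s * besselJ' n s) * besselJ' n s
        + s * besselJ n s * besselJ'' n s)
    · exact ((continuous_id.mul (continuous_besselJ n)).mul (continuous_besselJ' n)).continuousOn
    · intro s _
      exact ((hasDerivAt_id s).mul (hasDerivAt_besselJ n s)).mul (hasDerivAt_besselJ' n s)
    · intro s hs
      have ode := bessel_ode n s
      have e : s * ((1 * besselJ n s + s * besselJ' n s) * besselJ' n s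
        + s * besselJ n s * besselJ'' n s) =
          (s * besselJ' n s) ^ 2 + (n ^ 2 - s ^ 2) * besselJ n s ^ 2 := by
        linear_combination besselJ n s * ode
      have h1 : 0 ≤ (n : ℝ) ^ 2 - s ^ 2 := by nlinarith [hs.1, hs.2]
      have : 0 ≤ s * ((1 * besselJ n s + s * besselJ' n s) * besselJ' n s
        + s * besselJ n s * besselJ'' n s) := by rw [e]; positivity
      exact nonneg_of_mul_nonneg_right this hs.1
  have m2 : MonotoneOn (fun s => besselJ n s ^ 2) (Icc (0:ℝ) n) := by
    apply monotoneOn_Icc_of_deriv (f' := fun s => 2 * besselJ n s ^ 1 * besselJ' n s)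
    · exact ((continuous_besselJ n).pow 2).continuousOn
    · intro s _
      exact (hasDerivAt_besselJ n s).pow 2
    · intro s hs
      have := m1 ⟨le_rfl, cast_nonneg n⟩ (Ioo_subset_Icc_self hs) hs.1.le
      simp only [zero_mul] at this
      have h0 : 0 ≤ s * (besselJ n s * besselJ' n s) := by linarith
      have := nonneg_of_mul_nonneg_right h0 hs.1
      rw [pow_one]; linarith
  have nn : (n : ℝ) ∈ Icc (0:ℝ) n := ⟨cast_nonneg n, le_rfl⟩
  have aux : ∀ σ : ℝ, |σ| = 1 → 0 ≤ σ * besselJ n n → ∀ s ∈ Icc (0:ℝ) n, 0 ≤ σ * besselJ n s := by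
    intro σ hσ h0 s hs
    by_contra hneg
    push Not at hneg
    have hc : ContinuousOn (fun s => σ * besselJ n s) (Icc s n) :=
      (continuous_const.mul (continuous_besselJ n)).continuousOn
    obtain ⟨z, hz, hz0⟩ := intermediate_value_Icc hs.2 hc ⟨hneg.le, h0⟩
    have hσ0 : σ ≠ 0 := by bound
    have hz1 : besselJ n z = 0 := (mul_eq_zero.mp hz0).resolve_left hσ0
    have := m2 hs ⟨hs.1.trans hz.1, hz.2⟩ hz.1
    simp only [hz1] at this
    have : besselJ n s ≠ 0 := by intro h; simp_all
    simp_all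
  rcases le_total 0 (besselJ n n) with h | h
  · exact ⟨1, by simp, aux 1 (by simp) (by simpa using h)⟩
  · exact ⟨-1, by simp, aux (-1) (by simp) (by simpa using h)⟩

lemma integral_abs_besselJ_le (n : ℕ) {a : ℝ} (ha : 0 ≤ a) (ha' : a ≤ n + besselWidth n) :
    ∫ s in a..(n + besselWidth n), |besselJ n s| ≤ 40 := by
  have hcont : Continuous fun s => |besselJ n s| := (continuous_besselJ n).abs
  have ii : ∀ u v, IntervalIntegrable (fun s => |besselJ n s|) volume u v :=
    fun u v => hcont.intervalIntegrable u v
  have hmono : ∫ s in a..(n + besselWidth n), |besselJ n s| ≤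
      ∫ s in (0:ℝ)..(n + besselWidth n), |besselJ n s| :=
    integral_mono_interval ha ha' le_rfl
      (.of_forall fun x => abs_nonneg _) (ii _ _)
  refine hmono.trans ?_
  set b := besselWidth n with hb
  have hb1 : 1 ≤ b := one_le_besselWidth n
  rcases Nat.eq_zero_or_pos n with h0 | hn
  · have : b = 1 := by
      simp [hb, besselWidth, h0]
    subst h0
    rw [this]
    have := intervalIntegral.norm_integral_le_of_norm_le_const (a := 0) (b := (0:ℕ) + 1) (C := 1)
      (f := fun s => |besselJ 0 s|) (by
        intro s _; rw [norm_eq_abs, abs_abs]; exact abs_besselJ_le_one 0 s)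
    refine (le_abs_self _).trans (this.trans ?_)
    norm_num
  have hb3 : b ^ 3 = n := besselWidth_cube n hn
  have hbn : b ≤ n := by rw [← hb3]; bound
  obtain ⟨σ, hσ, hJ⟩ := besselJ_sign n
  have hsub : Icc (0:ℝ) (n - b) ⊆ Icc (0:ℝ) n := Icc_subset_Icc le_rfl (by linarith)
  have habs : ∀ s ∈ Icc (0:ℝ) n, |besselJ n s| = σ * besselJ n s := by
    intro s hs
    rw [← abs_of_nonneg (hJ s hs), abs_mul, hσ, one_mul]
  have hd : ∀ s, HasDerivAt (fun s => σ * (s * besselJ' n s))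
      (σ * (1 * besselJ' n s + s * besselJ'' n s)) s :=
    fun s => ((hasDerivAt_id s).mul (hasDerivAt_besselJ' n s)).const_mul σ
  have hode : ∀ s, s * (σ * (1 * besselJ' n s + s * besselJ'' n s)) =
      (n ^ 2 - s ^ 2) * (σ * besselJ n s) := by
    intro s; linear_combination σ * bessel_ode n s
  have m1 : MonotoneOn (fun s => σ * (s * besselJ' n s)) (Icc (0:ℝ) n) := by
    apply monotoneOn_Icc_of_deriv _ (fun s _ => hd s)
    · intro s hs
      have h1 : 0 ≤ (n : ℝ) ^ 2 - s ^ 2 := by nlinarith [hs.1, hs.2]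
      have := mul_nonneg h1 (hJ s (Ioo_subset_Icc_self hs))
      rw [← hode] at this
      exact nonneg_of_mul_nonneg_right this hs.1
    · exact (continuous_const.mul (continuous_id.mul (continuous_besselJ' n))).continuousOn
  set I : ℝ → ℝ := fun s => ∫ x in (0:ℝ)..s, σ * besselJ n x with hI
  have hcI : Continuous fun x => σ * besselJ n x := continuous_const.mul (continuous_besselJ n)
  have hId : ∀ s, HasDerivAt I (σ * besselJ n s) s :=
      fun s => (hcI.integral_hasStrictDerivAt 0 s).hasDerivAt
  have m2 : MonotoneOn (fun s => σ * (s * besselJ' n s) - 2 * b * I s) (Icc (0:ℝ) (n - b)) := by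
    apply monotoneOn_Icc_of_deriv _ (fun s _ => (hd s).sub ((hId s).const_mul (2 * b)))
    · intro s hs
      have hJs := hJ s (hsub (Ioo_subset_Icc_self hs))
      have h1 : 2 * b * s ≤ (n : ℝ) ^ 2 - s ^ 2 := by nlinarith [hs.1, hs.2]
      have := mul_le_mul_of_nonneg_right h1 hJs
      rw [← hode] at this
      apply nonneg_of_mul_nonneg_right _ hs.1
      rw [mul_sub]; nlinarith
    · exact (((continuous_const.mul (continuous_id.mul (continuous_besselJ' n)))).sub
        (continuous_const.mul
            (continuous_iff_continuousAt.mpr fun s => (hId s).continuousAt))).continuousOn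
  have I1 : ∫ s in (0:ℝ)..(n - b), |besselJ n s| ≤ 2 := by
    have e : ∫ s in (0:ℝ)..(n - b), |besselJ n s| = I (n - b) := by
      apply integral_congr
      intro s hs; rw [uIcc_of_le (by linarith)] at hs
      exact habs s (hsub hs)
    have h1 := m2 ⟨le_rfl, by linarith⟩ ⟨by linarith, le_rfl⟩ (by linarith : (0:ℝ) ≤ n - b)
    have h2 := m1 (hsub ⟨by linarith, le_rfl⟩) ⟨by linarith, le_rfl⟩ (by linarith : (n:ℝ) - b ≤ n)
    have I0 : I 0 = 0 := integral_same
    simp only [I0, zero_mul, mul_zero, sub_zero] at h1 h2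
    have h3 : σ * (n * besselJ' n n) ≤ 4 * b := by
      refine (le_abs_self _).trans ?_
      rw [abs_mul, hσ, one_mul, abs_mul, Nat.abs_cast]
      exact abs_besselJ'_transition n hn
    rw [e]
    have : 2 * b * I (n - b) ≤ 2 * b * 2 := by linarith
    exact le_of_mul_le_mul_left this (by linarith)
  have I2 : ∫ s in ((n:ℝ) - b)..(n + b), |besselJ n s| ≤ 38 := by
    have hbound : ∀ s, (n:ℝ) - b ≤ s → |besselJ n s| ≤ 19 / b := by
      intro s hs
      rcases le_total b 2 with h2 | h2
      · refine (abs_besselJ_le_one n s).trans ?_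
        rw [le_div_iff₀ (by linarith)]; linarith
      · have hs2 : (n : ℝ) / 2 ≤ s := by rw [← hb3] at hs ⊢; nlinarith [sq_nonneg (b - 2)]
        have hn8 : (8 : ℝ) ≤ n := by rw [← hb3]; nlinarith [sq_nonneg (b - 2)]
        refine (abs_besselJ_le_third n (by linarith)).trans ?_
        have h5 : s ^ (-(1/3) : ℝ) ≤ 2 / b := by
          have h6 : (b / 2) ^ (3:ℕ) ≤ s := by rw [div_pow, hb3]; linarith
          have h7 : b / 2 ≤ s ^ (1/3 : ℝ) := by
            calc b / 2 = ((b / 2) ^ (3:ℕ)) ^ (1/3 : ℝ) := by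
                  rw [← rpow_natCast, ← rpow_mul (by linarith)]; norm_num
              _ ≤ _ := by gcongr
          rw [rpow_neg (by linarith), inv_eq_one_div]
          calc 1 / s ^ (1/3:ℝ) ≤ 1 / (b / 2) := by gcongr
            _ = _ := by field_simp
        calc _ ≤ 6 * (2 / b) := by gcongr
          _ = 12 / b := by ring
          _ ≤ _ := by gcongr; norm_num
    have := intervalIntegral.norm_integral_le_of_norm_le_const (a := (n:ℝ) - b) (b := n + b)
        (C := 19 / b)
      (f := fun s => |besselJ n s|) (by
        intro s hs; rw [norm_eq_abs, abs_abs]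
        rw [uIoc_of_le (by linarith)] at hs
        exact hbound s hs.1.le)
    refine (le_abs_self _).trans (this.trans (le_of_eq ?_))
    rw [show (n:ℝ) + b - (n - b) = 2 * b by ring, abs_of_pos (by linarith)]
    field_simp; norm_num
  rw [← integral_add_adjacent_intervals (ii 0 (n - b)) (ii (n - b) (n + b))]
  linarith

/-- The fourth root of `s² - n²`. -/
def wkbRoot (n : ℕ) (s : ℝ) : ℝ := √(√(s ^ 2 - n ^ 2))

/-- The phase of `J_n` beyond the transition point. -/
def wkbPhase (n : ℕ) (s : ℝ) : ℝ := √(s ^ 2 - n ^ 2) - n * arccos (n / s)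

/-- The normalized Bessel function. -/
def wkbY (n : ℕ) (s : ℝ) : ℝ := besselJ n s * wkbRoot n s

/-- The derivative of `wkbY` with respect to the phase. -/
def wkbZ (n : ℕ) (s : ℝ) : ℝ :=
  s / wkbRoot n s * besselJ' n s + s ^ 2 / (2 * wkbRoot n s ^ 5) * besselJ n s

/-- The perturbation in the equation for `wkbY`. -/
def wkbErr (n : ℕ) (s : ℝ) : ℝ := s * (s ^ 2 / 4 + n ^ 2) / wkbRoot n s ^ 10

/-- An antiderivative majorizing `wkbErr`, up to a factor. -/
def wkbTail (n : ℕ) (s : ℝ) : ℝ := 1 / wkbRoot n s ^ 2 + n ^ 2 / 3 / wkbRoot n s ^ 6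

/-- The slowly varying coefficient of `J_n`. -/
def wkbCoeff (n : ℕ) (s : ℝ) : ℂ :=
  1 / 2 * cis(-wkbPhase n s) * ((wkbY n s : ℂ) - I * wkbZ n s)

/-- The derivative of `wkbCoeff`. -/
def wkbCoeff' (n : ℕ) (s : ℝ) : ℂ :=
  I / 2 * cis(-wkbPhase n s) * ((wkbErr n s * wkbY n s : ℝ) : ℂ)

section
variable {n : ℕ} {s : ℝ}

lemma wkb_pos (h : (n : ℝ) < s) : 0 < s ^ 2 - (n : ℝ) ^ 2 := by nlinarith

lemma wkbRoot_pos (h : (n : ℝ) < s) : 0 < wkbRoot n s :=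
  sqrt_pos.mpr (sqrt_pos.mpr (wkb_pos h))

lemma wkbRoot_sq : wkbRoot n s ^ 2 = √(s ^ 2 - n ^ 2) :=
  sq_sqrt (sqrt_nonneg _)

lemma wkbRoot_pow_four (h : (n : ℝ) < s) : wkbRoot n s ^ 4 = s ^ 2 - n ^ 2 := by
  rw [show wkbRoot n s ^ 4 = (wkbRoot n s ^ 2) ^ 2 by ring, wkbRoot_sq,
    sq_sqrt (wkb_pos h).le]

lemma hasDerivAt_wkbRoot (h : (n : ℝ) < s) :
    HasDerivAt (wkbRoot n) (s / (2 * wkbRoot n s ^ 3)) s := by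
  have h1 : HasDerivAt (fun s : ℝ => s ^ 2 - (n : ℝ) ^ 2) (2 * s ^ 1) s := by
    simpa using (hasDerivAt_pow 2 s).sub_const ((n:ℝ) ^ 2)
  have h2 := (h1.sqrt (wkb_pos h).ne').sqrt (sqrt_pos.mpr (wkb_pos h)).ne'
  refine h2.congr_deriv ?_
  rw [← wkbRoot_sq]
  have := wkbRoot_pos h
  have e : √(wkbRoot n s ^ 2) = wkbRoot n s := sqrt_sq this.le
  rw [e]
  field_simp

lemma hasDerivAt_wkbPhase (h : (n : ℝ) < s) :
    HasDerivAt (wkbPhase n) (wkbRoot n s ^ 2 / s) s := by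
  have n0 : (0 : ℝ) ≤ n := cast_nonneg n
  have s0 : 0 < s := by linarith
  have q0 := wkbRoot_pos h
  have h1 : HasDerivAt (fun s : ℝ => s ^ 2 - (n : ℝ) ^ 2) (2 * s ^ 1) s := by
    simpa using (hasDerivAt_pow 2 s).sub_const ((n:ℝ) ^ 2)
  have h2 := h1.sqrt (wkb_pos h).ne'
  have h3 : HasDerivAt (fun s : ℝ => (n : ℝ) / s) (-(n : ℝ) / s ^ 2) s := by
    have := (hasDerivAt_inv s0.ne').const_mul (n : ℝ)
    simp only [div_eq_mul_inv]
    refine this.congr_deriv ?_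
    ring
  have hlt : (n : ℝ) / s < 1 := by rwa [div_lt_one s0]
  have hge : 0 ≤ (n : ℝ) / s := by positivity
  have h4 := (hasDerivAt_arccos (x := (n:ℝ) / s) (by linarith) (by linarith)).comp s h3
  have h5 := h2.sub (h4.const_mul (n : ℝ))
  refine h5.congr_deriv ?_
  have e : √(1 - ((n : ℝ) / s) ^ 2) = wkbRoot n s ^ 2 / s := by
    rw [wkbRoot_sq, show 1 - ((n : ℝ) / s) ^ 2 = (s ^ 2 - n ^ 2) / s ^ 2 by field_simp,
      sqrt_div (wkb_pos h).le, sqrt_sq s0.le]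
  rw [e, ← wkbRoot_sq]
  have h6 := wkbRoot_pow_four h
  field_simp
  linear_combination -h6

lemma hasDerivAt_wkbY (h : (n : ℝ) < s) :
    HasDerivAt (wkbY n) (wkbRoot n s ^ 2 / s * wkbZ n s) s := by
  have s0 : 0 < s := (cast_nonneg n).trans_lt h
  have q0 := wkbRoot_pos h
  refine ((hasDerivAt_besselJ n s).mul (hasDerivAt_wkbRoot h)).congr_deriv ?_
  simp only [wkbZ]; field_simp

lemma hasDerivAt_wkbZ (h : (n : ℝ) < s) :
    HasDerivAt (wkbZ n) (-(wkbRoot n s ^ 2 / s * wkbY n s) - wkbErr n s * wkbY n s) s := by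
  have s0 : 0 < s := (cast_nonneg n).trans_lt h
  have q0 := wkbRoot_pos h
  have hq := hasDerivAt_wkbRoot h
  have h1 := ((hasDerivAt_id s).div hq q0.ne').mul (hasDerivAt_besselJ' n s)
  have h2 := ((hasDerivAt_pow 2 s).div ((hq.pow 5).const_mul 2)
    (by simp only [Pi.pow_apply]; positivity)).mul
    (hasDerivAt_besselJ n s)
  refine (h1.add h2).congr_deriv ?_
  have ode := bessel_ode n s
  have h6 := wkbRoot_pow_four h
  simp only [wkbY, wkbErr, id, Pi.div_apply, Pi.pow_apply]
  set q := wkbRoot n s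
  set J := besselJ n s
  set J1 := besselJ' n s
  have hJ2 : besselJ'' n s = -(s * J1 + q ^ 4 * J) / s ^ 2 := by
    rw [eq_div_iff (by positivity), h6]; linear_combination ode
  have hn : (n : ℝ) ^ 2 = s ^ 2 - q ^ 4 := by linear_combination h6
  rw [hJ2, hn]
  push_cast
  field_simp
  ring

lemma hasDerivAt_wkbTail (h : (n : ℝ) < s) :
    HasDerivAt (wkbTail n) (-(s ^ 3 / wkbRoot n s ^ 10)) s := by
  have q0 := wkbRoot_pos h
  have hq := hasDerivAt_wkbRoot h
  have h1 := (hasDerivAt_const s (1:ℝ)).div (hq.pow 2) (by simp only [Pi.pow_apply]; positivity)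
  have h2 := (hasDerivAt_const s ((n:ℝ)^2/3)).div (hq.pow 6)
    (by simp only [Pi.pow_apply]; positivity)
  refine (h1.add h2).congr_deriv ?_
  have h6 := wkbRoot_pow_four h
  simp only [Pi.pow_apply]
  set q := wkbRoot n s
  have hn : (n : ℝ) ^ 2 = s ^ 2 - q ^ 4 := by linear_combination h6
  rw [hn]
  field_simp
  ring

lemma wkbErr_nonneg (h : (n : ℝ) < s) : 0 ≤ wkbErr n s := by
  have s0 : 0 < s := (cast_nonneg n).trans_lt h
  have q0 := wkbRoot_pos h
  unfold wkbErr; positivity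

lemma wkbErr_le (h : (n : ℝ) < s) : wkbErr n s ≤ 5 / 4 * (s ^ 3 / wkbRoot n s ^ 10) := by
  have n0 : (0 : ℝ) ≤ n := cast_nonneg n
  have s0 : 0 < s := by linarith
  have q0 := wkbRoot_pos h
  unfold wkbErr
  rw [← mul_div_assoc]
  have : s * (s ^ 2 / 4 + n ^ 2) ≤ 5 / 4 * s ^ 3 := by nlinarith [mul_nonneg s0.le (wkb_pos h).le]
  gcongr

lemma lt_of_wkb (h : n + besselWidth n ≤ s) : (n : ℝ) < s := by linarith [besselWidth_pos n]

lemma wkbTail_nonneg (h : (n : ℝ) < s) : 0 ≤ wkbTail n s := by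
  have q0 := wkbRoot_pos h
  unfold wkbTail; positivity

lemma wkbTail_le (h : n + besselWidth n ≤ s) : wkbTail n s ≤ 4 / 3 := by
  have n0 : (0 : ℝ) ≤ n := cast_nonneg n
  have h' := lt_of_wkb h
  have q0 := wkbRoot_pos h'
  have h6 := wkbRoot_pow_four h'
  unfold wkbTail
  set q := wkbRoot n s
  have b1 := one_le_besselWidth n
  set b := besselWidth n
  have hs2 : ((n:ℝ) + b) ^ 2 ≤ s ^ 2 := by gcongr
  have q1 : 1 ≤ q ^ 4 := by nlinarith
  have q1' : 1 ≤ q := by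
    by_contra hc; push Not at hc
    have : q ^ 4 < 1 := pow_lt_one₀ q0.le hc (by norm_num)
    linarith
  have first : 1 / q ^ 2 ≤ 1 := by bound
  have second : (n:ℝ) ^ 2 / 3 / q ^ 6 ≤ 1 / 3 := by
    rcases Nat.eq_zero_or_pos n with h0 | hn
    · rw [h0]; norm_num
    have hb3 : b ^ 3 = n := besselWidth_cube n hn
    have h8 : b ^ 4 ≤ q ^ 4 := by nlinarith
    have h9 : b ≤ q := le_of_pow_le_pow_left₀ (by norm_num) q0.le h8
    rw [div_div, div_le_div_iff₀ (by positivity) (by norm_num)]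
    have : b ^ 6 ≤ q ^ 6 := by gcongr
    have : (n:ℝ) ^ 2 = b ^ 6 := by rw [← hb3]; ring
    linarith
  linarith

end

lemma wkb_energy_antitone (n : ℕ) {a b : ℝ} (ha : (n : ℝ) < a) :
    MonotoneOn (fun s => (wkbY n s ^ 2 + wkbZ n s ^ 2) * exp (-(5 / 4 * wkbTail n s)))
      (Icc a b) := by
  have hlt : ∀ x ∈ Icc a b, (n : ℝ) < x := fun x hx => ha.trans_le hx.1
  have hd : ∀ x ∈ Icc a b, HasDerivAt
      (fun s => (wkbY n s ^ 2 + wkbZ n s ^ 2) * exp (-(5 / 4 * wkbTail n s)))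
      ((-2 * wkbErr n x * wkbY n x * wkbZ n x + 5 / 4 * (x ^ 3 / wkbRoot n x ^ 10) *
        (wkbY n x ^ 2 + wkbZ n x ^ 2)) * exp (-(5 / 4 * wkbTail n x))) x := by
    intro x hx
    have h := hlt x hx
    have := (((hasDerivAt_wkbY h).pow 2).add ((hasDerivAt_wkbZ h).pow 2)).mul
      (((hasDerivAt_wkbTail h).const_mul (5 / 4)).neg.exp)
    refine this.congr_deriv ?_
    simp only [Pi.add_apply, Pi.pow_apply, Pi.neg_apply]
    push_cast
    ring
  apply monotoneOn_Icc_of_deriv (fun x hx => (hd x hx).continuousAt.continuousWithinAt)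
    (fun x hx => hd x (Ioo_subset_Icc_self hx))
  intro x hx
  have h := hlt x (Ioo_subset_Icc_self hx)
  have e0 := wkbErr_nonneg h
  have e1 := wkbErr_le h
  apply mul_nonneg _ (exp_pos _).le
  have h1 : wkbErr n x * (wkbY n x ^ 2 + wkbZ n x ^ 2) ≤
    5 / 4 * (x ^ 3 / wkbRoot n x ^ 10) * (wkbY n x ^ 2 + wkbZ n x ^ 2) := by gcongr
  nlinarith [mul_nonneg e0 (sq_nonneg (wkbY n x - wkbZ n x))]

lemma wkb_energy_far {n : ℕ} {s : ℝ} (h1 : 1 ≤ s) (h2 : 2 * (n : ℝ) ≤ s) :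
    wkbY n s ^ 2 + wkbZ n s ^ 2 ≤ 40000 := by
  have n0 : (0 : ℝ) ≤ n := cast_nonneg n
  have h : (n : ℝ) < s := by linarith
  have s0 : 0 < s := by linarith
  have q0 := wkbRoot_pos h
  have h6 := wkbRoot_pow_four h
  have hJ := abs_besselJ_le_half h1 h2
  have hJ' := abs_besselJ'_le_half h1 h2
  have ss : √s ^ 2 = s := sq_sqrt s0.le
  have r1 : 1 ≤ √s := one_le_sqrt.mpr h1
  have qle : wkbRoot n s ≤ √s := by
    apply le_of_pow_le_pow_left₀ (n := 4) (by norm_num) (by positivity)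
    rw [h6, show √s ^ 4 = (√s ^ 2) ^ 2 by ring, ss]; nlinarith
  have qge : 9 / 10 * √s ≤ wkbRoot n s := by
    apply le_of_pow_le_pow_left₀ (n := 4) (by norm_num) (by positivity)
    rw [h6, mul_pow, show √s ^ 4 = (√s ^ 2) ^ 2 by ring, ss]; nlinarith
  have hy : |wkbY n s| ≤ 15 := by
    rw [wkbY, abs_mul, abs_of_pos q0]
    calc _ ≤ 15 / √s * √s := by gcongr
      _ = 15 := by field_simp
  have hz : |wkbZ n s| ≤ 150 := by
    have t1 : |s / wkbRoot n s * besselJ' n s| ≤ 1200 / 9 := by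
      rw [abs_mul, abs_of_pos (by positivity)]
      calc _ ≤ s / (9 / 10 * √s) * (120 / √s) := by gcongr
        _ = 1200 / 9 := by
          nth_rewrite 1 [← ss]; field_simp; norm_num
    have t2 : |s ^ 2 / (2 * wkbRoot n s ^ 5) * besselJ n s| ≤ 14 := by
      rw [abs_mul, abs_of_pos (by positivity)]
      calc _ ≤ s ^ 2 / (2 * (9 / 10 * √s) ^ 5) * (15 / √s) := by gcongr
        _ = (15 / (2 * (9/10)^5)) / √s ^ 2 := by
          nth_rewrite 1 [← ss]; field_simp
        _ ≤ (15 / (2 * (9/10)^5)) / 1 := by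
          gcongr; exact one_le_pow₀ r1
        _ ≤ 14 := by norm_num
    rw [wkbZ]
    exact (abs_add_le _ _).trans (by linarith)
  have := sq_le_sq' (by linarith [neg_abs_le (wkbY n s)]) ((le_abs_self _).trans hy)
  have := sq_le_sq' (by linarith [neg_abs_le (wkbZ n s)]) ((le_abs_self _).trans hz)
  linarith

lemma wkb_energy {n : ℕ} {s : ℝ} (h : n + besselWidth n ≤ s) :
    wkbY n s ^ 2 + wkbZ n s ^ 2 ≤ 640000 := by
  have n0 : (0 : ℝ) ≤ n := cast_nonneg n
  have b1 := one_le_besselWidth n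
  set S := max s (2 * n) with hS
  have hsS : s ≤ S := le_max_left _ _
  have hnS : 2 * (n : ℝ) ≤ S := le_max_right _ _
  have m := wkb_energy_antitone n (b := S) (lt_of_wkb h) ⟨le_rfl, hsS⟩ ⟨hsS, le_rfl⟩ hsS
  simp only at m
  have far := wkb_energy_far (n := n) (s := S) (by linarith) hnS
  have t0 : 0 ≤ wkbTail n S := wkbTail_nonneg (by linarith [lt_of_wkb h])
  have t1 := wkbTail_le h
  have e1 : exp (-(5 / 4 * wkbTail n S)) ≤ 1 := exp_le_one_iff.mpr (by linarith)
  have e2 : 1 / 16 ≤ exp (-(5 / 4 * wkbTail n s)) := by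
    have h1 : exp (-2) ≤ exp (-(5 / 4 * wkbTail n s)) := exp_le_exp.mpr (by linarith)
    have h2 : exp 1 < 2.7182818286 := exp_one_lt_d9
    have h3 : exp (-2) = 1 / (exp 1) ^ 2 := by
      rw [exp_neg, ← exp_nat_mul]; norm_num
    have h4 : 1 / 16 ≤ exp (-2) := by
      rw [h3]
      apply one_div_le_one_div_of_le (by positivity)
      nlinarith [exp_pos 1]
    linarith
  have p0 : 0 ≤ wkbY n s ^ 2 + wkbZ n s ^ 2 := by positivity
  have p1 : 0 ≤ wkbY n S ^ 2 + wkbZ n S ^ 2 := by positivity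
  have := mul_le_mul_of_nonneg_left e2 p0
  have := mul_le_mul_of_nonneg_left e1 p1
  linarith

lemma hasDerivAt_wkbCoeff {n : ℕ} {s : ℝ} (h : (n : ℝ) < s) :
    HasDerivAt (wkbCoeff n) (wkbCoeff' n s) s := by
  have hp := ((hasDerivAt_wkbPhase h).neg.ofReal_comp.const_mul I).cexp.const_mul (1/2 : ℂ)
  have hyz := (hasDerivAt_wkbY h).ofReal_comp.sub ((hasDerivAt_wkbZ h).ofReal_comp.const_mul I)
  refine (hp.mul hyz).congr_deriv ?_
  simp only [wkbCoeff', Pi.neg_apply, Pi.sub_apply]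
  push_cast
  linear_combination (1 / 2 * Complex.exp (I * -(wkbPhase n s : ℂ)) *
    ((wkbRoot n s : ℂ) ^ 2 / s) * (wkbZ n s)) * I_sq

lemma wkb_continuousOn {n : ℕ} {f f' : ℝ → ℝ} {a b : ℝ} (ha : (n : ℝ) < a)
    (h : ∀ s, (n : ℝ) < s → HasDerivAt f (f' s) s) : ContinuousOn f (Icc a b) :=
  fun x hx => (h x (ha.trans_le hx.1)).continuousAt.continuousWithinAt

lemma bvAmp_wkbCoeff {n : ℕ} {a b : ℝ} (ha : n + besselWidth n ≤ a) (hab : a ≤ b) :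
    BVAmp (wkbCoeff n) (wkbCoeff' n) a b 800 := by
  have hlt : ∀ x ∈ Icc a b, (n : ℝ) < x := fun x hx => (lt_of_wkb ha).trans_le hx.1
  have cq : ContinuousOn (wkbRoot n) (Icc a b) :=
    wkb_continuousOn (lt_of_wkb ha) fun s => hasDerivAt_wkbRoot
  have cp : ContinuousOn (wkbPhase n) (Icc a b) :=
    wkb_continuousOn (lt_of_wkb ha) fun s => hasDerivAt_wkbPhase
  have cy : ContinuousOn (wkbY n) (Icc a b) :=
    wkb_continuousOn (lt_of_wkb ha) fun s => hasDerivAt_wkbY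
  have ce : ContinuousOn (wkbErr n) (Icc a b) := by
    apply ContinuousOn.div (by fun_prop) (cq.pow 10)
    intro x hx; exact (pow_pos (wkbRoot_pos (hlt x hx)) 10).ne'
  have cc : ContinuousOn (wkbCoeff' n) (Icc a b) := by
    apply ContinuousOn.mul
    · fun_prop
    · fun_prop
  have ybound : ∀ x ∈ Icc a b, |wkbY n x| ≤ 800 := by
    intro x hx
    have := wkb_energy (ha.trans hx.1)
    apply abs_le_of_sq_le_sq _ (by norm_num)
    nlinarith [sq_nonneg (wkbZ n x)]
  have zbound : ∀ x ∈ Icc a b, |wkbZ n x| ≤ 800 := by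
    intro x hx
    have := wkb_energy (ha.trans hx.1)
    apply abs_le_of_sq_le_sq _ (by norm_num)
    nlinarith [sq_nonneg (wkbY n x)]
  refine ⟨fun x hx => hasDerivAt_wkbCoeff (hlt x hx), cc, fun x hx => ?_, ?_⟩
  · rw [wkbCoeff, norm_mul, norm_mul, norm_exp_I_mul_real]
    have h1 : ‖(wkbY n x : ℂ) - I * wkbZ n x‖ ≤ 1600 := by
      refine (norm_sub_le _ _).trans ?_
      rw [norm_mul, norm_I, norm_real, norm_real, norm_eq_abs,
        norm_eq_abs]
      linarith [ybound x hx, zbound x hx]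
    have h2 : ‖(1 / 2 : ℂ)‖ = 1 / 2 := by norm_num
    rw [h2]; linarith
  · have nb : ∀ x ∈ Icc a b, ‖wkbCoeff' n x‖ ≤ -(500 * -(x ^ 3 / wkbRoot n x ^ 10)) := by
      intro x hx
      have h2 : ‖(I / 2 : ℂ)‖ = 1 / 2 := by simp
      rw [wkbCoeff', norm_mul, norm_mul, norm_exp_I_mul_real, h2, norm_real,
        norm_eq_abs, abs_mul, abs_of_nonneg (wkbErr_nonneg (hlt x hx))]
      have := mul_le_mul (wkbErr_le (hlt x hx)) (ybound x hx) (abs_nonneg _)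
        ((wkbErr_nonneg (hlt x hx)).trans (wkbErr_le (hlt x hx)))
      linarith
    have ct : ContinuousOn (fun x => -(x ^ 3 / wkbRoot n x ^ 10)) (Icc a b) := by
      apply ContinuousOn.neg
      apply ContinuousOn.div (by fun_prop) (cq.pow 10)
      intro x hx; exact (pow_pos (wkbRoot_pos (hlt x hx)) 10).ne'
    have it : IntervalIntegrable (fun x => -(x ^ 3 / wkbRoot n x ^ 10)) volume a b := by
      exact intervalIntegrable_of_Icc hab ‹_›
    have ftc := integral_eq_sub_of_hasDerivAt (a := a) (b := b)
      (fun x hx => hasDerivAt_wkbTail (hlt x (by rwa [uIcc_of_le hab] at hx))) it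
    calc ∫ x in a..b, ‖wkbCoeff' n x‖ ≤ ∫ x in a..b, -(500 * -(x ^ 3 / wkbRoot n x ^ 10)) := by
          apply integral_mono_on hab _ (it.const_mul 500).neg nb
          exact intervalIntegrable_of_Icc hab cc.norm
      _ = 500 * (wkbTail n a - wkbTail n b) := by
          rw [intervalIntegral.integral_neg, intervalIntegral.integral_const_mul, ftc]; ring
      _ ≤ 800 := by
          have := wkbTail_le ha
          have := wkbTail_nonneg (hlt b ⟨hab, le_rfl⟩)
          linarith

/-- The WKB representation of `J_n`. -/
lemma besselJ_eq_wkb {n : ℕ} {s : ℝ} (h : (n : ℝ) < s) :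
    (besselJ n s : ℂ) = ((1 / wkbRoot n s : ℝ) : ℂ) *
      (cis(wkbPhase n s) * wkbCoeff n s +
        cis(-wkbPhase n s) * conj (wkbCoeff n s)) := by
  have q0 : (wkbRoot n s : ℂ) ≠ 0 := by exact_mod_cast (wkbRoot_pos h).ne'
  have e : cis(wkbPhase n s) *
      cis(-wkbPhase n s) = 1 := by
    rw [← Complex.exp_add]; push_cast; ring_nf; exact Complex.exp_zero
  have ec : conj (cis(-wkbPhase n s)) =
      cis(wkbPhase n s) := by
    rw [← exp_conj]; simp
  rw [wkbCoeff]
  simp only [map_mul, map_sub, conj_ofReal, conj_I, map_div₀, map_one, map_ofNat, ec]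
  have hy : (besselJ n s : ℂ) = ((1 / wkbRoot n s : ℝ) : ℂ) * wkbY n s := by
    rw [wkbY]; push_cast; field_simp
  rw [hy]
  congr 1
  linear_combination (-(wkbY n s : ℂ)) * e

lemma bvAmp_conj {G G' : ℝ → ℂ} {a b A : ℝ} (h : BVAmp G G' a b A) :
    BVAmp (fun x => conj (G x)) (fun x => conj (G' x)) a b A := by
  refine ⟨fun x hx => (h.deriv x hx).star_conj, ?_, fun x hx => ?_, ?_⟩
  · exact continuous_conj.comp_continuousOn h.cont
  · rw [norm_conj]; exact h.bound x hx
  · simp only [norm_conj]; exact h.var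

lemma bvAmp_wkbRoot {n : ℕ} {a b : ℝ} (ha : (n : ℝ) < a) (hab : a ≤ b) :
    BVAmp (fun x => ((1 / wkbRoot n x : ℝ) : ℂ))
      (fun x => ((-(x / (2 * wkbRoot n x ^ 5)) : ℝ) : ℂ)) a b (1 / wkbRoot n a) := by
  have hlt : ∀ x ∈ Icc a b, (n : ℝ) < x := fun x hx => ha.trans_le hx.1
  have cq : ContinuousOn (wkbRoot n) (Icc a b) :=
    wkb_continuousOn ha fun s => hasDerivAt_wkbRoot
  refine BVAmp.of_antitone (G := fun x => 1 / wkbRoot n x) hab (fun x hx => ?_) ?_ ?_ ?_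
  · have q0 := wkbRoot_pos (hlt x hx)
    refine ((hasDerivAt_const x (1:ℝ)).div (hasDerivAt_wkbRoot (hlt x hx)) q0.ne').congr_deriv ?_
    field_simp; ring
  · apply ContinuousOn.neg
    apply ContinuousOn.div (by fun_prop) (continuousOn_const.mul (cq.pow 5))
    intro x hx; exact (mul_pos two_pos (pow_pos (wkbRoot_pos (hlt x hx)) 5)).ne'
  · intro x hx
    have q0 := wkbRoot_pos (hlt x hx)
    have s0 : 0 < x := (cast_nonneg n).trans_lt (hlt x hx)
    simp only [Left.neg_nonpos_iff]; positivity
  · intro x hx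
    have q0 := wkbRoot_pos (hlt x hx)
    positivity

/-- The Fresnel integral. -/
def fresnel (V : ℝ) : ℂ := ∫ x in (0:ℝ)..V, cis(x ^ 2)

lemma continuous_exp_phase {X : Type*} [TopologicalSpace X] {Φ : X → ℝ} (h : Continuous Φ) :
    Continuous fun x => cis(Φ x) :=
  Complex.continuous_exp.comp (continuous_const.mul (continuous_ofReal.comp h))

lemma norm_fresnel_sub_le {V W : ℝ} (hV : 0 < V) (hVW : V ≤ W) :
    ‖fresnel W - fresnel V‖ ≤ 3 / (2 * V) := by
  have hi : ∀ a b : ℝ, IntervalIntegrable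
      (fun x => cis(x ^ 2)) volume a b := fun a b =>
    (continuous_exp_phase (by fun_prop)).intervalIntegrable a b
  rw [fresnel, fresnel, integral_interval_sub_left (hi _ _) (hi _ _)]
  have : OscBound (fun x => x ^ 2) V W (3 / (2 * V)) := by
    refine oscBound_of_deriv_ge (Φ' := fun x => 2 * x) (Φ'' := fun _ => 2) (by positivity)
      (fun x _ => ?_) (fun x _ => ?_) continuousOn_const (fun x hx => ?_)
      (Or.inl fun x _ => by norm_num)
    · simpa using hasDerivAt_pow 2 x
    · simpa using (hasDerivAt_id x).const_mul 2
    · linarith [hx.1]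
  exact this V W le_rfl hVW le_rfl

lemma exists_fresnel_limit : ∃ L : ℂ, L ≠ 0 ∧ ∀ V : ℝ, 0 < V → ‖fresnel V - L‖ ≤ 3 / (2 * V) := by
  have hc : CauchySeq fun n : ℕ => fresnel (n + 1) := by
    refine cauchySeq_of_le_tendsto_0 (fun n : ℕ => 3 / (2 * ((n:ℝ) + 1)) + 3 / (2 * ((n:ℝ) + 1)))
      (fun n m N hn hm => ?_) ?_
    · have hn' : (N:ℝ) ≤ n := by exact_mod_cast hn
      have hm' : (N:ℝ) ≤ m := by exact_mod_cast hm
      have h1 := norm_fresnel_sub_le (V := N + 1) (W := n + 1) (by positivity) (by linarith)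
      have h2 := norm_fresnel_sub_le (V := N + 1) (W := m + 1) (by positivity) (by linarith)
      rw [dist_eq_norm]
      calc ‖fresnel (n + 1) - fresnel (m + 1)‖
          = ‖(fresnel (n + 1) - fresnel (N + 1)) - (fresnel (m + 1) - fresnel (N + 1))‖ := by
            congr 1; ring
        _ ≤ _ := (norm_sub_le _ _).trans (add_le_add h1 h2)
    · have := (tendsto_one_div_add_atTop_nhds_zero_nat (𝕜 := ℝ)).const_mul 3
      rw [mul_zero] at this
      refine this.congr fun n => ?_
      have : (n:ℝ) + 1 ≠ 0 := by positivity
      field_simp; norm_num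
  obtain ⟨L, hL⟩ := cauchySeq_tendsto_of_complete hc
  have key : ∀ V : ℝ, 0 < V → ‖fresnel V - L‖ ≤ 3 / (2 * V) := by
    intro V hV
    refine le_of_tendsto (tendsto_const_nhds.sub hL).norm ?_
    obtain ⟨N, hN⟩ := exists_nat_ge V
    filter_upwards [Filter.eventually_ge_atTop N] with n hn
    rw [norm_sub_rev]
    refine norm_fresnel_sub_le hV ?_
    have : (N:ℝ) ≤ n := by exact_mod_cast hn
    linarith
  refine ⟨L, fun h0 => ?_, key⟩
  subst h0
  have h2 : (√2)^2 = (2:ℝ) := sq_sqrt (by norm_num)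
  have s0 : (0:ℝ) < √2 := by positivity
  have hb := key (√2) s0
  rw [sub_zero] at hb
  have hint : ∀ f : ℝ → ℝ, Continuous f → IntervalIntegrable f volume 0 (√2) :=
    fun f hf => hf.intervalIntegrable _ _
  have hexp : ∀ a b : ℝ, IntervalIntegrable
      (fun x => cis(x ^ 2)) volume a b := fun a b =>
    (continuous_exp_phase (by fun_prop)).intervalIntegrable a b
  have hre : (fresnel (√2)).re = ∫ x in (0:ℝ)..√2, cos (x ^ 2) := by
    have := reCLM.intervalIntegral_comp_comm (hexp 0 (√2))
    rw [fresnel, ← reCLM_apply, ← this]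
    refine integral_congr fun x _ => ?_
    simp [-Complex.ofReal_pow, exp_re]
  have him : (fresnel (√2)).im = ∫ x in (0:ℝ)..√2, sin (x ^ 2) := by
    have := imCLM.intervalIntegral_comp_comm (hexp 0 (√2))
    rw [fresnel, ← imCLM_apply, ← this]
    refine integral_congr fun x _ => ?_
    simp [-Complex.ofReal_pow, exp_im]
  have h1 : √2 * (1 - 4 / 10) ≤ (fresnel (√2)).re := by
    rw [hre]
    calc √2 * (1 - 4 / 10) = ∫ x in (0:ℝ)..√2, (1 - x ^ 4 / 2) := by
          rw [intervalIntegral.integral_sub (hint _ (by fun_prop)) (hint _ (by fun_prop)),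
            intervalIntegral.integral_div, integral_pow]
          simp only [intervalIntegral.integral_const, smul_eq_mul]
          have : (√2)^5 = √2 * 4 := by
            calc (√2)^5 = ((√2)^2)^2 * √2 := by ring
              _ = _ := by rw [h2]; ring
          norm_num [this]; ring
      _ ≤ _ := by
          refine integral_mono_on s0.le (hint _ (by fun_prop)) (hint _ (by fun_prop))
            fun x _ => ?_
          have := one_sub_sq_div_two_le_cos (x := x ^ 2)
          nlinarith
  have h3 : √2 * (2 / 3 - 8 / 42) ≤ (fresnel (√2)).im := by
    rw [him]
    calc √2 * (2 / 3 - 8 / 42) = ∫ x in (0:ℝ)..√2, (x ^ 2 - x ^ 6 / 6) := by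
          rw [intervalIntegral.integral_sub (hint _ (by fun_prop)) (hint _ (by fun_prop)),
            intervalIntegral.integral_div, integral_pow, integral_pow]
          have e7 : (√2)^7 = √2 * 8 := by
            calc (√2)^7 = ((√2)^2)^3 * √2 := by ring
              _ = _ := by rw [h2]; ring
          have e3 : (√2)^3 = √2 * 2 := by
            calc (√2)^3 = ((√2)^2) * √2 := by ring
              _ = _ := by rw [h2]; ring
          norm_num [e7, e3]; ring
      _ ≤ _ := by
          refine integral_mono_on s0.le (hint _ (by fun_prop)) (hint _ (by fun_prop))
            fun x _ => ?_
          have := sin_ge_sub_cube (x := x ^ 2) (by positivity)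
          nlinarith
  have h4 : ‖fresnel (√2)‖ ^ 2 ≤ 9 / 8 := by
    calc ‖fresnel (√2)‖ ^ 2 ≤ (3 / (2 * √2)) ^ 2 := by gcongr
      _ = 9 / 8 := by rw [div_pow, mul_pow, h2]; norm_num
  rw [Complex.sq_norm, Complex.normSq_apply] at h4
  nlinarith

/-- The phase in the subordination formula for `exp (i t √E)`. -/
def subPhase (E w : ℝ) : ℝ := E * w ^ 2 + 1 / (4 * w ^ 2)

lemma subPhase_eq {E w : ℝ} (hE : 0 ≤ E) (hw : w ≠ 0) :
    subPhase E w = √E + (√E * w - 1 / (2 * w)) ^ 2 := by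
  have := sq_sqrt hE
  rw [subPhase]
  field_simp
  linear_combination (-(w^4)) * 4 * 4 * this

lemma hasDerivAt_subPhase_root {E w : ℝ} (hw : w ≠ 0) :
    HasDerivAt (fun w => √E * w - 1 / (2 * w)) (√E + 1 / (2 * w ^ 2)) w := by
  have h := ((hasDerivAt_id w).const_mul (√E)).sub
    ((hasDerivAt_const w (1:ℝ)).div ((hasDerivAt_id w).const_mul 2) (by simpa using hw))
  refine h.congr_deriv ?_
  simp only [id]
  field_simp
  ring

/-- The subordination integral over an interval symmetric about the self-dual point. -/
lemma subordination_symm {E t m b : ℝ} (hE : 0 < E) (ht : 0 < t) (hm : 0 < m)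
    (hmE : m ^ 2 * (2 * √E) = 1) (hmb : m ≤ b) :
    ((√E * √t : ℝ) : ℂ) * ∫ w in (m ^ 2 / b)..b, cis(t * subPhase E w)
      = cis(t * √E) * fresnel (√t * (√E * b - 1 / (2 * b))) := by
  have hb : 0 < b := hm.trans_le hmb
  have hsE : 0 < √E := by positivity
  have hst : 0 < √t := by positivity
  set v : ℝ → ℝ := fun w => √E * w - 1 / (2 * w) with hv
  set f : ℝ → ℂ := fun w => cis(t * v w ^ 2) with hf
  have hpos1 : ∀ x ∈ uIcc m b, 0 < x := fun x hx => by
    rw [uIcc_of_le hmb] at hx; exact hm.trans_le hx.1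
  have hle : m ^ 2 / b ≤ m := by
    rw [div_le_iff₀ hb, pow_two]; gcongr
  have hpos2 : ∀ x ∈ uIcc (m ^ 2 / b) m, 0 < x := fun x hx => by
    rw [uIcc_of_le hle] at hx
    exact (by positivity : 0 < m ^ 2 / b).trans_le hx.1
  have hvc : ContinuousOn v (Ioi 0) := fun x hx =>
    (hasDerivAt_subPhase_root (E := E) (ne_of_gt hx)).continuousAt.continuousWithinAt
  have hfc : ContinuousOn f (Ioi 0) :=
    continuousOn_exp_phase (continuousOn_const.mul (hvc.pow 2))
  have hfi1 : IntervalIntegrable f volume m b :=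
    (hfc.mono fun x hx => hpos1 x hx).intervalIntegrable
  have hfi2 : IntervalIntegrable f volume (m ^ 2 / b) m :=
    (hfc.mono fun x hx => hpos2 x hx).intervalIntegrable
  have hwi : IntervalIntegrable (fun x => ((1 / (2 * x ^ 2) : ℝ) : ℂ) * f x) volume m b := by
    apply ContinuousOn.intervalIntegrable
    refine ContinuousOn.mul (continuous_ofReal.comp_continuousOn ?_)
      (hfc.mono fun x hx => hpos1 x hx)
    refine continuousOn_const.div (by fun_prop) fun x hx => ?_
    have := hpos1 x hx
    positivity
  have e0 : ∫ w in (m ^ 2 / b)..b, cis(t * subPhase E w) =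
      cis(t * √E) * ∫ w in (m ^ 2 / b)..b, f w := by
    rw [← intervalIntegral.integral_const_mul]
    refine integral_congr fun w hw => ?_
    have hw0 : 0 < w := by
      rw [uIcc_of_le (hle.trans hmb)] at hw
      exact (by positivity : 0 < m ^ 2 / b).trans_le hw.1
    simp only [hf]
    rw [← Complex.exp_add, subPhase_eq hE.le hw0.ne']
    rw [← mul_add, ← ofReal_add, mul_add]
  have e1 : (√E : ℂ) * ∫ w in (m ^ 2 / b)..m, f w =
      ∫ w in m..b, ((1 / (2 * w ^ 2) : ℝ) : ℂ) * f w := by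
    have := integral_deriv_smul_comp'' (a := m) (b := b) (f := fun x => m ^ 2 / x)
      (f' := fun x => -m ^ 2 / x ^ 2) (g := f)
      (continuousOn_const.div continuousOn_id fun x hx => (hpos1 x hx).ne')
      (fun x hx => by
        have hx0 : x ≠ 0 := (hpos1 x (Ioo_subset_Icc_self hx)).ne'
        have := (hasDerivAt_const x (m ^ 2)).div (hasDerivAt_id x) hx0
        refine (this.congr_deriv ?_).hasDerivWithinAt
        simp)
      (continuousOn_const.div (by fun_prop) fun x hx => by
        have := hpos1 x hx; positivity)
      (hfc.mono (by
        rintro _ ⟨x, hx, rfl⟩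
        have := hpos1 x hx
        simp only [mem_Ioi]; positivity))
    have hmm : m ^ 2 / m = m := by field_simp
    rw [hmm] at this
    rw [integral_symm, ← this, mul_neg, ← intervalIntegral.integral_const_mul,
      ← intervalIntegral.integral_neg]
    refine integral_congr fun x hx => ?_
    have hx0 := hpos1 x hx
    have hvx : v (m ^ 2 / x) ^ 2 = v x ^ 2 := by
      have hmm : m ^ 2 = 1 / (2 * √E) := by field_simp; linarith
      simp only [hv]
      rw [hmm]
      field_simp
      ring
    simp only [Function.comp, hf]
    rw [hvx, real_smul, ← mul_assoc, ← neg_mul, ← Complex.ofReal_mul, ← ofReal_neg]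
    congr 2
    field_simp
    linarith
  have e2 : ∫ w in m..b, f w * ((√E + 1 / (2 * w ^ 2) : ℝ) : ℂ) =
      ∫ y in (0:ℝ)..v b, cis(t * y ^ 2) := by
    have := integral_deriv_smul_comp'' (a := m) (b := b) (f := v)
      (f' := fun x => √E + 1 / (2 * x ^ 2))
      (g := fun y => cis(t * y ^ 2))
      (hvc.mono fun x hx => hpos1 x hx)
      (fun x hx => (hasDerivAt_subPhase_root
        (hpos1 x (Ioo_subset_Icc_self hx)).ne').hasDerivWithinAt)
      (continuousOn_const.add (continuousOn_const.div (by fun_prop) fun x hx => by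
        have := hpos1 x hx; positivity))
      (continuous_exp_phase (by fun_prop)).continuousOn
    have hvm : v m = 0 := by
      simp only [hv]; field_simp; linarith
    rw [hvm] at this
    rw [← this]
    refine integral_congr fun x _ => ?_
    simp only [Function.comp, hf, real_smul]
    ring
  have e3 : (√t : ℂ) * ∫ y in (0:ℝ)..v b, cis(t * y ^ 2) =
      fresnel (√t * v b) := by
    have := intervalIntegral.integral_comp_mul_left (a := 0) (b := v b)
      (fun x : ℝ => cis(x ^ 2)) hst.ne'
    rw [mul_zero] at this
    rw [fresnel]
    have h2 : ∀ y : ℝ, (√t * y) ^ 2 = t * y ^ 2 := fun y => by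
      rw [mul_pow, sq_sqrt ht.le]
    simp only [h2] at this
    rw [this, real_smul, ← mul_assoc, ← Complex.ofReal_mul, mul_inv_cancel₀ hst.ne']
    simp
  have e4 : (√E : ℂ) * ∫ w in (m ^ 2 / b)..b, f w =
      ∫ w in m..b, f w * ((√E + 1 / (2 * w ^ 2) : ℝ) : ℂ) := by
    rw [← integral_add_adjacent_intervals hfi2 hfi1, mul_add, e1,
      ← intervalIntegral.integral_const_mul, ← intervalIntegral.integral_add hwi (hfi1.const_mul _)]
    refine integral_congr fun x _ => ?_
    push_cast
    ring
  rw [e0, ← e3, ← e2, ← e4]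
  push_cast
  ring

lemma BVAmp.of_deriv_sign {G G' : ℝ → ℝ} {a b A : ℝ} (hab : a ≤ b)
    (h1 : ∀ x ∈ Icc a b, HasDerivAt G (G' x) x) (h2 : ContinuousOn G' (Icc a b))
    (h3 : (∀ x ∈ Icc a b, 0 ≤ G' x) ∨ (∀ x ∈ Icc a b, G' x ≤ 0))
    (h4 : ∀ x ∈ Icc a b, |G x| ≤ A) :
    BVAmp (fun x => (G x : ℂ)) (fun x => (G' x : ℂ)) a b (2 * A) := by
  have hA : 0 ≤ A := (abs_nonneg _).trans (h4 a ⟨le_rfl, hab⟩)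
  have hi : IntervalIntegrable G' volume a b := by
    exact intervalIntegrable_of_Icc hab ‹_›
  have ftc := integral_eq_sub_of_hasDerivAt
    (fun x hx => h1 x (by rwa [uIcc_of_le hab] at hx)) hi
  refine ⟨fun x hx => (h1 x hx).ofReal_comp, continuous_ofReal.comp_continuousOn h2,
    fun x hx => ?_, ?_⟩
  · rw [norm_real, norm_eq_abs]
    linarith [h4 x hx]
  · have ha := abs_le.mp (h4 a ⟨le_rfl, hab⟩)
    have hb := abs_le.mp (h4 b ⟨hab, le_rfl⟩)
    rcases h3 with h3 | h3
    · have e : ∫ x in a..b, ‖(G' x : ℂ)‖ = ∫ x in a..b, G' x := by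
        refine integral_congr fun x hx => ?_
        rw [uIcc_of_le hab] at hx
        simp only [norm_real, norm_eq_abs, abs_of_nonneg (h3 x hx)]
      rw [e, ftc]; linarith
    · have e : ∫ x in a..b, ‖(G' x : ℂ)‖ = -∫ x in a..b, G' x := by
        rw [← intervalIntegral.integral_neg]
        refine integral_congr fun x hx => ?_
        rw [uIcc_of_le hab] at hx
        simp only [norm_real, norm_eq_abs, abs_of_nonpos (h3 x hx)]
      rw [e, ftc]; linarith

/-- One integration by parts, with a remainder controlled by the oscillation of the phase. -/
lemma norm_integral_exp_sub_boundary_le {Φ Φ' G G' G'' : ℝ → ℝ} {a b τ M A : ℝ} (hab : a ≤ b)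
    (h1 : ∀ x ∈ Icc a b, HasDerivAt Φ (Φ' x) x)
    (hG : ∀ x ∈ Icc a b, HasDerivAt G (G' x) x)
    (hGΦ : ∀ x ∈ Icc a b, G x * Φ' x = τ) (hM : OscBound Φ a b M)
    (hA : BVAmp (fun x => (G' x : ℂ)) (fun x => (G'' x : ℂ)) a b A) :
    ‖I * (τ : ℂ) * (∫ x in a..b, cis(Φ x)) -
      (cis(Φ b) * G b -
        cis(Φ a) * G a)‖ ≤ 2 * M * A := by
  have hΦc : ContinuousOn Φ (Icc a b) :=
    fun x hx => (h1 x hx).continuousAt.continuousWithinAt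
  have hec := continuousOn_exp_phase hΦc
  have hu : uIcc a b = Icc a b := uIcc_of_le hab
  have hi1 : IntervalIntegrable (fun x => I * (τ : ℂ) * cis(Φ x))
      volume a b := by
    apply ContinuousOn.intervalIntegrable; rw [hu]; exact continuousOn_const.mul hec
  have hi2 : IntervalIntegrable (fun x => cis(Φ x) * G' x)
      volume a b := by
    apply ContinuousOn.intervalIntegrable; rw [hu]; exact hec.mul hA.continuousOn
  have ftc := integral_eq_sub_of_hasDerivAt
    (f := fun x => cis(Φ x) * G x)
    (f' := fun x => I * (τ : ℂ) * cis(Φ x) +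
      cis(Φ x) * G' x) (a := a) (b := b)
    (fun x hx => by
      rw [hu] at hx
      have := (((h1 x hx).ofReal_comp.const_mul I).cexp).mul (hG x hx).ofReal_comp
      refine this.congr_deriv ?_
      rw [← hGΦ x hx]; push_cast; ring) (hi1.add hi2)
  rw [intervalIntegral.integral_add hi1 hi2, intervalIntegral.integral_const_mul] at ftc
  rw [← ftc, sub_add_cancel_left, norm_neg]
  exact hM.amp hab hΦc hA

section SubPhase
variable {E w : ℝ}

/-- The reciprocal of the derivative of `subPhase`. -/
def subAmp (E w : ℝ) : ℝ := 2 * w ^ 3 / (4 * E * w ^ 4 - 1)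

/-- The derivative of `subAmp`. -/
def subAmp' (E w : ℝ) : ℝ := -(8 * E * w ^ 6 + 6 * w ^ 2) / (4 * E * w ^ 4 - 1) ^ 2

/-- The second derivative of `subAmp`. -/
def subAmp'' (E w : ℝ) : ℝ :=
  (64 * E ^ 2 * w ^ 9 + 192 * E * w ^ 5 + 12 * w) / (4 * E * w ^ 4 - 1) ^ 3

lemma hasDerivAt_subPhase (hw : w ≠ 0) :
    HasDerivAt (subPhase E) ((4 * E * w ^ 4 - 1) / (2 * w ^ 3)) w := by
  have h := ((hasDerivAt_pow 2 w).const_mul E).add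
    ((hasDerivAt_const w (1:ℝ)).div ((hasDerivAt_pow 2 w).const_mul 4) (by positivity))
  refine h.congr_deriv ?_
  field_simp
  norm_num
  ring

lemma hasDerivAt_subPhase' (hw : w ≠ 0) :
    HasDerivAt (fun w => (4 * E * w ^ 4 - 1) / (2 * w ^ 3)) (2 * E + 3 / (2 * w ^ 4)) w := by
  have h := ((((hasDerivAt_pow 4 w).const_mul (4 * E)).sub_const 1).div
    ((hasDerivAt_pow 3 w).const_mul 2) (by positivity))
  refine h.congr_deriv ?_
  field_simp
  norm_num
  ring

lemma hasDerivAt_subAmp (h : 4 * E * w ^ 4 - 1 ≠ 0) :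
    HasDerivAt (subAmp E) (subAmp' E w) w := by
  have h := (((hasDerivAt_pow 3 w).const_mul 2).div
    (((hasDerivAt_pow 4 w).const_mul (4 * E)).sub_const 1) h)
  refine h.congr_deriv ?_
  rw [subAmp']
  congr 1
  norm_num
  ring

lemma hasDerivAt_subAmp' (h : 4 * E * w ^ 4 - 1 ≠ 0) :
    HasDerivAt (subAmp' E) (subAmp'' E w) w := by
  have h := ((((hasDerivAt_pow 6 w).const_mul (8 * E)).add
    ((hasDerivAt_pow 2 w).const_mul 6)).neg.div
    ((((hasDerivAt_pow 4 w).const_mul (4 * E)).sub_const 1).pow 2)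
      (by simpa using h))
  refine h.congr_deriv ?_
  rw [subAmp'']
  simp only [Pi.add_apply, Pi.pow_apply, Pi.neg_apply]
  have hD : 4 * E * w ^ 4 - 1 ≠ 0 := by assumption
  generalize hDD : 4 * E * w ^ 4 - 1 = D at *
  field_simp
  norm_num
  rw [← hDD]
  ring

end SubPhase

lemma subPhase_small {E w : ℝ} (hE : E ≤ 13) (hw : 0 < w) (hw1 : w ≤ 31 / 100) :
    4 * E * w ^ 4 - 1 ≤ -(51 / 100) := by
  have : w ^ 4 ≤ (31 / 100) ^ 4 := by gcongr
  have : E * w ^ 4 ≤ 13 * (31 / 100) ^ 4 := by gcongr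
  norm_num at this
  linarith

lemma subPhase_large {E w : ℝ} (hE1 : 1 ≤ E) (hw : 1 ≤ w) :
    3 * (E * w ^ 4) ≤ 4 * E * w ^ 4 - 1 := by
  have : 1 ≤ w ^ 4 := one_le_pow₀ hw
  nlinarith

lemma subAmp_small {E w : ℝ} (hE : E ≤ 13) (hE1 : 1 ≤ E) (hw : 0 < w) (hw1 : w ≤ 31 / 100) :
    |subAmp E w| ≤ 4 * w ∧ |subAmp' E w| ≤ 3 := by
  have hD := subPhase_small hE hw hw1
  have hw2 : w ^ 2 ≤ (31 / 100) ^ 2 := by gcongr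
  have hw6 : w ^ 6 ≤ (31 / 100) ^ 6 := by gcongr
  constructor
  · rw [subAmp, abs_div, abs_of_nonpos (a := 4 * E * w ^ 4 - 1) (by linarith),
      abs_of_pos (by positivity), div_le_iff₀ (by linarith)]
    nlinarith
  · have hp : 0 < 8 * E * w ^ 6 + 6 * w ^ 2 := by positivity
    rw [subAmp', abs_div, abs_neg, abs_of_pos hp,
      abs_of_nonneg (a := (4 * E * w ^ 4 - 1) ^ 2) (sq_nonneg _), div_le_iff₀ (by nlinarith)]
    have : E * w ^ 6 ≤ 13 * (31 / 100) ^ 6 := by gcongr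
    norm_num at this hw2
    nlinarith

lemma subAmp_large {E w : ℝ} (hE1 : 1 ≤ E) (hw : 1 ≤ w) :
    |subAmp E w| ≤ 1 / w ∧ |subAmp' E w| ≤ 2 := by
  have hD := subPhase_large hE1 hw
  have hw0 : 0 < w := by linarith
  have hp0 : 0 < E * w ^ 4 := by positivity
  have h4 : w ^ 4 ≤ E * w ^ 4 := le_mul_of_one_le_left (by positivity) hE1
  constructor
  · rw [subAmp, abs_div, abs_of_nonneg (a := 4 * E * w ^ 4 - 1) (by linarith),
      abs_of_pos (by positivity), div_le_div_iff₀ (by linarith) hw0]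
    linarith
  · have hp : 0 < 8 * E * w ^ 6 + 6 * w ^ 2 := by positivity
    rw [subAmp', abs_div, abs_neg, abs_of_pos hp,
      abs_of_nonneg (a := (4 * E * w ^ 4 - 1) ^ 2) (sq_nonneg _),
      div_le_iff₀ (by nlinarith)]
    calc 8 * E * w ^ 6 + 6 * w ^ 2 ≤ 8 * E * w ^ 8 + 6 * E * w ^ 8 := by
          have h1 : w ^ 6 ≤ w ^ 8 := pow_le_pow_right₀ hw (by norm_num)
          nlinarith
      _ = 14 * (1 * E * w ^ 8) := by ring
      _ ≤ 18 * (E * E * w ^ 8) := by gcongr; norm_num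
      _ = 2 * (3 * (E * w ^ 4)) ^ 2 := by ring
      _ ≤ _ := by gcongr

/-- The part of the subordination integral near the origin. -/
lemma subordination_small {E t a b : ℝ} (hE : E ≤ 13) (hE1 : 1 ≤ E) (ht : 0 < t) (ha : 0 < a)
    (hab : a ≤ b) (hb : b ≤ 31 / 100) :
    OscBound (fun w => t * subPhase E w) a b (3 / t) ∧
    BVAmp (fun x => (subAmp E x : ℂ)) (fun x => (subAmp' E x : ℂ)) a b 4 ∧
    BVAmp (fun x => (subAmp' E x : ℂ)) (fun x => (subAmp'' E x : ℂ)) a b 6 := by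
  have hpos : ∀ x ∈ Icc a b, 0 < x := fun x hx => ha.trans_le hx.1
  have hD : ∀ x ∈ Icc a b, 4 * E * x ^ 4 - 1 ≤ -(51 / 100) := fun x hx =>
    subPhase_small hE (hpos x hx) (hx.2.trans hb)
  have hD0 : ∀ x ∈ Icc a b, 4 * E * x ^ 4 - 1 ≠ 0 := fun x hx => by
    have := hD x hx; intro h; linarith
  refine ⟨?_, ?_, ?_⟩
  · refine OscBound.neg (oscBound_of_deriv_ge
      (Φ' := fun w => -(t * ((4 * E * w ^ 4 - 1) / (2 * w ^ 3))))
      (Φ'' := fun w => -(t * (2 * E + 3 / (2 * w ^ 4)))) ht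
      (fun x hx => ((hasDerivAt_subPhase (hpos x hx).ne').const_mul t).neg)
      (fun x hx => ((hasDerivAt_subPhase' (hpos x hx).ne').const_mul t).neg) ?_ ?_ (Or.inr ?_))
    · refine (continuousOn_const.mul (continuousOn_const.add
        (continuousOn_const.div (by fun_prop) fun x hx => ?_))).neg
      have := hpos x hx; positivity
    · intro x hx
      have hx0 := hpos x hx
      have h3 : x ^ 3 ≤ (31 / 100) ^ 3 := by have := hx.2.trans hb; gcongr
      have : (4 * E * x ^ 4 - 1) / (2 * x ^ 3) ≤ -1 := by
        rw [div_le_iff₀ (by positivity)]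
        norm_num at h3
        linarith [hD x hx]
      nlinarith
    · intro x hx
      have := hpos x hx
      rw [neg_nonpos]; positivity
  · refine (BVAmp.of_deriv_sign (A := 2) hab (fun x hx => hasDerivAt_subAmp (hD0 x hx)) ?_
      (Or.inr fun x hx => ?_) fun x hx => ?_).weaken le_rfl le_rfl hab (by norm_num)
    · exact fun x hx => (hasDerivAt_subAmp' (hD0 x hx)).continuousAt.continuousWithinAt
    · have := hpos x hx
      rw [subAmp', neg_div, neg_nonpos]; positivity
    · linarith [(subAmp_small hE hE1 (hpos x hx) (hx.2.trans hb)).1, hx.2]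
  · refine (BVAmp.of_deriv_sign (A := 3) hab (fun x hx => hasDerivAt_subAmp' (hD0 x hx)) ?_
      (Or.inr fun x hx => ?_) fun x hx =>
      (subAmp_small hE hE1 (hpos x hx) (hx.2.trans hb)).2).weaken le_rfl le_rfl hab (by norm_num)
    · unfold subAmp''
      exact ContinuousOn.div (by fun_prop) (by fun_prop) fun x hx => pow_ne_zero 3 (hD0 x hx)
    · have := hpos x hx
      have h3 : (4 * E * x ^ 4 - 1) ^ 3 < 0 :=
        Odd.pow_neg (by decide) (by linarith [hD x hx])
      rw [subAmp'']
      exact div_nonpos_of_nonneg_of_nonpos (by positivity) h3.le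

/-- The part of the subordination integral near infinity. -/
lemma subordination_large {E t a b : ℝ} (hE1 : 1 ≤ E) (ht : 0 < t) (ha : 1 ≤ a)
    (hab : a ≤ b) :
    OscBound (fun w => t * subPhase E w) a b (3 / t) ∧
    BVAmp (fun x => (subAmp E x : ℂ)) (fun x => (subAmp' E x : ℂ)) a b 4 ∧
    BVAmp (fun x => (subAmp' E x : ℂ)) (fun x => (subAmp'' E x : ℂ)) a b 6 := by
  have hone : ∀ x ∈ Icc a b, 1 ≤ x := fun x hx => ha.trans hx.1
  have hpos : ∀ x ∈ Icc a b, 0 < x := fun x hx => by linarith [hone x hx]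
  have hD : ∀ x ∈ Icc a b, 3 * (E * x ^ 4) ≤ 4 * E * x ^ 4 - 1 := fun x hx =>
    subPhase_large hE1 (hone x hx)
  have hDp : ∀ x ∈ Icc a b, 0 < 4 * E * x ^ 4 - 1 := fun x hx => by
    bound
  have hD0 : ∀ x ∈ Icc a b, 4 * E * x ^ 4 - 1 ≠ 0 := fun x hx => (hDp x hx).ne'
  refine ⟨?_, ?_, ?_⟩
  · refine oscBound_of_deriv_ge
      (Φ' := fun w => (t * ((4 * E * w ^ 4 - 1) / (2 * w ^ 3))))
      (Φ'' := fun w => (t * (2 * E + 3 / (2 * w ^ 4)))) ht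
      (fun x hx => ((hasDerivAt_subPhase (hpos x hx).ne').const_mul t))
      (fun x hx => ((hasDerivAt_subPhase' (hpos x hx).ne').const_mul t)) ?_ ?_ (Or.inl ?_)
    · refine (continuousOn_const.mul (continuousOn_const.add
        (continuousOn_const.div (by fun_prop) fun x hx => ?_)))
      have := hpos x hx; positivity
    · intro x hx
      have hx0 := hpos x hx
      have h1 := hone x hx
      have : 1 ≤ (4 * E * x ^ 4 - 1) / (2 * x ^ 3) := by
        rw [le_div_iff₀ (by positivity)]
        have h3 : 1 * x ^ 3 ≤ E * x ^ 4 := by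
          gcongr; linarith
        linarith [hD x hx, pow_pos hx0 3]
      nlinarith
    · intro x hx
      have := hpos x hx
      positivity
  · refine (BVAmp.of_deriv_sign (A := 2) hab (fun x hx => hasDerivAt_subAmp (hD0 x hx)) ?_
      (Or.inr fun x hx => ?_) fun x hx => ?_).weaken le_rfl le_rfl hab (by norm_num)
    · exact fun x hx => (hasDerivAt_subAmp' (hD0 x hx)).continuousAt.continuousWithinAt
    · have := hpos x hx
      rw [subAmp', neg_div, neg_nonpos]; positivity
    · refine (subAmp_large hE1 (hone x hx)).1.trans ?_
      rw [div_le_iff₀ (hpos x hx)]; linarith [hone x hx]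
  · refine (BVAmp.of_deriv_sign (A := 3) hab (fun x hx => hasDerivAt_subAmp' (hD0 x hx)) ?_
      (Or.inl fun x hx => ?_) fun x hx =>
      (subAmp_large hE1 (hone x hx)).2.trans (by norm_num)).weaken le_rfl le_rfl hab (by norm_num)
    · unfold subAmp''
      exact ContinuousOn.div (by fun_prop) (by fun_prop) fun x hx => pow_ne_zero 3 (hD0 x hx)
    · have := hpos x hx
      have := hDp x hx
      rw [subAmp'']
      positivity

lemma subAmp_mul_deriv {E t w : ℝ} (hw : w ≠ 0) (h : 4 * E * w ^ 4 - 1 ≠ 0) :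
    subAmp E w * (t * ((4 * E * w ^ 4 - 1) / (2 * w ^ 3))) = t := by
  rw [subAmp]
  generalize 4 * E * w ^ 4 - 1 = D at *
  field_simp

lemma norm_subordination_avg_sub_le {E t a b : ℝ} (hE : E ≤ 13) (hE1 : 1 ≤ E) (ht : 0 < t)
    (ha : 0 < a) (ha' : a ≤ 29 / 100) (hb : 2 ≤ b) :
    ‖I * t * ((∫ c in (29 / 100 : ℝ)..(31 / 100), ∫ w in c..(c + 3 / 4),
        cis(t * subPhase E w)) -
      ((1 / 50 : ℝ) : ℂ) * ∫ w in a..b, cis(t * subPhase E w))‖ ≤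
      60 / t + a + 1 / b := by
  set e : ℝ → ℂ := fun w => cis(t * subPhase E w) with he
  have hposw : ∀ {x : ℝ}, a ≤ x → x ≠ 0 := fun hx => (ha.trans_le hx).ne'
  have hψ : ∀ x, a ≤ x → HasDerivAt (fun w => t * subPhase E w)
      (t * ((4 * E * x ^ 4 - 1) / (2 * x ^ 3))) x := fun x hx =>
    (hasDerivAt_subPhase (hposw hx)).const_mul t
  have hec : ContinuousOn e (Ici a) := continuousOn_exp_phase
    fun x hx => (hψ x hx).continuousAt.continuousWithinAt
  have hei : ∀ {x y : ℝ}, a ≤ x → a ≤ y → IntervalIntegrable e volume x y := fun hx hy =>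
    (hec.mono fun z hz => (le_min hx hy).trans hz.1).intervalIntegrable
  have hDs : ∀ x, a ≤ x → x ≤ 31 / 100 → 4 * E * x ^ 4 - 1 ≠ 0 := fun x hx hx' h => by
    have := subPhase_small hE (ha.trans_le hx) hx'; linarith
  have hDl : ∀ x, 1 ≤ x → 4 * E * x ^ 4 - 1 ≠ 0 := fun x hx h => by
    have := subPhase_large hE1 hx
    linarith
  have hns : ∀ x, ‖e x‖ = 1 := fun x => norm_exp_I_mul_real _
  -- the two tails
  have small : ∀ c ∈ Icc (29 / 100 : ℝ) (31 / 100),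
      ‖I * t * (∫ w in a..c, e w) - (e c * subAmp E c - e a * subAmp E a)‖
        ≤ 2 * (3 / t) * 6 := by
    intro c hc
    obtain ⟨o, -, g⟩ := subordination_small hE hE1 ht ha (ha'.trans hc.1) hc.2
    exact norm_integral_exp_sub_boundary_le (ha'.trans hc.1) (fun x hx => hψ x hx.1)
      (fun x hx => hasDerivAt_subAmp (hDs x hx.1 (hx.2.trans hc.2)))
      (fun x hx => subAmp_mul_deriv (hposw hx.1) (hDs x hx.1 (hx.2.trans hc.2))) o g
  have large : ∀ c ∈ Icc (29 / 100 : ℝ) (31 / 100),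
      ‖I * t * (∫ w in (c + 3 / 4)..b, e w) -
        (e b * subAmp E b - e (c + 3 / 4) * (subAmp E (c + 3 / 4) : ℂ))‖
        ≤ 2 * (3 / t) * 6 := by
    intro c hc
    have h1 : 1 ≤ c + 3 / 4 := by linarith [hc.1]
    have h2 : c + 3 / 4 ≤ b := by linarith [hc.2]
    obtain ⟨o, -, g⟩ := subordination_large hE1 ht h1 h2
    exact norm_integral_exp_sub_boundary_le h2 (fun x hx => hψ x (by linarith [hx.1]))
      (fun x hx => hasDerivAt_subAmp (hDl x (h1.trans hx.1)))
      (fun x hx => subAmp_mul_deriv (by linarith [hx.1]) (hDl x (h1.trans hx.1))) o g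
  have ga : ‖e a * subAmp E a‖ ≤ 4 * a := by
    rw [norm_mul, hns, one_mul, norm_real]
    exact (subAmp_small hE hE1 ha (by linarith)).1
  have gb : ‖e b * subAmp E b‖ ≤ 1 / b := by
    rw [norm_mul, hns, one_mul, norm_real]
    exact (subAmp_large hE1 (by linarith)).1
  -- continuity of everything in sight
  have hPc : ContinuousOn (fun x => ∫ w in a..x, e w) (Icc a b) := by
    have := intervalIntegral.continuousOn_primitive_interval (a := a) (b := b) (f := e)
        (μ := volume)
      (by
        rw [uIcc_of_le (by linarith)]
        exact (hec.mono fun x hx => hx.1).integrableOn_compact isCompact_Icc)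
    rwa [uIcc_of_le (by linarith)] at this
  set I0 : Set ℝ := Icc (29 / 100 : ℝ) (31 / 100) with hI0
  have hu : uIcc (29 / 100 : ℝ) (31 / 100) = I0 := uIcc_of_le (by norm_num)
  have hadd : ContinuousOn (fun c : ℝ => c + 3 / 4) I0 := by fun_prop
  have c1 : ContinuousOn (fun c => ∫ w in a..c, e w) I0 :=
    hPc.mono fun x hx => ⟨ha'.trans hx.1, by linarith [hx.2]⟩
  have c2 : ContinuousOn (fun c => ∫ w in a..(c + 3 / 4), e w) I0 :=
    hPc.comp hadd fun x hx => ⟨by linarith [hx.1], by linarith [hx.2]⟩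
  have J_eq : ∀ c ∈ I0, ∫ w in c..(c + 3 / 4), e w =
      (∫ w in a..(c + 3 / 4), e w) - ∫ w in a..c, e w := fun c hc => by
    rw [integral_interval_sub_left (hei le_rfl (by linarith [hc.1]))
      (hei le_rfl (by linarith [hc.1]))]
  have cJ : ContinuousOn (fun c => ∫ w in c..(c + 3 / 4), e w) I0 := (c2.sub c1).congr J_eq
  have cB1 : ContinuousOn (fun c => e c * subAmp E c) I0 := by
    refine (hec.mono fun x hx => ha'.trans hx.1).mul
      (continuous_ofReal.comp_continuousOn fun x hx => ?_)
    exact (hasDerivAt_subAmp (hDs x (ha'.trans hx.1) hx.2)).continuousAt.continuousWithinAt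
  have cB2 : ContinuousOn (fun c => e (c + 3 / 4) * (subAmp E (c + 3 / 4) : ℂ)) I0 := by
    refine (hec.comp hadd fun x hx => ?_).mul
      (continuous_ofReal.comp_continuousOn (ContinuousOn.comp (g := subAmp E)
        (f := fun c : ℝ => c + 3 / 4) (t := Ici 1) (fun x hx => ?_) hadd fun x hx => ?_))
    · simp only [Set.mem_Ici]; linarith [hx.1]
    · exact (hasDerivAt_subAmp (hDl x hx)).continuousAt.continuousWithinAt
    · simp only [Set.mem_Ici]; linarith [hx.1]
  have ii : ∀ {f : ℝ → ℂ}, ContinuousOn f I0 →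
      IntervalIntegrable f volume (29 / 100) (31 / 100) := fun hf => by
    apply ContinuousOn.intervalIntegrable; rwa [hu]
  -- averaged boundary terms
  have av1 : ‖∫ c in (29 / 100 : ℝ)..(31 / 100), e c * subAmp E c‖ ≤ 2 * (3 / t) * 4 := by
    obtain ⟨o, g, -⟩ := subordination_small (t := t) (a := 29 / 100) (b := 31 / 100) hE hE1 ht
      (by norm_num) (by norm_num) (by norm_num)
    exact o.amp (by norm_num)
      (fun x hx => (hψ x (ha'.trans hx.1)).continuousAt.continuousWithinAt) g
  have av2 : ‖∫ c in (29 / 100 : ℝ)..(31 / 100), e (c + 3 / 4) * (subAmp E (c + 3 / 4) : ℂ)‖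
      ≤ 2 * (3 / t) * 4 := by
    obtain ⟨o, g, -⟩ := subordination_large (t := t) (a := 29 / 100 + 3 / 4)
      (b := 31 / 100 + 3 / 4) hE1 ht (by norm_num) (by norm_num)
    have := o.amp (by norm_num)
      (fun x hx => (hψ x (by linarith [hx.1])).continuousAt.continuousWithinAt) g
    rwa [← integral_comp_add_right
      (fun x => cis(t * subPhase E x) * subAmp E x)] at this
  -- the pointwise estimate in the cutoff
  have pt : ∀ c ∈ I0, ‖I * t * ((∫ w in c..(c + 3 / 4), e w) - ∫ w in a..b, e w) +
      e c * subAmp E c - e (c + 3 / 4) * (subAmp E (c + 3 / 4) : ℂ)‖ ≤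
        72 / t + 4 * a + 1 / b := by
    intro c hc
    have hs := small c hc
    have hl := large c hc
    have split : ∫ w in a..b, e w = (∫ w in a..c, e w) + (∫ w in c..(c + 3 / 4), e w) +
        ∫ w in (c + 3 / 4)..b, e w := by
      have h1 := hei (x := a) (y := c) le_rfl (ha'.trans hc.1)
      have h2 := hei (x := c) (y := c + 3 / 4) (ha'.trans hc.1) (by linarith [hc.1])
      have h3 := hei (x := c + 3 / 4) (y := b) (by linarith [hc.1]) (by linarith)
      rw [integral_add_adjacent_intervals h1 h2,
        integral_add_adjacent_intervals (h1.trans h2) h3]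
    rw [split]
    calc _ = ‖-(I * t * (∫ w in a..c, e w) -
              (e c * subAmp E c - e a * subAmp E a)) -
            (I * t * (∫ w in (c + 3 / 4)..b, e w) -
              (e b * subAmp E b - e (c + 3 / 4) * (subAmp E (c + 3 / 4) : ℂ))) +
            e a * subAmp E a - e b * subAmp E b‖ := by congr 1; ring
      _ ≤ 2 * (3 / t) * 6 + 2 * (3 / t) * 6 + 4 * a + 1 / b := by
          refine (norm_sub_le _ _).trans (add_le_add ((norm_add_le _ _).trans (add_le_add
            ((norm_sub_le _ _).trans (add_le_add ?_ hl)) ga)) gb)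
          rwa [norm_neg]
      _ = _ := by ring
  have int := intervalIntegral.norm_integral_le_of_norm_le_const
    (a := (29 / 100 : ℝ)) (b := 31 / 100) (C := 72 / t + 4 * a + 1 / b)
    (f := fun c => I * t * ((∫ w in c..(c + 3 / 4), e w) - ∫ w in a..b, e w) +
      e c * subAmp E c - e (c + 3 / 4) * (subAmp E (c + 3 / 4) : ℂ))
    (fun c hc => pt c (by
      rw [uIoc_of_le (by norm_num)] at hc; exact Set.Ioc_subset_Icc_self hc))
  have i1 : IntervalIntegrable (fun c => I * t *
      ((∫ w in c..(c + 3 / 4), e w) - ∫ w in a..b, e w)) volume (29 / 100) (31 / 100) :=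
    ii (continuousOn_const.mul (cJ.sub continuousOn_const))
  rw [intervalIntegral.integral_sub (i1.add (ii cB1)) (ii cB2),
    intervalIntegral.integral_add i1 (ii cB1), intervalIntegral.integral_const_mul,
    intervalIntegral.integral_sub (ii cJ) (ii continuousOn_const),
    intervalIntegral.integral_const] at int
  have e50 : (31 / 100 - 29 / 100 : ℝ) • (∫ w in a..b, e w) =
      ((1 / 50 : ℝ) : ℂ) * ∫ w in a..b, e w := by
    rw [real_smul]; norm_num
  rw [e50] at int
  calc _ = ‖(I * t * ((∫ c in (29 / 100 : ℝ)..(31 / 100), ∫ w in c..(c + 3 / 4), e w) -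
          ((1 / 50 : ℝ) : ℂ) * ∫ w in a..b, e w) +
        (∫ c in (29 / 100 : ℝ)..(31 / 100), e c * subAmp E c) -
        ∫ c in (29 / 100 : ℝ)..(31 / 100), e (c + 3 / 4) * (subAmp E (c + 3 / 4) : ℂ)) -
        (∫ c in (29 / 100 : ℝ)..(31 / 100), e c * subAmp E c) +
        ∫ c in (29 / 100 : ℝ)..(31 / 100), e (c + 3 / 4) * (subAmp E (c + 3 / 4) : ℂ)‖ := by
        congr 1; ring
    _ ≤ (72 / t + 4 * a + 1 / b) * |31 / 100 - 29 / 100| + 2 * (3 / t) * 4 + 2 * (3 / t) * 4 :=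
        (norm_add_le _ _).trans (add_le_add ((norm_sub_le _ _).trans (add_le_add int av1)) av2)
    _ ≤ _ := by
        rw [abs_of_pos (by norm_num)]
        have h1 : 0 < 1 / t := by positivity
        have h2 : 0 < 1 / b := by positivity
        have e1 : 72 / t = 72 * (1 / t) := by ring
        have e2 : 3 / t = 3 * (1 / t) := by ring
        have e3 : 60 / t = 60 * (1 / t) := by ring
        rw [e1, e2, e3]
        nlinarith

/-- Subordination: `exp (i t √E) / √E` is, up to `O(t^{-3/2})`, an average of integrals over
bounded intervals of the phase that is linear in `E`. -/
lemma subordination_avg : ∃ L : ℂ, L ≠ 0 ∧ ∀ E t : ℝ, 1 ≤ E → E ≤ 13 → 1 ≤ t →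
    ‖L * (cis(t * √E) * ((1 / √E : ℝ) : ℂ)) -
      (√t : ℂ) * ∫ c in (29 / 100 : ℝ)..(31 / 100), ∫ w in c..(c + 3 / 4),
        cis(t * subPhase E w)‖ ≤ 60 * t ^ (-(3 / 2) : ℝ) := by
  obtain ⟨F, hF0, hF⟩ := exists_fresnel_limit
  refine ⟨((1 / 50 : ℝ) : ℂ) * F, mul_ne_zero (by norm_num) hF0, fun E t hE1 hE ht => ?_⟩
  have ht0 : 0 < t := by linarith
  have hsE : 1 ≤ √E := one_le_sqrt.mpr hE1
  have hst : 1 ≤ √t := one_le_sqrt.mpr ht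
  have hsE0 : 0 < √E := by linarith
  have hst0 : 0 < √t := by linarith
  have hst2 : √t * √t = t := mul_self_sqrt ht0.le
  set S := ∫ c in (29 / 100 : ℝ)..(31 / 100), ∫ w in c..(c + 3 / 4),
        cis(t * subPhase E w) with hS
  set X := cis(t * √E) with hX
  have hXn : ‖X‖ = 1 := norm_exp_I_mul_real _
  have htt : t ^ (-(3 / 2) : ℝ) = 1 / (t * √t) := by
    rw [sqrt_eq_rpow, ← rpow_one_add' ht0.le (by norm_num), rpow_neg ht0.le, one_div]
    norm_num
  rw [htt]
  have key : ∀ b : ℝ, 2 ≤ b → ‖((1 / 50 : ℝ) : ℂ) * F * (X * ((1 / √E : ℝ) : ℂ)) - (√t : ℂ) * S‖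
      ≤ 60 * (1 / (t * √t)) + 4 / b := by
    intro b hb
    have hb0 : 0 < b := by linarith
    set m : ℝ := √(1 / (2 * √E)) with hm
    have hm2 : m ^ 2 = 1 / (2 * √E) := sq_sqrt (by positivity)
    have hm0 : 0 < m := by positivity
    have hm2' : m ^ 2 ≤ 1 / 2 := by
      rw [hm2, div_le_div_iff₀ (by positivity) (by norm_num)]; linarith
    have hmb : m ≤ b := by nlinarith
    have ex := subordination_symm (E := E) (t := t) (m := m) (b := b) (by linarith) ht0 hm0
      (by rw [hm2]; field_simp) hmb
    set a : ℝ := m ^ 2 / b with ha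
    have ha0 : 0 < a := by positivity
    have hab : a ≤ 1 / (2 * b) := by
      rw [ha, div_le_div_iff₀ hb0 (by positivity)]; nlinarith
    have ha' : a ≤ 29 / 100 := by
      refine hab.trans ?_
      rw [div_le_div_iff₀ (by positivity) (by norm_num)]; linarith
    have av := norm_subordination_avg_sub_le hE hE1 ht0 ha0 ha' hb
    set J := ∫ w in a..b, cis(t * subPhase E w) with hJ
    rw [norm_mul, norm_mul, norm_I, one_mul, norm_real, norm_eq_abs,
      abs_of_pos ht0] at av
    set V := √t * (√E * b - 1 / (2 * b)) with hV
    have hVb : b / 2 ≤ V := by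
      have h1 : 1 / (2 * b) ≤ 1 / 4 := by
        rw [div_le_div_iff₀ (by positivity) (by norm_num)]; linarith
      have h2 : b / 2 ≤ √E * b - 1 / (2 * b) := by nlinarith
      calc b / 2 ≤ 1 * (√E * b - 1 / (2 * b)) := by linarith
        _ ≤ V := by rw [hV]; gcongr; linarith
    have fr := hF V (by linarith)
    have fr' : ‖fresnel V - F‖ ≤ 3 / b := fr.trans (by
      rw [div_le_div_iff₀ (by linarith) hb0]; linarith)
    rw [← hX, Complex.ofReal_mul] at ex
    have hsEc : (√E : ℂ) ≠ 0 := by exact_mod_cast hsE0.ne'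
    have hstc : (√t : ℂ) ≠ 0 := by exact_mod_cast hst0.ne'
    have exJ : (√t : ℂ) * J = X * ((1 / √E : ℝ) : ℂ) * fresnel V := by
      have : (√E : ℂ) * ((√t : ℂ) * J) =
          (√E : ℂ) * (X * ((1 / √E : ℝ) : ℂ) * fresnel V) := by
        rw [← mul_assoc, ex]; push_cast; field_simp
      exact mul_left_cancel₀ hsEc this
    have avS : ‖S - ((1 / 50 : ℝ) : ℂ) * J‖ ≤ (60 / t + a + 1 / b) / t := by
      rw [le_div_iff₀ ht0]; linarith
    calc _ = ‖-((√t : ℂ) * (S - ((1 / 50 : ℝ) : ℂ) * J)) -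
          ((1 / 50 : ℝ) : ℂ) * (X * ((1 / √E : ℝ) : ℂ) * (fresnel V - F))‖ := by
          congr 1
          linear_combination -((1 / 50 : ℝ) : ℂ) * exJ
      _ ≤ √t * ((60 / t + a + 1 / b) / t) + 1 / 50 * (1 * 1 * (3 / b)) := by
          refine (norm_sub_le _ _).trans (add_le_add ?_ ?_)
          · rw [norm_neg, norm_mul, norm_real, norm_eq_abs, abs_of_pos hst0]
            gcongr
          · rw [norm_mul, norm_mul, norm_mul, hXn, norm_real, norm_real,
              norm_eq_abs, norm_eq_abs, abs_of_pos (by norm_num),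
              abs_of_pos (a := 1 / √E) (by positivity)]
            bound
      _ ≤ _ := by
          have e1 : √t * ((60 / t + a + 1 / b) / t) =
              60 * (√t / (t * t)) + (a + 1 / b) * (√t / t) := by
            field_simp
            ring
          have e2 : √t / (t * t) = 1 / (t * √t) := by
            rw [div_eq_div_iff (by positivity) (by positivity)]
            calc √t * (t * √t) = t * (√t * √t) := by ring
              _ = _ := by rw [hst2]; ring
          have e3 : √t / t ≤ 1 := by rw [div_le_one ht0]; nlinarith
          rw [e1, e2]
          have h2 : 0 < 1 / b := by positivity
          have h3 : 1 / (2 * b) = 1 / 2 * (1 / b) := by field_simp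
          have h4 : 3 / b = 3 * (1 / b) := by ring
          have h5 : 4 / b = 4 * (1 / b) := by ring
          rw [h4, h5]
          have : (a + 1 / b) * (√t / t) ≤ (a + 1 / b) * 1 := by gcongr
          linarith
  have lim : Tendsto (fun b : ℝ => 60 * (1 / (t * √t)) + 4 / b) atTop
      (nhds (60 * (1 / (t * √t)) + 0)) :=
    tendsto_const_nhds.add (tendsto_const_nhds.div_atTop Filter.tendsto_id)
  rw [add_zero] at lim
  refine ge_of_tendsto lim ?_
  filter_upwards [Filter.eventually_ge_atTop 2] with b hb using key b hb

lemma interval_cube_swap {d : ℕ} {h : ℝ → (Fin d → ℝ) → ℂ} (hh : Continuous (uncurry h))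
    (a b : ℝ) : ∫ x in a..b, ∫ ξ in cube d, h x ξ = ∫ ξ in cube d, ∫ x in a..b, h x ξ := by
  apply intervalIntegral_integral_swap
  rw [Measure.prod_restrict]
  have : IntegrableOn (uncurry h) (uIcc a b ×ˢ cube d) (volume.prod volume) :=
    hh.continuousOn.integrableOn_compact (isCompact_uIcc.prod isCompact_Icc)
  exact this.mono_set (Set.prod_mono Set.uIoc_subset_uIcc le_rfl)

/-- The one-dimensional Bessel integral on the circle. -/
lemma exists_circle_besselJ (n : ℤ) : ∃ u : ℂ, ‖u‖ = 1 ∧ ∀ s : ℝ,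
    ∫ θ in (0:ℝ)..2 * π, cis(n * θ - s * cos θ) =
      u * ((2 * π * besselJ n.natAbs s : ℝ) : ℂ) := by
  have nat : ∀ k : ℕ, ∀ s : ℝ,
      ∫ θ in (0:ℝ)..2 * π, cis(k * θ - s * cos θ) =
      cis(-(k * (π / 2))) * ((2 * π * besselJ k s : ℝ) : ℂ) := by
    intro k s
    set g : ℝ → ℂ := fun φ => cis(k * φ - s * sin φ) with hg
    have gc : Continuous g := continuous_exp_phase (by fun_prop)
    have gi : ∀ a b : ℝ, IntervalIntegrable g volume a b := fun a b => gc.intervalIntegrable a b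
    have per : Function.Periodic g (2 * π) := fun φ => by
      simp only [hg]
      rw [sin_add_two_pi, Complex.exp_eq_exp_iff_exists_int]
      exact ⟨k, by push_cast; ring⟩
    have e1 : ∫ θ in (0:ℝ)..2 * π, cis(k * θ - s * cos θ) =
        cis(-(k * (π / 2))) * ∫ φ in (0:ℝ)..2 * π, g φ := by
      have p := per.intervalIntegral_add_eq 0 (π / 2)
      rw [zero_add] at p
      have sh := integral_comp_add_right (a := 0) (b := 2 * π) g (π / 2)
      rw [zero_add, add_comm (2 * π)] at sh
      rw [p, ← sh, ← intervalIntegral.integral_const_mul]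
      refine integral_congr fun θ _ => ?_
      simp only [hg]
      rw [← Complex.exp_add, sin_add_pi_div_two, ← mul_add, ← ofReal_add]
      congr 4
      ring
    have e2 : ∫ φ in (0:ℝ)..2 * π, g φ = ((2 * π * besselJ k s : ℝ) : ℂ) := by
      have hrefl : ∫ φ in π..2 * π, g φ = ∫ φ in (0:ℝ)..π, conj (g φ) := by
        have r := integral_comp_sub_left (a := 0) (b := π) g (2 * π)
        rw [sub_zero, show 2 * π - π = π by ring] at r
        rw [← r]
        refine integral_congr fun φ _ => ?_
        simp only [hg]
        rw [← exp_conj, sin_two_pi_sub, Complex.exp_eq_exp_iff_exists_int]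
        exact ⟨k, by
          simp only [map_mul, conj_I, conj_ofReal]; push_cast; ring⟩
      have gci : IntervalIntegrable (fun φ => conj (g φ)) volume 0 π :=
        (continuous_conj.comp gc).intervalIntegrable _ _
      rw [← integral_add_adjacent_intervals (gi 0 π) (gi π (2 * π)), hrefl,
        ← intervalIntegral.integral_add (gi 0 π) gci, besselJ, ← mul_assoc]
      have : 2 * π * π⁻¹ = 2 := by field_simp
      rw [this, ← intervalIntegral.integral_const_mul, ← intervalIntegral.integral_ofReal]
      refine integral_congr fun φ _ => ?_
      simp only [hg]
      rw [Complex.add_conj, mul_comm I, Complex.exp_ofReal_mul_I_re]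
    rw [e1, e2]
  rcases Int.natAbs_eq n with h | h
  · refine ⟨cis(-(n.natAbs * (π / 2))), norm_exp_I_mul_real _,
      fun s => ?_⟩
    rw [← nat]
    have : (n : ℝ) = n.natAbs := by
      have := congrArg (Int.cast (R := ℝ)) h
      rwa [Int.cast_natCast] at this
    rw [this]
  · refine ⟨cis(-(n.natAbs * (π / 2))), norm_exp_I_mul_real _,
      fun s => ?_⟩
    have hn : (n : ℝ) = -n.natAbs := by
      have := congrArg (Int.cast (R := ℝ)) h
      rwa [Int.cast_neg, Int.cast_natCast] at this
    rw [← nat, hn]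
    have r := integral_comp_sub_left (a := 0) (b := 2 * π)
      (fun θ : ℝ => cis(n.natAbs * θ - s * cos θ)) (2 * π)
    rw [sub_zero, sub_self] at r
    rw [← r]
    refine integral_congr fun θ _ => ?_
    rw [cos_two_pi_sub, Complex.exp_eq_exp_iff_exists_int]
    generalize n.natAbs = k
    refine ⟨-(k : ℤ), ?_⟩
    push_cast
    ring

/-- The symbol of `1 - Δ` on `ℤ³`. -/
def kgSymbol (ξ : Fin 3 → ℝ) : ℝ := 7 - 2 * ∑ j, cos (ξ j)

lemma continuous_kgSymbol : Continuous kgSymbol := by unfold kgSymbol; fun_prop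

lemma one_le_kgSymbol (ξ : Fin 3 → ℝ) : 1 ≤ kgSymbol ξ := by
  simp only [kgSymbol, Fin.sum_univ_three]
  linarith [cos_le_one (ξ 0), cos_le_one (ξ 1), cos_le_one (ξ 2)]

lemma kgSymbol_le (ξ : Fin 3 → ℝ) : kgSymbol ξ ≤ 13 := by
  simp only [kgSymbol, Fin.sum_univ_three]
  linarith [neg_one_le_cos (ξ 0), neg_one_le_cos (ξ 1), neg_one_le_cos (ξ 2)]

lemma omegaKG_three (ξ : Fin 3 → ℝ) : omegaKG 3 ξ = √(kgSymbol ξ) := by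
  rw [omegaKG, kgSymbol]
  congr 1
  simp only [Fin.sum_univ_three]
  ring

/-- The character `exp (i n·ξ)`. -/
def torusChar (n : Fin 3 → ℤ) (ξ : Fin 3 → ℝ) : ℂ :=
  cis(∑ j, (n j : ℝ) * ξ j)

lemma continuous_torusChar (n : Fin 3 → ℤ) : Continuous (torusChar n) := by
  unfold torusChar; fun_prop

lemma norm_torusChar (n : Fin 3 → ℤ) (ξ : Fin 3 → ℝ) : ‖torusChar n ξ‖ = 1 :=
  norm_exp_I_mul_real _

lemma volume_cube_three : (volume (cube 3)).toReal = (2 * π) ^ 3 := by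
  rw [cube, volume_Icc_pi_toReal]
  · simp
  · intro i; simp only [Pi.zero_apply]; positivity

lemma exists_cube_besselJ (n : Fin 3 → ℤ) : ∃ u : ℂ, ‖u‖ = (2 * π) ^ 3 ∧ ∀ s : ℝ,
    ∫ ξ in cube 3, torusChar n ξ * cis(s / 2 * kgSymbol ξ) =
      u * (cis(7 * s / 2) *
        ((∏ j, besselJ (n j).natAbs s : ℝ) : ℂ)) := by
  choose u hu hus using fun j => exists_circle_besselJ (n j)
  refine ⟨∏ j, (u j * ((2 * π : ℝ) : ℂ)), ?_, fun s => ?_⟩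
  · rw [Finset.prod_mul_distrib, norm_mul, norm_prod, norm_prod]
    simp [hu, abs_of_pos pi_pos]
  · have e : ∀ ξ : Fin 3 → ℝ,
        torusChar n ξ * cis(s / 2 * kgSymbol ξ) =
        cis(7 * s / 2) *
          ∏ j, cis(n j * ξ j - s * cos (ξ j)) := by
      intro ξ
      rw [← Complex.exp_sum, torusChar, ← Complex.exp_add, ← Complex.exp_add, kgSymbol]
      congr 1
      simp only [Fin.sum_univ_three]
      push_cast
      ring
    simp_rw [e]
    rw [integral_const_mul]
    have hr : (volume.restrict (cube 3) : Measure (Fin 3 → ℝ)) =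
        pi fun _ => volume.restrict (Icc 0 (2 * π)) := by
      rw [← restrict_pi_pi, ← volume_pi, cube, ← Set.pi_univ_Icc]
      rfl
    rw [hr, integral_fintype_prod_eq_prod (fun (j : Fin 3) (θ : ℝ) =>
      cis(n j * θ - s * cos θ))]
    have e2 : ∀ j, ∫ θ in Icc 0 (2 * π),
        cis(n j * θ - s * cos θ) =
          u j * ((2 * π * besselJ (n j).natAbs s : ℝ) : ℂ) := by
      intro j
      rw [← hus, integral_Icc_eq_integral_Ioc, integral_of_le (by positivity)]
    simp_rw [e2]
    push_cast
    simp_rw [Finset.prod_mul_distrib]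
    ring

/-- The kernel of `exp (i t √(1-Δ)) / √(1-Δ)` on `ℤ³`, without normalization. -/
def kgKernel (t : ℝ) (n : Fin 3 → ℤ) : ℂ :=
  ∫ ξ in cube 3, torusChar n ξ *
    (cis(t * omegaKG 3 ξ) * ((1 / omegaKG 3 ξ : ℝ) : ℂ))

lemma subordination_change_var {t c : ℝ} (ht : 0 < t) (hc : 0 < c) {f : ℝ → ℂ}
    (hf : Continuous f) :
    (√t : ℂ) * ∫ w in c..(c + 3 / 4), cis(t / (4 * w ^ 2)) *
      f (2 * t * w ^ 2) = ((1 / √8 : ℝ) : ℂ) *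
      ∫ s in (2 * t * c ^ 2)..(2 * t * (c + 3 / 4) ^ 2),
        cis(t ^ 2 / (2 * s)) * (f s * ((1 / √s : ℝ) : ℂ)) := by
  have hpos : ∀ x ∈ uIcc c (c + 3 / 4), 0 < x := fun x hx => by
    rw [uIcc_of_le (by linarith)] at hx; exact hc.trans_le hx.1
  have := integral_deriv_smul_comp'' (a := c) (b := c + 3 / 4)
    (f := fun w => 2 * t * w ^ 2) (f' := fun w => 2 * t * (2 * w))
    (g := fun s => cis(t ^ 2 / (2 * s)) * (f s * ((1 / √s : ℝ) : ℂ)))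
    (by fun_prop) (fun x _ => by
      have := (hasDerivAt_pow 2 x).const_mul (2 * t)
      refine (this.congr_deriv ?_).hasDerivWithinAt
      norm_num) (by fun_prop) (by
      have hp : ∀ s ∈ (fun w => 2 * t * w ^ 2) '' uIcc c (c + 3 / 4), 0 < s := by
        rintro _ ⟨x, hx, rfl⟩
        have := hpos x hx
        positivity
      refine (continuousOn_exp_phase (continuousOn_const.div (by fun_prop) fun s hs => ?_)).mul
        (hf.continuousOn.mul (continuous_ofReal.comp_continuousOn
          (continuousOn_const.div (by fun_prop) fun s hs => ?_)))
      · have := hp s hs; positivity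
      · have := hp s hs; positivity)
  rw [← this, ← intervalIntegral.integral_const_mul, ← intervalIntegral.integral_const_mul]
  refine integral_congr fun w hw => ?_
  have hw0 := hpos w hw
  simp only [Function.comp, real_smul]
  have e1 : t ^ 2 / (2 * (2 * t * w ^ 2)) = t / (4 * w ^ 2) := by field_simp; norm_num
  have e2 : √(2 * t * w ^ 2) = √2 * √t * w := by
    rw [sqrt_mul (by positivity), sqrt_mul (by norm_num), sqrt_sq hw0.le]
  have e3 : √8 = 2 * √2 := by
    rw [show (8:ℝ) = 2 ^ 2 * 2 by norm_num, sqrt_mul (by norm_num), sqrt_sq (by norm_num)]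
  have e4 : 1 / √8 * (2 * t * (2 * w)) * (1 / √(2 * t * w ^ 2)) = √t := by
    have h2 : √2 * √2 = 2 := mul_self_sqrt (by norm_num)
    have ht2 : √t * √t = t := mul_self_sqrt ht.le
    rw [e2, e3]
    field_simp
    nlinarith
  rw [e1, ← e4]
  push_cast
  ring

/-- The kernel bound reduced to one-dimensional oscillatory integrals of products of Bessel
functions. -/
lemma exists_norm_kgKernel_le : ∃ C : ℝ, 0 < C ∧ ∀ (t : ℝ) (n : Fin 3 → ℤ) (M : ℝ), 1 ≤ t →
    (∀ c ∈ Icc (29 / 100 : ℝ) (31 / 100),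
      ‖∫ s in (2 * t * c ^ 2)..(2 * t * (c + 3 / 4) ^ 2),
        cis(t ^ 2 / (2 * s)) *
          (cis(7 * s / 2) *
        ((∏ j, besselJ (n j).natAbs s : ℝ) : ℂ) * ((1 / √s : ℝ) : ℂ))‖ ≤ M) →
    ‖kgKernel t n‖ ≤ C * (t ^ (-(3 / 2) : ℝ) + M) := by
  obtain ⟨L, hL0, hL⟩ := subordination_avg
  have hLn : 0 < ‖L‖ := norm_pos_iff.mpr hL0
  refine ⟨60 * (2 * π) ^ 3 / ‖L‖, by positivity, fun t n M ht hM => ?_⟩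
  have ht0 : 0 < t := by linarith
  have hM0 : 0 ≤ M := (norm_nonneg _).trans (hM (29 / 100) (by norm_num))
  obtain ⟨u, hu, hus⟩ := exists_cube_besselJ n
  -- a globally continuous version of the phase
  set k : ℝ → (Fin 3 → ℝ) → ℂ := fun w ξ => torusChar n ξ * Complex.exp (I *
    ((t * (kgSymbol ξ * (max w (1 / 10)) ^ 2 + 1 / (4 * (max w (1 / 10)) ^ 2)) : ℝ) : ℂ)) with hk
  have kc : Continuous (uncurry k) := by
    have h1 := continuous_torusChar n
    have h2 := continuous_kgSymbol
    have h3 : ∀ x : ℝ × (Fin 3 → ℝ), 4 * (max x.1 (1 / 10)) ^ 2 ≠ 0 := fun x => by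
      positivity
    fun_prop
  have kw : ∀ w ξ, 1 / 10 ≤ w → k w ξ =
      torusChar n ξ * cis(t * subPhase (kgSymbol ξ) w) := by
    intro w ξ hw
    simp only [hk, max_eq_left hw, subPhase]
  -- shift the inner variable to have constant limits
  set k2 : ℝ → (Fin 3 → ℝ) → ℂ := fun c ξ => ∫ y in (0:ℝ)..3 / 4, k (c + y) ξ with hk2
  have k2c : Continuous (uncurry k2) := by fun_prop
  have inner : ∀ c ∈ Icc (29 / 100 : ℝ) (31 / 100), ‖(√t : ℂ) * ∫ ξ in cube 3, k2 c ξ‖ ≤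
      (2 * π) ^ 3 * M := by
    intro c hc
    have hc0 : 0 < c := by linarith [hc.1]
    have sw := interval_cube_swap (d := 3) (h := fun y ξ => k (c + y) ξ)
      (kc.comp (f := fun q : ℝ × (Fin 3 → ℝ) => (c + q.1, q.2)) (by fun_prop)) 0 (3 / 4)
    simp only [hk2]
    rw [← sw, integral_comp_add_left (fun w => ∫ ξ in cube 3, k w ξ) c, add_zero]
    have e : ∫ w in c..(c + 3 / 4), ∫ ξ in cube 3, k w ξ =
        ∫ w in c..(c + 3 / 4), u * (cis(t / (4 * w ^ 2)) *
          (fun s : ℝ => cis(7 * s / 2) *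
        ((∏ j, besselJ (n j).natAbs s : ℝ) : ℂ)) (2 * t * w ^ 2)) := by
      refine integral_congr fun w hw => ?_
      rw [uIcc_of_le (by linarith)] at hw
      have hw0 : 0 < w := hc0.trans_le hw.1
      simp only []
      have e3 := hus (2 * t * w ^ 2)
      rw [mul_left_comm, ← e3, ← integral_const_mul]
      refine integral_congr_ae (.of_forall fun ξ => ?_)
      simp only []
      rw [kw w ξ (by linarith [hw.1, hc.1]), mul_left_comm, ← Complex.exp_add, ← mul_add,
        ← ofReal_add, subPhase]
      congr 4
      field_simp
      ring
    rw [e, intervalIntegral.integral_const_mul, mul_left_comm, subordination_change_var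
        (f := fun s : ℝ =>
        cis(7 * s / 2) *
          ((∏ j, besselJ (n j).natAbs s : ℝ) : ℂ)) ht0 hc0, norm_mul, hu, norm_mul]
    · have h8 : ‖((1 / √8 : ℝ) : ℂ)‖ ≤ 1 := by
        rw [norm_real, norm_eq_abs, abs_of_pos (by positivity),
          div_le_one (by positivity)]
        exact one_le_sqrt.mpr (by norm_num)
      gcongr
      calc _ ≤ 1 * M := by gcongr; exact hM c hc
        _ = M := one_mul M
    · have := fun j => continuous_besselJ (n j).natAbs
      fun_prop
  have outer : ‖(√t : ℂ) * ∫ ξ in cube 3, ∫ c in (29 / 100 : ℝ)..(31 / 100), k2 c ξ‖ ≤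
      (2 * π) ^ 3 * M := by
    rw [← interval_cube_swap k2c, ← intervalIntegral.integral_const_mul]
    refine (intervalIntegral.norm_integral_le_of_norm_le_const (C := (2 * π) ^ 3 * M)
      fun c hc => inner c ?_).trans ?_
    · rw [uIoc_of_le (by norm_num)] at hc; exact Set.Ioc_subset_Icc_self hc
    bound
  have k3 : ∀ ξ, ∫ c in (29 / 100 : ℝ)..(31 / 100), k2 c ξ =
      torusChar n ξ * ∫ c in (29 / 100 : ℝ)..(31 / 100), ∫ w in c..(c + 3 / 4),
        cis(t * subPhase (kgSymbol ξ) w) := by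
    intro ξ
    rw [← intervalIntegral.integral_const_mul]
    refine integral_congr fun c hc => ?_
    rw [uIcc_of_le (by norm_num)] at hc
    simp only [hk2]
    rw [integral_comp_add_left (fun w => k w ξ) c, add_zero,
      ← intervalIntegral.integral_const_mul]
    refine integral_congr fun w hw => ?_
    rw [uIcc_of_le (by linarith)] at hw
    exact kw w ξ (by linarith [hw.1, hc.1])
  have hωc : Continuous (omegaKG 3) := by
    have : omegaKG 3 = fun ξ => √(kgSymbol ξ) := funext omegaKG_three
    rw [this]; exact continuous_kgSymbol.sqrt
  have hω0 : ∀ ξ, omegaKG 3 ξ ≠ 0 := fun ξ => by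
    rw [omegaKG_three]
    have := one_le_kgSymbol ξ
    positivity
  set p : (Fin 3 → ℝ) → ℂ := fun ξ => torusChar n ξ *
    (cis(t * omegaKG 3 ξ) * ((1 / omegaKG 3 ξ : ℝ) : ℂ)) with hp
  have pc : Continuous p := by
    refine (continuous_torusChar n).mul (((Complex.continuous_exp.comp (continuous_const.mul
      (continuous_ofReal.comp (continuous_const.mul hωc))))).mul
      (continuous_ofReal.comp (continuous_const.div hωc hω0)))
  have k3c : Continuous fun ξ => ∫ c in (29 / 100 : ℝ)..(31 / 100), k2 c ξ := by fun_prop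
  have ci : ∀ {f : (Fin 3 → ℝ) → ℂ}, Continuous f → IntegrableOn f (cube 3) := fun hf =>
    hf.continuousOn.integrableOn_compact isCompact_Icc
  have diff : ‖L * kgKernel t n - (√t : ℂ) *
      ∫ ξ in cube 3, ∫ c in (29 / 100 : ℝ)..(31 / 100), k2 c ξ‖ ≤
      60 * t ^ (-(3 / 2) : ℝ) * (2 * π) ^ 3 := by
    have e : L * kgKernel t n - (√t : ℂ) *
        ∫ ξ in cube 3, ∫ c in (29 / 100 : ℝ)..(31 / 100), k2 c ξ =
        ∫ ξ in cube 3, (L * p ξ - (√t : ℂ) * ∫ c in (29 / 100 : ℝ)..(31 / 100), k2 c ξ) := by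
      rw [integral_sub ((ci pc).const_mul L) ((ci k3c).const_mul _), integral_const_mul,
        integral_const_mul]
      rfl
    rw [e, ← volume_cube_three]
    refine norm_setIntegral_le_of_norm_le_const
      (isCompact_Icc.measure_lt_top) fun ξ _ => ?_
    rw [k3 ξ]
    have := hL (kgSymbol ξ) t (one_le_kgSymbol ξ) (kgSymbol_le ξ) ht
    rw [← omegaKG_three] at this
    calc _ = ‖torusChar n ξ * (L * (cis(t * omegaKG 3 ξ) *
          ((1 / omegaKG 3 ξ : ℝ) : ℂ)) - (√t : ℂ) *
          ∫ c in (29 / 100 : ℝ)..(31 / 100), ∫ w in c..(c + 3 / 4),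
            cis(t * subPhase (kgSymbol ξ) w))‖ := by
          congr 1; simp only [hp]; ring
      _ ≤ _ := by rwa [norm_mul, norm_torusChar, one_mul]
  have fin : ‖L‖ * ‖kgKernel t n‖ ≤ 60 * (2 * π) ^ 3 * (t ^ (-(3 / 2) : ℝ) + M) := by
    rw [← norm_mul]
    calc _ ≤ 60 * t ^ (-(3 / 2) : ℝ) * (2 * π) ^ 3 + (2 * π) ^ 3 * M := by
          refine (norm_le_norm_sub_add _ _).trans (add_le_add diff outer)
      _ ≤ _ := by
          have : 0 ≤ (2 * π) ^ 3 * M := by positivity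
          nlinarith
  rw [div_mul_eq_mul_div, le_div_iff₀ hLn]
  linarith

section Pointwise

variable {T x₁ x₂ x₃ p₁ p₂ p₃ : ℝ}

lemma sub_inv_facts {x p : ℝ} (hx : 1 ≤ x) (hp : p * x = x ^ 2 - 1) :
    0 ≤ p ∧ p ≤ x ∧ x ≤ p + 1 := by
  refine ⟨?_, ?_, ?_⟩ <;> by_contra! h <;> nlinarith

lemma sub_inv_mono {x y p r : ℝ} (hy : 1 ≤ y) (hxy : y ≤ x) (hp : p * x = x ^ 2 - 1)
    (hr : r * y = y ^ 2 - 1) : r ≤ p := by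
  by_contra! h
  have : r * y - p * y ≤ 0 := by
    have : (p - r) * (x * y) = (x - y) * (x * y + 1) := by nlinarith
    have h2 : 0 ≤ (x - y) * (x * y + 1) := by nlinarith
    nlinarith
  nlinarith

/-- Signs `(-,-,±)`. -/
lemma phase_alternative_neg_neg {e : ℝ} (he : |e| ≤ 1) (hT : 19 / 100 ≤ T) (h3 : 1 ≤ x₃)
    (h32 : x₃ ≤ x₂) (h21 : x₂ ≤ x₁) (hp₁ : p₁ * x₁ = x₁ ^ 2 - 1) (hp₂ : p₂ * x₂ = x₂ ^ 2 - 1)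
    (hp₃ : p₃ * x₃ = x₃ ^ 2 - 1) (h : |T - p₁ - p₂ + e * p₃| < x₃ / 10000) :
    x₃ ^ 3 / 10000 ≤ p₁ ^ 2 * x₁ + p₂ ^ 2 * x₂ - e * (p₃ ^ 2 * x₃) := by
  obtain ⟨a3, b3, c3⟩ := sub_inv_facts h3 hp₃
  have m32 := sub_inv_mono h3 h32 hp₂ hp₃
  have m21 := sub_inv_mono (h3.trans h32) h21 hp₁ hp₂
  obtain ⟨he1, he2⟩ := abs_le.mp he
  have h' := (abs_lt.mp h).2
  have k1 : e * (p₃ ^ 2 * x₃) ≤ p₂ ^ 2 * x₂ := by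
    calc _ ≤ 1 * (p₃ ^ 2 * x₃) := by gcongr
      _ ≤ _ := by rw [one_mul]; gcongr
  have k2 : -p₃ ≤ e * p₃ := by nlinarith
  have k3 : T - 3 * p₁ < x₃ / 10000 := by linarith
  have k4 : x₃ / 20 ≤ p₁ := by nlinarith
  have k5 : (x₃ / 20) ^ 2 * x₃ ≤ p₁ ^ 2 * x₁ := by gcongr; linarith
  nlinarith [pow_pos (by linarith : 0 < x₃) 3]

/-- Signs `(-,+,-)`. -/
lemma phase_alternative_neg_pos_neg (hT : 19 / 100 ≤ T) (h3 : 1 ≤ x₃)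
    (h32 : x₃ ≤ x₂) (h21 : x₂ ≤ x₁) (hp₁ : p₁ * x₁ = x₁ ^ 2 - 1) (hp₂ : p₂ * x₂ = x₂ ^ 2 - 1)
    (hp₃ : p₃ * x₃ = x₃ ^ 2 - 1) (h : |T - p₁ + p₂ - p₃| < x₃ / 10000) :
    x₃ ^ 3 / 10000 ≤ p₁ ^ 2 * x₁ - p₂ ^ 2 * x₂ + p₃ ^ 2 * x₃ := by
  obtain ⟨a3, b3, c3⟩ := sub_inv_facts h3 hp₃
  have m32 := sub_inv_mono h3 h32 hp₂ hp₃
  have m21 := sub_inv_mono (h3.trans h32) h21 hp₁ hp₂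
  have h' := (abs_lt.mp h).2
  have k1 : (p₁ - p₂) ^ 2 * x₃ ≤ p₁ ^ 2 * x₁ - p₂ ^ 2 * x₂ := by
    have e1 : p₂ ^ 2 * x₂ ≤ p₂ ^ 2 * x₁ := by gcongr
    have e2 : (p₁ - p₂) ^ 2 * x₃ ≤ (p₁ - p₂) ^ 2 * x₁ := by gcongr; linarith
    have e3 : 0 ≤ (p₁ - p₂) * p₂ * x₁ := by bound
    nlinarith
  have k3 : x₃ / 10 ≤ (p₁ - p₂) + p₃ := by nlinarith
  have k4 : x₃ ^ 2 / 400 ≤ (p₁ - p₂) ^ 2 + p₃ ^ 2 := by nlinarith [sq_nonneg (p₁ - p₂ - p₃)]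
  nlinarith [pow_pos (by linarith : 0 < x₃) 3]

/-- Signs `(-,+,+)`. -/
lemma phase_alternative_neg_pos_pos (hT : 19 / 100 ≤ T) (h3 : 1 ≤ x₃)
    (h32 : x₃ ≤ x₂) (h21 : x₂ ≤ x₁) (hp₁ : p₁ * x₁ = x₁ ^ 2 - 1) (hp₂ : p₂ * x₂ = x₂ ^ 2 - 1)
    (hp₃ : p₃ * x₃ = x₃ ^ 2 - 1) (h : |T - p₁ + p₂ + p₃| < x₃ / 10000) :
    x₃ ^ 3 / 10000 ≤ p₁ ^ 2 * x₁ - p₂ ^ 2 * x₂ - p₃ ^ 2 * x₃ := by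
  obtain ⟨a3, b3, c3⟩ := sub_inv_facts h3 hp₃
  have m32 := sub_inv_mono h3 h32 hp₂ hp₃
  have m21 := sub_inv_mono (h3.trans h32) h21 hp₁ hp₂
  have h' := (abs_lt.mp h).2
  have k3 : x₃ / 10 ≤ p₁ - p₂ := by nlinarith
  have k4 : p₃ / 2 ≤ p₁ - p₂ := by nlinarith
  have k1 : ((p₁ - p₂) * (p₁ - p₂ + 2 * p₃)) * x₃ ≤ p₁ ^ 2 * x₁ - p₂ ^ 2 * x₂ := by
    have e1 : p₂ ^ 2 * x₂ ≤ p₂ ^ 2 * x₁ := by gcongr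
    have e2 : ((p₁ - p₂) * (p₁ - p₂ + 2 * p₃)) * x₃ ≤ ((p₁ - p₂) * (p₁ + p₂)) * x₁ := by
      refine mul_le_mul (mul_le_mul_of_nonneg_left (by linarith) (by linarith)) (by linarith)
        (by linarith) (mul_nonneg (by linarith) (by linarith))
    nlinarith
  have k5 : (x₃ / 10) ^ 2 ≤ (p₁ - p₂) * (p₁ - p₂ + 2 * p₃) - p₃ ^ 2 := by nlinarith
  have k6 : (x₃ / 10) ^ 2 * x₃ ≤ ((p₁ - p₂) * (p₁ - p₂ + 2 * p₃) - p₃ ^ 2) * x₃ := by gcongr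
  nlinarith [pow_pos (by linarith : 0 < x₃) 3]

/-- Signs `(+,-,-)` with `x₃` large. -/
lemma phase_alternative_pos_neg_neg_large (hT' : T ≤ 36) (h3 : 150 ≤ x₃)
    (h32 : x₃ ≤ x₂) (h21 : x₂ ≤ x₁) (hp₁ : p₁ * x₁ = x₁ ^ 2 - 1) (hp₂ : p₂ * x₂ = x₂ ^ 2 - 1)
    (hp₃ : p₃ * x₃ = x₃ ^ 2 - 1) (h : |T + p₁ - p₂ - p₃| < x₃ / 10000) :
    x₃ ^ 3 / 10000 ≤ p₁ ^ 2 * x₁ - p₂ ^ 2 * x₂ - p₃ ^ 2 * x₃ := by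
  have h1 : 1 ≤ x₃ := by linarith
  obtain ⟨a3, b3, c3⟩ := sub_inv_facts h1 hp₃
  have m32 := sub_inv_mono h1 h32 hp₂ hp₃
  have m21 := sub_inv_mono (h1.trans h32) h21 hp₁ hp₂
  obtain ⟨h'', h'⟩ := abs_lt.mp h
  have c4 : 99 / 100 * x₃ ≤ p₃ := by nlinarith
  have k3 : 3 / 4 * p₃ ≤ p₁ - p₂ := by linarith
  have k1 : ((p₁ - p₂) * (p₁ - p₂ + 2 * p₃)) * x₃ ≤ p₁ ^ 2 * x₁ - p₂ ^ 2 * x₂ := by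
    have e1 : p₂ ^ 2 * x₂ ≤ p₂ ^ 2 * x₁ := by gcongr
    have e2 : ((p₁ - p₂) * (p₁ - p₂ + 2 * p₃)) * x₃ ≤ ((p₁ - p₂) * (p₁ + p₂)) * x₁ := by
      refine mul_le_mul (mul_le_mul_of_nonneg_left (by linarith) (by linarith)) (by linarith)
        (by linarith) (mul_nonneg (by linarith) (by linarith))
    nlinarith
  have k5 : (x₃ / 2) ^ 2 ≤ (p₁ - p₂) * (p₁ - p₂ + 2 * p₃) - p₃ ^ 2 := by nlinarith
  have k6 : (x₃ / 2) ^ 2 * x₃ ≤ ((p₁ - p₂) * (p₁ - p₂ + 2 * p₃) - p₃ ^ 2) * x₃ := by gcongr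
  nlinarith [pow_pos (by linarith : 0 < x₃) 3]

/-- Signs `(+,-,-)`: degenerate points have a large next derivative. -/
lemma phase_alternative_pos_neg_neg (hT : 19 / 100 ≤ T) (h3 : 1 ≤ x₃)
    (h32 : x₃ ≤ x₂) (h21 : x₂ ≤ x₁) (hp₁ : p₁ * x₁ = x₁ ^ 2 - 1) (hp₂ : p₂ * x₂ = x₂ ^ 2 - 1)
    (hp₃ : p₃ * x₃ = x₃ ^ 2 - 1) (h : |T + p₁ - p₂ - p₃| < x₃ / 10000)
    (hq : |p₁ ^ 2 * x₁ - p₂ ^ 2 * x₂ - p₃ ^ 2 * x₃| < x₃ ^ 3 / 10000) :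
    x₁ ^ 2 / 2000 ≤ p₁ ^ 2 * x₁ ^ 3 - p₂ ^ 2 * x₂ ^ 3 - p₃ ^ 2 * x₃ ^ 3 := by
  obtain ⟨a3, b3, c3⟩ := sub_inv_facts h3 hp₃
  have m32 := sub_inv_mono h3 h32 hp₂ hp₃
  have m21 := sub_inv_mono (h3.trans h32) h21 hp₁ hp₂
  have h' := (abs_lt.mp h).2
  have hq' := (abs_lt.mp hq).1
  have k1 : 15 / 100 * x₃ ≤ p₃ := by nlinarith
  have k2 : (15 / 100 * x₃) ^ 2 * x₃ ≤ p₃ ^ 2 * x₃ := by gcongr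
  have hx3 : 1 ≤ x₃ ^ 3 := one_le_pow₀ h3
  have k3 : p₃ ^ 2 * x₃ ≤ p₂ ^ 2 * x₂ := by gcongr
  have k4 : 19 / 10 * (p₃ ^ 2 * x₃) ≤ p₁ ^ 2 * x₁ := by nlinarith
  -- `y = x ^ 2 - 1 = p x`
  have k5 : 19 / 10 * (p₃ * x₃) ^ 2 ≤ (p₁ * x₁) ^ 2 := by
    have e1 : 19 / 10 * (p₃ ^ 2 * x₃) * x₃ ≤ p₁ ^ 2 * x₁ * x₁ := by
      exact mul_le_mul k4 (h32.trans h21) (by linarith) (mul_nonneg (sq_nonneg _) (by linarith))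
    linarith
  have hy1 : 0 ≤ p₁ * x₁ := mul_nonneg (a3.trans (m32.trans m21)) (by linarith)
  have k6 : 13 / 10 * (p₃ * x₃) ≤ p₁ * x₁ := by
    refine (abs_le_of_sq_le_sq' ?_ hy1).2
    nlinarith [sq_nonneg (p₃ * x₃)]
  have k7 : 15 / 100 ≤ p₃ * x₃ := by nlinarith
  have k8 : x₁ ^ 2 / 25 ≤ x₁ ^ 2 - x₃ ^ 2 := by nlinarith
  have k9 : 225 / 10000 * x₃ ^ 3 * (x₁ ^ 2 / 25) ≤ p₃ ^ 2 * x₃ * (x₁ ^ 2 - x₃ ^ 2) := by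
    refine mul_le_mul (by linarith) k8 (by positivity) (by positivity)
  have k10 : 0 ≤ p₂ ^ 2 * x₂ * (x₁ ^ 2 - x₂ ^ 2) := by
    have : x₂ ^ 2 ≤ x₁ ^ 2 := by gcongr; linarith
    have : 0 ≤ x₂ := by linarith
    positivity
  have k11 : -(x₃ ^ 3 / 10000) * x₁ ^ 2 ≤
      (p₁ ^ 2 * x₁ - p₂ ^ 2 * x₂ - p₃ ^ 2 * x₃) * x₁ ^ 2 := by gcongr
  have k12 : x₁ ^ 2 * 1 ≤ x₁ ^ 2 * x₃ ^ 3 := by gcongr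
  nlinarith

end Pointwise

lemma OscBound.split {Φ F : ℝ → ℝ} {a b M₁ M₂ : ℝ} (κ : ℝ) (hab : a ≤ b)
    (hΦ : ContinuousOn Φ (Icc a b)) (hFc : ContinuousOn F (Icc a b))
    (hF : MonotoneOn F (Icc a b) ∨ AntitoneOn F (Icc a b)) (hM₁ : 0 ≤ M₁) (hM₂ : 0 ≤ M₂)
    (h₁ : ∀ c d, a ≤ c → c ≤ d → d ≤ b → (∀ x ∈ Icc c d, F x ≤ κ) → OscBound Φ c d M₁)
    (h₂ : ∀ c d, a ≤ c → c ≤ d → d ≤ b → (∀ x ∈ Icc c d, κ ≤ F x) → OscBound Φ c d M₂) :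
    OscBound Φ a b (M₁ + M₂) := by
  by_cases hle : ∀ x ∈ Icc a b, F x ≤ κ
  · exact (h₁ a b le_rfl hab le_rfl hle).mono le_rfl le_rfl (by linarith)
  by_cases hge : ∀ x ∈ Icc a b, κ ≤ F x
  · exact (h₂ a b le_rfl hab le_rfl hge).mono le_rfl le_rfl (by linarith)
  push Not at hle hge
  obtain ⟨x, hx, hxκ⟩ := hle
  obtain ⟨y, hy, hyκ⟩ := hge
  have hp : κ ∈ F '' Icc a b := by
    refine (isPreconnected_Icc.image F hFc).ordConnected.out ⟨y, hy, rfl⟩ ⟨x, hx, rfl⟩ ?_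
    exact ⟨hyκ.le, hxκ.le⟩
  obtain ⟨p, hp, hpκ⟩ := hp
  rcases hF with hF | hF
  · refine OscBound.append hp.1 hp.2 hΦ (h₁ a p le_rfl hp.1 hp.2 fun z hz => ?_)
      (h₂ p b hp.1 hp.2 le_rfl fun z hz => ?_)
    · rw [← hpκ]; exact hF ⟨hz.1, hz.2.trans hp.2⟩ hp hz.2
    · rw [← hpκ]; exact hF hp ⟨hp.1.trans hz.1, hz.2⟩ hz.1
  · rw [add_comm]
    refine OscBound.append hp.1 hp.2 hΦ (h₂ a p le_rfl hp.1 hp.2 fun z hz => ?_)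
      (h₁ p b hp.1 hp.2 le_rfl fun z hz => ?_)
    · rw [← hpκ]; exact hF ⟨hz.1, hz.2.trans hp.2⟩ hp hz.2
    · rw [← hpκ]; exact hF hp ⟨hp.1.trans hz.1, hz.2⟩ hz.1

lemma length_le_of_abs_le {F F' : ℝ → ℝ} {a b κ r : ℝ} (hab : a ≤ b) (hr : 0 < r) (hκ : 0 ≤ κ)
    (hF : ∀ x ∈ Icc a b, HasDerivAt F (F' x) x) (h : ∀ x ∈ Icc a b, |F x| ≤ κ)
    (h' : ∀ x ∈ Icc a b, r ≤ |F' x|) : b - a ≤ 2 * κ / r := by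
  rcases hab.eq_or_lt with rfl | hlt
  · rw [sub_self]; positivity
  obtain ⟨c, hc, hce⟩ := exists_hasDerivAt_eq_slope F F' hlt
    (fun x hx => (hF x hx).continuousAt.continuousWithinAt)
    (fun x hx => hF x (Ioo_subset_Icc_self hx))
  have h1 := h' c (Ioo_subset_Icc_self hc)
  rw [hce, abs_div, abs_of_pos (sub_pos.mpr hlt), le_div_iff₀ (sub_pos.mpr hlt)] at h1
  rw [le_div_iff₀ hr]
  have h2 := abs_sub (F b) (F a)
  linarith [h b ⟨hab, le_rfl⟩, h a ⟨le_rfl, hab⟩]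

/-- Derivative data for a phase with `Φ'' = H / x ^ 3`. -/
structure CubicPhase (Φ Φ' H H' : ℝ → ℝ) (a b S : ℝ) : Prop where
  pos : 0 < a
  le : b ≤ S
  deriv₁ : ∀ x ∈ Set.Icc a b, HasDerivAt Φ (Φ' x) x
  deriv₂ : ∀ x ∈ Set.Icc a b, HasDerivAt Φ' (H x / x ^ 3) x
  deriv₃ : ∀ x ∈ Set.Icc a b, HasDerivAt H (H' x) x

namespace CubicPhase

variable {Φ Φ' H H' : ℝ → ℝ} {a b S h₀ r₀ : ℝ}

lemma mono (hp : CubicPhase Φ Φ' H H' a b S) {c d : ℝ} (hc : a ≤ c) (hd : d ≤ b) :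
    CubicPhase Φ Φ' H H' c d S := by
  have hs : Icc c d ⊆ Icc a b := Icc_subset_Icc hc hd
  exact ⟨hp.pos.trans_le hc, hd.trans hp.le, fun x hx => hp.deriv₁ x (hs hx),
    fun x hx => hp.deriv₂ x (hs hx), fun x hx => hp.deriv₃ x (hs hx)⟩

lemma continuousOn (hp : CubicPhase Φ Φ' H H' a b S) : ContinuousOn Φ (Icc a b) :=
  fun x hx => (hp.deriv₁ x hx).continuousAt.continuousWithinAt

lemma continuousOn_H (hp : CubicPhase Φ Φ' H H' a b S) : ContinuousOn H (Icc a b) :=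
  fun x hx => (hp.deriv₃ x hx).continuousAt.continuousWithinAt

lemma oscBound_of_le (hp : CubicPhase Φ Φ' H H' a b S) (hab : a ≤ b) (hh : 0 < h₀)
    (h : ∀ x ∈ Icc a b, h₀ ≤ |H x|) : OscBound Φ a b (8 / √(h₀ / S ^ 3)) := by
  have hS : 0 < S := hp.pos.trans_le (hab.trans hp.le)
  refine oscBound_of_abs_deriv2_ge (by positivity) hp.deriv₁ hp.deriv₂
    (hp.continuousOn_H.div (by fun_prop) fun x hx => ?_) fun x hx => ?_
  · have : 0 < x := hp.pos.trans_le hx.1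
    positivity
  · have hx0 : 0 < x := hp.pos.trans_le hx.1
    rw [abs_div, abs_of_pos (pow_pos hx0 3)]
    have := h x hx
    have : x ≤ S := hx.2.trans hp.le
    gcongr

lemma monotone_or_antitone (hp : CubicPhase Φ Φ' H H' a b S)
    (hs : (∀ x ∈ Icc a b, 0 ≤ H' x) ∨ (∀ x ∈ Icc a b, H' x ≤ 0)) :
    MonotoneOn H (Icc a b) ∨ AntitoneOn H (Icc a b) := by
  have key : ∀ F F' : ℝ → ℝ, (∀ x ∈ Icc a b, HasDerivAt F (F' x) x) →
      (∀ x ∈ Icc a b, 0 ≤ F' x) → MonotoneOn F (Icc a b) := by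
    intro F F' h1 h2
    refine monotoneOn_of_deriv_nonneg (convex_Icc a b)
      (fun x hx => (h1 x hx).continuousAt.continuousWithinAt) ?_ ?_
    · intro x hx
      exact (h1 x (interior_subset hx)).differentiableAt.differentiableWithinAt
    · intro x hx
      rw [(h1 x (interior_subset hx)).deriv]
      exact h2 x (interior_subset hx)
  rcases hs with hs | hs
  · exact Or.inl (key H H' hp.deriv₃ hs)
  · right
    have := key (fun x => -H x) (fun x => -H' x) (fun x hx => (hp.deriv₃ x hx).neg)
      (fun x hx => by linarith [hs x hx])
    intro x hx y hy hxy
    have := this hx hy hxy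
    simp only at this
    linarith

/-- Splitting according to the size of the second derivative. -/
lemma oscBound_split (hp : CubicPhase Φ Φ' H H' a b S) (hab : a ≤ b) (hh : 0 < h₀)
    (hs : (∀ x ∈ Icc a b, 0 ≤ H' x) ∨ (∀ x ∈ Icc a b, H' x ≤ 0)) {L : ℝ} (hL : 0 ≤ L)
    (h : ∀ c d, a ≤ c → c ≤ d → d ≤ b → (∀ x ∈ Icc c d, |H x| ≤ h₀) → d - c ≤ L) :
    OscBound Φ a b (16 / √(h₀ / S ^ 3) + L) := by
  have hm := hp.monotone_or_antitone hs
  have hpos : 0 ≤ 8 / √(h₀ / S ^ 3) := by positivity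
  have e : 16 / √(h₀ / S ^ 3) + L = 8 / √(h₀ / S ^ 3) + (L + 8 / √(h₀ / S ^ 3)) := by ring
  rw [e]
  refine OscBound.split (-h₀) hab hp.continuousOn hp.continuousOn_H hm hpos (by positivity)
    (fun c d hc hcd hd hH => ?_) (fun c d hc hcd hd hH => ?_)
  · refine (hp.mono hc hd).oscBound_of_le hcd hh fun x hx => ?_
    exact le_abs.mpr (Or.inr (by linarith [hH x hx]))
  have hp' := hp.mono hc hd
  have sub : Icc c d ⊆ Icc a b := Icc_subset_Icc hc hd
  refine OscBound.split h₀ hcd hp'.continuousOn hp'.continuousOn_H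
    (hm.imp (fun h => h.mono sub) fun h => h.mono sub) hL hpos
    (fun c' d' hc' hcd' hd' hH' => ?_) (fun c' d' hc' hcd' hd' hH' => ?_)
  · refine oscBound_length _ (h c' d' (hc.trans hc') hcd' (hd'.trans hd) fun x hx => ?_)
    exact abs_le.mpr ⟨hH x ⟨hc'.trans hx.1, hx.2.trans hd'⟩, hH' x hx⟩
  · refine (hp'.mono hc' hd').oscBound_of_le hcd' hh fun x hx => ?_
    exact le_abs.mpr (Or.inl (hH' x hx))

lemma oscBound_two (hp : CubicPhase Φ Φ' H H' a b S) (hab : a ≤ b) (hh : 0 < h₀) (hr : 0 < r₀)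
    (hs : (∀ x ∈ Icc a b, 0 ≤ H' x) ∨ (∀ x ∈ Icc a b, H' x ≤ 0))
    (h : ∀ x ∈ Icc a b, |H x| ≤ h₀ → r₀ ≤ |H' x|) :
    OscBound Φ a b (16 / √(h₀ / S ^ 3) + 2 * h₀ / r₀) := by
  refine hp.oscBound_split hab hh hs (by positivity) fun c d hc hcd hd hH => ?_
  have sub : Icc c d ⊆ Icc a b := Icc_subset_Icc hc hd
  exact length_le_of_abs_le hcd hr hh.le (fun x hx => hp.deriv₃ x (sub hx)) hH
    fun x hx => h x (sub hx) (hH x hx)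

/-- The third derivative may change sign once: `H' = F * W` with `F` monotone and `W > 0`. -/
lemma oscBound_two_of_sign_change {F W : ℝ → ℝ} (hp : CubicPhase Φ Φ' H H' a b S) (hab : a ≤ b)
    (hh : 0 < h₀) (hr : 0 < r₀) (hF : MonotoneOn F (Icc a b) ∨ AntitoneOn F (Icc a b))
    (hFc : ContinuousOn F (Icc a b)) (hW : ∀ x ∈ Icc a b, 0 < W x)
    (hFW : ∀ x ∈ Icc a b, H' x = F x * W x)
    (h : ∀ x ∈ Icc a b, |H x| ≤ h₀ → r₀ ≤ |H' x|) :
    OscBound Φ a b (2 * (16 / √(h₀ / S ^ 3) + 2 * h₀ / r₀)) := by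
  rw [two_mul]
  refine OscBound.split 0 hab hp.continuousOn hFc hF (by positivity) (by positivity)
    (fun c d hc hcd hd hH => ?_) (fun c d hc hcd hd hH => ?_)
  · have sub : Icc c d ⊆ Icc a b := Icc_subset_Icc hc hd
    refine (hp.mono hc hd).oscBound_two hcd hh hr (Or.inr fun x hx => ?_) fun x hx => h x (sub hx)
    rw [hFW x (sub hx)]
    exact mul_nonpos_of_nonpos_of_nonneg (hH x hx) (hW x (sub hx)).le
  · have sub : Icc c d ⊆ Icc a b := Icc_subset_Icc hc hd
    refine (hp.mono hc hd).oscBound_two hcd hh hr (Or.inl fun x hx => ?_) fun x hx => h x (sub hx)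
    rw [hFW x (sub hx)]
    exact mul_nonneg (hH x hx) (hW x (sub hx)).le

/-- As `oscBound_two_of_sign_change`, using one more derivative where the third one is small. -/
lemma oscBound_three {F W H'' : ℝ → ℝ} {κ r₁ k₀ : ℝ} (hp : CubicPhase Φ Φ' H H' a b S)
    (hab : a ≤ b) (hh : 0 < h₀) (hr : 0 < r₀) (hκ : 0 < κ) (hr₁ : 0 < r₁) (hk : 0 < k₀)
    (hF : MonotoneOn F (Icc a b) ∨ AntitoneOn F (Icc a b))
    (hFc : ContinuousOn F (Icc a b)) (hW : ∀ x ∈ Icc a b, 0 < W x)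
    (hFW : ∀ x ∈ Icc a b, H' x = F x * W x)
    (hH'' : ∀ x ∈ Icc a b, HasDerivAt H' (H'' x) x)
    (h1 : ∀ x ∈ Icc a b, r₀ ≤ κ * W x) (h2 : ∀ x ∈ Icc a b, κ * W x ≤ r₁)
    (h3 : ∀ x ∈ Icc a b, |H x| ≤ h₀ → |H' x| ≤ r₁ → k₀ ≤ |H'' x|) :
    OscBound Φ a b (2 * (16 / √(h₀ / S ^ 3) + 2 * h₀ / r₀) +
      2 * (16 / √(h₀ / S ^ 3) + 2 * r₁ / k₀)) := by
  set A := 16 / √(h₀ / S ^ 3) + 2 * h₀ / r₀ with hA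
  set B := 16 / √(h₀ / S ^ 3) + 2 * r₁ / k₀ with hB
  have hA0 : 0 ≤ A := by positivity
  have hB0 : 0 ≤ B := by positivity
  have outer : ∀ c d, a ≤ c → c ≤ d → d ≤ b →
      ((∀ x ∈ Icc c d, F x ≤ -κ) ∨ (∀ x ∈ Icc c d, κ ≤ F x)) → OscBound Φ c d A := by
    intro c d hc hcd hd hs
    have sub : Icc c d ⊆ Icc a b := Icc_subset_Icc hc hd
    refine (hp.mono hc hd).oscBound_two hcd hh hr ?_ fun x hx _ => ?_
    · rcases hs with hs | hs
      · right; intro x hx; rw [hFW x (sub hx)]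
        exact mul_nonpos_of_nonpos_of_nonneg (by linarith [hs x hx]) (hW x (sub hx)).le
      · left; intro x hx; rw [hFW x (sub hx)]
        exact mul_nonneg (by linarith [hs x hx]) (hW x (sub hx)).le
    · have hw := hW x (sub hx)
      refine (h1 x (sub hx)).trans ?_
      rw [hFW x (sub hx), abs_mul, abs_of_pos hw]
      gcongr
      rcases hs with hs | hs
      · exact le_abs.mpr (Or.inr (by linarith [hs x hx]))
      · exact le_abs.mpr (Or.inl (hs x hx))
  have inner : ∀ c d, a ≤ c → c ≤ d → d ≤ b → (∀ x ∈ Icc c d, |F x| ≤ κ) →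
      ((∀ x ∈ Icc c d, 0 ≤ F x) ∨ (∀ x ∈ Icc c d, F x ≤ 0)) → OscBound Φ c d B := by
    intro c d hc hcd hd hk' hs
    have sub : Icc c d ⊆ Icc a b := Icc_subset_Icc hc hd
    refine (hp.mono hc hd).oscBound_split hcd hh ?_ (by positivity) fun c' d' hc' hcd' hd' hH => ?_
    · rcases hs with hs | hs
      · left; intro x hx; rw [hFW x (sub hx)]
        exact mul_nonneg (hs x hx) (hW x (sub hx)).le
      · right; intro x hx; rw [hFW x (sub hx)]
        exact mul_nonpos_of_nonpos_of_nonneg (hs x hx) (hW x (sub hx)).le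
    have sub' : Icc c' d' ⊆ Icc c d := Icc_subset_Icc hc' hd'
    have hle : ∀ x ∈ Icc c' d', |H' x| ≤ r₁ := fun x hx => by
      have hw := hW x (sub (sub' hx))
      refine le_trans ?_ (h2 x (sub (sub' hx)))
      rw [hFW x (sub (sub' hx)), abs_mul, abs_of_pos hw]
      have := hk' x (sub' hx)
      gcongr
    exact length_le_of_abs_le hcd' hk hr₁.le (fun x hx => hH'' x (sub (sub' hx))) hle
      fun x hx => h3 x (sub (sub' hx)) (hH x hx) (hle x hx)
  have e : 2 * A + 2 * B = A + ((B + B) + A) := by ring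
  rw [e]
  have mon : ∀ {c d : ℝ}, a ≤ c → d ≤ b → ContinuousOn Φ (Icc c d) ∧
      ContinuousOn F (Icc c d) ∧ (MonotoneOn F (Icc c d) ∨ AntitoneOn F (Icc c d)) := by
    intro c d hc hd
    have sub : Icc c d ⊆ Icc a b := Icc_subset_Icc hc hd
    exact ⟨hp.continuousOn.mono sub, hFc.mono sub,
      hF.imp (fun h => h.mono sub) fun h => h.mono sub⟩
  refine OscBound.split (-κ) hab hp.continuousOn hFc hF hA0 (by positivity)
    (fun c d hc hcd hd hH => outer c d hc hcd hd (Or.inl hH)) (fun c d hc hcd hd hH => ?_)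
  obtain ⟨m1, m2, m3⟩ := mon hc hd
  refine OscBound.split κ hcd m1 m2 m3 (by positivity) hA0
    (fun c' d' hc' hcd' hd' hH' => ?_)
    (fun c' d' hc' hcd' hd' hH' => outer c' d' (hc.trans hc') hcd' (hd'.trans hd) (Or.inr hH'))
  obtain ⟨n1, n2, n3⟩ := mon (hc.trans hc') (hd'.trans hd)
  have hin : ∀ x ∈ Icc c' d', |F x| ≤ κ := fun x hx =>
    abs_le.mpr ⟨hH x ⟨hc'.trans hx.1, hx.2.trans hd'⟩, hH' x hx⟩
  refine OscBound.split 0 hcd' n1 n2 n3 hB0 hB0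
    (fun c₂ d₂ hc₂ hcd₂ hd₂ h₂ => ?_) (fun c₂ d₂ hc₂ hcd₂ hd₂ h₂ => ?_)
  · exact inner c₂ d₂ (hc.trans (hc'.trans hc₂)) hcd₂ (hd₂.trans (hd'.trans hd))
      (fun x hx => hin x ⟨hc₂.trans hx.1, hx.2.trans hd₂⟩) (Or.inr h₂)
  · exact inner c₂ d₂ (hc.trans (hc'.trans hc₂)) hcd₂ (hd₂.trans (hd'.trans hd))
      (fun x hx => hin x ⟨hc₂.trans hx.1, hx.2.trans hd₂⟩) (Or.inl h₂)

end CubicPhase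

/-- `1 / √(s² - n²)`. -/
def wkbInv (n : ℕ) (s : ℝ) : ℝ := 1 / √(s ^ 2 - (n : ℝ) ^ 2)

section wkbInv

variable {n m : ℕ} {s : ℝ}

lemma wkbInv_pos (h : (n : ℝ) < s) : 0 < wkbInv n s := by
  have := wkb_pos h
  unfold wkbInv
  positivity

lemma wkbInv_sq_mul (h : (n : ℝ) < s) : wkbInv n s ^ 2 * (s ^ 2 - (n : ℝ) ^ 2) = 1 := by
  have := wkb_pos h
  rw [wkbInv, div_pow, sq_sqrt this.le]
  field_simp

lemma hasDerivAt_wkbInv (h : (n : ℝ) < s) :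
    HasDerivAt (wkbInv n) (-(s * wkbInv n s ^ 3)) s := by
  have hE := wkb_pos h
  have h1 : HasDerivAt (fun s : ℝ => s ^ 2 - (n : ℝ) ^ 2) (2 * s) s := by
    simpa using (hasDerivAt_pow 2 s).sub_const ((n : ℝ) ^ 2)
  have h2 := (h1.sqrt hE.ne').inv (sqrt_pos.mpr hE).ne'
  have e : wkbInv n = fun s => (√(s ^ 2 - (n : ℝ) ^ 2))⁻¹ := by
    funext s; rw [wkbInv, one_div]
  rw [e]
  refine h2.congr_deriv ?_
  have := sqrt_pos.mpr hE
  field_simp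

lemma wkbInv_mono (hmn : m ≤ n) (h : (n : ℝ) < s) : wkbInv m s ≤ wkbInv n s := by
  have hE := wkb_pos h
  have : (m : ℝ) ≤ n := by exact_mod_cast hmn
  unfold wkbInv
  gcongr

lemma one_le_mul_wkbInv (h : (n : ℝ) < s) : 1 ≤ s * wkbInv n s := by
  have h1 := wkbInv_sq_mul h
  have h2 := wkbInv_pos h
  have h3 : 0 ≤ s := (cast_nonneg n).trans h.le
  have h4 : 1 ≤ (s * wkbInv n s) ^ 2 := by nlinarith [sq_nonneg (wkbInv n s * n)]
  exact (one_le_sq_iff₀ (by positivity)).mp h4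

lemma wkbInv_relation (h : (n : ℝ) < s) :
    (n : ℝ) ^ 2 * wkbInv n s / s * (s * wkbInv n s) = (s * wkbInv n s) ^ 2 - 1 := by
  have h1 := wkbInv_sq_mul h
  have h3 : 0 < s := (cast_nonneg n).trans_lt h
  field_simp
  linarith

lemma wkbInv_ratio_monotone (hmn : m ≤ n) {s' : ℝ} (h : (n : ℝ) < s) (hs : s ≤ s') :
    wkbInv m s / wkbInv n s ≤ wkbInv m s' / wkbInv n s' := by
  have hm : (m : ℝ) ≤ n := by exact_mod_cast hmn
  have hm0 : (0 : ℝ) ≤ m := m.cast_nonneg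
  have hs0 : 0 ≤ s := by linarith
  have a1 := wkb_pos h
  have a2 := wkb_pos (h.trans_le hs)
  have a3 := wkb_pos (hm.trans_lt h)
  have a4 := wkb_pos (hm.trans_lt (h.trans_le hs))
  simp only [wkbInv, one_div, div_inv_eq_mul, inv_mul_eq_div]
  rw [← sqrt_div a1.le, ← sqrt_div a2.le]
  apply sqrt_le_sqrt
  rw [div_le_div_iff₀ a3 a4]
  have : 0 ≤ ((n : ℝ) ^ 2 - (m : ℝ) ^ 2) * (s' ^ 2 - s ^ 2) := by bound
  linarith

end wkbInv

section Phase

variable (t : ℝ) (e : Fin 3 → ℝ) (n : Fin 3 → ℕ)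

/-- The phases in the stationary phase analysis of the kernel. -/
def kgPhase (s : ℝ) : ℝ := 7 * s / 2 + t ^ 2 / (2 * s) + ∑ j, e j * wkbPhase (n j) s

def kgPhase' (s : ℝ) : ℝ := 7 / 2 - t ^ 2 / (2 * s ^ 2) + ∑ j, e j * (wkbRoot (n j) s ^ 2 / s)

def kgH (s : ℝ) : ℝ := t ^ 2 + ∑ j, e j * ((n j : ℝ) ^ 2 * (s * wkbInv (n j) s))

def kgH' (s : ℝ) : ℝ := -∑ j, e j * ((n j : ℝ) ^ 4 * wkbInv (n j) s ^ 3)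

def kgH'' (s : ℝ) : ℝ := 3 * ∑ j, e j * ((n j : ℝ) ^ 4 * (s * wkbInv (n j) s ^ 5))

variable {t e n} {s : ℝ}

lemma hasDerivAt_wkbPhase' {n : ℕ} (h : (n : ℝ) < s) :
    HasDerivAt (fun s => wkbRoot n s ^ 2 / s) ((n : ℝ) ^ 2 * (s * wkbInv n s) / s ^ 3) s := by
  have hs : 0 < s := (cast_nonneg n).trans_lt h
  have h1 := ((hasDerivAt_wkbRoot h).pow 2).div (hasDerivAt_id s) hs.ne'
  refine h1.congr_deriv ?_
  have r0 := wkbRoot_pos h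
  have r4 := wkbRoot_pow_four h
  have hv : wkbInv n s = 1 / wkbRoot n s ^ 2 := by
    rw [wkbRoot_sq, wkbInv]
  rw [hv]
  simp only [Pi.pow_apply, id]
  have hn : (n : ℝ) ^ 2 = s ^ 2 - wkbRoot n s ^ 4 := by rw [r4]; ring
  rw [hn]
  field_simp
  ring

lemma hasDerivAt_kgPhase (hs : ∀ j, (n j : ℝ) < s) :
    HasDerivAt (kgPhase t e n) (kgPhase' t e n s) s := by
  have hs0 : 0 < s := (cast_nonneg (n 0)).trans_lt (hs 0)
  have h1 : HasDerivAt (fun s : ℝ => 7 * s / 2) (7 / 2) s := by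
    simpa using ((hasDerivAt_id s).const_mul 7).div_const 2
  have h2 : HasDerivAt (fun s : ℝ => t ^ 2 / (2 * s)) (-(t ^ 2 / (2 * s ^ 2))) s := by
    have := (hasDerivAt_const s (t ^ 2)).div ((hasDerivAt_id s).const_mul 2)
      (by simp only [id]; positivity)
    refine this.congr_deriv ?_
    simp only [id]
    field_simp
    ring
  have h3 : HasDerivAt (fun s => ∑ j, e j * wkbPhase (n j) s)
      (∑ j, e j * (wkbRoot (n j) s ^ 2 / s)) s :=
    HasDerivAt.fun_sum fun j _ => (hasDerivAt_wkbPhase (hs j)).const_mul (e j)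
  exact ((h1.add h2).add h3).congr_deriv (by rw [kgPhase']; ring)

lemma hasDerivAt_kgPhase' (hs : ∀ j, (n j : ℝ) < s) :
    HasDerivAt (kgPhase' t e n) (kgH t e n s / s ^ 3) s := by
  have hs0 : 0 < s := (cast_nonneg (n 0)).trans_lt (hs 0)
  have h2 : HasDerivAt (fun s : ℝ => t ^ 2 / (2 * s ^ 2)) (-(t ^ 2 / s ^ 3)) s := by
    have := (hasDerivAt_const s (t ^ 2)).div ((hasDerivAt_pow 2 s).const_mul 2)
      (by positivity)
    refine this.congr_deriv ?_
    field_simp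
    norm_num
    ring
  have h3 : HasDerivAt (fun s => ∑ j, e j * (wkbRoot (n j) s ^ 2 / s))
      (∑ j, e j * ((n j : ℝ) ^ 2 * (s * wkbInv (n j) s) / s ^ 3)) s :=
    HasDerivAt.fun_sum fun j _ => (hasDerivAt_wkbPhase' (hs j)).const_mul (e j)
  refine ((h2.const_sub (7 / 2)).add h3).congr_deriv ?_
  rw [kgH, add_div, sum_div, neg_neg]
  field_simp

lemma hasDerivAt_kgH (hs : ∀ j, (n j : ℝ) < s) :
    HasDerivAt (kgH t e n) (kgH' e n s) s := by
  have h3 : HasDerivAt (fun s => ∑ j, e j * ((n j : ℝ) ^ 2 * (s * wkbInv (n j) s)))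
      (∑ j, e j * (-((n j : ℝ) ^ 4 * wkbInv (n j) s ^ 3))) s := by
    refine HasDerivAt.fun_sum fun j _ => ?_
    have := (((hasDerivAt_id s).mul (hasDerivAt_wkbInv (hs j))).const_mul ((n j : ℝ) ^ 2)).const_mul
      (e j)
    refine this.congr_deriv ?_
    have h1 := wkbInv_sq_mul (hs j)
    simp only [id]
    linear_combination (e j * (n j : ℝ) ^ 2 * wkbInv (n j) s) * -h1
  refine (h3.const_add (t ^ 2)).congr_deriv ?_
  simp only [kgH', mul_neg, Finset.sum_neg_distrib]

lemma hasDerivAt_kgH' (hs : ∀ j, (n j : ℝ) < s) :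
    HasDerivAt (kgH' e n) (kgH'' e n s) s := by
  have h3 : HasDerivAt (fun s => ∑ j, e j * ((n j : ℝ) ^ 4 * wkbInv (n j) s ^ 3))
      (∑ j, e j * (-3 * ((n j : ℝ) ^ 4 * (s * wkbInv (n j) s ^ 5)))) s := by
    refine HasDerivAt.fun_sum fun j _ => ?_
    have := (((hasDerivAt_wkbInv (hs j)).pow 3).const_mul ((n j : ℝ) ^ 4)).const_mul (e j)
    refine this.congr_deriv ?_
    norm_num
    left
    ring
  refine h3.neg.congr_deriv ?_
  simp only [kgH'', Fin.sum_univ_three]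
  ring

lemma cubicPhase_kgPhase {a b S : ℝ} (ha : ∀ j, (n j : ℝ) < a) (hb : b ≤ S) :
    CubicPhase (kgPhase t e n) (kgPhase' t e n) (kgH t e n) (kgH' e n) a b S :=
  ⟨(cast_nonneg (n 0)).trans_lt (ha 0), hb,
    fun _ hx => hasDerivAt_kgPhase fun j => (ha j).trans_le hx.1,
    fun _ hx => hasDerivAt_kgPhase' fun j => (ha j).trans_le hx.1,
    fun _ hx => hasDerivAt_kgH fun j => (ha j).trans_le hx.1⟩

lemma kgH_eq (hs : 0 < s) : kgH t e n s = s ^ 2 * (t ^ 2 / s ^ 2 +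
    ∑ j, e j * ((n j : ℝ) ^ 2 * wkbInv (n j) s / s)) := by
  rw [kgH, mul_add, mul_sum]
  congr 1
  · field_simp
  · exact sum_congr rfl fun j _ => by field_simp

lemma kgH'_eq (hs : 0 < s) : kgH' e n s = -(s *
    ∑ j, e j * (((n j : ℝ) ^ 2 * wkbInv (n j) s / s) ^ 2 * (s * wkbInv (n j) s))) := by
  rw [kgH', mul_sum]
  field_simp

lemma kgH''_eq (hs : 0 < s) : kgH'' e n s = 3 *
    ∑ j, e j * (((n j : ℝ) ^ 2 * wkbInv (n j) s / s) ^ 2 * (s * wkbInv (n j) s) ^ 3) := by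
  rw [kgH'']
  congr 1
  exact sum_congr rfl fun j _ => by field_simp


lemma abs_kgH'_ge (hn : Antitone n) (hs : ∀ j, (n j : ℝ) < s)
    (he : ∀ j, e j = 1 ∨ e j = -1)
    (hT : 19 / 100 * s ^ 2 ≤ t ^ 2) (hT' : t ^ 2 ≤ 36 * s ^ 2)
    (hex : e 0 = 1 → e 1 = -1 → e 2 = -1 → 150 ≤ s * wkbInv (n 2) s)
    (h : |kgH t e n s| < s ^ 2 * (s * wkbInv (n 2) s) / 10000) :
    s * (s * wkbInv (n 2) s) ^ 3 / 10000 ≤ |kgH' e n s| := by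
  have hs0 : 0 < s := (cast_nonneg (n 0)).trans_lt (hs 0)
  rw [kgH_eq hs0, abs_mul, abs_of_pos (by positivity : 0 < s ^ 2), mul_div_assoc,
    mul_lt_mul_iff_right₀ (by positivity)] at h
  rw [kgH'_eq hs0, abs_neg, abs_mul, abs_of_pos hs0, mul_div_assoc]
  refine mul_le_mul_of_nonneg_left ?_ hs0.le
  have hT1 : 19 / 100 ≤ t ^ 2 / s ^ 2 := (le_div_iff₀ (by positivity)).mpr hT
  have hT2 : t ^ 2 / s ^ 2 ≤ 36 := (div_le_iff₀ (by positivity)).mpr hT'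
  have x2 := one_le_mul_wkbInv (hs 2)
  have x21 : s * wkbInv (n 2) s ≤ s * wkbInv (n 1) s :=
    mul_le_mul_of_nonneg_left (wkbInv_mono (hn (by decide)) (hs 1)) hs0.le
  have x10 : s * wkbInv (n 1) s ≤ s * wkbInv (n 0) s :=
    mul_le_mul_of_nonneg_left (wkbInv_mono (hn (by decide)) (hs 0)) hs0.le
  have r0 := wkbInv_relation (hs 0)
  have r1 := wkbInv_relation (hs 1)
  have r2 := wkbInv_relation (hs 2)
  have m21 := sub_inv_mono x2 x21 r1 r2
  have m10 := sub_inv_mono (x2.trans x21) x10 r0 r1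
  obtain ⟨f1, f2, f3⟩ := sub_inv_facts x2 r2
  simp only [Fin.sum_univ_three] at h ⊢
  generalize t ^ 2 / s ^ 2 = T at *
  generalize (n 0 : ℝ) ^ 2 * wkbInv (n 0) s / s = p₀ at *
  generalize (n 1 : ℝ) ^ 2 * wkbInv (n 1) s / s = p₁ at *
  generalize (n 2 : ℝ) ^ 2 * wkbInv (n 2) s / s = p₂ at *
  generalize s * wkbInv (n 0) s = y₀ at *
  generalize s * wkbInv (n 1) s = y₁ at *
  generalize s * wkbInv (n 2) s = y₂ at *
  have big : T + p₂ ≤ T + (e 0 * p₀ + e 1 * p₁ + e 2 * p₂) → False := fun hb => by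
    have := (abs_lt.mp h).2
    linarith
  rcases he 0 with h0 | h0 <;> rcases he 1 with h1 | h1
  · exact (big (by rw [h0, h1]; rcases he 2 with h2 | h2 <;> rw [h2] <;> linarith)).elim
  · rcases he 2 with h2 | h2
    · exact (big (by rw [h0, h1, h2]; linarith)).elim
    · have := phase_alternative_pos_neg_neg_large hT2 (hex h0 h1 h2) x21 x10 r0 r1 r2
        (by rw [h0, h1, h2] at h; refine lt_of_eq_of_lt (congrArg abs ?_) (h.trans_eq ?_) <;> ring)
      refine this.trans ((le_abs_self _).trans_eq ?_)
      rw [h0, h1, h2]; congr 1; ring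
  · rcases he 2 with h2 | h2
    · have := phase_alternative_neg_pos_pos hT1 x2 x21 x10 r0 r1 r2
        (by rw [h0, h1, h2] at h; refine lt_of_eq_of_lt (congrArg abs ?_) (h.trans_eq ?_) <;> ring)
      refine this.trans ((neg_le_abs _).trans_eq' ?_)
      rw [h0, h1, h2]; ring
    · have := phase_alternative_neg_pos_neg hT1 x2 x21 x10 r0 r1 r2
        (by rw [h0, h1, h2] at h; refine lt_of_eq_of_lt (congrArg abs ?_) (h.trans_eq ?_) <;> ring)
      refine this.trans ((neg_le_abs _).trans_eq' ?_)
      rw [h0, h1, h2]; ring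
  · have he2 : |e 2| ≤ 1 := by rcases he 2 with h2 | h2 <;> rw [h2] <;> norm_num
    have := phase_alternative_neg_neg he2 hT1 x2 x21 x10 r0 r1 r2
        (by rw [h0, h1] at h; refine lt_of_eq_of_lt (congrArg abs ?_) (h.trans_eq ?_) <;> ring)
    refine this.trans ((neg_le_abs _).trans_eq' ?_)
    rw [h0, h1]; ring

lemma abs_kgH''_ge (hn : Antitone n) (hs : ∀ j, (n j : ℝ) < s)
    (hT : 19 / 100 * s ^ 2 ≤ t ^ 2) (h0 : e 0 = 1) (h1 : e 1 = -1) (h2 : e 2 = -1)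
    (h : |kgH t e n s| < s ^ 2 / 10000) (h' : |kgH' e n s| < s / 10000) :
    3 * (s * wkbInv (n 0) s) ^ 2 / 2000 ≤ |kgH'' e n s| := by
  have hs0 : 0 < s := (cast_nonneg (n 0)).trans_lt (hs 0)
  rw [kgH_eq hs0, abs_mul, abs_of_pos (by positivity : 0 < s ^ 2),
    show s ^ 2 / 10000 = s ^ 2 * (1 / 10000) by ring, mul_lt_mul_iff_right₀ (by positivity)] at h
  rw [kgH'_eq hs0, abs_neg, abs_mul, abs_of_pos hs0,
    show s / 10000 = s * (1 / 10000) by ring, mul_lt_mul_iff_right₀ hs0] at h'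
  rw [kgH''_eq hs0, abs_mul, abs_of_pos (by norm_num : (0:ℝ) < 3), mul_div_assoc]
  refine mul_le_mul_of_nonneg_left ?_ (by norm_num)
  have hT1 : 19 / 100 ≤ t ^ 2 / s ^ 2 := (le_div_iff₀ (by positivity)).mpr hT
  have x2 := one_le_mul_wkbInv (hs 2)
  have x21 : s * wkbInv (n 2) s ≤ s * wkbInv (n 1) s :=
    mul_le_mul_of_nonneg_left (wkbInv_mono (hn (by decide)) (hs 1)) hs0.le
  have x10 : s * wkbInv (n 1) s ≤ s * wkbInv (n 0) s :=
    mul_le_mul_of_nonneg_left (wkbInv_mono (hn (by decide)) (hs 0)) hs0.le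
  have r0 := wkbInv_relation (hs 0)
  have r1 := wkbInv_relation (hs 1)
  have r2 := wkbInv_relation (hs 2)
  simp only [Fin.sum_univ_three, h0, h1, h2] at h h' ⊢
  generalize t ^ 2 / s ^ 2 = T at *
  generalize (n 0 : ℝ) ^ 2 * wkbInv (n 0) s / s = p₀ at *
  generalize (n 1 : ℝ) ^ 2 * wkbInv (n 1) s / s = p₁ at *
  generalize (n 2 : ℝ) ^ 2 * wkbInv (n 2) s / s = p₂ at *
  generalize s * wkbInv (n 0) s = y₀ at *
  generalize s * wkbInv (n 1) s = y₁ at *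
  generalize s * wkbInv (n 2) s = y₂ at *
  have y3 : 1 ≤ y₂ ^ 3 := one_le_pow₀ x2
  have := phase_alternative_pos_neg_neg hT1 x2 x21 x10 r0 r1 r2
    (lt_of_eq_of_lt (by congr 1; ring) (h.trans_le (by linarith)))
    (lt_of_eq_of_lt (by congr 1; ring) (h'.trans_le (by linarith)))
  refine this.trans ((le_abs_self _).trans_eq ?_)
  congr 1; ring

lemma kgH'_term_mono (hn : Antitone n) (hs : ∀ j, (n j : ℝ) < s) {i j : Fin 3} (hij : i ≤ j) :
    (n j : ℝ) ^ 4 * wkbInv (n j) s ^ 3 ≤ (n i : ℝ) ^ 4 * wkbInv (n i) s ^ 3 := by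
  have h1 := hn hij
  have h2 : (n j : ℝ) ≤ n i := by exact_mod_cast h1
  have h3 := wkbInv_mono h1 (hs i)
  have h4 := wkbInv_pos (hs j)
  gcongr

lemma kgH'_sign (hn : Antitone n) (hs : ∀ j, (n j : ℝ) < s) (he : ∀ j, e j = 1 ∨ e j = -1)
    (hne : ¬ (e 1 = -e 0 ∧ e 2 = -e 0)) : e 0 * kgH' e n s ≤ 0 := by
  have a01 := kgH'_term_mono hn hs (i := 0) (j := 1) (by decide)
  have a12 := kgH'_term_mono hn hs (i := 1) (j := 2) (by decide)
  have a2 : 0 ≤ (n 2 : ℝ) ^ 4 * wkbInv (n 2) s ^ 3 := by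
    have := wkbInv_pos (hs 2)
    positivity
  simp only [kgH', Fin.sum_univ_three]
  rcases he 0 with h0 | h0 <;> rcases he 1 with h1 | h1 <;> rcases he 2 with h2 | h2 <;>
    simp only [h0, h1, h2] at hne ⊢ <;> first | linarith | exact absurd (by norm_num) hne

/-- `kgH'` divided by the cube of `wkbInv (n 0)`. -/
def kgRatio (e : Fin 3 → ℝ) (n : Fin 3 → ℕ) (s : ℝ) : ℝ :=
  -∑ j, e j * ((n j : ℝ) ^ 4 * (wkbInv (n j) s / wkbInv (n 0) s) ^ 3)

lemma kgH'_eq_ratio (hs : ∀ j, (n j : ℝ) < s) :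
    kgH' e n s = kgRatio e n s * wkbInv (n 0) s ^ 3 := by
  have := wkbInv_pos (hs 0)
  rw [kgH', kgRatio, neg_mul, sum_mul]
  field_simp

lemma continuousOn_kgRatio {a b : ℝ} (ha : ∀ j, (n j : ℝ) < a) :
    ContinuousOn (kgRatio e n) (Icc a b) := by
  have h1 : ∀ j, ContinuousOn (wkbInv (n j)) (Icc a b) := fun j x hx =>
    (hasDerivAt_wkbInv ((ha j).trans_le hx.1)).continuousAt.continuousWithinAt
  refine ContinuousOn.neg (continuousOn_finsetSum _ fun j _ => ?_)
  refine continuousOn_const.mul (continuousOn_const.mul (((h1 j).div (h1 0) fun x hx => ?_).pow 3))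
  exact (wkbInv_pos ((ha 0).trans_le hx.1)).ne'

lemma monotone_or_antitone_kgRatio {a b : ℝ} (hn : Antitone n) (ha : ∀ j, (n j : ℝ) < a)
    (he : ∀ j, e j = 1 ∨ e j = -1) (hex : e 1 = -e 0 ∧ e 2 = -e 0) :
    MonotoneOn (kgRatio e n) (Icc a b) ∨ AntitoneOn (kgRatio e n) (Icc a b) := by
  have key : ∀ j, MonotoneOn (fun s => (n j : ℝ) ^ 4 * (wkbInv (n j) s / wkbInv (n 0) s) ^ 3)
      (Icc a b) := by
    intro j x hx y hy hxy
    have := wkbInv_ratio_monotone (hn (Fin.zero_le j)) ((ha 0).trans_le hx.1) hxy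
    have h1 := wkbInv_pos ((ha 0).trans_le hx.1)
    have h2 := wkbInv_pos ((ha j).trans_le hx.1)
    simp only
    gcongr
  have z : ∀ x ∈ Icc a b, wkbInv (n 0) x / wkbInv (n 0) x = 1 := fun x hx =>
    div_self (wkbInv_pos ((ha 0).trans_le hx.1)).ne'
  rcases he 0 with h0 | h0
  · left
    intro x hx y hy hxy
    have k1 := key 1 hx hy hxy
    have k2 := key 2 hx hy hxy
    simp only [kgRatio, Fin.sum_univ_three, hex.1, hex.2, h0, z x hx, z y hy] at *
    linarith
  · right
    intro x hx y hy hxy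
    have k1 := key 1 hx hy hxy
    have k2 := key 2 hx hy hxy
    simp only [kgRatio, Fin.sum_univ_three, hex.1, hex.2, h0, z x hx, z y hy] at *
    linarith

end Phase

lemma wkbInv_bounds {m : ℕ} {s δ : ℝ} (hδ : 0 < δ) (h1 : δ ^ 2 ≤ s - m) (h2 : s - m ≤ 2 * δ ^ 2) :
    (wkbInv m s * δ) ^ 2 * s ≤ 1 ∧ 1 ≤ 4 * ((wkbInv m s * δ) ^ 2 * s) := by
  have hδ2 : 0 < δ ^ 2 := by positivity
  have hm : (0 : ℝ) ≤ m := m.cast_nonneg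
  have h := wkbInv_sq_mul (n := m) (s := s) (by linarith)
  have hv : 0 < wkbInv m s := wkbInv_pos (by linarith)
  have hs : 0 < s := by linarith
  have e1 : δ ^ 2 * s ≤ s ^ 2 - (m : ℝ) ^ 2 := by nlinarith
  have e2 : s ^ 2 - (m : ℝ) ^ 2 ≤ 4 * (δ ^ 2 * s) := by nlinarith
  have hv2 : 0 < wkbInv m s ^ 2 := by positivity
  constructor <;> nlinarith

/-- Dyadic pieces `[n₀ + ϖ⁴, n₀ + 2ϖ⁴]` of the oscillatory region at time `τ¹²`. -/
structure KgPiece (n : Fin 3 → ℕ) (τ ϖ σ a b : ℝ) : Prop where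
  anti : Antitone n
  one_le : 1 ≤ τ
  pos : 0 < ϖ
  pos' : 0 < σ
  left : a = n 0 + ϖ ^ 4
  sigma : σ ^ 2 = a - n 2
  le : a ≤ b
  right : b ≤ n 0 + 2 * ϖ ^ 4
  low : 168 / 1000 * τ ^ 12 ≤ a
  high : b ≤ 9 / 4 * τ ^ 12
  width : 6 / 100 * τ ^ 4 ≤ ϖ ^ 4

namespace KgPiece

variable {n : Fin 3 → ℕ} {τ ϖ σ a b s : ℝ}

lemma lt_left (h : KgPiece n τ ϖ σ a b) (j : Fin 3) : (n j : ℝ) < a := by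
  have h1 : (n j : ℝ) ≤ n 0 := by exact_mod_cast h.anti (Fin.zero_le j)
  have := h.pos
  have : 0 < ϖ ^ 4 := by positivity
  linarith [h.left]

lemma width_le (h : KgPiece n τ ϖ σ a b) : ϖ ^ 4 ≤ σ ^ 2 := by
  have h1 : (n 2 : ℝ) ≤ n 0 := by exact_mod_cast h.anti (Fin.zero_le 2)
  linarith [h.left, h.sigma]

lemma sigma_ge (h : KgPiece n τ ϖ σ a b) : 24 / 100 * τ ^ 2 ≤ σ := by
  have h1 := h.width_le.trans' h.width
  have := h.one_le
  refine le_of_sq_le_sq ?_ h.pos'.le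
  nlinarith [pow_pos (by linarith : 0 < τ) 4]

lemma bounds₂ (h : KgPiece n τ ϖ σ a b) (hs : s ∈ Icc a b) :
    (wkbInv (n 2) s * σ) ^ 2 * s ≤ 1 ∧ 1 ≤ 4 * ((wkbInv (n 2) s * σ) ^ 2 * s) := by
  have := h.width_le
  refine wkbInv_bounds h.pos' ?_ ?_ <;> linarith [hs.1, hs.2, h.left, h.right, h.sigma]

lemma bounds₀ (h : KgPiece n τ ϖ σ a b) (hs : s ∈ Icc a b) :
    (wkbInv (n 0) s * ϖ ^ 2) ^ 2 * s ≤ 1 ∧ 1 ≤ 4 * ((wkbInv (n 0) s * ϖ ^ 2) ^ 2 * s) := by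
  have := h.pos
  have e : (ϖ ^ 2) ^ 2 = ϖ ^ 4 := by ring
  refine wkbInv_bounds (by positivity) ?_ ?_ <;> rw [e] <;>
    linarith [hs.1, hs.2, h.left, h.right]

lemma lower_of_bound {v s τ : ℝ} (hv : 0 ≤ v) (hs : 168 / 1000 * τ ^ 12 ≤ s) (h0 : 0 < s)
    (h : 1 ≤ 4 * (v ^ 2 * s)) : 2 / 10 * τ ^ 6 ≤ s * v := by
  refine le_of_sq_le_sq ?_ (by positivity)
  nlinarith

lemma le_mul₂ (h : KgPiece n τ ϖ σ a b) (hs : s ∈ Icc a b) :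
    2 / 10 * τ ^ 6 ≤ s * wkbInv (n 2) s * σ := by
  have := (wkbInv_pos ((h.lt_left 2).trans_le hs.1)).le
  have := h.pos'
  have := (cast_nonneg (n 0)).trans_lt ((h.lt_left 0).trans_le hs.1)
  rw [mul_assoc]
  exact lower_of_bound (by positivity) (h.low.trans hs.1) this (h.bounds₂ hs).2

lemma le_mul₀ (h : KgPiece n τ ϖ σ a b) (hs : s ∈ Icc a b) :
    2 / 10 * τ ^ 6 ≤ s * wkbInv (n 0) s * ϖ ^ 2 := by
  have := (wkbInv_pos ((h.lt_left 0).trans_le hs.1)).le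
  have := h.pos
  have := (cast_nonneg (n 0)).trans_lt ((h.lt_left 0).trans_le hs.1)
  rw [mul_assoc]
  exact lower_of_bound (by positivity) (h.low.trans hs.1) this (h.bounds₀ hs).2

lemma time_bounds (h : KgPiece n τ ϖ σ a b) (hs : s ∈ Icc a b) :
    19 / 100 * s ^ 2 ≤ (τ ^ 12) ^ 2 ∧ (τ ^ 12) ^ 2 ≤ 36 * s ^ 2 := by
  have h1 := h.low.trans hs.1
  have h2 := hs.2.trans h.high
  have := h.one_le
  have h3 : 0 < τ ^ 12 := by positivity
  generalize τ ^ 12 = t at *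
  constructor <;> nlinarith

lemma ratio_lt (h : KgPiece n τ ϖ σ a b) {x : ℝ} (hx : x ∈ Icc a b) (hs : s ∈ Icc a b)
    (hlt : x * wkbInv (n 2) x < 150) : s * wkbInv (n 2) s ≤ 300 := by
  have hw := h.width_le
  have hx2 := (h.lt_left 2).trans_le hx.1
  have hs2 := (h.lt_left 2).trans_le hs.1
  have n2 : (0 : ℝ) ≤ n 2 := cast_nonneg _
  have n0 : (0 : ℝ) ≤ n 0 := cast_nonneg _
  have e1 := wkbInv_sq_mul hx2
  have e2 := wkbInv_sq_mul hs2
  have p1 := wkbInv_pos hx2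
  have p2 := wkbInv_pos hs2
  have l1 : x - n 2 ≤ 2 * (s - n 2) := by
    linarith [hs.1, hs.2, hx.1, hx.2, h.left, h.right, h.sigma]
  have l2 : x ^ 2 - (n 2 : ℝ) ^ 2 ≤ 4 * (s ^ 2 - (n 2 : ℝ) ^ 2) := by nlinarith
  have l3 : wkbInv (n 2) s ^ 2 ≤ 4 * wkbInv (n 2) x ^ 2 := by
    have : wkbInv (n 2) s ^ 2 * (wkbInv (n 2) x ^ 2 * (x ^ 2 - (n 2 : ℝ) ^ 2)) ≤
      4 * wkbInv (n 2) x ^ 2 * (wkbInv (n 2) s ^ 2 * (s ^ 2 - (n 2 : ℝ) ^ 2)) := by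
      have : 0 < wkbInv (n 2) s ^ 2 * wkbInv (n 2) x ^ 2 := by positivity
      nlinarith
    rwa [e1, e2, mul_one, mul_one] at this
  refine le_of_sq_le_sq ?_ (by norm_num)
  have hxv : (x * wkbInv (n 2) x) ^ 2 ≤ 150 ^ 2 := by
    have := n2.trans_lt hx2
    gcongr
  have q : (n 2 : ℝ) ^ 2 * wkbInv (n 2) s ^ 2 ≤ (n 2 : ℝ) ^ 2 * (4 * wkbInv (n 2) x ^ 2) := by
    gcongr
  nlinarith

lemma two_alternative (h : KgPiece n τ ϖ σ a b) {e : Fin 3 → ℝ} (he : ∀ j, e j = 1 ∨ e j = -1)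
    (hex : e 0 = 1 → e 1 = -1 → e 2 = -1 → ∀ s ∈ Icc a b, 150 ≤ s * wkbInv (n 2) s) :
    OscBound (kgPhase (τ ^ 12) e n) a b (400000 * (τ ^ 2 * σ)) := by
  have hp := cubicPhase_kgPhase (t := τ ^ 12) (e := e) h.lt_left h.high
  have hτ := h.one_le
  have hσ := h.pos'
  have hσ' := h.sigma_ge
  set h₀ := τ ^ 32 / (10000000 * σ ^ 2) with hh₀
  set r₀ := τ ^ 30 / (10000000 * σ ^ 3) with hr₀
  have h₀pos : 0 < h₀ := by positivity
  have r₀pos : 0 < r₀ := by positivity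
  have alt : ∀ x ∈ Icc a b, |kgH (τ ^ 12) e n x| ≤ h₀ → r₀ ≤ |kgH' e n x| := by
    intro x hx hH
    have hx0 : ∀ j, (n j : ℝ) < x := fun j => (h.lt_left j).trans_le hx.1
    have hx1 := h.low.trans hx.1
    have ht := h.time_bounds hx
    have hl := h.le_mul₂ hx
    have hv := wkbInv_pos (hx0 2)
    have hl' : 2 / 10 * τ ^ 6 / σ ≤ x * wkbInv (n 2) x := (div_le_iff₀ hσ).mpr hl
    have hb : (0:ℝ) ≤ 2 / 10 * τ ^ 6 / σ := by positivity
    have hxpos : 0 ≤ x := (cast_nonneg (n 0)).trans (hx0 0).le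
    refine le_trans ?_ (abs_kgH'_ge h.anti hx0 he ht.1 ht.2 (fun a b c => hex a b c x hx)
      (hH.trans_lt ?_))
    · calc r₀ ≤ 168 / 1000 * τ ^ 12 * (2 / 10 * τ ^ 6 / σ) ^ 3 / 10000 := by
            rw [hr₀, div_le_iff₀ (by positivity)]
            field_simp
            norm_num
        _ ≤ _ := by gcongr
    · calc h₀ < (168 / 1000 * τ ^ 12) ^ 2 * (2 / 10 * τ ^ 6 / σ) / 10000 := by
            rw [hh₀, div_lt_iff₀ (by positivity)]
            field_simp
            nlinarith
        _ ≤ _ := by gcongr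
  have hS : 16 / √(h₀ / (9 / 4 * τ ^ 12) ^ 3) ≤ 180000 * (τ ^ 2 * σ) := by
    have : 16 / (180000 * (τ ^ 2 * σ)) ≤ √(h₀ / (9 / 4 * τ ^ 12) ^ 3) := by
      refine le_sqrt_of_sq_le ?_
      rw [hh₀, le_div_iff₀ (by positivity)]
      field_simp
      norm_num
    rw [div_le_iff₀ (by positivity)] at this ⊢
    linarith
  have hR : 2 * h₀ / r₀ = 2 * (τ ^ 2 * σ) := by
    rw [hh₀, hr₀]; field_simp
  have hts : 0 < τ ^ 2 * σ := by positivity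
  by_cases hne : e 1 = -e 0 ∧ e 2 = -e 0
  · refine (hp.oscBound_two_of_sign_change h.le h₀pos r₀pos
      (monotone_or_antitone_kgRatio h.anti h.lt_left he hne) (continuousOn_kgRatio h.lt_left)
      (W := fun s => wkbInv (n 0) s ^ 3)
      (fun x hx => pow_pos (wkbInv_pos ((h.lt_left 0).trans_le hx.1)) 3)
      (fun x hx => kgH'_eq_ratio fun j => (h.lt_left j).trans_le hx.1) alt).mono le_rfl le_rfl ?_
    linarith
  · refine (hp.oscBound_two h.le h₀pos r₀pos ?_ alt).mono le_rfl le_rfl (by linarith)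
    have hs := fun x (hx : x ∈ Icc a b) =>
      kgH'_sign h.anti (fun j => (h.lt_left j).trans_le hx.1) he hne
    rcases he 0 with h0 | h0 <;> rw [h0] at hs
    · right; intro x hx; linarith [hs x hx]
    · left; intro x hx; linarith [hs x hx]

lemma three_alternative (h : KgPiece n τ ϖ σ a b) {e : Fin 3 → ℝ} (h0 : e 0 = 1) (h1 : e 1 = -1)
    (h2 : e 2 = -1) (hϖ : τ ^ 2 ≤ ϖ) :
    OscBound (kgPhase (τ ^ 12) e n) a b (300000 * (τ ^ 6 * ϖ)) := by
  have hp := cubicPhase_kgPhase (t := τ ^ 12) (e := e) h.lt_left h.high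
  have hτ := h.one_le
  have hϖ0 := h.pos
  have he : ∀ j, e j = 1 ∨ e j = -1 := by
    intro j; fin_cases j
    · exact Or.inl h0
    · exact Or.inr h1
    · exact Or.inr h2
  set h₀ := τ ^ 24 / (1000000 * ϖ ^ 2) with hh₀
  set r₀ := 3 * τ ^ 18 / (100000000 * ϖ ^ 3) with hr₀
  set r₁ := 16 * τ ^ 18 / (1000000 * ϖ ^ 3) with hr₁
  set k₀ := 6 * τ ^ 12 / (100000 * ϖ ^ 4) with hk₀
  set κ := τ ^ 36 * ϖ ^ 3 / 1000000 with hκ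
  have h₀pos : 0 < h₀ := by positivity
  have r₀pos : 0 < r₀ := by positivity
  have r₁pos : 0 < r₁ := by positivity
  have k₀pos : 0 < k₀ := by positivity
  have κpos : 0 < κ := by positivity
  have τ2 : 1 ≤ τ ^ 2 := one_le_pow₀ hτ
  have hv : ∀ x ∈ Icc a b, 1 / (3 * ϖ ^ 2 * τ ^ 6) ≤ wkbInv (n 0) x ∧
      wkbInv (n 0) x ≤ 5 / (2 * ϖ ^ 2 * τ ^ 6) := by
    intro x hx
    have hb := h.bounds₀ hx
    have hx1 := h.low.trans hx.1
    have hx2 := hx.2.trans h.high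
    have hv := wkbInv_pos ((h.lt_left 0).trans_le hx.1)
    generalize wkbInv (n 0) x = v at *
    rw [div_le_iff₀ (by positivity), le_div_iff₀ (by positivity)]
    have e12 : (τ ^ 6) ^ 2 = τ ^ 12 := by ring
    have q : 0 < (v * ϖ ^ 2) ^ 2 := by positivity
    constructor
    · refine le_of_sq_le_sq ?_ (by positivity)
      have : (v * (3 * ϖ ^ 2 * τ ^ 6)) ^ 2 = 9 * (v * ϖ ^ 2) ^ 2 * τ ^ 12 := by ring
      rw [this]
      nlinarith
    · refine le_of_sq_le_sq ?_ (by positivity)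
      have : (v * (2 * ϖ ^ 2 * τ ^ 6)) ^ 2 = 4 * (v * ϖ ^ 2) ^ 2 * τ ^ 12 := by ring
      rw [this]
      nlinarith
  have hS : 16 / √(h₀ / (9 / 4 * τ ^ 12) ^ 3) ≤ 60000 * (τ ^ 6 * ϖ) := by
    have : 16 / (60000 * (τ ^ 6 * ϖ)) ≤ √(h₀ / (9 / 4 * τ ^ 12) ^ 3) := by
      refine le_sqrt_of_sq_le ?_
      rw [hh₀, le_div_iff₀ (by positivity)]
      field_simp
      norm_num
    rw [div_le_iff₀ (by positivity)] at this ⊢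
    linarith
  have hR : 2 * h₀ / r₀ ≤ 70 * (τ ^ 6 * ϖ) := by
    rw [hh₀, hr₀, div_le_iff₀ (by positivity)]; field_simp; norm_num
  have hR' : 2 * r₁ / k₀ ≤ τ ^ 6 * ϖ := by
    rw [hr₁, hk₀, div_le_iff₀ (by positivity)]; field_simp; norm_num
  have hts : 0 < τ ^ 6 * ϖ := by positivity
  refine (hp.oscBound_three h.le h₀pos r₀pos κpos r₁pos k₀pos
      (monotone_or_antitone_kgRatio h.anti h.lt_left he (by norm_num [h0, h1, h2]))
      (continuousOn_kgRatio h.lt_left)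
      (W := fun s => wkbInv (n 0) s ^ 3)
      (fun x hx => pow_pos (wkbInv_pos ((h.lt_left 0).trans_le hx.1)) 3)
      (fun x hx => kgH'_eq_ratio fun j => (h.lt_left j).trans_le hx.1)
      (fun x hx => hasDerivAt_kgH' fun j => (h.lt_left j).trans_le hx.1) ?_ ?_ ?_).mono
      le_rfl le_rfl ?_
  · intro x hx
    have := (hv x hx).1
    calc r₀ ≤ κ * (1 / (3 * ϖ ^ 2 * τ ^ 6)) ^ 3 := by
          rw [hr₀, hκ, div_le_iff₀ (by positivity)]; field_simp; norm_num
      _ ≤ _ := by gcongr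
  · intro x hx
    have := (hv x hx).2
    have v0 := wkbInv_pos ((h.lt_left 0).trans_le hx.1)
    calc κ * wkbInv (n 0) x ^ 3 ≤ κ * (5 / (2 * ϖ ^ 2 * τ ^ 6)) ^ 3 := by gcongr
      _ ≤ r₁ := by
          rw [hr₁, hκ, le_div_iff₀ (by positivity)]; field_simp; norm_num
  · intro x hx hH hH'
    have hx1 := h.low.trans hx.1
    have hl := h.le_mul₀ hx
    have hl' : 2 / 10 * τ ^ 6 / ϖ ^ 2 ≤ x * wkbInv (n 0) x := (div_le_iff₀ (by positivity)).mpr hl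
    have ϖ1 : 1 ≤ ϖ := τ2.trans hϖ
    refine le_trans ?_ (abs_kgH''_ge h.anti (fun j => (h.lt_left j).trans_le hx.1)
      (h.time_bounds hx).1 h0 h1 h2 (hH.trans_lt ?_) (hH'.trans_lt ?_))
    · calc k₀ = 3 * (2 / 10 * τ ^ 6 / ϖ ^ 2) ^ 2 / 2000 := by
            rw [hk₀]; field_simp; norm_num
        _ ≤ _ := by gcongr
    · calc h₀ < (168 / 1000 * τ ^ 12) ^ 2 / 10000 := by
            rw [hh₀, div_lt_iff₀ (by positivity)]
            have : 1 ≤ ϖ ^ 2 := one_le_pow₀ ϖ1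
            have : 0 < τ ^ 24 := by positivity
            nlinarith
        _ ≤ _ := by gcongr
    · calc r₁ < (168 / 1000 * τ ^ 12) / 10000 := by
            rw [hr₁, div_lt_iff₀ (by positivity)]
            have : (τ ^ 2) ^ 3 ≤ ϖ ^ 3 := by gcongr
            have : τ ^ 12 * τ ^ 6 ≤ τ ^ 12 * ϖ ^ 3 := by gcongr; linarith
            have : 0 < τ ^ 18 := by positivity
            nlinarith
        _ ≤ _ := by gcongr
  · linarith

lemma oscBound (h : KgPiece n τ ϖ σ a b) {e : Fin 3 → ℝ} (he : ∀ j, e j = 1 ∨ e j = -1) :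
    OscBound (kgPhase (τ ^ 12) e n) a b (400000 * (τ ^ 2 * σ)) ∨
      ((∀ s ∈ Icc a b, s * wkbInv (n 2) s ≤ 300) ∧
        (τ ^ 2 ≤ ϖ → OscBound (kgPhase (τ ^ 12) e n) a b (300000 * (τ ^ 6 * ϖ)))) := by
  by_cases hex : e 0 = 1 → e 1 = -1 → e 2 = -1 → ∀ s ∈ Icc a b, 150 ≤ s * wkbInv (n 2) s
  · exact Or.inl (h.two_alternative he hex)
  · push Not at hex
    obtain ⟨h0, h1, h2, x, hx, hlt⟩ := hex
    exact Or.inr ⟨fun s hs => h.ratio_lt hx hs hlt, h.three_alternative h0 h1 h2⟩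

end KgPiece

lemma besselWidth_mono {m n : ℕ} (h : m ≤ n) : besselWidth m ≤ besselWidth n := by
  unfold besselWidth
  gcongr

/-- The two WKB amplitudes. -/
def wkbSigned (p : Bool) (n : ℕ) (s : ℝ) : ℂ :=
  ((1 / wkbRoot n s : ℝ) : ℂ) * (if p then wkbCoeff n s else conj (wkbCoeff n s))

/-- The sign attached to a branch of the WKB form. -/
def boolSign (p : Bool) : ℝ := if p then 1 else -1

lemma boolSign_eq (p : Bool) : boolSign p = 1 ∨ boolSign p = -1 := by
  cases p <;> simp [boolSign]

lemma besselJ_eq_sum {n : ℕ} {s : ℝ} (h : (n : ℝ) < s) :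
    (besselJ n s : ℂ) = ∑ p : Bool,
      cis(boolSign p * wkbPhase n s) * wkbSigned p n s := by
  rw [besselJ_eq_wkb h]
  simp [boolSign, wkbSigned]
  ring

lemma exists_bvAmp_wkbSigned (p : Bool) {n : ℕ} {a b : ℝ} (ha : n + besselWidth n ≤ a)
    (hab : a ≤ b) : ∃ G', BVAmp (wkbSigned p n) G' a b (1600 / wkbRoot n a) := by
  have h1 := bvAmp_wkbRoot (lt_of_wkb ha) hab
  have h2 := bvAmp_wkbCoeff ha hab
  have e : (1600 : ℝ) / wkbRoot n a = 2 * (1 / wkbRoot n a) * 800 := by ring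
  rw [e]
  cases p
  · exact ⟨_, h1.mul hab (bvAmp_conj h2)⟩
  · exact ⟨_, h1.mul hab h2⟩

lemma exists_bvAmp_inv_sqrt {a b : ℝ} (ha : 0 < a) (hab : a ≤ b) :
    ∃ G', BVAmp (fun s => ((1 / √s : ℝ) : ℂ)) G' a b (1 / √a) := by
  refine ⟨_, BVAmp.of_antitone (G := fun s => 1 / √s) (G' := fun s => -(1 / (2 * √s)) / √s ^ 2) hab
    (fun x hx => ?_) ?_ ?_ fun x hx => by positivity⟩
  · have hx0 : 0 < x := ha.trans_le hx.1
    refine ((hasDerivAt_const x (1:ℝ)).div (hasDerivAt_sqrt hx0.ne')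
      (by positivity)).congr_deriv ?_
    ring
  · refine ContinuousOn.div ?_ (by fun_prop) fun x hx => ?_
    · refine (continuousOn_const.div (by fun_prop) fun x hx => ?_).neg
      have hx0 : 0 < x := ha.trans_le hx.1
      positivity
    · have hx0 : 0 < x := ha.trans_le hx.1
      positivity
  · intro x hx
    exact div_nonpos_of_nonpos_of_nonneg (neg_nonpos.mpr (by positivity)) (by positivity)

/-- Amplitude of one of the eight oscillating terms. -/
def kgAmp (p : Fin 3 → Bool) (n : Fin 3 → ℕ) (s : ℝ) : ℂ :=
  ((1 / √s : ℝ) : ℂ) * (wkbSigned (p 0) (n 0) s * (wkbSigned (p 1) (n 1) s *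
    wkbSigned (p 2) (n 2) s))

lemma exists_bvAmp_kgAmp (p : Fin 3 → Bool) {n : Fin 3 → ℕ} (hn : Antitone n) {a b : ℝ}
    (ha : n 0 + besselWidth (n 0) ≤ a) (hab : a ≤ b) :
    ∃ G', BVAmp (kgAmp p n) G' a b (2 * (1 / √a) * (2 * (1600 / wkbRoot (n 0) a) *
      (2 * (1600 / wkbRoot (n 1) a) * (1600 / wkbRoot (n 2) a)))) := by
  have ha' : ∀ j, n j + besselWidth (n j) ≤ a := fun j => by
    have h1 : (n j : ℝ) ≤ n 0 := by exact_mod_cast hn (Fin.zero_le j)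
    have h2 := besselWidth_mono (hn (Fin.zero_le j))
    linarith
  have hpos : 0 < a := (cast_nonneg (n 0)).trans_lt (lt_of_wkb ha)
  obtain ⟨_, h⟩ := exists_bvAmp_inv_sqrt hpos hab
  obtain ⟨_, h0⟩ := exists_bvAmp_wkbSigned (p 0) (ha' 0) hab
  obtain ⟨_, h1⟩ := exists_bvAmp_wkbSigned (p 1) (ha' 1) hab
  obtain ⟨_, h2⟩ := exists_bvAmp_wkbSigned (p 2) (ha' 2) hab
  exact ⟨_, h.mul hab (h0.mul hab (h1.mul hab h2))⟩

/-- The oscillatory integrand of the subordination formula. -/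
def kgIntegrand (t : ℝ) (n : Fin 3 → ℕ) (s : ℝ) : ℂ :=
  cis(t ^ 2 / (2 * s)) *
    (cis(7 * s / 2) * ((∏ j, besselJ (n j) s : ℝ) : ℂ) *
      ((1 / √s : ℝ) : ℂ))

lemma kgIntegrand_eq_sum {t s : ℝ} {n : Fin 3 → ℕ} (hs : ∀ j, (n j : ℝ) < s) :
    kgIntegrand t n s = ∑ p : Fin 3 → Bool,
      cis(kgPhase t (fun j => boolSign (p j)) n s) * kgAmp p n s := by
  rw [kgIntegrand, Complex.ofReal_prod]
  simp_rw [besselJ_eq_sum (hs _)]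
  rw [Finset.prod_univ_sum, Fintype.piFinset_univ, mul_sum, sum_mul, mul_sum]
  refine sum_congr rfl fun p _ => ?_
  simp only [kgPhase, kgAmp, Fin.prod_univ_three, Fin.sum_univ_three, ofReal_add, mul_add,
    Complex.exp_add]
  ring

lemma norm_integral_kgIntegrand_le {t : ℝ} {n : Fin 3 → ℕ} (hn : Antitone n) {a b X : ℝ}
    (ha : n 0 + besselWidth (n 0) ≤ a) (hab : a ≤ b)
    (h : ∀ p : Fin 3 → Bool, ∃ M, OscBound (kgPhase t (fun j => boolSign (p j)) n) a b M ∧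
      M * (1 / √a * (1 / wkbRoot (n 0) a * (1 / wkbRoot (n 1) a * (1 / wkbRoot (n 2) a)))) ≤ X) :
    ‖∫ s in a..b, kgIntegrand t n s‖ ≤ 128 * 1600 ^ 3 * X := by
  have hlt : ∀ x ∈ Icc a b, ∀ j, (n j : ℝ) < x := fun x hx j => by
    have h1 : (n j : ℝ) ≤ n 0 := by exact_mod_cast hn (Fin.zero_le j)
    exact h1.trans_lt ((lt_of_wkb ha).trans_le hx.1)
  have hcp : ∀ p : Fin 3 → Bool,
      ContinuousOn (kgPhase t (fun j => boolSign (p j)) n) (Icc a b) := fun p =>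
    (cubicPhase_kgPhase (fun j => hlt a ⟨le_rfl, hab⟩ j) le_rfl).continuousOn
  have e : ∫ s in a..b, kgIntegrand t n s = ∑ p : Fin 3 → Bool, ∫ s in a..b,
      cis(kgPhase t (fun j => boolSign (p j)) n s) * kgAmp p n s := by
    rw [← intervalIntegral.integral_finsetSum]
    · refine integral_congr fun x hx => ?_
      rw [uIcc_of_le hab] at hx
      exact kgIntegrand_eq_sum (hlt x hx)
    · intro p _
      obtain ⟨_, hG⟩ := exists_bvAmp_kgAmp p hn ha hab
      refine ContinuousOn.intervalIntegrable ?_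
      rw [uIcc_of_le hab]
      exact (continuousOn_exp_phase (hcp p)).mul hG.continuousOn
  rw [e]
  refine (norm_sum_le _ _).trans ?_
  have : ∀ p ∈ (Finset.univ : Finset (Fin 3 → Bool)), ‖∫ s in a..b,
      cis(kgPhase t (fun j => boolSign (p j)) n s) * kgAmp p n s‖ ≤
      16 * 1600 ^ 3 * X := by
    intro p _
    obtain ⟨M, hM, hX⟩ := h p
    obtain ⟨_, hG⟩ := exists_bvAmp_kgAmp p hn ha hab
    refine (hM.amp hab (hcp p) hG).trans ?_
    refine le_of_eq_of_le ?_ (mul_le_mul_of_nonneg_left hX (by norm_num : (0:ℝ) ≤ 16 * 1600 ^ 3))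
    ring
  refine (Finset.sum_le_card_nsmul _ _ _ this).trans_eq ?_
  simp
  ring

/-- Size of the contribution of a piece. -/
def minInv (x : ℝ) : ℝ := min x (1 / x)

lemma minInv_nonneg {x : ℝ} (hx : 0 ≤ x) : 0 ≤ minInv x := le_min hx (by positivity)

/-- A bounded increasing function used for telescoping. -/
def ratioFun (x : ℝ) : ℝ := x / (1 + x)

lemma minInv_le_ratioFun {x y : ℝ} (hx : 0 < x) (hy : 118 / 100 * x ≤ y) :
    minInv x ≤ 25 * (ratioFun y - ratioFun x) := by
  have hy0 : 0 < y := by linarith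
  have h1 : ratioFun (118 / 100 * x) ≤ ratioFun y := by
    unfold ratioFun
    rw [div_le_div_iff₀ (by positivity) (by positivity)]
    nlinarith
  have h2 : ratioFun (118 / 100 * x) - ratioFun x =
      18 / 100 * x / ((1 + 118 / 100 * x) * (1 + x)) := by
    unfold ratioFun
    field_simp
    ring
  have h3 : minInv x ≤ 25 * (18 / 100 * x / ((1 + 118 / 100 * x) * (1 + x))) := by
    rcases le_total x 1 with h | h
    · refine (min_le_left _ _).trans ?_
      rw [← mul_div_assoc, le_div_iff₀ (by positivity)]
      have : (1 + 118 / 100 * x) * (1 + x) ≤ 436 / 100 := by nlinarith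
      nlinarith
    · refine (min_le_right _ _).trans ?_
      rw [← mul_div_assoc, div_le_div_iff₀ (by positivity) (by positivity)]
      nlinarith
  linarith

lemma ratioFun_mem {x : ℝ} (hx : 0 ≤ x) : 0 ≤ ratioFun x ∧ ratioFun x ≤ 1 := by
  unfold ratioFun
  bound

/-- Potential function for the dyadic summation. -/
def kgPotential (τ d ρ : ℝ) : ℝ := ratioFun (√ρ / (√√(ρ + d) * τ)) + ratioFun (√√ρ / τ ^ 2)

lemma sqrt_sqrt_two_mul {x : ℝ} : 118 / 100 * √√x ≤ √√(2 * x) ∧ √√(2 * x) = √√2 * √√x := by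
  have e : √√(2 * x) = √√2 * √√x := by simp
  refine ⟨?_, e⟩
  rw [e]
  gcongr
  refine le_sqrt_of_sq_le (le_sqrt_of_sq_le ?_)
  norm_num

lemma minInv_le_kgPotential {τ d ρ : ℝ} (hτ : 0 < τ) (hd : 0 ≤ d) (hρ : 0 < ρ) :
    minInv (√ρ / (√√(ρ + d) * τ)) + minInv (√√ρ / τ ^ 2) ≤
      25 * (kgPotential τ d (2 * ρ) - kgPotential τ d ρ) := by
  have h1 := minInv_le_ratioFun (x := √ρ / (√√(ρ + d) * τ)) (y := √(2 * ρ) / (√√(2 * ρ + d) * τ))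
    (by positivity) (by
      have a1 : √√(2 * ρ + d) ≤ √√2 * √√(ρ + d) := by
        rw [← sqrt_sqrt_two_mul.2]
        gcongr
        linarith
      have a2 : √(2 * ρ) = √√2 * √√2 * √ρ := by simp
      have a3 : 118 / 100 ≤ √√(2:ℝ) := by
        refine le_sqrt_of_sq_le (le_sqrt_of_sq_le ?_)
        norm_num
      have p1 : 0 < √√(2 * ρ + d) := by positivity
      have p2 : 0 < √ρ := by positivity
      rw [a2, ← mul_div_assoc, div_le_div_iff₀ (by positivity) (by positivity)]
      calc 118 / 100 * √ρ * (√√(2 * ρ + d) * τ)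
          ≤ √√2 * √ρ * (√√2 * √√(ρ + d) * τ) := by gcongr
        _ = _ := by ring)
  have h2 := minInv_le_ratioFun (x := √√ρ / τ ^ 2) (y := √√(2 * ρ) / τ ^ 2)
    (by positivity) (by
      have := (sqrt_sqrt_two_mul (x := ρ)).1
      rw [← mul_div_assoc]
      gcongr)
  unfold kgPotential
  linarith

lemma kgPotential_mem {τ d ρ : ℝ} (hτ : 0 < τ) : 0 ≤ kgPotential τ d ρ ∧ kgPotential τ d ρ ≤ 2 := by
  have h1 := ratioFun_mem (x := √ρ / (√√(ρ + d) * τ)) (by positivity)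
  have h2 := ratioFun_mem (x := √√ρ / τ ^ 2) (by positivity)
  unfold kgPotential
  bound

/-- Dyadic summation with a bounded potential. -/
lemma norm_integral_le_of_dyadic {f : ℝ → ℂ} {n β K ρ₀ b : ℝ} {Ψ : ℝ → ℝ} (hK : 0 ≤ K)
    (hρ₀ : 0 < ρ₀) (hb : n + ρ₀ ≤ b) (hbβ : b ≤ β)
    (hΨ : ∀ ρ, 0 ≤ Ψ ρ ∧ Ψ ρ ≤ 2)
    (hf : ∀ x y, n + ρ₀ ≤ x → x ≤ y → IntervalIntegrable f volume x y)
    (h : ∀ ρ b, ρ₀ ≤ ρ → n + ρ ≤ b → b ≤ n + 2 * ρ → b ≤ β →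
      ‖∫ s in (n + ρ)..b, f s‖ ≤ K * (Ψ (2 * ρ) - Ψ ρ)) :
    ‖∫ s in (n + ρ₀)..b, f s‖ ≤ K * 2 := by
  have key : ∀ k : ℕ, ∀ ρ, ρ₀ ≤ ρ → n + ρ ≤ b → b ≤ n + 2 ^ k * ρ →
      ‖∫ s in (n + ρ)..b, f s‖ ≤ K * (2 - Ψ ρ) := by
    intro k
    induction k with
    | zero =>
      intro ρ _ h1 h2
      have : b = n + ρ := by linarith
      rw [this, integral_same, norm_zero]
      exact mul_nonneg hK (by linarith [(hΨ ρ).2])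
    | succ k ih =>
      intro ρ hρ h1 h2
      have hρ0 : 0 < ρ := hρ₀.trans_le hρ
      rcases le_total b (n + 2 * ρ) with h3 | h3
      · refine (h ρ b hρ h1 h3 hbβ).trans ?_
        gcongr
        exact (hΨ _).2
      · have i1 := ih (2 * ρ) (by linarith) h3 (by rw [pow_succ] at h2; linarith)
        have i2 := h ρ (n + 2 * ρ) hρ (by linarith) le_rfl (h3.trans hbβ)
        rw [← integral_add_adjacent_intervals
          (hf (n + ρ) (n + 2 * ρ) (by linarith) (by linarith))
          (hf (n + 2 * ρ) b (by linarith) h3)]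
        refine (norm_add_le _ _).trans ?_
        linarith
  obtain ⟨k, hk⟩ := pow_unbounded_of_one_lt ((b - n) / ρ₀) (one_lt_two)
  rw [div_lt_iff₀ hρ₀] at hk
  refine (key k ρ₀ le_rfl hb (by linarith)).trans ?_
  gcongr
  linarith [(hΨ ρ₀).1]

lemma inv_wkbRoot_sq {n : ℕ} {s : ℝ} : (1 / wkbRoot n s) ^ 2 = wkbInv n s := by
  rw [div_pow, one_pow, wkbRoot, wkbInv, sq_sqrt (sqrt_nonneg _)]

lemma mul_minInv_of_le {M A K τ ϖ ς : ℝ} (hτ : 0 < τ) (hϖ : 0 < ϖ) (hς : 0 < ς)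
    (hK : 1 ≤ K) (h1 : M ≤ ϖ ^ 4) (h2 : M ≤ K * (τ ^ 2 * ς ^ 2)) (hA : 0 ≤ A)
    (hA' : A ≤ 10 / (τ ^ 15 * ϖ ^ 2 * ς)) :
    M * A ≤ 10 * K / τ ^ 14 * minInv (ϖ ^ 2 / (ς * τ)) := by
  rw [minInv, mul_min_of_nonneg _ _ (by positivity)]
  refine le_min ?_ ?_
  · calc M * A ≤ ϖ ^ 4 * (10 / (τ ^ 15 * ϖ ^ 2 * ς)) := by gcongr
      _ = 10 * 1 / τ ^ 14 * (ϖ ^ 2 / (ς * τ)) := by field_simp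
      _ ≤ _ := by gcongr
  · calc M * A ≤ K * (τ ^ 2 * ς ^ 2) * (10 / (τ ^ 15 * ϖ ^ 2 * ς)) := by gcongr
      _ = _ := by field_simp

lemma mul_minInv_of_le' {M A K τ ϖ : ℝ} (hτ : 0 < τ) (hϖ : 0 < ϖ)
    (hK : 1 ≤ K) (h1 : M ≤ ϖ ^ 4) (h2 : τ ^ 2 ≤ ϖ → M ≤ K * (τ ^ 6 * ϖ)) (hA : 0 ≤ A)
    (hA' : A ≤ 300 / (τ ^ 18 * ϖ ^ 2)) :
    M * A ≤ 300 * K / τ ^ 14 * minInv (ϖ / τ ^ 2) := by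
  rcases le_total (τ ^ 2) ϖ with h | h
  · have e : minInv (ϖ / τ ^ 2) = 1 / (ϖ / τ ^ 2) := by
      refine min_eq_right ?_
      have : 1 ≤ ϖ / τ ^ 2 := (one_le_div (by positivity)).mpr h
      exact ((div_le_one (by positivity)).mpr this).trans this
    rw [e]
    calc M * A ≤ K * (τ ^ 6 * ϖ) * (300 / (τ ^ 18 * ϖ ^ 2)) := by gcongr; exact h2 h
      _ = _ := by field_simp
  · have l1 : ϖ / τ ^ 2 ≤ 1 := (div_le_one (by positivity)).mpr h
    have e : minInv (ϖ / τ ^ 2) = ϖ / τ ^ 2 := by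
      refine min_eq_left (l1.trans ?_)
      bound
    rw [e]
    calc M * A ≤ ϖ ^ 4 * (300 / (τ ^ 18 * ϖ ^ 2)) := by gcongr
      _ = 300 * 1 / τ ^ 14 * (ϖ / τ ^ 2 * (ϖ / τ ^ 2)) := by field_simp
      _ ≤ 300 * K / τ ^ 14 * (ϖ / τ ^ 2 * 1) := by gcongr
      _ = _ := by ring

namespace KgPiece

variable {n : Fin 3 → ℕ} {τ ϖ ς a b : ℝ}

lemma amp_bounds (h : KgPiece n τ ϖ (ς ^ 2) a b) (hς : 0 < ς) :
    1 / √a * (1 / wkbRoot (n 0) a * (1 / wkbRoot (n 1) a * (1 / wkbRoot (n 2) a))) ≤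
      10 / (τ ^ 15 * ϖ ^ 2 * ς) ∧ (a * wkbInv (n 2) a ≤ 300 →
    1 / √a * (1 / wkbRoot (n 0) a * (1 / wkbRoot (n 1) a * (1 / wkbRoot (n 2) a))) ≤
      300 / (τ ^ 18 * ϖ ^ 2)) := by
  have hmem : a ∈ Icc a b := ⟨le_rfl, h.le⟩
  have hτ : 0 < τ := one_pos.trans_le h.one_le
  have hϖ := h.pos
  have ha : 0 < a := (cast_nonneg (n 0)).trans_lt (h.lt_left 0)
  have b0 := (h.bounds₀ hmem).1
  have b2 := (h.bounds₂ hmem).1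
  have v10 : wkbInv (n 1) a ≤ wkbInv (n 0) a := wkbInv_mono (h.anti (Fin.zero_le 1)) (h.lt_left 0)
  have hsa : 4 / 10 * τ ^ 6 ≤ √a := by
    refine le_sqrt_of_sq_le (le_trans ?_ h.low)
    nlinarith [pow_pos hτ 12]
  have hsa0 : 0 < √a := by positivity
  have hq : 1 / √a ≤ 5 / (2 * τ ^ 6) := by
    rw [div_le_div_iff₀ (by positivity) (by positivity)]; linarith
  have r0 := wkbRoot_pos (h.lt_left 0)
  have r1 := wkbRoot_pos (h.lt_left 1)
  have r2 := wkbRoot_pos (h.lt_left 2)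
  have e0 := inv_wkbRoot_sq (n := n 0) (s := a)
  have e1 := inv_wkbRoot_sq (n := n 1) (s := a)
  have e2 := inv_wkbRoot_sq (n := n 2) (s := a)
  have u0 : 0 < 1 / wkbRoot (n 0) a := by positivity
  have u1 : 0 < 1 / wkbRoot (n 1) a := by positivity
  have u2 : 0 < 1 / wkbRoot (n 2) a := by positivity
  have aux : ∀ y : ℝ, 0 ≤ y → y ^ 2 * a ≤ 1 → y ≤ 5 / (2 * τ ^ 6) := fun y hy h => by
    refine le_trans ?_ hq
    rw [le_div_iff₀ hsa0]
    refine le_of_sq_le_sq ?_ zero_le_one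
    rwa [mul_pow, sq_sqrt ha.le, one_pow]
  have c0 := aux _ (mul_nonneg (wkbInv_pos (h.lt_left 0)).le (by positivity)) b0
  have c2 := aux _ (mul_nonneg (wkbInv_pos (h.lt_left 2)).le (by positivity)) b2
  rw [← e0] at c0 v10
  rw [← e1] at v10
  rw [← e2] at c2 ⊢
  generalize 1 / wkbRoot (n 0) a = x₀ at *
  generalize 1 / wkbRoot (n 1) a = x₁ at *
  generalize 1 / wkbRoot (n 2) a = x₂ at *
  have h10 : x₁ ≤ x₀ := le_of_sq_le_sq v10 u0.le
  have c0' : x₀ ^ 2 ≤ 5 / (2 * τ ^ 6 * ϖ ^ 2) := by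
    rw [le_div_iff₀ (by positivity)] at c0 ⊢
    linarith
  have main : ∀ z, x₂ ≤ z → 1 / √a * (x₀ * (x₁ * x₂)) ≤
      5 / (2 * τ ^ 6) * (5 / (2 * τ ^ 6 * ϖ ^ 2) * z) := fun z hz => by
    calc 1 / √a * (x₀ * (x₁ * x₂)) ≤ 5 / (2 * τ ^ 6) * (x₀ * (x₀ * z)) := by gcongr
      _ = 5 / (2 * τ ^ 6) * (x₀ ^ 2 * z) := by ring
      _ ≤ _ := by
        have : 0 ≤ z := u2.le.trans hz
        gcongr
  constructor
  · refine (main (16 / (10 * τ ^ 3 * ς)) ?_).trans_eq (by field_simp; norm_num)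
    refine le_of_sq_le_sq ?_ (by positivity)
    rw [le_div_iff₀ (by positivity)] at c2
    rw [div_pow, le_div_iff₀ (by positivity)]
    nlinarith
  · intro h3
    refine (main (43 / τ ^ 6) ?_).trans ?_
    · refine le_of_sq_le_sq ?_ (by positivity)
      rw [div_pow, le_div_iff₀ (by positivity)]
      have := mul_le_mul_of_nonneg_right h.low (sq_nonneg x₂)
      nlinarith
    · rw [← sub_nonneg]
      have : 300 / (τ ^ 18 * ϖ ^ 2) - 5 / (2 * τ ^ 6) * (5 / (2 * τ ^ 6 * ϖ ^ 2) * (43 / τ ^ 6)) =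
        (300 - 5 * 5 * 43 / 4) / (τ ^ 18 * ϖ ^ 2) := by field_simp; norm_num
      rw [this]
      positivity

lemma norm_integral_le (h : KgPiece n τ ϖ (ς ^ 2) a b) (hς : 0 < ς)
    (ha : n 0 + besselWidth (n 0) ≤ a) :
    ‖∫ s in a..b, kgIntegrand (τ ^ 12) n s‖ ≤ 128 * 1600 ^ 3 *
      (100000000 / τ ^ 14 * (minInv (ϖ ^ 2 / (ς * τ)) + minInv (ϖ / τ ^ 2))) := by
  have hτ : 0 < τ := one_pos.trans_le h.one_le
  have hϖ := h.pos
  have hr := fun j => wkbRoot_pos (h.lt_left j)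
  have hA : 0 ≤ 1 / √a * (1 / wkbRoot (n 0) a * (1 / wkbRoot (n 1) a * (1 / wkbRoot (n 2) a))) := by
    simp_all
  have hlen : ∀ p : Fin 3 → Bool,
      OscBound (kgPhase (τ ^ 12) (fun j => boolSign (p j)) n) a b (ϖ ^ 4) := fun p =>
    oscBound_length _ (by linarith [h.left, h.right])
  have m1 : 0 ≤ minInv (ϖ ^ 2 / (ς * τ)) := minInv_nonneg (by positivity)
  have m2 : 0 ≤ minInv (ϖ / τ ^ 2) := minInv_nonneg (by positivity)
  have hmin : ∀ {Φ : ℝ → ℝ} {M₁ M₂ : ℝ}, OscBound Φ a b M₁ → OscBound Φ a b M₂ →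
      OscBound Φ a b (min M₁ M₂) :=
          fun h1 h2 c d hc hcd hd => le_min (h1 c d hc hcd hd) (h2 c d hc hcd hd)
  refine norm_integral_kgIntegrand_le h.anti ha h.le fun p => ?_
  rcases h.oscBound (fun j => boolSign_eq (p j)) with h1 | ⟨h1, h2⟩
  · refine ⟨_, hmin (hlen p) h1, ?_⟩
    refine (mul_minInv_of_le (K := 400000) hτ hϖ hς (by norm_num) (min_le_left _ _) ?_ hA
      (h.amp_bounds hς).1).trans ?_
    · exact min_le_right _ _
    bound
  · by_cases hc : τ ^ 2 ≤ ϖ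
    · refine ⟨_, hmin (hlen p) (h2 hc), ?_⟩
      refine (mul_minInv_of_le' (K := 300000) hτ hϖ (by norm_num) (min_le_left _ _)
        (fun _ => min_le_right _ _) hA ((h.amp_bounds hς).2 (h1 a ⟨le_rfl, h.le⟩))).trans ?_
      gcongr
      · norm_num
      · linarith
    · refine ⟨_, hlen p, ?_⟩
      refine (mul_minInv_of_le' (K := 300000) hτ hϖ (by norm_num) le_rfl
        (fun h => absurd h hc) hA ((h.amp_bounds hς).2 (h1 a ⟨le_rfl, h.le⟩))).trans ?_
      gcongr
      · norm_num
      · linarith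

end KgPiece

lemma continuousOn_kgIntegrand {t x y : ℝ} {n : Fin 3 → ℕ} (hx : 0 < x) :
    ContinuousOn (kgIntegrand t n) (Icc x y) := by
  have h : ∀ z ∈ Icc x y, 0 < z := fun z hz => hx.trans_le hz.1
  refine ContinuousOn.mul ?_ (ContinuousOn.mul (ContinuousOn.mul ?_ ?_) ?_)
  · refine continuousOn_exp_phase (Φ := fun s => t ^ 2 / (2 * s))
      (continuousOn_const.div (by fun_prop) fun z hz => ?_)
    have := h z hz
    positivity
  · exact continuousOn_exp_phase (Φ := fun s => 7 * s / 2) (by fun_prop)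
  · exact (continuous_ofReal.comp
      (continuous_finsetProd _ fun j _ => continuous_besselJ (n j))).continuousOn
  · refine continuous_ofReal.comp_continuousOn
      (continuousOn_const.div (by fun_prop) fun z hz => ?_)
    have := h z hz
    positivity

lemma norm_kgIntegrand_le {τ s : ℝ} {n : Fin 3 → ℕ} (hτ : 0 < τ) (hs : 1 ≤ s)
    (hτs : 168 / 1000 * τ ^ 12 ≤ s) :
    ‖kgIntegrand (τ ^ 12) n s‖ ≤ 360 / τ ^ 14 * |besselJ (n 0) s| := by
  have hs0 : 0 < s := one_pos.trans_le hs
  have e : ‖kgIntegrand (τ ^ 12) n s‖ =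
      |besselJ (n 0) s| * |besselJ (n 1) s| * |besselJ (n 2) s| * (1 / √s) := by
    rw [kgIntegrand, norm_mul, norm_mul, norm_mul, norm_exp_I_mul_real, norm_exp_I_mul_real,
      norm_real, norm_real, norm_eq_abs, norm_eq_abs,
      abs_of_nonneg (by positivity : 0 ≤ 1 / √s), Finset.abs_prod, Fin.prod_univ_three]
    ring
  have h13 : s ^ (-(1 / 3) : ℝ) ≤ 2 / τ ^ 4 := by
    have h0 : 0 ≤ s ^ (-(1 / 3) : ℝ) := by positivity
    refine le_of_pow_le_pow_left₀ (n := 3) (by norm_num) (by positivity) ?_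
    rw [← rpow_natCast, ← rpow_mul hs0.le, div_pow]
    norm_num
    rw [rpow_neg_one, inv_eq_one_div, div_le_div_iff₀ hs0 (by positivity)]
    nlinarith [pow_pos hτ 12]
  have hb : ∀ m, |besselJ m s| ≤ 12 / τ ^ 4 := fun m => by
    refine (abs_besselJ_le_third m hs).trans ?_
    calc 6 * s ^ (-(1 / 3) : ℝ) ≤ 6 * (2 / τ ^ 4) := by gcongr
      _ = _ := by ring
  have hq : 1 / √s ≤ 5 / (2 * τ ^ 6) := by
    have : 4 / 10 * τ ^ 6 ≤ √s := by
      refine le_sqrt_of_sq_le (le_trans ?_ hτs)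
      nlinarith [pow_pos hτ 12]
    rw [div_le_div_iff₀ (by positivity) (by positivity)]; linarith
  rw [e]
  calc |besselJ (n 0) s| * |besselJ (n 1) s| * |besselJ (n 2) s| * (1 / √s)
      ≤ |besselJ (n 0) s| * (12 / τ ^ 4) * (12 / τ ^ 4) * (5 / (2 * τ ^ 6)) := by
        gcongr
        · exact hb _
        · exact hb _
    _ = _ := by field_simp; ring

lemma norm_integral_pretransition_le {τ a b : ℝ} {n : Fin 3 → ℕ} (hτ : 0 < τ) (ha : 1 ≤ a)
    (hτa : 168 / 1000 * τ ^ 12 ≤ a) (hab : a ≤ b) (hb : b ≤ n 0 + besselWidth (n 0)) :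
    ‖∫ s in a..b, kgIntegrand (τ ^ 12) n s‖ ≤ 14400 / τ ^ 14 := by
  have ii : ∀ u v, IntervalIntegrable (fun s => |besselJ (n 0) s|) volume u v :=
    fun u v => (continuous_besselJ (n 0)).abs.intervalIntegrable u v
  calc ‖∫ s in a..b, kgIntegrand (τ ^ 12) n s‖
      ≤ ∫ s in a..b, 360 / τ ^ 14 * |besselJ (n 0) s| := by
        refine intervalIntegral.norm_integral_le_of_norm_le hab
          (.of_forall fun x hx => ?_) ((ii a b).const_mul _)
        exact norm_kgIntegrand_le hτ (ha.trans hx.1.le) (hτa.trans hx.1.le)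
    _ = 360 / τ ^ 14 * ∫ s in a..b, |besselJ (n 0) s| :=
        intervalIntegral.integral_const_mul _ _
    _ ≤ 360 / τ ^ 14 * ∫ s in a..(n 0 + besselWidth (n 0)), |besselJ (n 0) s| := by
        gcongr
        exact integral_mono_interval le_rfl hab hb
          (.of_forall fun x => abs_nonneg _) (ii _ _)
    _ ≤ 360 / τ ^ 14 * 40 := by
        gcongr
        exact integral_abs_besselJ_le (n 0) (by linarith) (hab.trans hb)
    _ = _ := by ring

lemma width_of_besselWidth {τ ρ : ℝ} {m : ℕ} (hτ : 1 ≤ τ) (hρ : besselWidth m ≤ ρ)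
    (hlow : 168 / 1000 * τ ^ 12 ≤ m + ρ) : 6 / 100 * τ ^ 4 ≤ ρ := by
  have h1 := one_le_besselWidth m
  by_contra! hlt
  have hτ4 : τ ^ 4 ≤ τ ^ 12 := pow_le_pow_right₀ hτ (by norm_num)
  have hm : 1 / 10 * τ ^ 12 ≤ m := by linarith
  rcases Nat.eq_zero_or_pos m with rfl | hm1
  · linarith
  · have h2 := besselWidth_cube m hm1
    have h3 : besselWidth m ^ 3 < (6 / 100 * τ ^ 4) ^ 3 := by
      have : besselWidth m < 6 / 100 * τ ^ 4 := hρ.trans_lt hlt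
      gcongr
    linarith

/-- The constant in the oscillatory region. -/
def kgConst : ℝ := 128 * 1600 ^ 3 * 100000000 * 50

lemma norm_integral_oscillatory_le {τ a b : ℝ} {n : Fin 3 → ℕ} (hn : Antitone n) (hτ : 1 ≤ τ)
    (hτa : 168 / 1000 * τ ^ 12 ≤ a) (hab : a ≤ b) (hb : b ≤ 9 / 4 * τ ^ 12)
    (ha : n 0 + besselWidth (n 0) ≤ a) :
    ‖∫ s in a..b, kgIntegrand (τ ^ 12) n s‖ ≤ kgConst / τ ^ 14 := by
  have hτ0 : 0 < τ := one_pos.trans_le hτ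
  have h1 := one_le_besselWidth (n 0)
  set d : ℝ := n 0 - n 2 with hd
  have hd0 : 0 ≤ d := by
    have : (n 2 : ℝ) ≤ n 0 := by exact_mod_cast hn (Fin.zero_le 2)
    linarith
  have e : a = n 0 + (a - n 0) := by ring
  have := norm_integral_le_of_dyadic (f := kgIntegrand (τ ^ 12) n) (n := n 0) (β := b)
    (K := 128 * 1600 ^ 3 * 100000000 * 25 / τ ^ 14) (ρ₀ := a - n 0) (b := b)
    (Ψ := kgPotential τ d) (by positivity) (by linarith) (by linarith) le_rfl
    (fun ρ => kgPotential_mem hτ0) (fun x y hx hxy => ?_) fun ρ b' hρ h2 h3 h4 => ?_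
  · rw [← e] at this
    refine this.trans_eq ?_
    rw [kgConst]; ring
  · refine ContinuousOn.intervalIntegrable ?_
    rw [uIcc_of_le hxy]
    refine continuousOn_kgIntegrand ?_
    linarith
  · have hρ0 : 0 < ρ := by linarith
    have s1 : (√√(ρ + d)) ^ 2 = √(ρ + d) := sq_sqrt (sqrt_nonneg _)
    have s2 : (√√ρ) ^ 2 = √ρ := sq_sqrt (sqrt_nonneg _)
    have s4 : (√√ρ) ^ 4 = ρ := by
      rw [show (√√ρ) ^ 4 = ((√√ρ) ^ 2) ^ 2 by ring, s2, sq_sqrt hρ0.le]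
    have piece : KgPiece n τ (√√ρ) (√√(ρ + d) ^ 2) (n 0 + ρ) b' := by
      refine ⟨hn, hτ, by positivity, by positivity, by rw [s4], ?_, h2, by rw [s4]; exact h3,
        by linarith, h4.trans hb, ?_⟩
      · rw [s1, sq_sqrt (by positivity), hd]; ring
      · rw [s4]
        exact width_of_besselWidth hτ (m := n 0) (by linarith) (by linarith)
    refine (piece.norm_integral_le (by positivity) (by linarith)).trans ?_
    rw [s2]
    calc _ ≤ 128 * 1600 ^ 3 * (100000000 / τ ^ 14 *
          (25 * (kgPotential τ d (2 * ρ) - kgPotential τ d ρ))) := by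
          gcongr
          exact minInv_le_kgPotential hτ0 hd0 hρ0
      _ = _ := by ring

lemma norm_integral_kgIntegrand_le' {τ a b : ℝ} {n : Fin 3 → ℕ} (hn : Antitone n) (hτ : 1 ≤ τ)
    (ha : 1 ≤ a) (hτa : 168 / 1000 * τ ^ 12 ≤ a) (hab : a ≤ b) (hb : b ≤ 9 / 4 * τ ^ 12) :
    ‖∫ s in a..b, kgIntegrand (τ ^ 12) n s‖ ≤ (14400 + kgConst) / τ ^ 14 := by
  have hτ0 : 0 < τ := one_pos.trans_le hτ
  have hk : 0 ≤ kgConst := by unfold kgConst; norm_num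
  set m := n 0 + besselWidth (n 0) with hm
  rcases le_total m a with h | h
  · refine (norm_integral_oscillatory_le hn hτ hτa hab hb h).trans ?_
    gcongr
    linarith
  rcases le_total b m with h' | h'
  · refine (norm_integral_pretransition_le hτ0 ha hτa hab h').trans ?_
    gcongr
    linarith
  have ii : ∀ x y, a ≤ x → x ≤ y →
      IntervalIntegrable (kgIntegrand (τ ^ 12) n) volume x y := fun x y hx hxy => by
    refine ContinuousOn.intervalIntegrable ?_
    rw [uIcc_of_le hxy]
    exact continuousOn_kgIntegrand (by linarith)
  rw [← integral_add_adjacent_intervals (ii a m le_rfl h) (ii m b h h'), add_div]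
  exact (norm_add_le _ _).trans (add_le_add (norm_integral_pretransition_le hτ0 ha hτa h le_rfl)
    (norm_integral_oscillatory_le hn hτ (hτa.trans h) h' hb le_rfl))

lemma exists_perm_antitone (m : Fin 3 → ℕ) : ∃ σ : Equiv.Perm (Fin 3), Antitone (m ∘ σ) := by
  refine ⟨Fin.revPerm.trans (Tuple.sort m), fun i j hij => ?_⟩
  exact Tuple.monotone_sort m (Fin.rev_le_rev.mpr hij)

lemma kgIntegrand_perm (t : ℝ) (m : Fin 3 → ℕ) (σ : Equiv.Perm (Fin 3)) :
    kgIntegrand t (m ∘ σ) = kgIntegrand t m := by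
  funext s
  rw [kgIntegrand, kgIntegrand]
  congr 4
  exact Equiv.prod_comp σ fun j => besselJ (m j) s

lemma norm_kgKernel_le (t : ℝ) (n : Fin 3 → ℤ) : ‖kgKernel t n‖ ≤ (2 * π) ^ 3 := by
  rw [← volume_cube_three, ← one_mul (volume (cube 3)).toReal]
  refine norm_setIntegral_le_of_norm_le_const (isCompact_Icc.measure_lt_top) fun ξ _ => ?_
  have h1 : 1 ≤ omegaKG 3 ξ := by
    rw [omegaKG_three]; exact one_le_sqrt.mpr (one_le_kgSymbol ξ)
  rw [norm_mul, norm_mul, norm_torusChar, norm_exp_I_mul_real, norm_real, one_mul, one_mul,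
    norm_of_nonneg (by positivity)]
  exact (div_le_one (by linarith)).mpr h1

lemma kgKernel_conj (t : ℝ) (n : Fin 3 → ℤ) :
    conj (kgKernel t n) = kgKernel (-t) (-n) := by
  rw [kgKernel, kgKernel, ← integral_conj]
  congr 1
  funext ξ
  rw [map_mul, map_mul, torusChar, torusChar, ← exp_conj, ← exp_conj, map_mul,
    map_mul, conj_I, conj_ofReal, conj_ofReal, conj_ofReal]
  simp

theorem exists_norm_kgKernel_decay : ∃ C > 0, ∀ (t : ℝ) (n : Fin 3 → ℤ), 1 ≤ |t| →
    ‖kgKernel t n‖ ≤ C * |t| ^ (-(7 / 6) : ℝ) := by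
  obtain ⟨C, hC, h⟩ := exists_norm_kgKernel_le
  have hk : 0 ≤ kgConst := by unfold kgConst; norm_num
  have hC' : 0 < C * (14401 + kgConst) + 64 * (2 * π) ^ 3 := by positivity
  have key : ∀ (t : ℝ) (n : Fin 3 → ℤ), 1 ≤ t →
      ‖kgKernel t n‖ ≤ (C * (14401 + kgConst) + 64 * (2 * π) ^ 3) * t ^ (-(7 / 6) : ℝ) := by
    intro t n ht
    have ht0 : 0 < t := one_pos.trans_le ht
    rcases le_total t 8 with h8 | h8
    · refine (norm_kgKernel_le t n).trans ?_
      have h1 : 1 ≤ 64 * t ^ (-(7 / 6) : ℝ) := by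
        have : (64:ℝ)⁻¹ ≤ t ^ (-(7 / 6) : ℝ) := by
          rw [rpow_neg ht0.le]
          gcongr
          calc t ^ (7 / 6 : ℝ) ≤ t ^ (2 : ℝ) := rpow_le_rpow_of_exponent_le ht (by norm_num)
            _ = t ^ 2 := by norm_num
            _ ≤ 64 := by nlinarith
        linarith
      nlinarith
    · set τ := t ^ (1 / 12 : ℝ) with hτ
      have hτ12 : τ ^ 12 = t := by
        rw [hτ, ← rpow_natCast, ← rpow_mul ht0.le]; norm_num
      have hτ14 : 1 / τ ^ 14 = t ^ (-(7 / 6) : ℝ) := by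
        rw [hτ, ← rpow_natCast, ← rpow_mul ht0.le, rpow_neg ht0.le, one_div]
        norm_num
      have hτ1 : 1 ≤ τ := one_le_rpow ht (by norm_num)
      obtain ⟨σ, hσ⟩ := exists_perm_antitone fun j => (n j).natAbs
      refine (h t n ((14400 + kgConst) / τ ^ 14) ht fun c hc => ?_).trans ?_
      · have hc1 : 84 / 1000 ≤ c ^ 2 := by nlinarith [hc.1, hc.2]
        have hc2 : (c + 3 / 4) ^ 2 ≤ 9 / 8 := by nlinarith [hc.1, hc.2]
        have hc3 := mul_le_mul_of_nonneg_left hc1 ht0.le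
        have hc4 := mul_le_mul_of_nonneg_left hc2 ht0.le
        have := norm_integral_kgIntegrand_le' hσ hτ1 (a := 2 * t * c ^ 2)
          (b := 2 * t * (c + 3 / 4) ^ 2) (by linarith) ?_ ?_ ?_
        · rw [hτ12, kgIntegrand_perm] at this
          exact this
        · rw [hτ12]; linarith
        · have : 0 ≤ c := by linarith [hc.1]
          gcongr
          linarith
        · rw [hτ12]; linarith
      · have h32 : t ^ (-(3 / 2) : ℝ) ≤ t ^ (-(7 / 6) : ℝ) :=
          rpow_le_rpow_of_exponent_le ht (by norm_num)
        have h14 : (14400 + kgConst) / τ ^ 14 = (14400 + kgConst) * t ^ (-(7 / 6) : ℝ) := by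
          rw [← hτ14]; ring
        rw [h14]
        have : 0 ≤ 64 * (2 * π) ^ 3 * t ^ (-(7 / 6) : ℝ) := by positivity
        nlinarith
  refine ⟨_, hC', fun t n ht => ?_⟩
  rcases le_total 0 t with h0 | h0
  · rw [abs_of_nonneg h0] at ht ⊢
    exact key t n ht
  · rw [abs_of_nonpos h0] at ht ⊢
    rw [← norm_conj, kgKernel_conj]
    exact key (-t) (-n) ht

lemma ENNReal.mul_le_weighted_sq_add_sq {l : ℝ≥0∞} (h0 : l ≠ 0) (ht : l ≠ ∞) (x y : ℝ≥0∞) :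
    x * y ≤ l * x ^ 2 + l⁻¹ * y ^ 2 := by
  rcases le_total y (l * x) with h | h
  · refine le_add_right ?_
    calc x * y ≤ x * (l * x) := by gcongr
      _ = _ := by ring
  · refine le_add_left ?_
    have : x ≤ l⁻¹ * y := by
      calc x = l⁻¹ * (l * x) := by rw [← mul_assoc, ENNReal.inv_mul_cancel h0 ht, one_mul]
        _ ≤ _ := by gcongr
    calc x * y ≤ l⁻¹ * y * y := by gcongr
      _ = _ := by ring

lemma ENNReal.mul_le_sq_add_sq (x y : ℝ≥0∞) : x * y ≤ x ^ 2 + y ^ 2 := by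
  simpa using ENNReal.mul_le_weighted_sq_add_sq one_ne_zero ENNReal.one_ne_top x y

lemma lintegral_lintegral_conv {f κ : ℝ → ℝ≥0∞} (hf : Measurable f) (hκ : Measurable κ) :
    ∫⁻ t, ∫⁻ s, f s * κ (t - s) = (∫⁻ τ, κ τ) * ∫⁻ s, f s := by
  have hκ2 : Measurable fun p : ℝ × ℝ => κ (p.1 - p.2) := hκ.comp (by fun_prop)
  rw [lintegral_lintegral_swap]
  · calc ∫⁻ s, ∫⁻ t, f s * κ (t - s) = ∫⁻ s, f s * ∫⁻ τ, κ τ := by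
          refine lintegral_congr fun s => ?_
          have hm : Measurable fun t => κ (t - s) := hκ.comp (by fun_prop)
          rw [lintegral_const_mul _ hm, lintegral_sub_right_eq_self κ s]
      _ = _ := by rw [lintegral_mul_const _ hf, mul_comm]
  fun_prop

/-- Schur's test for a convolution kernel on the line. -/
lemma lintegral_lintegral_mul_conv_le {a b κ : ℝ → ℝ≥0∞} (ha : Measurable a) (hb : Measurable b)
    (hκ : Measurable κ) :
    ∫⁻ t, ∫⁻ s, a s * b t * κ (t - s) ≤ (∫⁻ τ, κ τ) * ((∫⁻ s, a s ^ 2) + ∫⁻ t, b t ^ 2) := by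
  have hκ2 : Measurable fun p : ℝ × ℝ => κ (p.1 - p.2) := hκ.comp (by fun_prop)
  have h1 := lintegral_lintegral_conv (ha.pow_const 2) hκ
  have h2 : ∫⁻ t, ∫⁻ s, b t ^ 2 * κ (t - s) = (∫⁻ τ, κ τ) * ∫⁻ t, b t ^ 2 := by
    calc ∫⁻ t, ∫⁻ s, b t ^ 2 * κ (t - s) = ∫⁻ t, b t ^ 2 * ∫⁻ τ, κ τ := by
          refine lintegral_congr fun t => ?_
          have hm : Measurable fun s => κ (t - s) := hκ.comp (by fun_prop)
          rw [lintegral_const_mul _ hm, lintegral_sub_left_eq_self κ t]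
      _ = _ := by rw [lintegral_mul_const _ (by fun_prop), mul_comm]
  calc ∫⁻ t, ∫⁻ s, a s * b t * κ (t - s)
      ≤ ∫⁻ t, ∫⁻ s, (a s ^ 2 * κ (t - s) + b t ^ 2 * κ (t - s)) := by
        refine lintegral_mono fun t => lintegral_mono fun s => ?_
        rw [← add_mul]
        gcongr
        exact ENNReal.mul_le_sq_add_sq _ _
    _ = (∫⁻ t, ∫⁻ s, a s ^ 2 * κ (t - s)) + ∫⁻ t, ∫⁻ s, b t ^ 2 * κ (t - s) := by
        rw [← lintegral_add_left]
        · refine lintegral_congr fun t => lintegral_add_left ?_ _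
          fun_prop
        fun_prop
    _ = _ := by rw [h1, h2, mul_add]

lemma lintegral_Ioi_rpow_neg {R : ℝ} (hR : 0 < R) :
    ∫⁻ τ in Ioi R, ofReal (τ ^ (-(7 / 6) : ℝ)) =
      ofReal (6 * R ^ (-(1 / 6) : ℝ)) := by
  rw [← ofReal_integral_eq_lintegral_ofReal (integrableOn_Ioi_rpow_of_lt (by norm_num) hR),
    integral_Ioi_rpow_of_lt (by norm_num) hR]
  · congr 1
    norm_num
    ring
  · filter_upwards [ae_restrict_mem measurableSet_Ioi] with τ hτ
    have : (0:ℝ) < τ := hR.trans hτ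
    positivity

/-- A kernel that is constant up to `R` and has the dispersive decay beyond. -/
def truncKernel (α β R τ : ℝ) : ℝ≥0∞ :=
  (Icc (-R) R).indicator (fun _ => ofReal α) τ +
    (Ioi R).indicator (fun τ => ofReal (β * τ ^ (-(7 / 6) : ℝ))) τ +
    (Ioi R).indicator (fun τ => ofReal (β * τ ^ (-(7 / 6) : ℝ))) (-τ)

lemma measurable_truncKernel (α β R : ℝ) : Measurable (truncKernel α β R) := by
  unfold truncKernel
  have h : Measurable ((Ioi R).indicator
      (fun τ : ℝ => ofReal (β * τ ^ (-(7 / 6) : ℝ)))) := by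
    refine Measurable.indicator ?_ measurableSet_Ioi
    fun_prop
  refine ((measurable_const.indicator measurableSet_Icc).add h).add (h.comp measurable_neg)

lemma lintegral_indicator_decay {β R : ℝ} (hβ : 0 ≤ β) (hR : 0 < R) :
    ∫⁻ τ, (Ioi R).indicator (fun τ => ofReal (β * τ ^ (-(7 / 6) : ℝ))) τ =
      ofReal (6 * β * R ^ (-(1 / 6) : ℝ)) := by
  rw [lintegral_indicator measurableSet_Ioi]
  simp_rw [ofReal_mul hβ]
  rw [lintegral_const_mul _ (by fun_prop), lintegral_Ioi_rpow_neg hR, ← ofReal_mul hβ]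
  congr 1
  ring

lemma lintegral_truncKernel {α β R : ℝ} (hα : 0 ≤ α) (hβ : 0 ≤ β) (hR : 0 < R) :
    ∫⁻ τ, truncKernel α β R τ = ofReal (2 * R * α + 12 * β * R ^ (-(1 / 6) : ℝ)) := by
  unfold truncKernel
  have h : Measurable ((Ioi R).indicator
      (fun τ : ℝ => ofReal (β * τ ^ (-(7 / 6) : ℝ)))) := by
    refine Measurable.indicator ?_ measurableSet_Ioi
    fun_prop
  have h' : Measurable fun τ => (Ioi R).indicator
      (fun τ : ℝ => ofReal (β * τ ^ (-(7 / 6) : ℝ))) (-τ) := h.comp measurable_neg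
  rw [lintegral_add_right _ h', lintegral_add_right _ h,
    lintegral_neg_eq_self ((Ioi R).indicator
      (fun τ : ℝ => ofReal (β * τ ^ (-(7 / 6) : ℝ)))),
    lintegral_indicator_decay hβ hR, lintegral_indicator measurableSet_Icc, lintegral_const,
    Measure.restrict_apply_univ, volume_Icc, ← ofReal_mul hα,
    ← ENNReal.ofReal_add (mul_nonneg hα (by linarith)) (by positivity),
    ← ENNReal.ofReal_add (add_nonneg (mul_nonneg hα (by linarith)) (by positivity))
      (by positivity)]
  congr 1
  ring

section PairBounds

variable {𝓗 : Type*} [NormedAddCommGroup 𝓗] [InnerProductSpace ℂ 𝓗]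

/-- A path in a Hilbert space with size `μ⁻¹² a` and self-correlations decaying as
`K μ⁴ |t - s|^(-7/6) a(s) a(t)`. -/
structure DispersiveAtom (K μ : ℝ) (F : ℝ → 𝓗) (a : ℝ → ℝ≥0∞) : Prop where
  pos : 0 < μ
  integrable : Integrable F
  measurable : Measurable a
  size : ∀ t, ‖F t‖ₑ ≤ ENNReal.ofReal (1 / μ ^ 12) * a t
  decay : ∀ s t, s ≠ t →
    ‖inner ℂ (F s) (F t)‖ₑ ≤ ENNReal.ofReal (K * μ ^ 4 * |t - s| ^ (-(7 / 6) : ℝ)) * (a s * a t)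

lemma enorm_inner_le (x y : 𝓗) : ‖inner ℂ x y‖ₑ ≤ ‖x‖ₑ * ‖y‖ₑ := by
  rw [← ofReal_norm, ← ofReal_norm, ← ofReal_norm, ← ofReal_mul (norm_nonneg _)]
  exact ofReal_le_ofReal (norm_inner_le_norm x y)

lemma enorm_sq_eq_enorm_inner (x : 𝓗) : ‖x‖ₑ ^ 2 = ‖inner ℂ x x‖ₑ := by
  rw [← ofReal_norm, ← ofReal_norm, ← ofReal_pow (norm_nonneg _),
    inner_self_eq_norm_sq_to_K]
  simp

lemma DispersiveAtom.inner_le {K μ : ℝ} {F : ℝ → 𝓗} {a : ℝ → ℝ≥0∞} (h : DispersiveAtom K μ F a)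
    (s t : ℝ) : ‖inner ℂ (F s) (F t)‖ₑ ≤
      a s * a t * truncKernel (1 / μ ^ 24) (K * μ ^ 4) (μ ^ 24) (t - s) := by
  have hμ := h.pos
  have hR : 0 < μ ^ 24 := by positivity
  rcases le_or_gt |t - s| (μ ^ 24) with h1 | h1
  · calc ‖inner ℂ (F s) (F t)‖ₑ ≤ ‖F s‖ₑ * ‖F t‖ₑ := enorm_inner_le _ _
      _ ≤ (ofReal (1 / μ ^ 12) * a s) * (ofReal (1 / μ ^ 12) * a t) := by
          gcongr
          · exact h.size s
          · exact h.size t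
      _ = a s * a t * ofReal (1 / μ ^ 24) := by
          have : (1 / μ ^ 24) = 1 / μ ^ 12 * (1 / μ ^ 12) := by field_simp
          rw [this, ofReal_mul (by positivity)]
          ring
      _ ≤ _ := by
          gcongr
          rw [truncKernel, indicator_of_mem (s := Icc _ _) (abs_le.mp h1), add_assoc]
          exact le_self_add
  · have hne : s ≠ t := by
      rintro rfl
      rw [sub_self, abs_zero] at h1
      linarith
    refine (h.decay s t hne).trans ?_
    rw [mul_comm]
    gcongr
    rcases lt_abs.mp h1 with h2 | h2
    · rw [truncKernel, indicator_of_mem (s := Ioi _) (mem_Ioi.mpr h2),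
        abs_of_pos (hR.trans h2)]
      exact le_add_right (le_add_left le_rfl)
    · rw [truncKernel, indicator_of_mem (s := Ioi _) (a := -(t - s)) (mem_Ioi.mpr h2),
        abs_of_neg (by linarith)]
      exact le_add_left le_rfl

variable [CompleteSpace 𝓗]

lemma inner_integral_left {f : ℝ → 𝓗} {ν : Measure ℝ} (hf : Integrable f ν) (c : 𝓗) :
    inner ℂ (∫ s, f s ∂ν) c = ∫ s, inner ℂ (f s) c ∂ν := by
  rw [← inner_conj_symm, ← integral_inner hf c, ← integral_conj]
  simp_rw [inner_conj_symm]

lemma enorm_inner_integral_le {f : ℝ → 𝓗} {ν : Measure ℝ} (hf : Integrable f ν) (c : 𝓗) :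
    ‖inner ℂ (∫ s, f s ∂ν) c‖ₑ ≤ ∫⁻ s, ‖inner ℂ (f s) c‖ₑ ∂ν := by
  rw [inner_integral_left hf]
  exact enorm_integral_le_lintegral_enorm _

/-- The homogeneous estimate for an atom. -/
lemma DispersiveAtom.enorm_setIntegral_sq_le {K μ : ℝ} {F : ℝ → 𝓗} {a : ℝ → ℝ≥0∞}
    (h : DispersiveAtom K μ F a) (hK : 0 ≤ K) {I : Set ℝ} (hI : MeasurableSet I) :
    ‖∫ s in I, F s‖ₑ ^ 2 ≤ ofReal (4 + 24 * K) * ∫⁻ s in I, a s ^ 2 := by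
  have hμ := h.pos
  have hF := h.integrable.integrableOn (s := I)
  set κ := truncKernel (1 / μ ^ 24) (K * μ ^ 4) (μ ^ 24)
  have hκ : ∫⁻ τ, κ τ = ofReal (2 + 12 * K) := by
    rw [lintegral_truncKernel (by positivity) (by positivity) (by positivity)]
    congr 1
    have : (μ ^ 24) ^ (-(1 / 6) : ℝ) = 1 / μ ^ 4 := by
      have h4 : (μ ^ 24) ^ (-(1 / 6) : ℝ) = μ ^ (-(4 : ℝ)) := by
        rw [← rpow_natCast, ← rpow_mul hμ.le]
        norm_num
      simp_all
    rw [this]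
    field_simp
  have hind : ∫⁻ s, I.indicator a s ^ 2 = ∫⁻ s in I, a s ^ 2 := by
    rw [← lintegral_indicator hI]
    refine lintegral_congr fun s => ?_
    by_cases hs : s ∈ I <;> simp [hs]
  calc ‖∫ s in I, F s‖ₑ ^ 2 = ‖inner ℂ (∫ s in I, F s) (∫ t in I, F t)‖ₑ :=
        enorm_sq_eq_enorm_inner _
    _ = ‖∫ t in I, inner ℂ (∫ s in I, F s) (F t)‖ₑ := by rw [integral_inner hF]
    _ ≤ ∫⁻ t in I, ‖inner ℂ (∫ s in I, F s) (F t)‖ₑ := enorm_integral_le_lintegral_enorm _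
    _ ≤ ∫⁻ t in I, ∫⁻ s in I, ‖inner ℂ (F s) (F t)‖ₑ :=
        lintegral_mono fun t => enorm_inner_integral_le hF _
    _ ≤ ∫⁻ t in I, ∫⁻ s in I, a s * a t * κ (t - s) :=
        lintegral_mono fun t => lintegral_mono fun s => h.inner_le s t
    _ = ∫⁻ t, ∫⁻ s, I.indicator a s * I.indicator a t * κ (t - s) := by
        rw [← lintegral_indicator hI]
        refine lintegral_congr fun t => ?_
        by_cases ht : t ∈ I
        · rw [indicator_of_mem ht, ← lintegral_indicator hI]
          refine lintegral_congr fun s => ?_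
          by_cases hs : s ∈ I <;> simp [hs, ht]
        · simp [ht]
    _ ≤ (∫⁻ τ, κ τ) * ((∫⁻ s, I.indicator a s ^ 2) + ∫⁻ s, I.indicator a s ^ 2) :=
        lintegral_lintegral_mul_conv_le (h.measurable.indicator hI) (h.measurable.indicator hI)
          (measurable_truncKernel _ _ _)
    _ = _ := by
        rw [hκ, hind, ← two_mul, ← mul_assoc]
        congr 1
        rw [← ofReal_ofNat 2, ← ofReal_mul (by positivity)]
        congr 1
        ring

/-- The retarded interaction of two atoms, the earlier one having the larger size. -/
lemma DispersiveAtom.enorm_retarded_le {K μ ν : ℝ} {F G : ℝ → 𝓗} {a b : ℝ → ℝ≥0∞}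
    (hF : DispersiveAtom K μ F a) (hG : DispersiveAtom K ν G b) (hK : 0 ≤ K) (hμν : μ ≤ ν)
    (hFG : ∀ s t, s < t → ‖inner ℂ (F s) (G t)‖ₑ ≤
      ofReal (K * (μ ^ 2 * ν ^ 2) * |t - s| ^ (-(7 / 6) : ℝ)) * (a s * b t)) :
    ‖∫ t, inner ℂ (∫ s in Iic t, F s) (G t)‖ₑ ≤
      ofReal ((4 + 30 * K) * (μ / ν)) * ((∫⁻ s, a s ^ 2) + ∫⁻ t, b t ^ 2) := by
  have hμ := hF.pos
  have hν := hG.pos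
  set R := μ ^ 6 * ν ^ 18 with hRdef
  have hR : 0 < R := by positivity
  have hR6 : R ^ (-(1 / 6) : ℝ) = 1 / (μ * ν ^ 3) := by
    have h4 : R ^ (-(1 / 6) : ℝ) = (μ * ν ^ 3) ^ (-(1 : ℝ)) := by
      rw [show R = (μ * ν ^ 3) ^ (6 : ℕ) by rw [hRdef]; ring, ← rpow_natCast,
        ← rpow_mul (by positivity)]
      norm_num
    rw [h4, rpow_neg_one, one_div]
  set A := ∫⁻ s, a s ^ 2
  set B := ∫⁻ t, b t ^ 2
  set κ : ℝ → ℝ≥0∞ := (Ioi R).indicator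
    (fun τ => ofReal (K * (μ ^ 2 * ν ^ 2) * τ ^ (-(7 / 6) : ℝ))) with hκdef
  have hκm : Measurable κ := by
    refine Measurable.indicator ?_ measurableSet_Ioi
    fun_prop
  set χ : ℝ → ℝ≥0∞ := (Icc 0 R).indicator 1 with hχdef
  have hχm : Measurable χ := measurable_one.indicator measurableSet_Icc
  have near : ∀ t, ‖inner ℂ (∫ s in Icc (t - R) t, F s) (G t)‖ₑ ≤
      ofReal ((4 + 24 * K) / (μ ^ 3 * ν ^ 21)) * (∫⁻ s, a s ^ 2 * χ (t - s)) +
        ofReal ((μ / ν) ^ 3) * b t ^ 2 := fun t => by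
    set X := ‖∫ s in Icc (t - R) t, F s‖ₑ
    have e : ∫⁻ s in Icc (t - R) t, a s ^ 2 = ∫⁻ s, a s ^ 2 * χ (t - s) := by
      rw [← lintegral_indicator measurableSet_Icc]
      refine lintegral_congr fun s => ?_
      have : t - s ∈ Icc 0 R ↔ s ∈ Icc (t - R) t := by
        simp only [mem_Icc]
        constructor <;> rintro ⟨h1, h2⟩ <;> constructor <;> linarith
      by_cases hs : s ∈ Icc (t - R) t
      · rw [indicator_of_mem hs, hχdef, indicator_of_mem (this.mpr hs), Pi.one_apply,
          mul_one]
      · rw [indicator_of_notMem hs, hχdef, indicator_of_notMem (this.not.mpr hs), mul_zero]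
    have hX : X ^ 2 ≤ ofReal (4 + 24 * K) * ∫⁻ s, a s ^ 2 * χ (t - s) := by
      rw [← e]
      exact hF.enorm_setIntegral_sq_le hK measurableSet_Icc
    have hl : ofReal (1 / (μ ^ 3 * ν ^ 9)) ≠ 0 := by positivity
    calc ‖inner ℂ (∫ s in Icc (t - R) t, F s) (G t)‖ₑ ≤ X * ‖G t‖ₑ := enorm_inner_le _ _
      _ ≤ X * (ofReal (1 / ν ^ 12) * b t) := by gcongr; exact hG.size t
      _ = ofReal (1 / ν ^ 12) * (X * b t) := by ring
      _ ≤ ofReal (1 / ν ^ 12) * (ofReal (1 / (μ ^ 3 * ν ^ 9)) *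
            (ofReal (4 + 24 * K) * ∫⁻ s, a s ^ 2 * χ (t - s)) +
            (ofReal (1 / (μ ^ 3 * ν ^ 9)))⁻¹ * b t ^ 2) := by
          gcongr
          exact (ENNReal.mul_le_weighted_sq_add_sq hl ofReal_ne_top X (b t)).trans
            (by gcongr)
      _ = _ := by
          rw [← ENNReal.ofReal_inv_of_pos (by positivity), mul_add, ← mul_assoc, ← mul_assoc,
            ← mul_assoc, ← ofReal_mul (by positivity), ← ofReal_mul (by positivity),
            ← ofReal_mul (by positivity)]
          field_simp
  have far : ∀ t, ‖inner ℂ (∫ s in Iio (t - R), F s) (G t)‖ₑ ≤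
      ∫⁻ s, a s * b t * κ (t - s) := fun t => by
    refine (enorm_inner_integral_le hF.integrable.integrableOn _).trans ?_
    rw [← lintegral_indicator measurableSet_Iio]
    refine lintegral_mono fun s => ?_
    by_cases hs : s ∈ Iio (t - R)
    · have hs' : R < t - s := by linarith [Set.mem_Iio.mp hs]
      rw [indicator_of_mem hs, hκdef, indicator_of_mem (mem_Ioi.mpr hs')]
      refine (hFG s t (by linarith)).trans ?_
      rw [abs_of_pos (hR.trans hs'), mul_comm]
    · rw [indicator_of_notMem hs]
      exact zero_le
  have key : ∀ t, ‖inner ℂ (∫ s in Iic t, F s) (G t)‖ₑ ≤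
      (ofReal ((4 + 24 * K) / (μ ^ 3 * ν ^ 21)) * (∫⁻ s, a s ^ 2 * χ (t - s)) +
        ofReal ((μ / ν) ^ 3) * b t ^ 2) + ∫⁻ s, a s * b t * κ (t - s) := fun t => by
    have e : Icc (t - R) t ∪ Iio (t - R) = Iic t := by
      rw [Set.union_comm, Set.Iio_union_Icc_eq_Iic (by linarith)]
    rw [← e, setIntegral_union _ measurableSet_Iio hF.integrable.integrableOn
      hF.integrable.integrableOn, inner_add_left]
    · exact (enorm_add_le _ _).trans (add_le_add (near t) (far t))
    · rw [Set.disjoint_left]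
      intro s hs hs'
      exact absurd hs.1 (not_le.mpr hs')
  have hχI : ∫⁻ τ, χ τ = ofReal R := by
    rw [hχdef, lintegral_indicator_one measurableSet_Icc, volume_Icc, sub_zero]
  have ha2 : Measurable fun s => a s ^ 2 := hF.measurable.pow_const 2
  have hb2 : Measurable fun s => b s ^ 2 := hG.measurable.pow_const 2
  have m1 : Measurable fun t => ∫⁻ s, a s ^ 2 * χ (t - s) :=
    Measurable.lintegral_prod_right' (f := fun p : ℝ × ℝ => a p.2 ^ 2 * χ (p.1 - p.2))
      ((ha2.comp measurable_snd).mul (hχm.comp (by fun_prop)))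
  calc ‖∫ t, inner ℂ (∫ s in Iic t, F s) (G t)‖ₑ
      ≤ ∫⁻ t, ‖inner ℂ (∫ s in Iic t, F s) (G t)‖ₑ := enorm_integral_le_lintegral_enorm _
    _ ≤ _ := lintegral_mono key
    _ = (ofReal ((4 + 24 * K) / (μ ^ 3 * ν ^ 21)) * (ofReal R * A) +
          ofReal ((μ / ν) ^ 3) * B) + ∫⁻ t, ∫⁻ s, a s * b t * κ (t - s) := by
        have m2 : Measurable fun t => ofReal ((4 + 24 * K) / (μ ^ 3 * ν ^ 21)) *
            (∫⁻ s, a s ^ 2 * χ (t - s)) + ofReal ((μ / ν) ^ 3) * b t ^ 2 :=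
          (m1.const_mul _).add (hb2.const_mul _)
        rw [lintegral_add_left m2,
          lintegral_add_left (m1.const_mul _), lintegral_const_mul _ m1, lintegral_const_mul _ hb2,
          lintegral_lintegral_conv ha2 hχm, hχI]
    _ ≤ (ofReal ((4 + 24 * K) / (μ ^ 3 * ν ^ 21)) * (ofReal R * A) +
          ofReal ((μ / ν) ^ 3) * B) +
          ofReal (6 * K * (μ / ν)) * (A + B) := by
        gcongr
        refine (lintegral_lintegral_mul_conv_le hF.measurable hG.measurable hκm).trans_eq ?_
        rw [hκdef, lintegral_indicator_decay (by positivity) hR, hR6]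
        congr 2
        field_simp
    _ ≤ (ofReal ((4 + 24 * K) * (μ / ν)) * A +
          ofReal ((4 + 24 * K) * (μ / ν)) * B) +
          ofReal (6 * K * (μ / ν)) * (A + B) := by
        have hr : μ / ν ≤ 1 := (div_le_one hν).mpr hμν
        have hr0 : 0 ≤ μ / ν := by positivity
        have hr3 : (μ / ν) ^ 3 ≤ μ / ν := by
          calc (μ / ν) ^ 3 ≤ (μ / ν) ^ 1 := pow_le_pow_of_le_one hr0 hr (by norm_num)
            _ = _ := pow_one _
        rw [← mul_assoc, ← ofReal_mul (by positivity)]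
        have e : (4 + 24 * K) / (μ ^ 3 * ν ^ 21) * R = (4 + 24 * K) * (μ / ν) ^ 3 := by
          rw [hRdef]; field_simp
        rw [e]
        gcongr
        nlinarith
    _ = _ := by
        rw [← mul_add, ← add_mul, ← ENNReal.ofReal_add (by positivity) (by positivity)]
        congr 2
        ring

end PairBounds

section RetardedForm

variable {𝓗 : Type*} [NormedAddCommGroup 𝓗] [InnerProductSpace ℂ 𝓗]

/-- The retarded sesquilinear form `∫∫_{s ≤ t} ⟪F s, G t⟫`. -/
def retardedForm (F G : ℝ → 𝓗) : ℂ := ∫ t, inner ℂ (∫ s in Iic t, F s) (G t)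

lemma DispersiveAtom.reflect {K μ : ℝ} {F : ℝ → 𝓗} {a : ℝ → ℝ≥0∞} (h : DispersiveAtom K μ F a) :
    DispersiveAtom K μ (fun t => F (-t)) (fun t => a (-t)) where
  pos := h.pos
  integrable := h.integrable.comp_neg
  measurable := h.measurable.comp measurable_neg
  size t := h.size (-t)
  decay s t hst := by
    have := h.decay (-s) (-t) (by simpa using hst)
    rwa [show -t - -s = -(t - s) by ring, abs_neg] at this

lemma integrable_inner_prod {F G : ℝ → 𝓗} (hF : Integrable F) (hG : Integrable G) :
    Integrable (fun p : ℝ × ℝ => inner ℂ (F p.1) (G p.2)) := by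
  refine Integrable.mono' (hF.norm.mul_prod hG.norm) ?_ (.of_forall fun p => ?_)
  · exact AEStronglyMeasurable.inner hF.aestronglyMeasurable.comp_fst
      hG.aestronglyMeasurable.comp_snd
  · exact norm_inner_le_norm _ _

variable [CompleteSpace 𝓗]

lemma retardedForm_eq_integral_right {F G : ℝ → 𝓗} (hF : Integrable F) (hG : Integrable G) :
    retardedForm F G = ∫ s, inner ℂ (F s) (∫ t in Ici s, G t) := by
  set S : Set (ℝ × ℝ) := {p | p.1 ≤ p.2} with hS
  have hSm : MeasurableSet S := measurableSet_le measurable_fst measurable_snd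
  set H : ℝ → ℝ → ℂ := fun s t => S.indicator (fun p => inner ℂ (F p.1) (G p.2)) (s, t) with hH
  have hint : Integrable (uncurry H) := (integrable_inner_prod hF hG).indicator hSm
  have e1 : ∀ t, ∫ s, H s t = inner ℂ (∫ s in Iic t, F s) (G t) := fun t => by
    rw [inner_integral_left hF.integrableOn, ← integral_indicator measurableSet_Iic]
    bound
  have e2 : ∀ s, ∫ t, H s t = inner ℂ (F s) (∫ t in Ici s, G t) := fun s => by
    rw [← integral_inner hG.integrableOn, ← integral_indicator measurableSet_Ici]
    bound
  rw [retardedForm]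
  simp_rw [← e1, ← e2]
  exact (integral_integral_swap hint).symm

lemma retardedForm_reflect {F G : ℝ → 𝓗} (hF : Integrable F) (hG : Integrable G) :
    retardedForm F G =
      conj (retardedForm (fun t => G (-t)) (fun t => F (-t))) := by
  rw [retardedForm_eq_integral_right hF hG, retardedForm, ← integral_conj,
    ← integral_neg_eq_self]
  congr 1
  funext s
  rw [inner_conj_symm, integral_comp_neg_Iic, integral_Ici_eq_integral_Ioi]

lemma norm_retardedForm_atoms_le {K μ ν : ℝ} {F G : ℝ → 𝓗} {a b : ℝ → ℝ≥0∞}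
    (hF : DispersiveAtom K μ F a) (hG : DispersiveAtom K ν G b) (hK : 0 ≤ K)
    (hFG : ∀ s t, s < t → ‖inner ℂ (F s) (G t)‖ₑ ≤
      ofReal (K * (μ ^ 2 * ν ^ 2) * |t - s| ^ (-(7 / 6) : ℝ)) * (a s * b t)) :
    ‖retardedForm F G‖ₑ ≤
      ofReal ((4 + 30 * K) * min (μ / ν) (ν / μ)) *
        ((∫⁻ s, a s ^ 2) + ∫⁻ t, b t ^ 2) := by
  have hμ := hF.pos
  have hν := hG.pos
  rcases le_total μ ν with h | h
  · have : μ / ν ≤ ν / μ := by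
      rw [div_le_div_iff₀ hν hμ]; nlinarith
    rw [min_eq_left this]
    exact hF.enorm_retarded_le hG hK h hFG
  · have : ν / μ ≤ μ / ν := by
      rw [div_le_div_iff₀ hμ hν]; nlinarith
    rw [min_eq_right this, retardedForm_reflect hF.integrable hG.integrable, RCLike.enorm_conj]
    refine (hG.reflect.enorm_retarded_le hF.reflect hK h fun s t hst => ?_).trans_eq ?_
    · have := hFG (-t) (-s) (by linarith)
      rw [← inner_conj_symm, RCLike.enorm_conj]
      refine this.trans_eq ?_
      rw [show -s - -t = t - s by ring, mul_comm (μ ^ 2), mul_comm (a (-t))]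
    · rw [lintegral_neg_eq_self (fun t => b t ^ 2), lintegral_neg_eq_self (fun t => a t ^ 2),
        add_comm (∫⁻ t, b t ^ 2)]

end RetardedForm

/-- Indicator of the sublevel set `r ≤ N 2^(-26 m)`. -/
def levelInd (N r : ℝ) (m : ℕ) : ℝ := if r ≤ N / (2 ^ m) ^ 26 then 1 else 0

/-- Indicator of the `m`-th dyadic level of `r` relative to `N`; the levels from `M` on are
merged into one. -/
def levelWeight (N : ℝ) (M : ℕ) (r : ℝ) (m : ℕ) : ℝ :=
  if m < M then levelInd N r m - levelInd N r (m + 1) else levelInd N r m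

lemma sum_levelWeight {N r : ℝ} (h : r ≤ N) (M : ℕ) :
    ∑ m ∈ range (M + 1), levelWeight N M r m = 1 := by
  have h1 : ∑ m ∈ range M, levelWeight N M r m =
      ∑ m ∈ range M, (levelInd N r m - levelInd N r (m + 1)) :=
    sum_congr rfl fun m hm => by rw [levelWeight, if_pos (mem_range.mp hm)]
  rw [sum_range_succ, h1, Finset.sum_range_sub', levelWeight, if_neg (lt_irrefl M)]
  simp [levelInd, h]

lemma levelWeight_cases {N r : ℝ} (hN : 0 ≤ N) (M m : ℕ) :
    levelWeight N M r m = 0 ∨ (levelWeight N M r m = 1 ∧ r ≤ N / (2 ^ m) ^ 26 ∧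
      (m < M → N / (2 ^ (m + 1)) ^ 26 < r)) := by
  have hmono : N / (2 ^ (m + 1)) ^ 26 ≤ N / (2 ^ m) ^ 26 := by
    gcongr
    · norm_num
    · omega
  unfold levelWeight levelInd
  split_ifs with h1 h2 h3 h3 h2
  · simp
  · simp_all
  · exact absurd (h3.trans hmono) h2
  · simp
  · simp_all
  · simp

lemma levelWeight_nonneg {N r : ℝ} (hN : 0 ≤ N) (M m : ℕ) : 0 ≤ levelWeight N M r m := by
  rcases levelWeight_cases (r := r) hN M m with h | ⟨h, -⟩ <;> rw [h]
  exact zero_le_one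

lemma levelWeight_le_one {N r : ℝ} (hN : 0 ≤ N) (M m : ℕ) : levelWeight N M r m ≤ 1 := by
  rcases levelWeight_cases (r := r) hN M m with h | ⟨h, -⟩ <;> rw [h]
  exact zero_le_one

lemma measurable_levelWeight (M m : ℕ) {f g : ℝ → ℝ} (hf : Measurable f) (hg : Measurable g) :
    Measurable fun t => levelWeight (f t) M (g t) m := by
  have h : ∀ k, Measurable fun t => levelInd (f t) (g t) k := fun k =>
    Measurable.ite (measurableSet_le hg (hf.div_const _)) measurable_const measurable_const
  unfold levelWeight
  split_ifs
  · exact (h m).sub (h (m + 1))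
  · exact h m

section Levels

variable {ι : Type*}

/-- The `ℓ^{14/13}` norm over a finite set. -/
def endpointDualNorm (X : Finset ι) (c : ι → ℂ) : ℝ :=
  (∑ x ∈ X, ‖c x‖ ^ (14 / 13 : ℝ)) ^ (13 / 14 : ℝ)

lemma endpointDualNorm_nonneg (X : Finset ι) (c : ι → ℂ) : 0 ≤ endpointDualNorm X c := by
  unfold endpointDualNorm; positivity

lemma endpointDualNorm_rpow (X : Finset ι) (c : ι → ℂ) :
    endpointDualNorm X c ^ (14 / 13 : ℝ) = ∑ x ∈ X, ‖c x‖ ^ (14 / 13 : ℝ) := by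
  rw [endpointDualNorm, ← rpow_mul (by positivity)]
  norm_num

lemma norm_le_endpointDualNorm {X : Finset ι} (c : ι → ℂ) {x : ι} (hx : x ∈ X) :
    ‖c x‖ ≤ endpointDualNorm X c := by
  have h := single_le_sum (f := fun x => ‖c x‖ ^ (14 / 13 : ℝ))
    (fun i _ => by positivity) hx
  rw [← endpointDualNorm_rpow] at h
  exact (rpow_le_rpow_iff (norm_nonneg _) (endpointDualNorm_nonneg X c)
    (by norm_num)).mp h

/-- The number of points in the `m`-th level. -/
def levelCount (X : Finset ι) (c : ι → ℂ) (M m : ℕ) : ℝ :=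
  ∑ x ∈ X, levelWeight (endpointDualNorm X c) M ‖c x‖ m

/-- The square of the atomic amplitude of the `m`-th level. -/
def levelAmpSq (X : Finset ι) (c : ι → ℂ) (M m : ℕ) : ℝ :=
  endpointDualNorm X c ^ 2 * levelCount X c M m / (2 ^ m) ^ 28

/-- The part of `c` in the `m`-th level. -/
def levelPart (X : Finset ι) (c : ι → ℂ) (M m : ℕ) (x : ι) : ℂ :=
  (levelWeight (endpointDualNorm X c) M ‖c x‖ m : ℂ) * c x

lemma sum_levelPart {X : Finset ι} (c : ι → ℂ) (M : ℕ) {x : ι} (hx : x ∈ X) :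
    ∑ m ∈ range (M + 1), levelPart X c M m x = c x := by
  unfold levelPart
  rw [← sum_mul, ← ofReal_sum, sum_levelWeight (norm_le_endpointDualNorm c hx)]
  simp

lemma levelCount_nonneg (X : Finset ι) (c : ι → ℂ) (M m : ℕ) : 0 ≤ levelCount X c M m :=
  sum_nonneg fun _ _ => levelWeight_nonneg (endpointDualNorm_nonneg X c) M m

lemma levelAmpSq_nonneg (X : Finset ι) (c : ι → ℂ) (M m : ℕ) : 0 ≤ levelAmpSq X c M m := by
  have := levelCount_nonneg X c M m
  unfold levelAmpSq; positivity

lemma norm_levelPart_le (X : Finset ι) (c : ι → ℂ) (M m : ℕ) (x : ι) :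
    ‖levelPart X c M m x‖ ≤
      levelWeight (endpointDualNorm X c) M ‖c x‖ m * (endpointDualNorm X c / (2 ^ m) ^ 26) := by
  have hN := endpointDualNorm_nonneg X c
  rw [levelPart, norm_mul, norm_real, norm_of_nonneg (levelWeight_nonneg hN M m)]
  rcases levelWeight_cases (r := ‖c x‖) hN M m with h | ⟨h, h', -⟩
  · simp [h]
  · rw [h]; linarith

lemma sum_norm_levelPart_sq_le (X : Finset ι) (c : ι → ℂ) (M m : ℕ) :
    ∑ x ∈ X, ‖levelPart X c M m x‖ ^ 2 ≤ levelAmpSq X c M m / (2 ^ m) ^ 24 := by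
  have hN := endpointDualNorm_nonneg X c
  set N := endpointDualNorm X c
  calc ∑ x ∈ X, ‖levelPart X c M m x‖ ^ 2
      ≤ ∑ x ∈ X, levelWeight N M ‖c x‖ m * (N / (2 ^ m) ^ 26) ^ 2 := by
        refine sum_le_sum fun x _ => ?_
        have h0 := levelWeight_nonneg (r := ‖c x‖) hN M m
        have h1 := levelWeight_le_one (r := ‖c x‖) hN M m
        refine (pow_le_pow_left₀ (norm_nonneg _) (norm_levelPart_le X c M m x) 2).trans ?_
        rw [mul_pow]
        gcongr
        nlinarith
    _ = _ := by
        rw [← sum_mul, levelAmpSq, levelCount]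
        field_simp
        exact mul_comm _ _

lemma sum_levelCount_mul_le (X : Finset ι) (c : ι → ℂ) (M : ℕ) :
    ∑ m ∈ range M, levelCount X c M m *
      (endpointDualNorm X c ^ (14 / 13 : ℝ) / (2 ^ (m + 1)) ^ 28) ≤
      endpointDualNorm X c ^ (14 / 13 : ℝ) := by
  have hN := endpointDualNorm_nonneg X c
  rw [endpointDualNorm_rpow]
  have hp : ∀ m : ℕ, (∑ x ∈ X, ‖c x‖ ^ (14 / 13 : ℝ)) / (2 ^ (m + 1)) ^ 28 =
      (endpointDualNorm X c / (2 ^ (m + 1)) ^ 26) ^ (14 / 13 : ℝ) := fun m => by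
    rw [div_rpow hN (by positivity), endpointDualNorm_rpow]
    congr 1
    rw [← rpow_natCast _ 26, ← rpow_natCast _ 28, ← rpow_mul (by positivity)]
    norm_num
  simp_rw [hp, levelCount, sum_mul]
  rw [sum_comm]
  refine sum_le_sum fun x hx => ?_
  calc ∑ m ∈ range M, levelWeight (endpointDualNorm X c) M ‖c x‖ m *
        (endpointDualNorm X c / (2 ^ (m + 1)) ^ 26) ^ (14 / 13 : ℝ)
      ≤ ∑ m ∈ range M, levelWeight (endpointDualNorm X c) M ‖c x‖ m *
          ‖c x‖ ^ (14 / 13 : ℝ) := by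
        refine sum_le_sum fun m hm => ?_
        rcases levelWeight_cases (r := ‖c x‖) hN M m with h | ⟨h, -, h'⟩
        · simp [h]
        · rw [h]
          gcongr
          exact (h' (mem_range.mp hm)).le
    _ ≤ 1 * ‖c x‖ ^ (14 / 13 : ℝ) := by
        rw [← sum_mul]
        gcongr
        rw [← sum_levelWeight (norm_le_endpointDualNorm c hx) M, sum_range_succ]
        linarith [levelWeight_nonneg (r := ‖c x‖) hN M M]
    _ = _ := one_mul _

lemma sum_levelCount_div_le {X : Finset ι} {c : ι → ℂ} (hN : 0 < endpointDualNorm X c) (M : ℕ) :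
    ∑ m ∈ range M, levelCount X c M m / (2 ^ (m + 1)) ^ 28 ≤ 1 := by
  have h := sum_levelCount_mul_le X c M
  have hp : 0 < endpointDualNorm X c ^ (14 / 13 : ℝ) := by positivity
  refine le_of_mul_le_mul_right ?_ hp
  rw [sum_mul, one_mul]
  refine le_trans (le_of_eq (sum_congr rfl fun m _ => ?_)) h
  ring

lemma levelCount_le_card (X : Finset ι) (c : ι → ℂ) (M m : ℕ) :
    levelCount X c M m ≤ X.card := by
  refine (sum_le_sum fun x _ =>
    levelWeight_le_one (endpointDualNorm_nonneg X c) M m).trans ?_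
  simp

lemma levelCount_le {X : Finset ι} {c : ι → ℂ} (hN : 0 < endpointDualNorm X c) {M m : ℕ}
    (hM : (X.card : ℝ) ≤ (2 ^ M) ^ 28) (hm : m ≤ M) :
    levelCount X c M m ≤ (2 ^ (m + 1)) ^ 28 := by
  rcases hm.lt_or_eq with h | rfl
  · have h1 := single_le_sum
      (f := fun m => levelCount X c M m / (2 ^ (m + 1)) ^ 28)
      (fun i _ => div_nonneg (levelCount_nonneg X c M i) (by positivity)) (mem_range.mpr h)
    have h2 := h1.trans (sum_levelCount_div_le hN M)
    exact (div_le_one (by positivity)).mp h2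
  · refine (levelCount_le_card X c m m).trans (hM.trans ?_)
    gcongr
    · norm_num
    · omega

lemma sum_norm_levelPart_le {X : Finset ι} (c : ι → ℂ) {M m : ℕ}
    (hM : (X.card : ℝ) ≤ (2 ^ M) ^ 28) (hm : m ≤ M) :
    ∑ x ∈ X, ‖levelPart X c M m x‖ ≤ 2 ^ 14 * (2 ^ m) ^ 2 * √(levelAmpSq X c M m) := by
  have hN := endpointDualNorm_nonneg X c
  have h1 : ∑ x ∈ X, ‖levelPart X c M m x‖ ≤
      levelCount X c M m * (endpointDualNorm X c / (2 ^ m) ^ 26) := by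
    rw [levelCount, sum_mul]
    exact sum_le_sum fun x _ => norm_levelPart_le X c M m x
  refine h1.trans ?_
  rcases hN.eq_or_lt with h0 | h0
  · rw [← h0]; simp only [zero_div, mul_zero]; positivity
  · have hc := levelCount_le h0 hM hm
    have hc0 := levelCount_nonneg X c M m
    refine le_of_sq_le_sq ?_ (by positivity)
    rw [mul_pow (_ * _), sq_sqrt (levelAmpSq_nonneg X c M m), levelAmpSq]
    have hL : (0:ℝ) < 2 ^ m := by positivity
    rw [pow_succ (2:ℝ) m] at hc
    generalize levelCount X c M m = k at *
    generalize endpointDualNorm X c = N at *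
    generalize (2:ℝ) ^ m = L at *
    calc (k * (N / L ^ 26)) ^ 2 = k * (N ^ 2 * k) / L ^ 52 := by field_simp
      _ ≤ (L * 2) ^ 28 * (N ^ 2 * k) / L ^ 52 := by gcongr
      _ = _ := by field_simp

lemma sum_levelAmpSq_le {X : Finset ι} (c : ι → ℂ) {M : ℕ}
    (hM : (X.card : ℝ) ≤ (2 ^ M) ^ 28) :
    ∑ m ∈ range (M + 1), levelAmpSq X c M m ≤
      (2 ^ 28 + 1) * endpointDualNorm X c ^ 2 := by
  have hN := endpointDualNorm_nonneg X c
  rcases hN.eq_or_lt with h0 | h0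
  · simp [levelAmpSq, ← h0]
  rw [sum_range_succ, add_mul]
  refine add_le_add ?_ ?_
  · calc ∑ m ∈ range M, levelAmpSq X c M m
        = (∑ m ∈ range M, levelCount X c M m / (2 ^ (m + 1)) ^ 28) *
            (2 ^ 28 * endpointDualNorm X c ^ 2) := by
          rw [sum_mul]
          refine sum_congr rfl fun m _ => ?_
          rw [levelAmpSq, pow_succ (2:ℝ) m, mul_pow]
          field_simp
      _ ≤ 1 * (2 ^ 28 * endpointDualNorm X c ^ 2) := by
          gcongr
          exact sum_levelCount_div_le h0 M
      _ = _ := one_mul _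
  · rw [levelAmpSq, one_mul, div_le_iff₀ (by positivity)]
    gcongr
    exact (levelCount_le_card X c M M).trans hM

end Levels

lemma sum_min_two_pow_le (m n : ℕ) :
    ∑ l ∈ range n, min ((2:ℝ) ^ m / 2 ^ l) (2 ^ l / 2 ^ m) ≤ 4 := by
  have hup : ∀ k : ℕ, ∑ l ∈ range k, min ((2:ℝ) ^ m / 2 ^ (m + l)) (2 ^ (m + l) / 2 ^ m) ≤
      2 := fun k => by
    refine (sum_le_sum (g := fun l => (1 / 2 : ℝ) ^ l) fun l _ =>
      (min_le_left _ _).trans (le_of_eq ?_)).trans ?_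
    · rw [pow_add, div_mul_eq_div_div, div_self (by positivity), one_div_pow]
    · exact sum_geometric_two_le k
  have hlow : ∑ l ∈ range m, min ((2:ℝ) ^ m / 2 ^ l) (2 ^ l / 2 ^ m) ≤ 2 := by
    refine (sum_le_sum (g := fun l => (2:ℝ) ^ l / 2 ^ m) fun l _ =>
      min_le_right _ _).trans ?_
    rw [← sum_div, div_le_iff₀ (by positivity), geom_sum_eq (by norm_num)]
    have : (0:ℝ) < 2 ^ m := by positivity
    linarith
  refine (Finset.sum_le_sum_of_subset_of_nonneg (Finset.range_mono (Nat.le_add_left n m))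
    fun l _ _ => by positivity).trans ?_
  rw [Finset.sum_range_add]
  linarith [hup n]

section Family

variable {ι : Type*} {𝓗 : Type*} [NormedAddCommGroup 𝓗] [InnerProductSpace ℂ 𝓗]

/-- A time-dependent Bessel family whose correlations decay at the rate `|t - s|^(-7/6)`. -/
structure DispersiveFamily (v : ℝ → ι → 𝓗) (K : ℝ) : Prop where
  continuous : ∀ x, Continuous fun t => v t x
  bessel : ∀ (t : ℝ) (c : ι → ℂ) (X : Finset ι),
    ‖∑ x ∈ X, c x • v t x‖ ^ 2 ≤ K * ∑ x ∈ X, ‖c x‖ ^ 2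
  decay : ∀ s t, s ≠ t → ∀ x y, ‖inner ℂ (v s x) (v t y)‖ ≤ K * |t - s| ^ (-(7 / 6) : ℝ)
  one_le : 1 ≤ K

/-- Bounded measurable coefficient functions of compact time support. -/
structure IsTestFunction (φ : ℝ → ι → ℂ) : Prop where
  measurable : ∀ x, Measurable fun t => φ t x
  bounded : ∃ B, ∀ t x, ‖φ t x‖ ≤ B
  support : ∃ T, ∀ t, T < |t| → ∀ x, φ t x = 0

/-- The superposition of a finite part of the family `v`. -/
def synthesis (v : ℝ → ι → 𝓗) (X : Finset ι) (φ : ℝ → ι → ℂ) (t : ℝ) : 𝓗 :=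
  ∑ x ∈ X, φ t x • v t x

variable {v : ℝ → ι → 𝓗} {K : ℝ} {X Y : Finset ι} {φ ψ : ℝ → ι → ℂ}

lemma DispersiveFamily.pos (hv : DispersiveFamily v K) : 0 < K := one_pos.trans_le hv.one_le

lemma DispersiveFamily.norm_le (hv : DispersiveFamily v K) (t : ℝ) (x : ι) : ‖v t x‖ ≤ √K := by
  have h := hv.bessel t (fun _ => 1) {x}
  simp only [Finset.sum_singleton, one_smul, norm_one, one_pow, mul_one] at h
  exact le_sqrt_of_sq_le h

lemma IsTestFunction.of_norm_le (hφ : IsTestFunction φ) (hm : ∀ x, Measurable fun t => ψ t x)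
    {c : ℝ} (hc : 0 ≤ c) (h : ∀ t x, ‖ψ t x‖ ≤ c * ‖φ t x‖) : IsTestFunction ψ where
  measurable := hm
  bounded := by
    obtain ⟨B, hB⟩ := hφ.bounded
    exact ⟨c * B, fun t x => (h t x).trans (mul_le_mul_of_nonneg_left (hB t x) hc)⟩
  support := by
    obtain ⟨T, hT⟩ := hφ.support
    refine ⟨T, fun t ht x => norm_le_zero_iff.mp ((h t x).trans ?_)⟩
    rw [hT t ht x]; simp

lemma IsTestFunction.const_mul (hφ : IsTestFunction φ) (c : ℂ) :
    IsTestFunction fun t x => c * φ t x :=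
  hφ.of_norm_le (fun x => (hφ.measurable x).const_mul c) (norm_nonneg c) fun _ _ =>
    (norm_mul _ _).le

lemma IsTestFunction.indicator (hφ : IsTestFunction φ) {I : Set ℝ} (hI : MeasurableSet I) :
    IsTestFunction (I.indicator φ) := by
  have e : ∀ t x, I.indicator φ t x = I.indicator (fun t => φ t x) t := fun t x => by
    by_cases h : t ∈ I <;> simp [h]
  refine hφ.of_norm_le (fun x => ?_) zero_le_one fun t x => ?_
  · simp_rw [e]
    exact (hφ.measurable x).indicator hI
  · rw [e, one_mul]
    exact norm_indicator_le_norm_self _ _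

lemma measurable_endpointDualNorm (X : Finset ι) (hφ : ∀ x, Measurable fun t => φ t x) :
    Measurable fun t => endpointDualNorm X (φ t) := by
  unfold endpointDualNorm
  fun_prop

lemma IsTestFunction.measurable_levelPart (hφ : IsTestFunction φ) (X : Finset ι) (M m : ℕ) (x : ι) :
    Measurable fun t => levelPart X (φ t) M m x := by
  have := measurable_levelWeight M m (measurable_endpointDualNorm X hφ.measurable)
    (hφ.measurable x).norm
  exact (measurable_ofReal.comp this).mul (hφ.measurable x)

lemma IsTestFunction.levelPart (hφ : IsTestFunction φ) (X : Finset ι) (M m : ℕ) :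
    IsTestFunction fun t => levelPart X (φ t) M m := by
  refine hφ.of_norm_le (hφ.measurable_levelPart X M m) zero_le_one fun t x => ?_
  have hN := endpointDualNorm_nonneg X (φ t)
  rw [_root_.levelPart, norm_mul, norm_real,
    norm_of_nonneg (levelWeight_nonneg hN M m)]
  gcongr
  exact levelWeight_le_one hN M m

lemma IsTestFunction.integrable (hφ : IsTestFunction φ) (x : ι) : Integrable fun t => φ t x := by
  obtain ⟨B, hB⟩ := hφ.bounded
  obtain ⟨T, hT⟩ := hφ.support
  refine Integrable.mono' (g := (Icc (-T) T).indicator fun _ => B)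
    ((integrable_indicator_iff measurableSet_Icc).mpr
      (integrableOn_const (by simp))) (hφ.measurable x).aestronglyMeasurable
    (.of_forall fun t => ?_)
  by_cases h : t ∈ Icc (-T) T
  · simpa [h] using hB t x
  · rw [hT t (by rw [mem_Icc, ← abs_le] at h; exact not_le.mp h) x]
    simp [h]

lemma DispersiveFamily.integrable_synthesis (hv : DispersiveFamily v K) (X : Finset ι)
    (hφ : IsTestFunction φ) : Integrable (synthesis v X φ) := by
  refine integrable_finsetSum X fun x _ => ?_
  refine Integrable.mono' ((hφ.integrable x).norm.mul_const √K)
    ((hφ.measurable x).aestronglyMeasurable.smul (hv.continuous x).aestronglyMeasurable)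
    (.of_forall fun t => ?_)
  rw [norm_smul]
  exact mul_le_mul_of_nonneg_left (hv.norm_le t x) (norm_nonneg _)

lemma DispersiveFamily.norm_inner_sum_le (hv : DispersiveFamily v K) {s t : ℝ} (hst : s ≠ t)
    (X Y : Finset ι) (c d : ι → ℂ) :
    ‖inner ℂ (∑ x ∈ X, c x • v s x) (∑ y ∈ Y, d y • v t y)‖ ≤
      (∑ x ∈ X, ‖c x‖) * (∑ y ∈ Y, ‖d y‖) * (K * |t - s| ^ (-(7 / 6) : ℝ)) := by
  rw [sum_inner, Finset.sum_mul_sum, sum_mul]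
  refine norm_sum_le_of_le X fun x _ => ?_
  rw [inner_sum, sum_mul]
  refine norm_sum_le_of_le Y fun y _ => ?_
  rw [inner_smul_left, inner_smul_right, norm_mul, norm_mul, RCLike.norm_conj, ← mul_assoc]
  gcongr
  exact hv.decay s t hst x y

/-- The amplitude of the `m`-th level of a test function. -/
def levelAmp (K : ℝ) (X : Finset ι) (φ : ℝ → ι → ℂ) (M m : ℕ) (t : ℝ) : ℝ≥0∞ :=
  ofReal (√K * √(levelAmpSq X (φ t) M m))

lemma DispersiveFamily.enorm_inner_levels_le (hv : DispersiveFamily v K) {M m l : ℕ}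
    (hX : (X.card : ℝ) ≤ (2 ^ M) ^ 28) (hY : (Y.card : ℝ) ≤ (2 ^ M) ^ 28)
    (hm : m ≤ M) (hl : l ≤ M) {s t : ℝ} (hst : s ≠ t) :
    ‖inner ℂ (synthesis v X (fun t => _root_.levelPart X (φ t) M m) s)
      (synthesis v Y (fun t => _root_.levelPart Y (ψ t) M l) t)‖ₑ ≤
      ofReal (2 ^ 28 * ((2 ^ m) ^ 2 * (2 ^ l) ^ 2) * |t - s| ^ (-(7 / 6) : ℝ)) *
        (levelAmp K X φ M m s * levelAmp K Y ψ M l t) := by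
  have hK := hv.pos
  rw [levelAmp, levelAmp, ← ofReal_mul (by positivity), ← ofReal_mul (by positivity),
    ← ofReal_norm]
  refine ofReal_le_ofReal ((hv.norm_inner_sum_le hst X Y _ _).trans ?_)
  have h1 := sum_norm_levelPart_le (φ s) hX hm
  have h2 := sum_norm_levelPart_le (ψ t) hY hl
  have h3 : 0 ≤ |t - s| ^ (-(7 / 6) : ℝ) := by positivity
  calc _ ≤ 2 ^ 14 * (2 ^ m) ^ 2 * √(levelAmpSq X (φ s) M m) *
        (2 ^ 14 * (2 ^ l) ^ 2 * √(levelAmpSq Y (ψ t) M l)) * (K * |t - s| ^ (-(7 / 6) : ℝ)) := by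
        gcongr
    _ = 2 ^ 14 * (2 ^ m) ^ 2 * √(levelAmpSq X (φ s) M m) *
        (2 ^ 14 * (2 ^ l) ^ 2 * √(levelAmpSq Y (ψ t) M l)) *
          ((√K * √K) * |t - s| ^ (-(7 / 6) : ℝ)) := by rw [mul_self_sqrt hK.le]
    _ = _ := by ring

lemma DispersiveFamily.atom (hv : DispersiveFamily v K) (hφ : IsTestFunction φ) {M m : ℕ}
    (hX : (X.card : ℝ) ≤ (2 ^ M) ^ 28) (hm : m ≤ M) :
    DispersiveAtom (2 ^ 28) (2 ^ m) (synthesis v X fun t => levelPart X (φ t) M m)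
      (levelAmp K X φ M m) where
  pos := by positivity
  integrable := hv.integrable_synthesis X (hφ.levelPart X M m)
  measurable := by
    have hN := measurable_endpointDualNorm X hφ.measurable
    have : Measurable fun t => levelCount X (φ t) M m :=
      Finset.measurable_fun_sum X fun x _ => measurable_levelWeight M m hN (hφ.measurable x).norm
    unfold levelAmp levelAmpSq
    fun_prop
  size t := by
    have hK := hv.pos
    rw [levelAmp, ← ofReal_mul (by positivity), ← ofReal_norm]
    refine ofReal_le_ofReal (le_of_sq_le_sq ?_ (by positivity))
    refine (hv.bessel t _ X).trans ?_
    refine (mul_le_mul_of_nonneg_left (sum_norm_levelPart_sq_le X (φ t) M m) hK.le).trans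
      (le_of_eq ?_)
    rw [mul_pow, mul_pow, sq_sqrt hK.le, sq_sqrt (levelAmpSq_nonneg _ _ _ _)]
    field_simp
  decay s t hst := by
    have := hv.enorm_inner_levels_le (φ := φ) (ψ := φ) hX hX hm hm hst
    rwa [← pow_add] at this

lemma sum_lintegral_levelAmp_sq_le (hK : 0 ≤ K) (hφ : IsTestFunction φ) {M : ℕ}
    (hX : (X.card : ℝ) ≤ (2 ^ M) ^ 28)
    (hm : ∀ m ∈ range (M + 1), Measurable (levelAmp K X φ M m)) :
    ∑ m ∈ range (M + 1), ∫⁻ t, levelAmp K X φ M m t ^ 2 ≤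
      ofReal (K * (2 ^ 28 + 1)) * ∫⁻ t, ofReal (endpointDualNorm X (φ t) ^ 2) := by
  have hN := measurable_endpointDualNorm X hφ.measurable
  rw [← lintegral_finsetSum _ fun m h => (hm m h).pow_const 2,
    ← lintegral_const_mul _ (by fun_prop)]
  refine lintegral_mono fun t => ?_
  have h : ∀ m, levelAmp K X φ M m t ^ 2 = ofReal (K * levelAmpSq X (φ t) M m) := fun m => by
    rw [levelAmp, ← ofReal_pow (by positivity), mul_pow, sq_sqrt hK,
      sq_sqrt (levelAmpSq_nonneg _ _ _ _)]
  simp_rw [h]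
  rw [← ofReal_sum_of_nonneg fun m _ => mul_nonneg hK (levelAmpSq_nonneg _ _ _ _),
    ← ofReal_mul (by positivity), ← mul_sum, mul_assoc]
  exact ofReal_le_ofReal (mul_le_mul_of_nonneg_left (sum_levelAmpSq_le _ hX) hK)

lemma synthesis_eq_sum_levels (v : ℝ → ι → 𝓗) (X : Finset ι) (φ : ℝ → ι → ℂ) (M : ℕ) :
    synthesis v X φ = fun t => ∑ m ∈ range (M + 1),
      synthesis v X (fun t => levelPart X (φ t) M m) t := by
  funext t
  unfold synthesis
  rw [sum_comm]
  refine sum_congr rfl fun x hx => ?_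
  rw [← Finset.sum_smul, sum_levelPart (φ t) M hx]

variable [CompleteSpace 𝓗]

lemma integrable_inner_setIntegral_Iic {F G : ℝ → 𝓗} (hF : Integrable F) (hG : Integrable G) :
    Integrable fun t => inner ℂ (∫ s in Iic t, F s) (G t) := by
  set S : Set (ℝ × ℝ) := {p | p.1 ≤ p.2} with hS
  have hSm : MeasurableSet S := measurableSet_le measurable_fst measurable_snd
  have hint := ((integrable_inner_prod hF hG).indicator hSm).integral_prod_right
  refine hint.congr (.of_forall fun t => ?_)
  dsimp only
  rw [inner_integral_left hF.integrableOn, ← integral_indicator measurableSet_Iic]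
  bound

lemma retardedForm_sum {κ : Type*} (A B : Finset κ) {F G : κ → ℝ → 𝓗}
    (hF : ∀ m ∈ A, Integrable (F m)) (hG : ∀ l ∈ B, Integrable (G l)) :
    retardedForm (fun t => ∑ m ∈ A, F m t) (fun t => ∑ l ∈ B, G l t) =
      ∑ m ∈ A, ∑ l ∈ B, retardedForm (F m) (G l) := by
  unfold retardedForm
  have h : ∀ t, inner ℂ (∫ s in Iic t, ∑ m ∈ A, F m s) (∑ l ∈ B, G l t) =
      ∑ m ∈ A, ∑ l ∈ B, inner ℂ (∫ s in Iic t, F m s) (G l t) := fun t => by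
    rw [integral_finsetSum _ fun m hm => (hF m hm).integrableOn, sum_inner]
    simp_rw [inner_sum]
  simp_rw [h]
  rw [integral_finsetSum _ fun m hm => integrable_finsetSum _ fun l hl =>
    integrable_inner_setIntegral_Iic (hF m hm) (hG l hl)]
  refine sum_congr rfl fun m hm => ?_
  rw [integral_finsetSum _ fun l hl => integrable_inner_setIntegral_Iic (hF m hm) (hG l hl)]

/-- The constant in the retarded endpoint estimate. -/
def retardedConst (K : ℝ) : ℝ := (4 + 30 * 2 ^ 28) * 4 * (K * (2 ^ 28 + 1))

/-- The retarded endpoint estimate in additive form. -/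
theorem DispersiveFamily.enorm_retardedForm_le (hv : DispersiveFamily v K)
    (hφ : IsTestFunction φ) (hψ : IsTestFunction ψ) :
    ‖retardedForm (synthesis v X φ) (synthesis v Y ψ)‖ₑ ≤ ofReal (retardedConst K) *
      ((∫⁻ t, ofReal (endpointDualNorm X (φ t) ^ 2)) +
        ∫⁻ t, ofReal (endpointDualNorm Y (ψ t) ^ 2)) := by
  have hK := hv.pos
  obtain ⟨M, hX, hY⟩ : ∃ M : ℕ, (X.card : ℝ) ≤ (2 ^ M) ^ 28 ∧ (Y.card : ℝ) ≤ (2 ^ M) ^ 28 := by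
    have h : ∀ k M : ℕ, k ≤ M → (k : ℝ) ≤ (2 ^ M) ^ 28 := fun k M h => by
      have h1 : (k : ℝ) ≤ 2 ^ M := by
        exact_mod_cast h.trans (Nat.lt_two_pow_self).le
      exact h1.trans (le_self_pow₀ (one_le_pow₀ (by norm_num)) (by norm_num))
    exact ⟨max X.card Y.card, h _ _ (le_max_left _ _), h _ _ (le_max_right _ _)⟩
  have hle : ∀ m ∈ range (M + 1), m ≤ M := fun m hm =>
    Nat.lt_succ_iff.mp (mem_range.mp hm)
  have hF := fun m hm => hv.atom (X := X) hφ hX (hle m hm)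
  have hG := fun m hm => hv.atom (X := Y) hψ hY (hle m hm)
  rw [synthesis_eq_sum_levels v X φ M, synthesis_eq_sum_levels v Y ψ M,
    retardedForm_sum _ _ (fun m hm => (hF m hm).integrable) fun m hm => (hG m hm).integrable]
  set A := fun m => ∫⁻ t, levelAmp K X φ M m t ^ 2
  set B := fun m => ∫⁻ t, levelAmp K Y ψ M m t ^ 2
  set q := fun m l : ℕ => ofReal (min ((2:ℝ) ^ m / 2 ^ l) (2 ^ l / 2 ^ m)) with hq
  have hsum : ∀ m, ∑ l ∈ range (M + 1), q m l ≤ 4 := fun m => by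
    rw [hq, ← ofReal_sum_of_nonneg fun l _ => by positivity]
    refine (ofReal_le_ofReal (sum_min_two_pow_le m _)).trans ?_
    simp
  have hsymm : ∀ m l, q m l = q l m := fun m l => by simp only [hq, min_comm]
  calc _ ≤ ∑ m ∈ range (M + 1), ∑ l ∈ range (M + 1),
        ofReal (4 + 30 * 2 ^ 28) * (q m l * (A m + B l)) := by
        refine (enorm_sum_le _ _).trans (sum_le_sum fun m hm => ?_)
        refine (enorm_sum_le _ _).trans (sum_le_sum fun l hl => ?_)
        refine (norm_retardedForm_atoms_le (hF m hm) (hG l hl) (by positivity) fun s t hst =>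
          hv.enorm_inner_levels_le hX hY (hle m hm) (hle l hl) hst.ne).trans (le_of_eq ?_)
        rw [ofReal_mul (by positivity), mul_assoc]
    _ = ofReal (4 + 30 * 2 ^ 28) * (∑ m ∈ range (M + 1),
          (∑ l ∈ range (M + 1), q m l) * A m + ∑ l ∈ range (M + 1),
          (∑ m ∈ range (M + 1), q l m) * B l) := by
        simp_rw [← mul_sum, mul_add, Finset.sum_add_distrib, sum_mul]
        rw [sum_comm (f := fun m l => q m l * B l), ← mul_add]
        congr 2
        exact sum_congr rfl fun l _ => sum_congr rfl fun m _ => by rw [hsymm]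
    _ ≤ ofReal (4 + 30 * 2 ^ 28) * (∑ m ∈ range (M + 1), 4 * A m +
          ∑ l ∈ range (M + 1), 4 * B l) := by
        gcongr <;> exact hsum _
    _ ≤ ofReal (4 + 30 * 2 ^ 28) *
          (4 * (ofReal (K * (2 ^ 28 + 1)) *
            ∫⁻ t, ofReal (endpointDualNorm X (φ t) ^ 2)) +
          4 * (ofReal (K * (2 ^ 28 + 1)) *
            ∫⁻ t, ofReal (endpointDualNorm Y (ψ t) ^ 2))) := by
        rw [← mul_sum, ← mul_sum]
        gcongr
        · exact sum_lintegral_levelAmp_sq_le hK.le hφ hX fun m hm => (hF m hm).measurable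
        · exact sum_lintegral_levelAmp_sq_le hK.le hψ hY fun m hm => (hG m hm).measurable
    _ = _ := by
        have h4 : ofReal 4 = 4 := by simp
        rw [retardedConst, ofReal_mul (p := (4 + 30 * 2 ^ 28) * 4) (by positivity),
          ofReal_mul (p := 4 + 30 * 2 ^ 28) (by positivity), h4]
        ring

end Family

section EndpointDuality

variable {ι : Type*}

/-- The `ℓ^14` norm over a finite set. -/
def endpointNorm (Y : Finset ι) (w : ι → ℂ) : ℝ := (∑ y ∈ Y, ‖w y‖ ^ 14) ^ (1 / 14 : ℝ)

lemma endpointNorm_nonneg (Y : Finset ι) (w : ι → ℂ) : 0 ≤ endpointNorm Y w := by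
  unfold endpointNorm; positivity

lemma endpointNorm_pow (Y : Finset ι) (w : ι → ℂ) :
    endpointNorm Y w ^ 14 = ∑ y ∈ Y, ‖w y‖ ^ 14 := by
  rw [endpointNorm, ← rpow_natCast, ← rpow_mul (by positivity)]
  norm_num

lemma norm_le_endpointNorm {Y : Finset ι} (w : ι → ℂ) {y : ι} (hy : y ∈ Y) :
    ‖w y‖ ≤ endpointNorm Y w := by
  have h := single_le_sum (f := fun y => ‖w y‖ ^ 14) (fun i _ => by positivity) hy
  rw [← endpointNorm_pow] at h
  exact le_of_pow_le_pow_left₀ (by norm_num) (endpointNorm_nonneg Y w) h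

lemma eLpNorm_fourteen_sq [MeasurableSpace ι] [MeasurableSingletonClass ι] (w : ι → ℂ) :
    eLpNorm w 14 count ^ 2 = ⨆ Y : Finset ι, ofReal (endpointNorm Y w ^ 2) := by
  have h : ∀ Y : Finset ι, ofReal (endpointNorm Y w ^ 2) =
      ENNReal.orderIsoRpow (1 / 7) (by norm_num) (∑ y ∈ Y, ‖w y‖ₑ ^ (14 : ℝ)) := fun Y => by
    have e : ∑ y ∈ Y, ‖w y‖ₑ ^ (14 : ℝ) = ofReal (∑ y ∈ Y, ‖w y‖ ^ 14) := by
      rw [ofReal_sum_of_nonneg fun _ _ => by positivity]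
      simp
    rw [e, ENNReal.orderIsoRpow_apply, ENNReal.ofReal_rpow_of_nonneg (by positivity) (by norm_num),
      endpointNorm, ← rpow_natCast, ← rpow_mul (by positivity)]
    norm_num
  simp_rw [h]
  rw [← OrderIso.map_iSup, ← tsum_eq_iSup_sum, ENNReal.orderIsoRpow_apply,
    eLpNorm_eq_lintegral_rpow_enorm_toReal (by norm_num) (by norm_num), lintegral_count,
    ← ENNReal.rpow_natCast, ← ENNReal.rpow_mul]
  norm_num

/-- The function dual to `w` in the `ℓ^14` norm over `Y`. -/
def dualCoeff (Y : Finset ι) (w : ι → ℂ) : ι → ℂ :=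
  (Y : Set ι).indicator fun y => w y * ((‖w y‖ ^ 12 / endpointNorm Y w ^ 12 : ℝ) : ℂ)

lemma norm_dualCoeff {Y : Finset ι} (w : ι → ℂ) {y : ι} (hy : y ∈ Y) :
    ‖dualCoeff Y w y‖ = ‖w y‖ ^ 13 / endpointNorm Y w ^ 12 := by
  have hP := endpointNorm_nonneg Y w
  rw [dualCoeff, indicator_of_mem (by simpa using hy), norm_mul, norm_real,
    norm_of_nonneg (by positivity)]
  ring

lemma pow_div_pow_self {P : ℝ} (m n : ℕ) (hn : n ≠ 0) : P ^ (m + n) / P ^ m = P ^ n := by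
  rcases eq_or_ne P 0 with rfl | h
  · simp [hn]
  · rw [pow_add, mul_div_cancel_left₀ _ (pow_ne_zero _ h)]

lemma norm_dualCoeff_le (Y : Finset ι) (w : ι → ℂ) (y : ι) :
    ‖dualCoeff Y w y‖ ≤ endpointNorm Y w := by
  have hP := endpointNorm_nonneg Y w
  by_cases hy : y ∈ Y
  · rw [norm_dualCoeff w hy]
    calc ‖w y‖ ^ 13 / endpointNorm Y w ^ 12 ≤ endpointNorm Y w ^ 13 / endpointNorm Y w ^ 12 := by
          gcongr
          exact norm_le_endpointNorm w hy
      _ = _ := by field_simp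
  · rw [dualCoeff, indicator_of_notMem (by simpa using hy)]
    simpa using hP

lemma sum_conj_dualCoeff_mul (Y : Finset ι) (w : ι → ℂ) :
    ∑ y ∈ Y, conj (dualCoeff Y w y) * w y = ((endpointNorm Y w ^ 2 : ℝ) : ℂ) := by
  rw [← pow_div_pow_self 12 2 two_ne_zero, endpointNorm_pow, sum_div, ofReal_sum]
  refine sum_congr rfl fun y hy => ?_
  rw [dualCoeff, indicator_of_mem (by simpa using hy), map_mul, conj_ofReal,
    mul_right_comm, mul_comm (conj (w y)), Complex.mul_conj, ← Complex.ofReal_mul,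
    Complex.normSq_eq_norm_sq]
  congr 1
  ring

lemma endpointDualNorm_dualCoeff (Y : Finset ι) (w : ι → ℂ) :
    endpointDualNorm Y (dualCoeff Y w) = endpointNorm Y w := by
  have hP := endpointNorm_nonneg Y w
  have h : ∑ y ∈ Y, ‖dualCoeff Y w y‖ ^ (14 / 13 : ℝ) =
      endpointNorm Y w ^ 14 / (endpointNorm Y w ^ 12) ^ (14 / 13 : ℝ) := by
    rw [endpointNorm_pow, sum_div]
    refine sum_congr rfl fun y hy => ?_
    rw [norm_dualCoeff w hy, div_rpow (by positivity) (by positivity),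
      ← rpow_natCast _ 13, ← rpow_mul (norm_nonneg _)]
    norm_num
  rw [endpointDualNorm, h, div_rpow (by positivity) (by positivity),
    ← rpow_mul (by positivity)]
  have e : (endpointNorm Y w ^ 14) ^ (13 / 14 : ℝ) = endpointNorm Y w ^ 13 := by
    rw [← rpow_natCast _ 14, ← rpow_mul hP]
    norm_num
  rw [e]
  norm_num
  field_simp

lemma le_of_sq_le_mul_self {I S : ℝ≥0∞} (hI : I ≠ ∞) (h : I ^ 2 ≤ S * I) : I ≤ S := by
  rcases eq_or_ne I 0 with rfl | h0
  · exact zero_le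
  · rw [sq] at h
    exact (ENNReal.mul_le_mul_iff_left h0 hI).mp h

lemma measurable_endpointNorm (Y : Finset ι) {w : ℝ → ι → ℂ}
    (hm : ∀ y, Measurable fun s => w s y) : Measurable fun s => endpointNorm Y (w s) := by
  unfold endpointNorm
  fun_prop

/-- Duality for the mixed norm `L²ℓ^14`. -/
theorem lintegral_eLpNorm_sq_le_of_dual [Countable ι] [MeasurableSpace ι]
    [MeasurableSingletonClass ι] {w : ℝ → ι → ℂ} (hm : ∀ y, Measurable fun s => w s y)
    {B : ℝ} (hB : ∀ s y, ‖w s y‖ ≤ B) {S : ℝ≥0∞}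
    (h : ∀ (Y : Finset ι) (φ : ℝ → ι → ℂ), IsTestFunction φ →
      ‖∫ s, ∑ y ∈ Y, conj (φ s y) * w s y‖ₑ ^ 2 ≤
        S * ∫⁻ s, ofReal (endpointDualNorm Y (φ s) ^ 2)) :
    ∫⁻ s, eLpNorm (w s) 14 count ^ 2 ≤ S := by
  have hB0 : ∀ Y : Finset ι, ∀ s, endpointNorm Y (w s) ≤ (Y.card * |B| ^ 14) ^ (1 / 14 : ℝ) :=
    fun Y s => by
    refine rpow_le_rpow (by positivity) ?_ (by norm_num)
    rw [← nsmul_eq_mul]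
    refine Finset.sum_le_card_nsmul _ _ _ fun y _ => ?_
    gcongr
    exact (hB s y).trans (le_abs_self B)
  have hP := fun Y => measurable_endpointNorm Y hm
  have key : ∀ (Y : Finset ι) (n : ℕ),
      ∫⁻ s in Icc (-n : ℝ) n, ofReal (endpointNorm Y (w s) ^ 2) ≤ S := fun Y n => by
    set J := Icc (-n : ℝ) n
    have hJ : MeasurableSet J := measurableSet_Icc
    set φ : ℝ → ι → ℂ := J.indicator fun s => dualCoeff Y (w s) with hφ
    have hφt : IsTestFunction φ := by
      refine ⟨fun y => ?_, ⟨(Y.card * |B| ^ 14) ^ (1 / 14 : ℝ), fun s y => ?_⟩, n, fun s hs y => ?_⟩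
      · have e : (fun s => φ s y) = J.indicator fun s => dualCoeff Y (w s) y := by
          funext s
          by_cases hs : s ∈ J <;> simp [hφ, hs]
        rw [e]
        refine Measurable.indicator ?_ hJ
        by_cases hy : y ∈ Y
        · simp only [dualCoeff, indicator_of_mem (show y ∈ (Y : Set ι) by simpa using hy)]
          fun_prop
        · simp only [dualCoeff, indicator_of_notMem (show y ∉ (Y : Set ι) by simpa using hy)]
          exact measurable_const
      · refine le_trans ?_ (hB0 Y s)
        by_cases hs : s ∈ J
        · simpa [hφ, hs] using norm_dualCoeff_le Y (w s) y
        · simpa [hφ, hs] using endpointNorm_nonneg Y (w s)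
      · have : s ∉ J := by
          rw [mem_Icc, ← abs_le]; exact not_le.mpr hs
        simp [hφ, this]
    have hfin : IntegrableOn (fun s => endpointNorm Y (w s) ^ 2) J := by
      refine IntegrableOn.of_bound (by simp [J]) ((hP Y).pow_const 2).aestronglyMeasurable
        (((Y.card * |B| ^ 14) ^ (1 / 14 : ℝ)) ^ 2) (.of_forall fun s => ?_)
      rw [norm_pow, norm_of_nonneg (endpointNorm_nonneg _ _)]
      exact pow_le_pow_left₀ (endpointNorm_nonneg _ _) (hB0 Y s) 2
    have hI : ofReal (∫ s in J, endpointNorm Y (w s) ^ 2) =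
        ∫⁻ s in J, ofReal (endpointNorm Y (w s) ^ 2) :=
      ofReal_integral_eq_lintegral_ofReal hfin
        (.of_forall fun s => by positivity)
    have e1 : ∫ s, ∑ y ∈ Y, conj (φ s y) * w s y =
        ((∫ s in J, endpointNorm Y (w s) ^ 2 : ℝ) : ℂ) := by
      rw [← integral_complex_ofReal, ← integral_indicator hJ]
      congr 1
      funext s
      by_cases hs : s ∈ J
      · simpa [hφ, hs] using sum_conj_dualCoeff_mul Y (w s)
      · simp [hφ, hs]
    have e2 : ∫⁻ s, ofReal (endpointDualNorm Y (φ s) ^ 2) =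
        ∫⁻ s in J, ofReal (endpointNorm Y (w s) ^ 2) := by
      rw [← lintegral_indicator hJ]
      congr 1
      funext s
      by_cases hs : s ∈ J
      · simp [hφ, hs, endpointDualNorm_dualCoeff]
      · simp [hφ, hs, endpointDualNorm]
    have h1 := h Y φ hφt
    rw [e1, e2, ← ofReal_norm, norm_real,
      norm_of_nonneg (integral_nonneg fun s => by positivity), hI] at h1
    exact le_of_sq_le_mul_self (hI ▸ ofReal_ne_top) h1
  simp_rw [eLpNorm_fourteen_sq]
  rw [lintegral_iSup_directed (fun Y => ((hP Y).pow_const 2).ennreal_ofReal.aemeasurable)]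
  · refine iSup_le fun Y => ?_
    have hU : ⋃ n : ℕ, Icc (-n : ℝ) n = univ := by
      refine Set.eq_univ_of_forall fun s => Set.mem_iUnion.mpr ?_
      obtain ⟨n, hn⟩ := exists_nat_ge |s|
      exact ⟨n, abs_le.mp hn⟩
    rw [← setLIntegral_univ, ← hU, setLIntegral_iUnion_of_directed]
    · exact iSup_le fun n => key Y n
    · refine Monotone.directed_le fun m n hmn => ?_
      gcongr
  · refine Monotone.directed_le fun Y Z hYZ s => ?_
    refine ofReal_le_ofReal (pow_le_pow_left₀ (endpointNorm_nonneg _ _) ?_ 2)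
    exact rpow_le_rpow (by positivity)
      (Finset.sum_le_sum_of_subset_of_nonneg hYZ fun _ _ _ => by positivity) (by norm_num)

end EndpointDuality

lemma ENNReal.sq_le_of_forall_le_weighted {T A B : ℝ≥0∞} {C : ℝ} (hC : 0 ≤ C) (hA : A ≠ ∞)
    (hB : B ≠ ∞)
    (h : ∀ l : ℝ, 0 < l → T ≤ ofReal C *
      (ofReal (l ^ 2) * A + ofReal ((l⁻¹) ^ 2) * B)) :
    T ^ 2 ≤ ofReal (4 * C ^ 2) * (A * B) := by
  have hT : T ≠ ∞ := by
    refine ne_top_of_le_ne_top ?_ (h 1 one_pos)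
    simpa using mul_ne_top ofReal_ne_top (ENNReal.add_ne_top.mpr ⟨hA, hB⟩)
  lift T to NNReal using hT
  lift A to NNReal using hA
  lift B to NNReal using hB
  have h' : ∀ l : ℝ, 0 < l → (T : ℝ) ≤ C * (l ^ 2 * A + (l⁻¹) ^ 2 * B) := fun l hl => by
    have := h l hl
    rw [← ofReal_coe_nnreal, ← ofReal_coe_nnreal, ← ofReal_coe_nnreal,
      ← ofReal_mul (by positivity), ← ofReal_mul (by positivity),
      ← ENNReal.ofReal_add (by positivity) (by positivity), ← ofReal_mul hC,
      ENNReal.ofReal_le_ofReal_iff (by positivity)] at this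
    exact this
  have hq : ∀ x : ℝ, 0 ≤ C * A * (x * x) + (-T) * x + C * B := fun x => by
    rcases le_or_gt x 0 with hx | hx
    · have : 0 ≤ -(T : ℝ) * x := mul_nonneg_of_nonpos_of_nonpos (by simp) hx
      have h1 : 0 ≤ C * A * (x * x) := by
        have := mul_self_nonneg x
        positivity
      positivity
    · have h1 := h' (√x) (Real.sqrt_pos.mpr hx)
      rw [inv_pow, Real.sq_sqrt hx.le] at h1
      have h2 := mul_le_mul_of_nonneg_right h1 hx.le
      have h3 : C * (x * A + x⁻¹ * B) * x = C * A * (x * x) + C * B := by field_simp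
      linarith
  have hd := discrim_le_zero hq
  rw [discrim] at hd
  rw [← ofReal_coe_nnreal, ← ofReal_coe_nnreal, ← ofReal_coe_nnreal,
    ← ofReal_pow (by positivity), ← ofReal_mul (by positivity),
    ← ofReal_mul (by positivity)]
  refine ofReal_le_ofReal ?_
  nlinarith

section Exports

variable {ι : Type*} {𝓗 : Type*} [NormedAddCommGroup 𝓗] [InnerProductSpace ℂ 𝓗]
variable {v : ℝ → ι → 𝓗} {K : ℝ} {X Y : Finset ι} {φ ψ : ℝ → ι → ℂ}

/-- The squared dual endpoint norm of a test function. -/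
def testNormSq (X : Finset ι) (φ : ℝ → ι → ℂ) : ℝ≥0∞ :=
  ∫⁻ t, ofReal (endpointDualNorm X (φ t) ^ 2)

lemma endpointDualNorm_const_mul (X : Finset ι) (c : ℂ) (d : ι → ℂ) :
    endpointDualNorm X (fun x => c * d x) = ‖c‖ * endpointDualNorm X d := by
  unfold endpointDualNorm
  simp_rw [norm_mul]
  rw [sum_congr rfl fun x _ => mul_rpow (norm_nonneg c) (norm_nonneg (d x)),
    ← mul_sum, mul_rpow (by positivity) (by positivity),
    ← rpow_mul (norm_nonneg c)]
  norm_num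

lemma testNormSq_const_mul (X : Finset ι) (hφ : IsTestFunction φ) (c : ℂ) :
    testNormSq X (fun t x => c * φ t x) = ofReal (‖c‖ ^ 2) * testNormSq X φ := by
  have hN := measurable_endpointDualNorm X hφ.measurable
  unfold testNormSq
  rw [← lintegral_const_mul _ (by fun_prop)]
  refine lintegral_congr fun t => ?_
  rw [endpointDualNorm_const_mul, mul_pow, ofReal_mul (by positivity)]

lemma testNormSq_ne_top (X : Finset ι) (hφ : IsTestFunction φ) : testNormSq X φ ≠ ∞ := by
  obtain ⟨B, hB⟩ := hφ.bounded
  obtain ⟨T, hT⟩ := hφ.support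
  have hN := measurable_endpointDualNorm X hφ.measurable
  set b := ((∑ _x ∈ X, |B| ^ (14 / 13 : ℝ)) ^ (13 / 14 : ℝ)) with hb
  refine ne_top_of_le_ne_top (b := ∫⁻ _t in Icc (-T) T, ofReal (b ^ 2)) ?_ ?_
  · rw [setLIntegral_const]
    exact mul_ne_top ofReal_ne_top (by simp)
  · rw [testNormSq, ← lintegral_indicator measurableSet_Icc]
    refine lintegral_mono fun t => ?_
    by_cases h : t ∈ Icc (-T) T
    · rw [indicator_of_mem h]
      refine ofReal_le_ofReal (pow_le_pow_left₀ (endpointDualNorm_nonneg _ _) ?_ 2)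
      refine rpow_le_rpow (by positivity) (sum_le_sum fun x _ => ?_) (by norm_num)
      exact rpow_le_rpow (norm_nonneg _) ((hB t x).trans (le_abs_self B)) (by norm_num)
    · have h0 := hT t (by rw [mem_Icc, ← abs_le] at h; exact not_le.mp h)
      simp [endpointDualNorm, h0]

lemma synthesis_const_mul (v : ℝ → ι → 𝓗) (X : Finset ι) (φ : ℝ → ι → ℂ) (c : ℂ) :
    synthesis v X (fun t x => c * φ t x) = fun t => c • synthesis v X φ t := by
  funext t
  simp [synthesis, Finset.smul_sum, mul_smul]

lemma DispersiveFamily.sum_norm_inner_sq_le (hv : DispersiveFamily v K) (t : ℝ) (h : 𝓗)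
    (X : Finset ι) : ∑ x ∈ X, ‖inner ℂ (v t x) h‖ ^ 2 ≤ K * ‖h‖ ^ 2 := by
  have hK := hv.pos
  set c : ι → ℂ := fun x => inner ℂ (v t x) h
  set A := ∑ x ∈ X, ‖c x‖ ^ 2
  have hA : 0 ≤ A := by positivity
  have h1 : inner ℂ (∑ x ∈ X, c x • v t x) h = (A : ℂ) := by
    rw [sum_inner, ofReal_sum]
    refine sum_congr rfl fun x _ => ?_
    rw [inner_smul_left, mul_comm]
    simpa [c] using Complex.mul_conj' (c x)
  have h2 : A ≤ ‖∑ x ∈ X, c x • v t x‖ * ‖h‖ := by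
    have := norm_inner_le_norm (𝕜 := ℂ) (∑ x ∈ X, c x • v t x) h
    rwa [h1, norm_real, norm_of_nonneg hA] at this
  have h3 := hv.bessel t c X
  have h4 : A ^ 2 ≤ K * A * ‖h‖ ^ 2 := by nlinarith
  rcases hA.eq_or_lt with h0 | h0
  · rw [← h0]; positivity
  nlinarith

lemma retardedForm_const_mul (c d : ℂ) (F G : ℝ → 𝓗) :
    retardedForm (fun t => c • F t) (fun t => d • G t) =
      (starRingEnd ℂ c) * d * retardedForm F G := by
  unfold retardedForm
  rw [← integral_const_mul]
  congr 1
  funext t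
  rw [integral_smul, inner_smul_left, inner_smul_right, mul_assoc]

lemma sum_conj_mul_inner (v : ℝ → ι → 𝓗) (Y : Finset ι) (φ : ℝ → ι → ℂ) (H : ℝ → 𝓗) :
    (fun s => ∑ y ∈ Y, conj (φ s y) * inner ℂ (v s y) (H s)) =
      fun s => inner ℂ (synthesis v Y φ s) (H s) := by
  funext s
  rw [synthesis, sum_inner]
  simp_rw [inner_smul_left]

lemma continuous_setIntegral_Ici {F : ℝ → 𝓗} (hF : Integrable F) :
    Continuous fun s => ∫ t in Ici s, F t := by
  have h : ∀ s, ∫ t in Ici s, F t = (∫ t in Ioi 0, F t) - ∫ t in (0:ℝ)..s, F t :=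
    fun s => by
    rw [integral_Ici_eq_integral_Ioi, eq_sub_iff_add_eq, add_comm]
    exact intervalIntegral.integral_interval_add_Ioi hF.integrableOn hF.integrableOn
  simp_rw [h]
  exact continuous_const.sub
    (intervalIntegral.continuous_primitive (fun a b => hF.intervalIntegrable) 0)

variable [CompleteSpace 𝓗]

theorem DispersiveFamily.enorm_retardedForm_sq_le (hv : DispersiveFamily v K)
    (hφ : IsTestFunction φ) (hψ : IsTestFunction ψ) :
    ‖retardedForm (synthesis v X φ) (synthesis v Y ψ)‖ₑ ^ 2 ≤
      ofReal (4 * retardedConst K ^ 2) * (testNormSq X φ * testNormSq Y ψ) := by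
  have hK := hv.pos
  refine ENNReal.sq_le_of_forall_le_weighted (by unfold retardedConst; positivity)
    (testNormSq_ne_top X hφ) (testNormSq_ne_top Y hψ) fun l hl => ?_
  have h := hv.enorm_retardedForm_le (X := X) (Y := Y) (hφ.const_mul (l : ℂ))
    (hψ.const_mul ((l⁻¹ : ℝ) : ℂ))
  rw [synthesis_const_mul, synthesis_const_mul, retardedForm_const_mul, conj_ofReal,
    ← Complex.ofReal_mul, mul_inv_cancel₀ hl.ne', ofReal_one, one_mul] at h
  refine h.trans (le_of_eq ?_)
  have e1 := testNormSq_const_mul X hφ (l : ℂ)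
  have e2 := testNormSq_const_mul Y hψ ((l⁻¹ : ℝ) : ℂ)
  rw [norm_real, norm_eq_abs, sq_abs] at e1 e2
  rw [← e1, ← e2, testNormSq, testNormSq]

lemma inner_integral_eq_retardedForm {F : ℝ → 𝓗} (hF : Integrable F) :
    inner ℂ (∫ t, F t) (∫ t, F t) =
      retardedForm F F + conj (retardedForm F F) := by
  have h1 : ∀ s, (∫ t, F t) = (∫ t in Iio s, F t) + ∫ t in Ici s, F t := fun s =>
    (intervalIntegral.integral_Iio_add_Ici hF.integrableOn hF.integrableOn).symm
  have h2 : ∀ s, inner ℂ (F s) (∫ t, F t) = conj (inner ℂ (∫ t in Iic s, F t) (F s)) +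
      inner ℂ (F s) (∫ t in Ici s, F t) := fun s => by
    conv_lhs => rw [h1 s]
    rw [inner_add_right, inner_conj_symm, integral_Iic_eq_integral_Iio]
  have hi1 := integrable_inner_setIntegral_Iic hF hF
  have hi1' : Integrable fun s => conj (inner ℂ (∫ t in Iic s, F t) (F s)) :=
    (LinearIsometryEquiv.integrable_comp_iff Complex.conjLIE).mpr hi1
  have hi : Integrable fun s => inner ℂ (F s) (∫ t, F t) :=
    hF.inner_const _
  rw [inner_integral_left hF, retardedForm_eq_integral_right hF hF]
  nth_rewrite 2 [← retardedForm_eq_integral_right hF hF]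
  rw [retardedForm, ← integral_conj, ← integral_add]
  · refine integral_congr_ae (.of_forall fun s => ?_)
    exact (h2 s).trans (add_comm _ _)
  · simp_all
  · exact hi1'

/-- The constant in the homogeneous endpoint estimate. -/
def endpointConst (K : ℝ) : ℝ := 4 * retardedConst K

/-- The dual homogeneous endpoint estimate. -/
theorem DispersiveFamily.enorm_integral_sq_le (hv : DispersiveFamily v K)
    (hφ : IsTestFunction φ) :
    ‖∫ t, synthesis v X φ t‖ₑ ^ 2 ≤ ofReal (endpointConst K) * testNormSq X φ := by
  have hK := hv.pos
  have h := hv.enorm_retardedForm_le (X := X) (Y := X) hφ hφ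
  rw [enorm_sq_eq_enorm_inner, inner_integral_eq_retardedForm (hv.integrable_synthesis X hφ)]
  refine (enorm_add_le _ _).trans ?_
  rw [RCLike.enorm_conj]
  refine (add_le_add h h).trans (le_of_eq ?_)
  have h4 : ofReal 4 = 4 := by simp
  rw [endpointConst, ofReal_mul (by positivity), h4, testNormSq]
  ring

/-- The homogeneous endpoint estimate. -/
theorem DispersiveFamily.lintegral_eLpNorm_inner_sq_le [Countable ι] [MeasurableSpace ι]
    [MeasurableSingletonClass ι] (hv : DispersiveFamily v K) (h : 𝓗) :
    ∫⁻ s, eLpNorm (fun y => inner ℂ (v s y) h) 14 count ^ 2 ≤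
      ofReal (endpointConst K) * ‖h‖ₑ ^ 2 := by
  refine lintegral_eLpNorm_sq_le_of_dual (B := √K * ‖h‖)
    (fun y => ((hv.continuous y).inner continuous_const).measurable) (fun s y => ?_)
    fun Y φ hφ => ?_
  · refine (norm_inner_le_norm _ _).trans ?_
    gcongr
    exact hv.norm_le s y
  · rw [sum_conj_mul_inner v Y φ fun _ => h,
      ← inner_integral_left (hv.integrable_synthesis Y hφ)]
    calc _ ≤ (‖∫ s, synthesis v Y φ s‖ₑ * ‖h‖ₑ) ^ 2 := by
          gcongr
          exact enorm_inner_le _ _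
      _ = ‖∫ s, synthesis v Y φ s‖ₑ ^ 2 * ‖h‖ₑ ^ 2 := mul_pow _ _ _
      _ ≤ ofReal (endpointConst K) * testNormSq Y φ * ‖h‖ₑ ^ 2 := by
          gcongr
          exact hv.enorm_integral_sq_le hφ
      _ = _ := by rw [testNormSq]; ring

/-- The retarded endpoint estimate. -/
theorem DispersiveFamily.lintegral_eLpNorm_inner_retarded_sq_le [Countable ι] [MeasurableSpace ι]
    [MeasurableSingletonClass ι] (hv : DispersiveFamily v K) (hψ : IsTestFunction ψ) :
    ∫⁻ s, eLpNorm (fun y => inner ℂ (v s y) (∫ t in Ici s, synthesis v X ψ t)) 14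
      count ^ 2 ≤ ofReal (4 * retardedConst K ^ 2) * testNormSq X ψ := by
  have hG := hv.integrable_synthesis X hψ
  refine lintegral_eLpNorm_sq_le_of_dual (B := √K * ∫ t, ‖synthesis v X ψ t‖)
    (fun y => ((hv.continuous y).inner (continuous_setIntegral_Ici hG)).measurable)
    (fun s y => ?_) fun Y φ hφ => ?_
  · refine (norm_inner_le_norm _ _).trans ?_
    gcongr
    · exact hv.norm_le s y
    · refine (norm_integral_le_integral_norm _).trans ?_
      exact setIntegral_le_integral hG.norm (.of_forall fun _ => norm_nonneg _)
  · rw [sum_conj_mul_inner v Y φ fun s => ∫ t in Ici s, synthesis v X ψ t,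
      ← retardedForm_eq_integral_right (hv.integrable_synthesis Y hφ) hG]
    refine (hv.enorm_retardedForm_sq_le hφ hψ).trans (le_of_eq ?_)
    rw [testNormSq, testNormSq]
    ring

end Exports

instance isFiniteMeasure_restrict_cube : IsFiniteMeasure (volume.restrict (cube 3)) :=
  ⟨by rw [Measure.restrict_apply_univ]; exact isCompact_Icc.measure_lt_top⟩

/-- The `L²` space of the torus. -/
abbrev TorusL2 := Lp ℂ 2 (volume.restrict (cube 3))

lemma torusChar_zero (ξ : Fin 3 → ℝ) : torusChar 0 ξ = 1 := by simp [torusChar]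

lemma torusChar_add (m n : Fin 3 → ℤ) (ξ : Fin 3 → ℝ) :
    torusChar (m + n) ξ = torusChar m ξ * torusChar n ξ := by
  unfold torusChar
  rw [← Complex.exp_add, ← mul_add, ← ofReal_add, ← Finset.sum_add_distrib]
  simp [add_mul]

lemma conj_torusChar (n : Fin 3 → ℤ) (ξ : Fin 3 → ℝ) :
    conj (torusChar n ξ) = torusChar (-n) ξ := by
  unfold torusChar
  rw [← exp_conj, map_mul, conj_I, conj_ofReal]
  simp

lemma integral_torusChar (n : Fin 3 → ℤ) :
    ∫ ξ in cube 3, torusChar n ξ = if n = 0 then (((2 * π) ^ 3 : ℝ) : ℂ) else 0 := by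
  split_ifs with h
  · simp_rw [h, torusChar_zero]
    rw [setIntegral_const, measureReal_def, volume_cube_three]
    simp
  · obtain ⟨j, hj⟩ : ∃ j, n j ≠ 0 := by
      by_contra! h'
      exact h (funext h')
    have e : ∀ ξ : Fin 3 → ℝ, torusChar n ξ = ∏ i, Complex.exp (I * n i * ξ i) := fun ξ => by
      rw [torusChar, ← Complex.exp_sum]
      congr 1
      push_cast
      rw [mul_sum]
      exact sum_congr rfl fun i _ => by ring
    have hr : volume.restrict (cube 3) =
        pi fun _ : Fin 3 => (volume : Measure ℝ).restrict (Icc 0 (2 * π)) := by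
      rw [cube, ← Set.pi_univ_Icc, volume_pi, restrict_pi_pi]
      rfl
    simp_rw [e]
    rw [hr, integral_fintype_prod_eq_prod (fun i (x : ℝ) => Complex.exp (I * n i * x))]
    refine Finset.prod_eq_zero (Finset.mem_univ j) ?_
    have hc : I * n j ≠ 0 := mul_ne_zero Complex.I_ne_zero (by exact_mod_cast hj)
    rw [integral_Icc_eq_integral_Ioc, ← integral_of_le (by positivity),
      integral_exp_mul_complex hc]
    have : Complex.exp (I * n j * ((2 * π : ℝ) : ℂ)) = 1 := by
      rw [Complex.exp_eq_one_iff]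
      exact ⟨n j, by push_cast; ring⟩
    rw [this]
    simp

lemma continuous_omegaKG_three : Continuous (omegaKG 3) := by
  have : omegaKG 3 = fun ξ => √(kgSymbol ξ) := funext omegaKG_three
  rw [this]; exact continuous_kgSymbol.sqrt

lemma one_le_omegaKG (ξ : Fin 3 → ℝ) : 1 ≤ omegaKG 3 ξ := by
  rw [omegaKG_three]; exact one_le_sqrt.mpr (one_le_kgSymbol ξ)

lemma omegaKG_le (ξ : Fin 3 → ℝ) : omegaKG 3 ξ ≤ 4 := by
  rw [omegaKG_three, sqrt_le_left (by norm_num)]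
  linarith [kgSymbol_le ξ]

lemma omegaKG_rpow_le (p : ℝ) (ξ : Fin 3 → ℝ) : omegaKG 3 ξ ^ p ≤ 4 ^ |p| :=
  (rpow_le_rpow_of_exponent_le (one_le_omegaKG ξ) (le_abs_self p)).trans
    (rpow_le_rpow (by linarith [one_le_omegaKG ξ]) (omegaKG_le ξ) (abs_nonneg p))

/-- The function `e^{inξ} e^{itω} ω^p`. -/
def kgSymbolFun (t p : ℝ) (n : Fin 3 → ℤ) (ξ : Fin 3 → ℝ) : ℂ :=
  torusChar n ξ * (cis(t * omegaKG 3 ξ) *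
    ((omegaKG 3 ξ ^ p : ℝ) : ℂ))

lemma continuous_kgSymbolFun (t p : ℝ) (n : Fin 3 → ℤ) : Continuous (kgSymbolFun t p n) := by
  have h1 := continuous_torusChar n
  have h2 := continuous_omegaKG_three
  have h3 : Continuous fun ξ => omegaKG 3 ξ ^ p :=
    h2.rpow_const fun ξ => Or.inl (by linarith [one_le_omegaKG ξ])
  unfold kgSymbolFun
  fun_prop

lemma norm_kgSymbolFun (t p : ℝ) (n : Fin 3 → ℤ) (ξ : Fin 3 → ℝ) :
    ‖kgSymbolFun t p n ξ‖ = omegaKG 3 ξ ^ p := by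
  have := one_le_omegaKG ξ
  rw [kgSymbolFun, norm_mul, norm_mul, norm_torusChar, norm_exp_I_mul_real, norm_real,
    one_mul, one_mul, norm_of_nonneg (by positivity)]

/-- `kgSymbolFun` as a bounded continuous function. -/
def kgBounded (t p : ℝ) (n : Fin 3 → ℤ) : BoundedContinuousFunction (Fin 3 → ℝ) ℂ :=
  BoundedContinuousFunction.ofNormedAddCommGroup (kgSymbolFun t p n)
    (continuous_kgSymbolFun t p n) (4 ^ |p|) fun ξ => by
      rw [norm_kgSymbolFun]; exact omegaKG_rpow_le p ξ

/-- `kgSymbolFun` as an element of `L²` of the torus. -/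
def kgVec (t p : ℝ) (n : Fin 3 → ℤ) : TorusL2 :=
  BoundedContinuousFunction.toLp 2 (volume.restrict (cube 3)) ℂ (kgBounded t p n)

lemma inner_kgVec (s t p q : ℝ) (m n : Fin 3 → ℤ) :
    inner ℂ (kgVec s p m) (kgVec t q n) =
      ∫ ξ in cube 3, torusChar (n - m) ξ *
        (cis((t - s) * omegaKG 3 ξ) *
          ((omegaKG 3 ξ ^ (p + q) : ℝ) : ℂ)) := by
  rw [kgVec, kgVec, BoundedContinuousFunction.inner_toLp]
  congr 1
  funext ξ
  have hω : 0 < omegaKG 3 ξ := by linarith [one_le_omegaKG ξ]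
  change kgSymbolFun t q n ξ * conj (kgSymbolFun s p m ξ) = _
  rw [kgSymbolFun, kgSymbolFun, map_mul, map_mul, conj_torusChar, conj_ofReal,
    ← exp_conj, map_mul, conj_I, conj_ofReal, sub_eq_add_neg n m,
    torusChar_add, rpow_add hω, show I * (((t - s) * omegaKG 3 ξ : ℝ) : ℂ) =
      I * ((t * omegaKG 3 ξ : ℝ) : ℂ) + -I * ((s * omegaKG 3 ξ : ℝ) : ℂ) by
        push_cast; ring, Complex.exp_add]
  push_cast
  ring

lemma norm_sum_kgVec_zero_sq (c : (Fin 3 → ℤ) → ℂ) (X : Finset (Fin 3 → ℤ)) :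
    ‖∑ x ∈ X, c x • kgVec 0 0 (-x)‖ ^ 2 = (2 * π) ^ 3 * ∑ x ∈ X, ‖c x‖ ^ 2 := by
  have h : ∀ x y, inner ℂ (kgVec 0 0 (-x)) (kgVec 0 0 (-y)) =
      if x = y then (((2 * π) ^ 3 : ℝ) : ℂ) else 0 := fun x y => by
    rw [inner_kgVec]
    simp only [sub_self, zero_mul, Complex.ofReal_zero, mul_zero, Complex.exp_zero, add_zero,
      rpow_zero, ofReal_one, mul_one]
    rw [integral_torusChar]
    have : -y - -x = 0 ↔ x = y := by rw [neg_sub_neg, sub_eq_zero]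
    simp only [this]
  have h2 : ((‖∑ x ∈ X, c x • kgVec 0 0 (-x)‖ ^ 2 : ℝ) : ℂ) =
      (((2 * π) ^ 3 * ∑ x ∈ X, ‖c x‖ ^ 2 : ℝ) : ℂ) := by
    rw [Complex.ofReal_pow]
    refine (inner_self_eq_norm_sq_to_K (𝕜 := ℂ) (∑ x ∈ X, c x • kgVec 0 0 (-x))).symm.trans ?_
    rw [sum_inner]
    simp_rw [inner_sum, inner_smul_left, inner_smul_right, h]
    simp only [mul_ite, mul_zero, Finset.sum_ite_eq]
    push_cast
    rw [mul_sum]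
    refine sum_congr rfl fun x hx => ?_
    rw [if_pos hx, ← mul_assoc, conj_mul']
    ring
  exact_mod_cast h2

lemma norm_sum_kgVec_sq_le (t p : ℝ) (c : (Fin 3 → ℤ) → ℂ) (X : Finset (Fin 3 → ℤ)) :
    ‖∑ x ∈ X, c x • kgVec t p (-x)‖ ^ 2 ≤
      (4 ^ |p|) ^ 2 * (2 * π) ^ 3 * ∑ x ∈ X, ‖c x‖ ^ 2 := by
  rw [mul_assoc, ← norm_sum_kgVec_zero_sq, ← mul_pow]
  refine pow_le_pow_left₀ (norm_nonneg _) ?_ 2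
  have e : ∀ t p, ∑ x ∈ X, c x • kgVec t p (-x) =
      BoundedContinuousFunction.toLp 2 (volume.restrict (cube 3)) ℂ
        (∑ x ∈ X, c x • kgBounded t p (-x)) := fun t p => by
    simp [kgVec]
  rw [e, e]
  refine Lp.norm_le_mul_norm_of_ae_le_mul ?_
  filter_upwards [BoundedContinuousFunction.coeFn_toLp 2 (volume.restrict (cube 3)) ℂ
      (∑ x ∈ X, c x • kgBounded t p (-x)),
    BoundedContinuousFunction.coeFn_toLp 2 (volume.restrict (cube 3)) ℂ
      (∑ x ∈ X, c x • kgBounded 0 0 (-x))] with ξ h1 h2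
  rw [h1, h2]
  have h3 : ∀ t p, (∑ x ∈ X, c x • kgBounded t p (-x)) ξ =
      (∑ x ∈ X, c x * torusChar (-x) ξ) *
        (cis(t * omegaKG 3 ξ) * ((omegaKG 3 ξ ^ p : ℝ) : ℂ)) :=
    fun t p => by
    rw [BoundedContinuousFunction.coe_sum, Finset.sum_apply, sum_mul]
    exact sum_congr rfl fun x _ => (mul_assoc _ _ _).symm
  have hω := one_le_omegaKG ξ
  rw [h3, h3, norm_mul, norm_mul _ (_ * _), norm_mul, norm_mul, norm_exp_I_mul_real,
    norm_exp_I_mul_real, norm_real, norm_real,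
    norm_of_nonneg (by positivity), norm_of_nonneg (by positivity), rpow_zero]
  have := omegaKG_rpow_le p ξ
  have h5 := norm_nonneg (∑ x ∈ X, c x * torusChar (-x) ξ)
  nlinarith

lemma continuous_kgVec (p : ℝ) (n : Fin 3 → ℤ) : Continuous fun t => kgVec t p n := by
  refine (ContinuousLinearMap.continuous _).comp ?_
  have h4 : (0:ℝ) ≤ 4 * 4 ^ |p| := by positivity
  refine (LipschitzWith.of_dist_le_mul (K := ⟨4 * 4 ^ |p|, h4⟩) fun s t => ?_).continuous
  rw [BoundedContinuousFunction.dist_le (by positivity)]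
  intro ξ
  have hω := one_le_omegaKG ξ
  change dist (kgSymbolFun s p n ξ) (kgSymbolFun t p n ξ) ≤ 4 * 4 ^ |p| * dist s t
  rw [dist_eq_norm, kgSymbolFun, kgSymbolFun, ← mul_sub, ← sub_mul, norm_mul, norm_mul,
    norm_torusChar, one_mul, norm_real, norm_of_nonneg (by positivity)]
  have h1 : ‖cis(s * omegaKG 3 ξ) -
      cis(t * omegaKG 3 ξ)‖ ≤ 4 * dist s t := by
    have e : cis(s * omegaKG 3 ξ) -
        cis(t * omegaKG 3 ξ) =
        cis(t * omegaKG 3 ξ) *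
          (cis((s - t) * omegaKG 3 ξ) - 1) := by
      rw [mul_sub, mul_one, ← Complex.exp_add]
      congr 2
      push_cast
      ring
    rw [e, norm_mul, norm_exp_I_mul_real, one_mul]
    refine (norm_exp_I_mul_ofReal_sub_one_le).trans ?_
    rw [norm_mul, dist_eq, mul_comm, norm_eq_abs, norm_eq_abs]
    rw [abs_of_nonneg (by positivity : 0 ≤ omegaKG 3 ξ)]
    gcongr
    exact omegaKG_le ξ
  calc _ ≤ 4 * dist s t * 4 ^ |p| := by
        gcongr
        exact omegaKG_rpow_le p ξ
    _ = _ := by ring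

/-- The dispersive family of the Klein--Gordon propagator. -/
def kgWave (t : ℝ) (x : Fin 3 → ℤ) : TorusL2 := kgVec t (-(1 / 2)) (-x)

lemma inner_kgWave (s t : ℝ) (x y : Fin 3 → ℤ) :
    inner ℂ (kgWave s x) (kgWave t y) = kgKernel (t - s) (x - y) := by
  rw [kgWave, kgWave, inner_kgVec, kgKernel]
  norm_num [rpow_neg_one, ← sub_eq_neg_add]

theorem exists_dispersiveFamily_kgWave : ∃ K, DispersiveFamily kgWave K ∧
    DispersiveFamily (fun t => kgWave (-t)) K := by
  obtain ⟨C, hC, hdecay⟩ := exists_norm_kgKernel_decay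
  set K : ℝ := 1 + (4 ^ |(-(1 / 2) : ℝ)|) ^ 2 * (2 * π) ^ 3 + (C + (2 * π) ^ 3) with hK
  have h1 : (0:ℝ) ≤ (4 ^ |(-(1 / 2) : ℝ)|) ^ 2 * (2 * π) ^ 3 := by positivity
  have h2 : (0:ℝ) ≤ (2 * π) ^ 3 := by positivity
  have hbessel : ∀ t (c : (Fin 3 → ℤ) → ℂ) X, ‖∑ x ∈ X, c x • kgWave t x‖ ^ 2 ≤
      K * ∑ x ∈ X, ‖c x‖ ^ 2 := fun t c X =>
    (norm_sum_kgVec_sq_le t (-(1 / 2)) c X).trans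
      (mul_le_mul_of_nonneg_right (by linarith) (sum_nonneg fun _ _ => sq_nonneg _))
  have hdec : ∀ t n, t ≠ 0 → ‖kgKernel t n‖ ≤ K * |t| ^ (-(7 / 6) : ℝ) := fun t n ht => by
    have ht0 : 0 < |t| := abs_pos.mpr ht
    have hp : 0 < |t| ^ (-(7 / 6) : ℝ) := rpow_pos_of_pos ht0 _
    rcases le_total 1 |t| with h | h
    · exact (hdecay t n h).trans (mul_le_mul_of_nonneg_right (by linarith) hp.le)
    · have h3 : 1 ≤ |t| ^ (-(7 / 6) : ℝ) :=
        one_le_rpow_of_pos_of_le_one_of_nonpos ht0 h (by norm_num)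
      have := norm_kgKernel_le t n
      have hKK : (2 * π) ^ 3 ≤ K := by linarith
      calc _ ≤ K * 1 := by linarith
        _ ≤ _ := by gcongr
  have hK1 : 1 ≤ K := by linarith
  refine ⟨K, ⟨fun x => continuous_kgVec _ _, hbessel, fun s t hst x y => ?_, hK1⟩,
    ⟨fun x => (continuous_kgVec _ _).comp continuous_neg, fun t => hbessel (-t),
      fun s t hst x y => ?_, hK1⟩⟩
  · rw [inner_kgWave]
    exact hdec _ _ (sub_ne_zero.mpr hst.symm)
  · rw [inner_kgWave, show |t - s| = |-t - -s| by rw [← abs_neg]; ring_nf]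
    exact hdec _ _ (sub_ne_zero.mpr fun h => hst (neg_injective h).symm)

section EndpointBound

variable {ι : Type*} [MeasurableSpace ι]

/-- Simultaneous bounds in `L^∞ℓ²` (for every time) and in `L²ℓ^14`. -/
structure EndpointBound (w : ℝ → ι → ℂ) (D : ℝ≥0∞) : Prop where
  measurable : ∀ x, Measurable fun t => w t x
  sup_le : ∀ t, eLpNorm (w t) 2 Measure.count ≤ D
  sq_le : ∫⁻ t, eLpNorm (w t) 14 Measure.count ^ 2 ≤ D ^ 2

variable {w w' : ℝ → ι → ℂ} {D D' : ℝ≥0∞}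

lemma EndpointBound.mono_const (h : EndpointBound w D) (hD : D ≤ D') : EndpointBound w D' :=
  ⟨h.measurable, fun t => (h.sup_le t).trans hD, h.sq_le.trans (by gcongr)⟩

lemma EndpointBound.const_mul (h : EndpointBound w D) (c : ℂ) :
    EndpointBound (fun t x => c * w t x) (‖c‖ₑ * D) := by
  have e : ∀ t (p : ℝ≥0∞), eLpNorm (fun x => c * w t x) p count =
      ‖c‖ₑ * eLpNorm (w t) p count := fun t p => eLpNorm_const_smul c (w t) p _
  refine ⟨fun x => (h.measurable x).const_mul c, fun t => ?_, ?_⟩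
  · rw [e]
    gcongr
    exact h.sup_le t
  · simp_rw [e, mul_pow]
    rw [lintegral_const_mul' _ _ (by finiteness)]
    gcongr
    exact h.sq_le

lemma EndpointBound.comp_neg (h : EndpointBound w D) : EndpointBound (fun t => w (-t)) D :=
  ⟨fun x => (h.measurable x).comp measurable_neg, fun t => h.sup_le (-t),
    ((Measure.measurePreserving_neg (volume : Measure ℝ)).lintegral_comp_emb
      (MeasurableEquiv.neg ℝ).measurableEmbedding
        fun t => eLpNorm (w t) 14 count ^ 2).le.trans h.sq_le⟩

lemma EndpointBound.of_norm_le (h : EndpointBound w D) (hm : ∀ x, Measurable fun t => w' t x)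
    (hle : ∀ t x, ‖w' t x‖ ≤ ‖w t x‖) : EndpointBound w' D :=
  ⟨hm, fun t => (eLpNorm_mono (hle t)).trans (h.sup_le t),
    (lintegral_mono fun t => pow_le_pow_left₀ zero_le (eLpNorm_mono (hle t)) 2).trans h.sq_le⟩

variable [MeasurableSingletonClass ι]

lemma eLpNorm_count_le_of_le {p r : ℝ≥0∞} (hp : p ≠ 0) (hpr : p ≤ r) (w : ι → ℂ) :
    eLpNorm w r count ≤ eLpNorm w p count := by
  rcases eq_or_ne p ∞ with rfl | hp'
  · rw [top_le_iff.mp hpr]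
  have hr : r ≠ 0 := fun h => hp (le_zero_iff.mp (h ▸ hpr))
  rcases eq_or_ne r ∞ with rfl | hr'
  · rw [eLpNorm_exponent_top, eLpNormEssSup_count]
    exact iSup_le fun x => enorm_le_eLpNorm_count w x hp
  set N := eLpNorm w p count with hN
  have hp0 : 0 < p.toReal := toReal_pos hp hp'
  have hr0 : 0 < r.toReal := toReal_pos hr hr'
  have hpr' : p.toReal ≤ r.toReal := toReal_mono hr' hpr
  rcases eq_or_ne N ∞ with h | hNt
  · rw [h]; exact le_top
  rw [eLpNorm_eq_lintegral_rpow_enorm_toReal hr hr', lintegral_count]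
  have h1 : ∑' x, ‖w x‖ₑ ^ p.toReal = N ^ p.toReal := by
    rw [hN, eLpNorm_eq_lintegral_rpow_enorm_toReal hp hp', lintegral_count, ← ENNReal.rpow_mul,
      one_div_mul_cancel hp0.ne', ENNReal.rpow_one]
  have h2 : ∑' x, ‖w x‖ₑ ^ r.toReal ≤ N ^ r.toReal := by
    calc _ ≤ ∑' x, N ^ (r.toReal - p.toReal) * ‖w x‖ₑ ^ p.toReal := by
          refine ENNReal.tsum_le_tsum fun x => ?_
          calc _ = ‖w x‖ₑ ^ (r.toReal - p.toReal) * ‖w x‖ₑ ^ p.toReal := by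
                rw [← ENNReal.rpow_add_of_nonneg _ _ (by linarith) hp0.le, sub_add_cancel]
            _ ≤ _ := by
                gcongr
                exact enorm_le_eLpNorm_count w x hp
      _ = _ := by
          rw [ENNReal.tsum_mul_left, h1, ← ENNReal.rpow_add_of_nonneg _ _ (by linarith) hp0.le,
            sub_add_cancel]
  calc _ ≤ (N ^ r.toReal) ^ (1 / r.toReal) := by gcongr
    _ = N := by rw [← ENNReal.rpow_mul, mul_one_div_cancel hr0.ne', ENNReal.rpow_one]

lemma measurable_eLpNorm_count [Countable ι] {w : ℝ → ι → ℂ} {r : ℝ≥0∞} (hr : r ≠ 0)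
    (hm : ∀ y, Measurable fun t => w t y) :
    Measurable fun t => eLpNorm (w t) r count := by
  rcases eq_or_ne r ∞ with rfl | hr'
  · simp_rw [eLpNorm_exponent_top, eLpNormEssSup_count]
    exact Measurable.iSup fun x => (hm x).enorm
  · simp_rw [eLpNorm_eq_lintegral_rpow_enorm_toReal hr hr', lintegral_count]
    exact (Measurable.tsum fun x => (hm x).enorm.pow_const _).pow_const _

lemma EndpointBound.add [Countable ι] (h : EndpointBound w D) (h' : EndpointBound w' D') :
    EndpointBound (fun t x => w t x + w' t x) (D + D') := by
  have hae : ∀ u : ι → ℂ, AEStronglyMeasurable u count := fun u =>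
    (Measurable.of_discrete (f := u)).aestronglyMeasurable
  refine ⟨fun x => (h.measurable x).add (h'.measurable x), fun t =>
    (eLpNorm_add_le (hae _) (hae _) (by norm_num)).trans (add_le_add (h.sup_le t) (h'.sup_le t)),
    ?_⟩
  set f := fun t => eLpNorm (w t) 14 count
  set g := fun t => eLpNorm (w' t) 14 count
  have hf : Measurable f := measurable_eLpNorm_count (by norm_num) h.measurable
  have hg : Measurable g := measurable_eLpNorm_count (by norm_num) h'.measurable
  have key := ENNReal.lintegral_Lp_add_le (p := 2) (μ := (volume : Measure ℝ)) hf.aemeasurable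
    hg.aemeasurable (by norm_num)
  have hsq : ∀ (F : ℝ → ℝ≥0∞) (E : ℝ≥0∞), ∫⁻ t, F t ^ 2 ≤ E ^ 2 →
      (∫⁻ t, F t ^ (2:ℝ)) ^ (1 / 2 : ℝ) ≤ E := fun F E hE => by
    have : (E ^ 2) ^ (1 / 2 : ℝ) = E := by
      rw [← ENNReal.rpow_two, ← ENNReal.rpow_mul]; norm_num
    rw [← this]
    simp_rw [ENNReal.rpow_two]
    gcongr
  have h3 := key.trans (add_le_add (hsq f D h.sq_le) (hsq g D' h'.sq_le))
  calc _ ≤ ∫⁻ t, (f + g) t ^ (2:ℝ) := by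
        refine lintegral_mono fun t => ?_
        rw [ENNReal.rpow_two]
        gcongr
        exact eLpNorm_add_le (hae _) (hae _) (by norm_num)
    _ = ((∫⁻ t, (f + g) t ^ (2:ℝ)) ^ (1 / 2 : ℝ)) ^ 2 := by
        rw [← ENNReal.rpow_two, ← ENNReal.rpow_mul]; norm_num
    _ ≤ _ := by gcongr

lemma eLpNorm_rpow_le_of_interpolation (w : ι → ℂ) {q : ℝ} (hq : 2 ≤ q) {r : ℝ≥0∞}
    (hr : ofReal (14 * q / (7 * q - 12)) ≤ r) :
    eLpNorm w r count ^ q ≤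
      eLpNorm w 2 count ^ (q - 2) * eLpNorm w 14 count ^ 2 := by
  have h7 : 0 < 7 * q - 12 := by linarith
  set ρ := 14 * q / (7 * q - 12) with hρ
  have hρ0 : 0 < ρ := by positivity
  have hρ2 : 2 ≤ ρ := by rw [hρ, le_div_iff₀ h7]; linarith
  have hρ14 : ρ ≤ 14 := by rw [hρ, div_le_iff₀ h7]; linarith
  have hne : ofReal ρ ≠ 0 := by simpa using hρ0
  have htr : (ofReal ρ).toReal = ρ := ENNReal.toReal_ofReal hρ0.le
  have key : ∑' x, ‖w x‖ₑ ^ ρ ≤ (∑' x, ‖w x‖ₑ ^ (2:ℝ)) ^ ((14 - ρ) / 12) *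
      (∑' x, ‖w x‖ₑ ^ (14:ℝ)) ^ ((ρ - 2) / 12) := by
    let : MeasurableSpace ι := ⊤
    have := ENNReal.lintegral_mul_norm_pow_le (μ := (count : Measure ι))
      (f := fun x => ‖w x‖ₑ ^ (2:ℝ)) (g := fun x => ‖w x‖ₑ ^ (14:ℝ))
      (Measurable.of_discrete).aemeasurable (Measurable.of_discrete).aemeasurable
      (p := (14 - ρ) / 12) (q := (ρ - 2) / 12)
      (div_nonneg (by linarith) (by norm_num)) (div_nonneg (by linarith) (by norm_num)) (by ring)
    rw [lintegral_count, lintegral_count, lintegral_count] at this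
    refine le_trans (le_of_eq ?_) this
    refine tsum_congr fun x => ?_
    rw [← ENNReal.rpow_mul, ← ENNReal.rpow_mul, ← ENNReal.rpow_add_of_nonneg]
    · congr 1; ring
    · linarith
    linarith
  have hsum : ∀ p : ℝ≥0∞, p ≠ 0 → p ≠ ∞ →
      ∑' x, ‖w x‖ₑ ^ p.toReal = eLpNorm w p count ^ p.toReal := fun p h0 h1 => by
    rw [eLpNorm_eq_lintegral_rpow_enorm_toReal h0 h1, lintegral_count, ← ENNReal.rpow_mul,
      one_div_mul_cancel (toReal_pos h0 h1).ne', ENNReal.rpow_one]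
  have h2 := hsum 2 (by norm_num) (by norm_num)
  have h14 := hsum 14 (by norm_num) (by norm_num)
  have hr' := hsum _ hne ofReal_ne_top
  rw [htr] at hr'
  simp only [toReal_ofNat] at h2 h14
  rw [hr', h2, h14, ← ENNReal.rpow_mul, ← ENNReal.rpow_mul] at key
  have hm : ρ * (7 * q - 12) = 14 * q := div_mul_cancel₀ _ h7.ne'
  have e0 : q / ρ = (7 * q - 12) / 14 := by
    rw [div_eq_iff hρ0.ne']; linarith
  have e1 : 2 * ((14 - ρ) / 12) * (q / ρ) = q - 2 := by
    rw [e0]; linear_combination (-1 / 84 : ℝ) * hm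
  have e2 : 14 * ((ρ - 2) / 12) * (q / ρ) = 2 := by linarith
  calc _ ≤ eLpNorm w (ofReal ρ) count ^ q :=
        ENNReal.rpow_le_rpow (eLpNorm_count_le_of_le hne hr w) (by linarith)
    _ = (eLpNorm w (ofReal ρ) count ^ ρ) ^ (q / ρ) := by
        rw [← ENNReal.rpow_mul]; congr 1; field_simp
    _ ≤ _ := ENNReal.rpow_le_rpow key (by positivity)
    _ = _ := by
        rw [ENNReal.mul_rpow_of_nonneg _ _ (by positivity), ← ENNReal.rpow_mul,
          ← ENNReal.rpow_mul, e1, e2, ENNReal.rpow_two]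

/-- Interpolation between the two endpoints covers all admissible pairs. -/
lemma EndpointBound.lqNorm_le (h : EndpointBound w D) (hD : D ≠ ∞) {q r : ℝ≥0∞} (hq : 2 ≤ q)
    (hr : 2 ≤ r) (hadm : 1 / q ≤ 7 / 6 * (1 / 2 - 1 / r)) :
    lqNorm q (fun t => eLpNorm (w t) r count) ≤ D := by
  unfold lqNorm
  split_ifs with hqt
  · exact essSup_le_of_ae_le _ (.of_forall fun t =>
      (eLpNorm_count_le_of_le (by norm_num) hr _).trans (h.sup_le t))
  have hq2 : 2 ≤ q.toReal := by
    have := toReal_mono hqt hq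
    simpa using this
  have hρ : ofReal (14 * q.toReal / (7 * q.toReal - 12)) ≤ r := by
    rcases eq_or_ne r ∞ with rfl | hrt
    · exact le_top
    have hr2 : 2 ≤ r.toReal := by
      have := toReal_mono hrt hr
      simpa using this
    have h1 : 1 / r ≤ 1 / 2 := div_le_div_left hr 1
    have h2 := toReal_mono (mul_ne_top (by finiteness) (by finiteness)) hadm
    rw [ENNReal.toReal_mul, ENNReal.toReal_sub_of_le h1 (by finiteness), toReal_div,
      toReal_div, toReal_div, toReal_div] at h2
    simp only [toReal_one, toReal_ofNat] at h2
    refine ENNReal.ofReal_le_of_le_toReal ?_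
    generalize q.toReal = a at *
    generalize r.toReal = b at *
    have h3 : 1 / a * (a * b) ≤ 7 / 6 * (1 / 2 - 1 / b) * (a * b) := by gcongr
    have e1 : 1 / a * (a * b) = b := by field_simp
    have e2 : 7 / 6 * (1 / 2 - 1 / b) * (a * b) = 7 / 12 * (a * b) - 7 / 6 * a := by
      field_simp; ring
    rw [div_le_iff₀ (by linarith)]
    nlinarith
  have hpt : ∀ t, eLpNorm (w t) r count ^ q.toReal ≤
      D ^ (q.toReal - 2) * eLpNorm (w t) 14 count ^ 2 := fun t =>
    (eLpNorm_rpow_le_of_interpolation (w t) hq2 hρ).trans (by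
      gcongr
      exact h.sup_le t)
  have hDD : D ^ (q.toReal - 2) * D ^ 2 = D ^ q.toReal := by
    rw [← ENNReal.rpow_two, ← ENNReal.rpow_add_of_nonneg _ _ (by linarith) (by norm_num),
      sub_add_cancel]
  calc _ ≤ (D ^ q.toReal) ^ (1 / q.toReal) := by
        refine ENNReal.rpow_le_rpow ?_ (by positivity)
        calc _ ≤ ∫⁻ t, D ^ (q.toReal - 2) * eLpNorm (w t) 14 count ^ 2 :=
              lintegral_mono hpt
          _ = D ^ (q.toReal - 2) * ∫⁻ t, eLpNorm (w t) 14 count ^ 2 :=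
              lintegral_const_mul' _ _ (ENNReal.rpow_ne_top_of_nonneg (by linarith) hD)
          _ ≤ _ := by
              rw [← hDD]
              gcongr
              exact h.sq_le
    _ = D := by
        rw [← ENNReal.rpow_mul, mul_one_div_cancel (by linarith), ENNReal.rpow_one]

end EndpointBound

section Holder

/-- Hölder's inequality in time where one factor is only a (possibly nonmeasurable) majorant. -/
lemma lintegral_enorm_le_lqNorm_mul {q q' : ℝ≥0∞} (hq : 2 ≤ q) (hqq : 1 / q + 1 / q' = 1)
    {p : ℝ → ℂ} {N k : ℝ → ℝ≥0∞} (hp : AEMeasurable p) (hk : Measurable k)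
    (hkt : ∀ s, k s ≠ ∞) (hN : lqNorm q' N ≠ ∞)
    (h : ∀ᵐ s, N s ≠ ∞ → ‖p s‖ₑ ≤ N s * k s) :
    ∫⁻ s, ‖p s‖ₑ ≤ lqNorm q' N * lqNorm q k := by
  have hq'0 : q' ≠ 0 := by rintro rfl; simp at hqq
  have hq't : q' ≠ ∞ := by
    rintro rfl
    simp_all
  have hq'r : 0 < q'.toReal := toReal_pos hq'0 hq't
  rw [lqNorm, if_neg hq't] at hN ⊢
  set ρ := fun s => ‖p s‖ₑ / k s with hρ
  have hρm : AEMeasurable ρ := hp.enorm.div hk.aemeasurable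
  have hρN : ∀ᵐ s, ρ s ≤ N s := by
    filter_upwards [h] with s hs
    rcases eq_or_ne (N s) ∞ with h' | h'
    · rw [h']; exact le_top
    · exact ENNReal.div_le_of_le_mul (hs h')
  have hint : ∫⁻ s, ρ s ^ q'.toReal ≤ ∫⁻ s, N s ^ q'.toReal :=
    lintegral_mono_ae (hρN.mono fun s hs => by gcongr)
  have hNt : ∫⁻ s, N s ^ q'.toReal ≠ ∞ := fun h' => hN (by
    simp_all)
  have hρt : ∀ᵐ s, ρ s ^ q'.toReal < ∞ :=
    ae_lt_top' (hρm.pow_const _) (ne_top_of_le_ne_top hNt hint)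
  have hpe : ∀ᵐ s, ‖p s‖ₑ = ρ s * k s := by
    filter_upwards [hρt] with s hs
    rcases eq_or_ne (k s) 0 with h0 | h0
    · rw [h0, mul_zero]
      by_contra hne
      have : ρ s = ∞ := by rw [hρ]; simp only [h0]; exact ENNReal.div_zero hne
      rw [this, top_rpow_of_pos hq'r] at hs
      exact lt_irrefl _ hs
    · rw [hρ, ENNReal.div_mul_cancel h0 (hkt s)]
  rw [lintegral_congr_ae hpe]
  refine le_trans ?_ (mul_le_mul_left (ENNReal.rpow_le_rpow hint (by positivity)) _)
  rcases eq_or_ne q ∞ with rfl | hqt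
  · have h1 : q' = 1 := by simp_all
    rw [lqNorm, if_pos rfl, h1]
    simp only [toReal_one, ENNReal.rpow_one, div_one]
    rw [← lintegral_mul_const'' _ hρm]
    refine lintegral_mono_ae ?_
    filter_upwards [ENNReal.ae_le_essSup k] with s hs
    gcongr
  · rw [lqNorm, if_neg hqt]
    have hc : q.toReal.HolderConjugate q'.toReal := by
      have : ENNReal.HolderConjugate q q' := ENNReal.holderConjugate_iff.mpr (by simpa using hqq)
      refine ENNReal.HolderConjugate.toReal ?_
      have := toReal_mono hqt hq
      rw [toReal_ofNat] at this
      linarith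
    exact ENNReal.lintegral_mul_le_Lp_mul_Lq volume hc.symm hρm hk.aemeasurable

lemma measure_eq_zero_of_ae_eq_top {q : ℝ≥0∞} (hq0 : q ≠ 0) (hqt : q ≠ ∞) {N : ℝ → ℝ≥0∞}
    (hN : lqNorm q N ≠ ∞) {B : Set ℝ} (hB : MeasurableSet B) (h : ∀ᵐ s, s ∈ B → N s = ∞) :
    volume B = 0 := by
  have hq : 0 < q.toReal := toReal_pos hq0 hqt
  rw [lqNorm, if_neg hqt] at hN
  have hNt : ∫⁻ s, N s ^ q.toReal ≠ ∞ := fun h' => hN (by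
    simp_all)
  by_contra hne
  refine hNt (top_le_iff.mp ?_)
  calc ∞ = ∫⁻ s, B.indicator (fun _ => ∞) s := by simp_all
    _ ≤ _ := by
        refine lintegral_mono_ae ?_
        filter_upwards [h] with s hs
        by_cases hsB : s ∈ B
        · simp_all
        simp_all

end Holder

section Synthesis

variable {ι : Type*} [MeasurableSpace ι] [MeasurableSingletonClass ι]

lemma eLpNorm_two_count_sq (f : ι → ℂ) :
    eLpNorm f 2 count ^ 2 = ∑' x, ‖f x‖ₑ ^ 2 := by
  rw [eLpNorm_eq_lintegral_rpow_enorm_toReal (by norm_num) (by norm_num), lintegral_count,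
    ← ENNReal.rpow_two, ← ENNReal.rpow_mul]
  norm_num

lemma tsum_enorm_mul_le_eLpNorm_mul [Countable ι] {r r' : ℝ≥0∞} (hr : 1 / r + 1 / r' = 1)
    (f g : ι → ℂ) :
    ∑' x, ‖f x * g x‖ₑ ≤ eLpNorm f r' count * eLpNorm g r count := by
  have : ENNReal.HolderTriple r' r 1 := ENNReal.holderConjugate_iff.mpr (by
    rw [add_comm]; simpa using hr)
  have h := eLpNorm_smul_le_mul_eLpNorm (r := 1) (μ := (count : Measure ι))
    (f := g) (φ := f) (p := r') (q := r) (Measurable.of_discrete).aestronglyMeasurable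
    (Measurable.of_discrete).aestronglyMeasurable
  rw [eLpNorm_one_eq_lintegral_enorm, lintegral_count] at h
  exact h

variable {𝓗 : Type*} [NormedAddCommGroup 𝓗] [InnerProductSpace ℂ 𝓗] [CompleteSpace 𝓗]
  {e : ι → 𝓗} {K : ℝ} {f : ι → ℂ}

lemma hasSum_norm_sq_of_eLpNorm_ne_top (hf : eLpNorm f 2 count ≠ ∞) :
    HasSum (fun x => ‖f x‖ ^ 2) (eLpNorm f 2 count ^ 2).toReal := by
  have h : ∑' x, ‖f x‖ₑ ^ 2 ≠ ∞ := by rw [← eLpNorm_two_count_sq]; finiteness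
  have := ENNReal.hasSum_toReal h
  rw [← ENNReal.tsum_toReal_eq fun x => by finiteness, ← eLpNorm_two_count_sq] at this
  simpa using this

lemma summable_smul_of_bessel
    (he : ∀ (c : ι → ℂ) (X : Finset ι), ‖∑ x ∈ X, c x • e x‖ ^ 2 ≤ K * ∑ x ∈ X, ‖c x‖ ^ 2)
    (hK : 0 < K) (hf : eLpNorm f 2 count ≠ ∞) : Summable fun x => f x • e x := by
  rw [summable_iff_vanishing_norm]
  intro ε hε
  obtain ⟨s, hs⟩ := summable_iff_vanishing_norm.mp
    (hasSum_norm_sq_of_eLpNorm_ne_top hf).summable (ε ^ 2 / K) (by positivity)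
  refine ⟨s, fun t ht => ?_⟩
  have h1 := hs t ht
  rw [norm_of_nonneg (sum_nonneg fun _ _ => sq_nonneg _), lt_div_iff₀ hK] at h1
  have h2 := he f t
  nlinarith

lemma enorm_tsum_smul_sq_le
    (he : ∀ (c : ι → ℂ) (X : Finset ι), ‖∑ x ∈ X, c x • e x‖ ^ 2 ≤ K * ∑ x ∈ X, ‖c x‖ ^ 2)
    (hK : 0 < K) (hf : eLpNorm f 2 count ≠ ∞) :
    ‖∑' x, f x • e x‖ₑ ^ 2 ≤ ofReal K * eLpNorm f 2 count ^ 2 := by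
  have h1 := (summable_smul_of_bessel he hK hf).hasSum
  have h2 := hasSum_norm_sq_of_eLpNorm_ne_top hf
  have h3 : ‖∑' x, f x • e x‖ ^ 2 ≤ K * (eLpNorm f 2 count ^ 2).toReal :=
    le_of_tendsto_of_tendsto (h1.norm.pow 2) (Tendsto.const_mul K h2)
      (.of_forall fun X => he f X)
  rw [← ofReal_norm, ← ofReal_pow (norm_nonneg _)]
  refine (ofReal_le_ofReal h3).trans (le_of_eq ?_)
  rw [ofReal_mul hK.le, ENNReal.ofReal_toReal (by finiteness)]

lemma hasSum_mul_inner_of_bessel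
    (he : ∀ (c : ι → ℂ) (X : Finset ι), ‖∑ x ∈ X, c x • e x‖ ^ 2 ≤ K * ∑ x ∈ X, ‖c x‖ ^ 2)
    (hK : 0 < K) (hf : eLpNorm f 2 count ≠ ∞) (h : 𝓗) :
    HasSum (fun x => f x * inner ℂ h (e x)) (inner ℂ h (∑' x, f x • e x)) := by
  have := (innerSL ℂ h).hasSum (summable_smul_of_bessel he hK hf).hasSum
  simpa [inner_smul_right] using this

end Synthesis

section Representation

lemma integrable_torusChar_mul (n : Fin 3 → ℤ) (s p : ℝ) :
    Integrable (fun ξ => torusChar n ξ * (cis(s * omegaKG 3 ξ) *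
      ((omegaKG 3 ξ ^ p : ℝ) : ℂ))) (volume.restrict (cube 3)) :=
  (continuous_kgSymbolFun s p n).continuousOn.integrableOn_compact isCompact_Icc

lemma multKernel_cos (t : ℝ) (x y : Fin 3 → ℤ) :
    multKernel 3 (fun ξ => cos (t * omegaKG 3 ξ)) (x - y) =
      (((2 * (2 * π) ^ 3)⁻¹ : ℝ) : ℂ) *
        (inner ℂ (kgWave (-t) x) (kgVec 0 (1 / 2) (-y)) +
          inner ℂ (kgWave t x) (kgVec 0 (1 / 2) (-y))) := by
  rw [kgWave, kgWave, inner_kgVec, inner_kgVec, ← integral_add (integrable_torusChar_mul _ _ _)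
    (integrable_torusChar_mul _ _ _), multKernel, mul_inv, Complex.ofReal_mul,
    mul_comm ((2⁻¹ : ℝ) : ℂ), mul_assoc]
  congr 1
  refine Eq.trans ?_ (integral_const_mul _ _)
  refine integral_congr_ae (.of_forall fun ξ => ?_)
  simp only [neg_sub_neg]
  change torusChar (x - y) ξ * _ = _
  rw [neg_add_cancel, rpow_zero, ofReal_one, mul_one, mul_one, ← mul_add,
    Complex.ofReal_cos, Complex.cos]
  push_cast
  ring_nf

lemma multKernel_sin (t s : ℝ) (x y : Fin 3 → ℤ) :
    multKernel 3 (fun ξ => sin ((t - s) * omegaKG 3 ξ) / omegaKG 3 ξ) (x - y) =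
      ((((2 * (2 * π) ^ 3)⁻¹ : ℝ) : ℂ) * -I) *
        (inner ℂ (kgWave (-t) x) (kgWave (-s) y) - inner ℂ (kgWave t x) (kgWave s y)) := by
  rw [kgWave, kgWave, kgWave, kgWave, inner_kgVec, inner_kgVec,
    ← integral_sub (integrable_torusChar_mul _ _ _)
    (integrable_torusChar_mul _ _ _), multKernel, mul_inv, Complex.ofReal_mul,
    mul_comm ((2⁻¹ : ℝ) : ℂ), mul_assoc, mul_assoc, ← mul_assoc ((2⁻¹ : ℝ) : ℂ)]
  congr 1
  refine Eq.trans ?_ (integral_const_mul _ _)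
  refine integral_congr_ae (.of_forall fun ξ => ?_)
  simp only [neg_sub_neg]
  change torusChar (x - y) ξ * _ = _
  rw [show (-(1 / 2) + -(1 / 2) : ℝ) = -1 by norm_num, rpow_neg_one, ← mul_sub, ← sub_mul,
    Complex.ofReal_div, Complex.ofReal_sin, Complex.sin]
  push_cast
  ring_nf

variable {f : (Fin 3 → ℤ) → ℂ}

lemma cosProp_eq_inner (hf : eLpNorm f 2 count ≠ ∞) (t : ℝ) (x : Fin 3 → ℤ) :
    cosProp 3 t f x = (((2 * (2 * π) ^ 3)⁻¹ : ℝ) : ℂ) *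
      (inner ℂ (kgWave (-t) x) (∑' y, f y • kgVec 0 (1 / 2) (-y)) +
        inner ℂ (kgWave t x) (∑' y, f y • kgVec 0 (1 / 2) (-y))) := by
  have h := fun h => hasSum_mul_inner_of_bessel (norm_sum_kgVec_sq_le 0 (1 / 2))
      (by positivity) hf h
  rw [cosProp, ← (((h _).add (h _)).mul_left _).tsum_eq]
  refine tsum_congr fun y => ?_
  rw [multKernel_cos]
  ring

lemma sinProp_eq_inner (hf : eLpNorm f 2 count ≠ ∞) (t s : ℝ) (x : Fin 3 → ℤ) :
    sinProp 3 (t - s) f x = ((((2 * (2 * π) ^ 3)⁻¹ : ℝ) : ℂ) * -I) *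
      (inner ℂ (kgWave (-t) x) (∑' y, f y • kgWave (-s) y) -
        inner ℂ (kgWave t x) (∑' y, f y • kgWave s y)) := by
  have h := fun s h =>
    hasSum_mul_inner_of_bessel (e := kgWave s) (norm_sum_kgVec_sq_le s (-(1 / 2)))
        (by positivity) hf h
  rw [sinProp, ← ((((h (-s) _).sub (h s _)).mul_left _).tsum_eq)]
  refine tsum_congr fun y => ?_
  rw [multKernel_sin]
  ring

end Representation

section FamilyBounds

variable {ι : Type*}
variable {𝓗 : Type*} [NormedAddCommGroup 𝓗] [InnerProductSpace ℂ 𝓗]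
variable {v : ℝ → ι → 𝓗} {K : ℝ} {X : Finset ι} {ψ : ℝ → ι → ℂ}

lemma DispersiveFamily.endpointConst_nonneg (hv : DispersiveFamily v K) : 0 ≤ endpointConst K := by
  have := hv.pos
  unfold endpointConst retardedConst
  positivity

lemma testNormSq_mono {φ : ℝ → ι → ℂ} (h : ∀ t x, ‖φ t x‖ ≤ ‖ψ t x‖) :
    testNormSq X φ ≤ testNormSq X ψ := by
  refine lintegral_mono fun t => ofReal_le_ofReal
    (pow_le_pow_left₀ (endpointDualNorm_nonneg _ _) ?_ 2)
  exact rpow_le_rpow (by positivity) (sum_le_sum fun x _ =>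
    rpow_le_rpow (norm_nonneg _) (h t x) (by norm_num)) (by norm_num)

variable [MeasurableSpace ι] [MeasurableSingletonClass ι]

lemma DispersiveFamily.eLpNorm_inner_sq_le (hv : DispersiveFamily v K) (t : ℝ) (h : 𝓗) :
    eLpNorm (fun x => inner ℂ (v t x) h) 2 count ^ 2 ≤ ofReal K * ‖h‖ₑ ^ 2 := by
  rw [eLpNorm_two_count_sq, tsum_eq_iSup_sum]
  refine iSup_le fun X => ?_
  have := ofReal_le_ofReal (hv.sum_norm_inner_sq_le t h X)
  rw [ofReal_sum_of_nonneg fun _ _ => sq_nonneg _, ofReal_mul hv.pos.le] at this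
  simpa [ofReal_pow] using this

/-- A common constant for the endpoint bounds of a dispersive family. -/
def familyConst (K : ℝ) : ℝ :=
    1 + K * (1 + endpointConst K) + endpointConst K + 4 * retardedConst K ^ 2

lemma ofReal_le_familyConst_sq {K a : ℝ} (hK : 0 < K)
    (ha : a ≤ K * (1 + endpointConst K) + endpointConst K + 4 * retardedConst K ^ 2) :
    ofReal a ≤ ofReal (familyConst K) ^ 2 := by
  have h0 : 0 ≤ K * (1 + endpointConst K) + endpointConst K + 4 * retardedConst K ^ 2 := by
    unfold endpointConst retardedConst
    positivity
  have h1 : 1 ≤ familyConst K := by unfold familyConst; linarith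
  rw [← ofReal_pow (by linarith)]
  refine ofReal_le_ofReal ?_
  unfold familyConst at h1 ⊢
  nlinarith

variable [CompleteSpace 𝓗] [Countable ι]

lemma DispersiveFamily.endpointBound_inner (hv : DispersiveFamily v K) (h : 𝓗) :
    EndpointBound (fun t x => inner ℂ (v t x) h) (ofReal (familyConst K) * ‖h‖ₑ) := by
  have hK := hv.pos
  have hE := hv.endpointConst_nonneg
  have hE' := mul_nonneg hK.le hE
  refine ⟨fun x => ((hv.continuous x).inner continuous_const).measurable, fun t => ?_, ?_⟩
  · refine (pow_le_pow_left_iff two_ne_zero).mp ((hv.eLpNorm_inner_sq_le t h).trans ?_)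
    rw [mul_pow]
    gcongr
    exact ofReal_le_familyConst_sq hK (by nlinarith)
  · refine (hv.lintegral_eLpNorm_inner_sq_le h).trans ?_
    rw [mul_pow]
    gcongr
    exact ofReal_le_familyConst_sq hK (by nlinarith)

lemma DispersiveFamily.endpointBound_retarded (hv : DispersiveFamily v K)
    (hψ : IsTestFunction ψ) :
    EndpointBound (fun s y => inner ℂ (v s y) (∫ t in Ici s, synthesis v X ψ t))
      (ofReal (familyConst K) * testNormSq X ψ ^ (1 / 2 : ℝ)) := by
  have hK := hv.pos
  have hE := hv.endpointConst_nonneg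
  have hE' := mul_nonneg hK.le hE
  have hsq : (ofReal (familyConst K) * testNormSq X ψ ^ (1 / 2 : ℝ)) ^ 2 =
      ofReal (familyConst K) ^ 2 * testNormSq X ψ := by
    rw [mul_pow, ← ENNReal.rpow_two (testNormSq X ψ ^ _), ← ENNReal.rpow_mul]
    norm_num
  refine ⟨fun x => ((hv.continuous x).inner (continuous_setIntegral_Ici
    (hv.integrable_synthesis X hψ))).measurable, fun s => ?_, ?_⟩
  · refine (pow_le_pow_left_iff two_ne_zero).mp ((hv.eLpNorm_inner_sq_le s _).trans ?_)
    have hψ' := hψ.indicator (measurableSet_Ici (a := s))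
    have e : ∫ t in Ici s, synthesis v X ψ t =
        ∫ t, synthesis v X ((Ici s).indicator ψ) t := by
      rw [← integral_indicator measurableSet_Ici]
      congr with t
      by_cases ht : t ∈ Ici s <;> simp [synthesis, ht]
    rw [hsq, e]
    calc _ ≤ ofReal K * (ofReal (endpointConst K) * testNormSq X ψ) := by
          gcongr
          refine (hv.enorm_integral_sq_le hψ').trans ?_
          gcongr
          refine testNormSq_mono fun t x => ?_
          by_cases ht : t ∈ Ici s <;> simp [ht]
      _ ≤ _ := by
          rw [← mul_assoc, ← ofReal_mul hK.le]
          gcongr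
          exact ofReal_le_familyConst_sq hK (by nlinarith)
  · refine (hv.lintegral_eLpNorm_inner_retarded_sq_le hψ).trans ?_
    rw [hsq]
    gcongr
    exact ofReal_le_familyConst_sq hK (by nlinarith)

end FamilyBounds

/-- A function of two variables that is continuous in the first one has a jointly measurable
majorant of its partial integrals, although no joint measurability is assumed. -/
lemma exists_measurable_version {g : ℝ → ℝ → ℂ} {N : ℝ → ℝ≥0∞}
    (hg : ∀ s, N s ≠ ∞ → Continuous fun t => g t s)
    (hN : ∀ B, MeasurableSet B → (∀ᵐ s, s ∈ B → N s = ∞) → volume B = 0) :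
    ∃ (T : Set ℝ) (H : ℝ → ℝ → ℂ), MeasurableSet T ∧ Measurable (fun p : ℝ × ℝ => H p.1 p.2) ∧
      (∀ᵐ s, N s ≠ ∞ → ∀ t, H t s = T.indicator (fun t => g t s) t) ∧
      ∀ t, ‖∫ s, g t s‖ ≤ ‖∫ s, H t s‖ := by
  set T' : Set ℝ := {t | AEMeasurable (g t)} with hT'
  have hout : ∀ t, t ∉ T' → ∫ s, g t s = 0 := fun t ht =>
    integral_undef fun hi => ht hi.aestronglyMeasurable.aemeasurable
  rcases T'.eq_empty_or_nonempty with h0 | hne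
  · refine ⟨∅, fun _ _ => 0, MeasurableSet.empty, measurable_const, by simp, fun t => ?_⟩
    rw [hout t (by simp [h0])]
    simp
  have : Nonempty T' := hne.to_subtype
  set e : ℕ → ℝ := fun n => (TopologicalSpace.denseSeq T' n : ℝ) with he
  have hmem : ∀ n, AEMeasurable (g (e n)) := fun n => (TopologicalSpace.denseSeq T' n).2
  set T := closure (Set.range e)
  have hTT : T' ⊆ T := fun t ht => by
    have h1 : (⟨t, ht⟩ : T') ∈ closure (Set.range (TopologicalSpace.denseSeq T')) :=
      TopologicalSpace.denseRange_denseSeq T' _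
    have h2 := image_closure_subset_closure_image continuous_subtype_val
      (Set.mem_image_of_mem Subtype.val h1)
    rwa [← Set.range_comp] at h2
  set Hk : ℕ → ℝ × ℝ → ℂ := fun k p =>
    (hmem (SimpleFunc.nearestPtInd e k p.1)).mk _ p.2 with hHk
  have hHkm : ∀ k, Measurable (Hk k) := fun k => by
    have h1 : Measurable fun p : ℕ × ℝ => (hmem p.1).mk _ p.2 :=
      measurable_from_prod_countable_right fun n => (hmem n).measurable_mk
    exact h1.comp (((SimpleFunc.nearestPtInd e k).measurable.comp measurable_fst).prodMk
      measurable_snd)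
  set L : ℝ × ℝ → ℂ := fun p => Filter.limUnder atTop fun k => Hk k p
  have hL : Measurable L :=
    (StronglyMeasurable.limUnder fun k => (hHkm k).stronglyMeasurable).measurable
  have hT : MeasurableSet T := isClosed_closure.measurableSet
  have hev : ∀ᵐ s, N s ≠ ∞ → ∀ t ∈ T, L (t, s) = g t s := by
    have : ∀ᵐ s, ∀ n, g (e n) s = (hmem n).mk _ s := ae_all_iff.mpr fun n => (hmem n).ae_eq_mk
    filter_upwards [this] with s hs hNs t ht
    have h1 := ((hg s hNs).tendsto t).comp (SimpleFunc.tendsto_nearestPt ht)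
    refine Tendsto.limUnder_eq (h1.congr fun k => ?_)
    exact hs _
  refine ⟨T, fun t s => (T ×ˢ univ).indicator L (t, s), hT,
    hL.indicator (hT.prod MeasurableSet.univ), ?_, fun t => ?_⟩
  · filter_upwards [hev] with s hs hNs t
    by_cases ht : t ∈ T
    · simpa [ht] using hs hNs t ht
    · simp [ht]
  · by_cases ht : t ∈ T'
    · refine (congrArg norm (integral_congr_ae ?_)).le
      have hm : AEMeasurable (g t) := ht
      have hLt : Measurable fun s => L (t, s) := hL.comp (measurable_const.prodMk measurable_id)
      have h1 := hN {s | hm.mk _ s ≠ L (t, s)}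
        (measurableSet_eq_fun hm.measurable_mk hLt).compl (by
          filter_upwards [hm.ae_eq_mk, hev] with s hs hs' hsB
          by_contra hNs
          exact hsB (by rw [← hs, hs' hNs t (hTT ht)]))
      filter_upwards [hm.ae_eq_mk, (measure_eq_zero_iff_ae_notMem.mp h1)] with s hs hs'
      simp only [not_not] at hs'
      simp [hTT ht, hs, hs']
    · rw [hout t ht]
      simp

lemma exponent_le_two {q q' : ℝ≥0∞} (hq : 2 ≤ q) (hqq : 1 / q + 1 / q' = 1) : q' ≤ 2 := by
  have h1 : 1 / q ≤ 1 / 2 := div_le_div_left hq 1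
  have h2 : (1 / 2 : ℝ≥0∞) ≤ 1 / q' := by
    have : (1 / 2 : ℝ≥0∞) + 1 / 2 ≤ 1 / 2 + 1 / q' := by
      rw [ENNReal.add_halves]
      exact hqq.ge.trans (by gcongr)
    simp_all
  simpa using h2

section Duhamel

variable {ι : Type*} {𝓗 : Type*} [NormedAddCommGroup 𝓗] [InnerProductSpace ℂ 𝓗]

/-- The superposition of the family `v` at time `s` with coefficients `F s`. -/
def sourceVec (v : ℝ → ι → 𝓗) (F : ℝ → ι → ℂ) (s : ℝ) : 𝓗 := ∑' y, F s y • v s y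

/-- The difference of the pairings of two vectors with the source terms of two families. -/
def sourcePairing (v v' : ℝ → ι → 𝓗) (F : ℝ → ι → ℂ) (s : ℝ) (h h' : 𝓗) : ℂ :=
  inner ℂ h (sourceVec v F s) - inner ℂ h' (sourceVec v' F s)

variable {v v' : ℝ → ι → 𝓗} {K : ℝ} {F : ℝ → ι → ℂ} {q r q' r' : ℝ≥0∞}

/-- The constant in the inhomogeneous endpoint estimates. -/
def duhamelConst (K : ℝ) : ℝ := 2 * familyConst K ^ 2

lemma one_le_familyConst (hv : DispersiveFamily v K) : 1 ≤ familyConst K := by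
  have := hv.pos
  unfold familyConst endpointConst retardedConst
  nlinarith

lemma DispersiveFamily.enorm_sum_smul_le (hv : DispersiveFamily v K) (t : ℝ) (c : ι → ℂ)
    (X : Finset ι) : ‖∑ x ∈ X, c x • v t x‖ₑ ≤
      ofReal (familyConst K) * (∑ x ∈ X, ‖c x‖ₑ ^ 2) ^ (1 / 2 : ℝ) := by
  have hK := hv.pos
  have hE := hv.endpointConst_nonneg
  have hE' := mul_nonneg hK.le hE
  refine (pow_le_pow_left_iff two_ne_zero).mp ?_
  rw [mul_pow, ← ENNReal.rpow_two (_ ^ (1 / 2 : ℝ)), ← ENNReal.rpow_mul]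
  have h1 := ofReal_le_ofReal (hv.bessel t c X)
  rw [ofReal_mul hK.le, ofReal_sum_of_nonneg fun _ _ => sq_nonneg _] at h1
  simp only [ofReal_pow (norm_nonneg _), ofReal_norm] at h1
  refine h1.trans ?_
  norm_num
  gcongr
  exact ofReal_le_familyConst_sq hK (by nlinarith)

variable [MeasurableSpace ι] [MeasurableSingletonClass ι] [CompleteSpace 𝓗]

lemma DispersiveFamily.hasSum_inner_sourceVec (hv : DispersiveFamily v K) {s : ℝ}
    (hF : eLpNorm (F s) 2 count ≠ ∞) (h : 𝓗) :
    HasSum (fun y => F s y * inner ℂ h (v s y)) (inner ℂ h (sourceVec v F s)) :=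
  hasSum_mul_inner_of_bessel (hv.bessel s) hv.pos hF h

variable [Countable ι]

lemma EndpointBound.sub {w w' : ℝ → ι → ℂ} {D D' : ℝ≥0∞} (h : EndpointBound w D)
    (h' : EndpointBound w' D') : EndpointBound (fun t x => w t x - w' t x) (D + D') := by
  simpa [sub_eq_add_neg] using h.add (h'.const_mul (-1))

lemma enorm_sourcePairing_le (hv : DispersiveFamily v K) (hv' : DispersiveFamily v' K)
    (hr : 1 / r + 1 / r' = 1) {s : ℝ} (hF : eLpNorm (F s) 2 count ≠ ∞) (h h' : 𝓗) :
    ‖sourcePairing v v' F s h h'‖ₑ ≤ eLpNorm (F s) r' count *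
      eLpNorm (fun y => inner ℂ (v s y) h - inner ℂ (v' s y) h') r count := by
  have h1 := (hv.hasSum_inner_sourceVec hF h).sub (hv'.hasSum_inner_sourceVec hF h')
  refine le_trans ?_ (tsum_enorm_mul_le_eLpNorm_mul hr _ _)
  rw [sourcePairing, ← h1.tsum_eq]
  refine (enorm_tsum_le_tsum_enorm).trans (le_of_eq (tsum_congr fun y => ?_))
  rw [← mul_sub, enorm_mul, enorm_mul, ← RCLike.enorm_conj (inner ℂ (v s y) h - _), map_sub,
    inner_conj_symm, inner_conj_symm]

lemma lintegral_enorm_le_of_sourcePairing (hv : DispersiveFamily v K)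
    (hv' : DispersiveFamily v' K) (hq : 2 ≤ q) (hr : 2 ≤ r)
    (hadm : 1 / q ≤ 7 / 6 * (1 / 2 - 1 / r)) (hqq : 1 / q + 1 / q' = 1)
    (hrr : 1 / r + 1 / r' = 1)
    (hF : lqNorm q' (fun s => eLpNorm (F s) r' count) ≠ ∞) {h h' : ℝ → 𝓗} {D : ℝ≥0∞}
    (hD : EndpointBound (fun s y => inner ℂ (v s y) (h s) - inner ℂ (v' s y) (h' s)) D)
    (hDt : D ≠ ∞) {p : ℝ → ℂ} (hp : AEMeasurable p)
    (hle : ∀ᵐ s, eLpNorm (F s) r' count ≠ ∞ →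
      ‖p s‖ₑ ≤ ‖sourcePairing v v' F s (h s) (h' s)‖ₑ) :
    ∫⁻ s, ‖p s‖ₑ ≤ lqNorm q' (fun s => eLpNorm (F s) r' count) * D := by
  have hr0 : r ≠ 0 := by rintro rfl; simp at hr
  have hr'0 : r' ≠ 0 := by rintro rfl; simp at hrr
  refine (lintegral_enorm_le_lqNorm_mul hq hqq hp (measurable_eLpNorm_count hr0 hD.measurable)
    (fun s => ne_top_of_le_ne_top hDt ((eLpNorm_count_le_of_le (by norm_num) hr _).trans
      (hD.sup_le s))) hF ?_).trans (mul_le_mul_right (hD.lqNorm_le hDt hq hr hadm) _)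
  filter_upwards [hle] with s hs hNs
  refine (hs hNs).trans (enorm_sourcePairing_le hv hv' hrr ?_ _ _)
  exact ne_top_of_le_ne_top hNs (eLpNorm_count_le_of_le hr'0 (exponent_le_two hr hrr) _)

lemma EndpointBound.inner_sub_inner (hv : DispersiveFamily v K) (hv' : DispersiveFamily v' K)
    (h h' : 𝓗) : EndpointBound (fun s y => inner ℂ (v s y) h - inner ℂ (v' s y) h')
      (ofReal (familyConst K) * (‖h‖ₑ + ‖h'‖ₑ)) := by
  rw [mul_add]
  exact (hv.endpointBound_inner h).sub (hv'.endpointBound_inner h')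

section Version

variable {H : ι → ℝ → ℝ → ℂ} {T : ι → Set ℝ}

lemma lintegral_enorm_sum_version_le (hv : DispersiveFamily v K)
    (hv' : DispersiveFamily v' K) (hq : 2 ≤ q) (hr : 2 ≤ r)
    (hadm : 1 / q ≤ 7 / 6 * (1 / 2 - 1 / r)) (hqq : 1 / q + 1 / q' = 1)
    (hrr : 1 / r + 1 / r' = 1)
    (hF : lqNorm q' (fun s => eLpNorm (F s) r' count) ≠ ∞)
    (hHm : ∀ x, Measurable fun p : ℝ × ℝ => H x p.1 p.2)
    (hH : ∀ᵐ s, eLpNorm (F s) r' count ≠ ∞ → ∀ x t, H x t s =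
      {t | t ∈ T x ∧ 0 < s ∧ s ≤ t}.indicator
        (fun t => sourcePairing v v' F s (v t x) (v' t x)) t)
    (t : ℝ) (c : ι → ℂ) (X : Finset ι) :
    ∫⁻ s, ‖∑ x ∈ X, c x * H x t s‖ₑ ≤ lqNorm q' (fun s => eLpNorm (F s) r' count) *
      (ofReal (duhamelConst K) * (∑ x ∈ X, ‖c x‖ₑ ^ 2) ^ (1 / 2 : ℝ)) := by
  set b : ι → ℂ := fun x => {x | t ∈ T x}.indicator (fun x => conj (c x)) x with hb
  have hbc : ∑ x ∈ X, ‖b x‖ₑ ^ 2 ≤ ∑ x ∈ X, ‖c x‖ₑ ^ 2 := sum_le_sum fun x _ => by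
    by_cases hx : t ∈ T x <;> simp [hb, hx]
  have hC := one_le_familyConst hv
  have hm : ∀ x, Measurable fun s => H x t s := fun x =>
    (hHm x).comp (measurable_const.prodMk measurable_id)
  refine (lintegral_enorm_le_of_sourcePairing hv hv' hq hr hadm hqq hrr hF
    (EndpointBound.inner_sub_inner hv hv' (∑ x ∈ X, b x • v t x) (∑ x ∈ X, b x • v' t x))
    (by finiteness)
    (measurable_sum X fun x _ => (hm x).const_mul (c x)).aemeasurable ?_).trans ?_
  · filter_upwards [hH] with s hs hNs
    by_cases h : 0 < s ∧ s ≤ t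
    · refine le_of_eq (congrArg _ ?_)
      simp only [sourcePairing, sum_inner, ← Finset.sum_sub_distrib]
      refine sum_congr rfl fun x _ => ?_
      rw [hs hNs]
      by_cases hx : t ∈ T x
      · simp [hb, hx, h, sourcePairing, inner_smul_left, mul_sub]
      · simp [hb, hx]
    · have : ∀ x ∈ X, c x * H x t s = 0 := fun x _ => by
        rw [hs hNs, indicator_of_notMem (fun hx => h hx.2), mul_zero]
      rw [sum_eq_zero this]
      simp
  · refine mul_le_mul_right ?_ _
    set Q := (∑ x ∈ X, ‖c x‖ₑ ^ 2) ^ (1 / 2 : ℝ)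
    have hQ : (∑ x ∈ X, ‖b x‖ₑ ^ 2) ^ (1 / 2 : ℝ) ≤ Q := ENNReal.rpow_le_rpow hbc (by norm_num)
    calc _ ≤ ofReal (familyConst K) * (ofReal (familyConst K) * Q +
          ofReal (familyConst K) * Q) := by
          gcongr
          · exact (hv.enorm_sum_smul_le t b X).trans (mul_le_mul_right hQ _)
          · exact (hv'.enorm_sum_smul_le t b X).trans (mul_le_mul_right hQ _)
      _ = _ := by
          rw [duhamelConst, ofReal_mul two_pos.le, ofReal_pow (by linarith),
            ofReal_ofNat]
          ring

lemma lintegral_enorm_test_version_le (hv : DispersiveFamily v K)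
    (hv' : DispersiveFamily v' K) (hq : 2 ≤ q) (hr : 2 ≤ r)
    (hadm : 1 / q ≤ 7 / 6 * (1 / 2 - 1 / r)) (hqq : 1 / q + 1 / q' = 1)
    (hrr : 1 / r + 1 / r' = 1)
    (hF : lqNorm q' (fun s => eLpNorm (F s) r' count) ≠ ∞)
    (hT : ∀ x, MeasurableSet (T x))
    (hHm : ∀ x, Measurable fun p : ℝ × ℝ => H x p.1 p.2)
    (hH : ∀ᵐ s, eLpNorm (F s) r' count ≠ ∞ → ∀ x t, H x t s =
      {t | t ∈ T x ∧ 0 < s ∧ s ≤ t}.indicator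
        (fun t => sourcePairing v v' F s (v t x) (v' t x)) t)
    {φ : ℝ → ι → ℂ} (hφ : IsTestFunction φ) (Y : Finset ι) :
    ∫⁻ s, ‖∫ t, ∑ y ∈ Y, conj (φ t y) * H y t s‖ₑ ≤
      lqNorm q' (fun s => eLpNorm (F s) r' count) *
      (ofReal (duhamelConst K) * testNormSq Y φ ^ (1 / 2 : ℝ)) := by
  set ψ : ℝ → ι → ℂ := fun t x => (T x).indicator (fun t => φ t x) t with hψd
  have hψφ : ∀ t x, ‖ψ t x‖ ≤ ‖φ t x‖ := fun t x => by
    by_cases hx : t ∈ T x <;> simp [hψd, hx]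
  have hψ : IsTestFunction ψ := hφ.of_norm_le (c := 1)
    (fun x => (hφ.measurable x).indicator (hT x)) zero_le_one (by simpa using hψφ)
  have hC := one_le_familyConst hv
  have htop := testNormSq_ne_top Y hψ
  have hD := (hv.endpointBound_retarded (X := Y) hψ).sub (hv'.endpointBound_retarded (X := Y) hψ)
  have hpm : AEMeasurable fun s => ∫ t, ∑ y ∈ Y, conj (φ t y) * H y t s := by
    refine (StronglyMeasurable.integral_prod_right (ν := volume)
      (f := fun s t => ∑ y ∈ Y, conj (φ t y) * H y t s) ?_).measurable.aemeasurable
    refine Measurable.stronglyMeasurable (measurable_sum Y fun y _ => ?_)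
    exact (continuous_conj.measurable.comp ((hφ.measurable y).comp measurable_snd)).mul
      ((hHm y).comp measurable_swap)
  refine (lintegral_enorm_le_of_sourcePairing hv hv' hq hr hadm hqq hrr hF hD
    (by finiteness) hpm ?_).trans ?_
  · filter_upwards [hH] with s hs hNs
    rcases le_or_gt s 0 with h | h
    · have : ∀ t, ∑ y ∈ Y, conj (φ t y) * H y t s = 0 := fun t =>
        sum_eq_zero fun x _ => by
          rw [hs hNs, indicator_of_notMem (fun hx => hx.2.1.not_ge h), mul_zero]
      simp [this]
    · refine le_of_eq (congrArg _ ?_)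
      have hi := (hv.integrable_synthesis Y hψ).integrableOn (s := Ici s)
      have hi' := (hv'.integrable_synthesis Y hψ).integrableOn (s := Ici s)
      rw [sourcePairing, inner_integral_left hi, inner_integral_left hi',
        ← integral_sub (hi.inner_const _) (hi'.inner_const _),
        ← integral_indicator measurableSet_Ici]
      refine integral_congr_ae (.of_forall fun t => ?_)
      by_cases ht : s ≤ t
      · rw [indicator_of_mem (by exact ht)]
        simp only [synthesis, sum_inner, ← Finset.sum_sub_distrib]
        refine sum_congr rfl fun x _ => ?_
        rw [hs hNs]
        by_cases hx : t ∈ T x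
        · simp [hψd, hx, h, ht, sourcePairing, inner_smul_left, mul_sub]
        · simp [hψd, hx]
      · rw [indicator_of_notMem (by exact ht)]
        refine sum_eq_zero fun x _ => ?_
        rw [hs hNs, indicator_of_notMem (fun hx => ht hx.2.2), mul_zero]
  · refine mul_le_mul_right ?_ _
    rw [← two_mul, ← mul_assoc]
    refine mul_le_mul' ?_ (ENNReal.rpow_le_rpow (testNormSq_mono hψφ) (by norm_num))
    rw [duhamelConst, ofReal_mul two_pos.le, ofReal_ofNat]
    gcongr
    nlinarith

/-- Endpoint bounds for the partial integrals of a measurable version of the retarded kernel. -/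
lemma endpointBound_integral_version (hv : DispersiveFamily v K)
    (hv' : DispersiveFamily v' K) (hq : 2 ≤ q) (hr : 2 ≤ r)
    (hadm : 1 / q ≤ 7 / 6 * (1 / 2 - 1 / r)) (hqq : 1 / q + 1 / q' = 1)
    (hrr : 1 / r + 1 / r' = 1)
    (hF : lqNorm q' (fun s => eLpNorm (F s) r' count) ≠ ∞)
    (hT : ∀ x, MeasurableSet (T x))
    (hHm : ∀ x, Measurable fun p : ℝ × ℝ => H x p.1 p.2)
    (hH : ∀ᵐ s, eLpNorm (F s) r' count ≠ ∞ → ∀ x t, H x t s =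
      {t | t ∈ T x ∧ 0 < s ∧ s ≤ t}.indicator
        (fun t => sourcePairing v v' F s (v t x) (v' t x)) t) :
    EndpointBound (fun t x => ∫ s, H x t s) (ofReal (duhamelConst K) *
      lqNorm q' (fun s => eLpNorm (F s) r' count)) := by
  have hQ := lintegral_enorm_sum_version_le hv hv' hq hr hadm hqq hrr hF hHm hH
  set M := lqNorm q' (fun s => eLpNorm (F s) r' count)
  have hm : ∀ x t, Measurable fun s => H x t s := fun x t =>
    (hHm x).comp (measurable_const.prodMk measurable_id)
  have hone : ∀ x t, ∫⁻ s, ‖H x t s‖ₑ ≤ ofReal (duhamelConst K) * M := fun x t => by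
    simpa [mul_comm] using hQ t (fun _ => 1) {x}
  have hfin : ofReal (duhamelConst K) * M ≠ ∞ := by finiteness
  have hint : ∀ x t, Integrable fun s => H x t s := fun x t =>
    ⟨(hm x t).aestronglyMeasurable, (hone x t).trans_lt hfin.lt_top⟩
  have hUm : ∀ x, Measurable fun t => ∫ s, H x t s := fun x =>
    (StronglyMeasurable.integral_prod_right (ν := volume) (f := fun t s => H x t s)
      (hHm x).stronglyMeasurable).measurable
  refine ⟨hUm, fun t => ?_, ?_⟩
  · refine (pow_le_pow_left_iff two_ne_zero).mp ?_
    rw [eLpNorm_two_count_sq, tsum_eq_iSup_sum]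
    refine iSup_le fun X => le_of_sq_le_mul_self
      (ENNReal.sum_ne_top.mpr fun _ _ => by finiteness) ?_
    set U : ι → ℂ := fun x => ∫ s, H x t s with hU
    have h1 : ∑ x ∈ X, ‖U x‖ₑ ^ 2 = ‖∫ s, ∑ x ∈ X, conj (U x) * H x t s‖ₑ := by
      rw [integral_finsetSum _ fun x _ => (hint x t).const_mul _]
      simp_rw [integral_const_mul]
      have h2 : ∑ x ∈ X, conj (U x) * ∫ s, H x t s = ((∑ x ∈ X, ‖U x‖ ^ 2 : ℝ) : ℂ) := by
        push_cast
        exact sum_congr rfl fun x _ => conj_mul' _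
      rw [h2, ← ofReal_norm, norm_real,
        norm_of_nonneg (sum_nonneg fun _ _ => sq_nonneg _),
        ofReal_sum_of_nonneg fun _ _ => sq_nonneg _]
      simp
    have h2 := (h1.trans_le (enorm_integral_le_lintegral_enorm _)).trans (hQ t _ X)
    simp_rw [RCLike.enorm_conj] at h2
    set I := ∑ x ∈ X, ‖U x‖ₑ ^ 2
    calc I ^ 2 ≤ (M * (ofReal (duhamelConst K) * I ^ (1 / 2 : ℝ))) ^ 2 := by gcongr
      _ = _ := by
        rw [mul_pow, mul_pow, ← ENNReal.rpow_two (I ^ (1 / 2 : ℝ)), ← ENNReal.rpow_mul]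
        norm_num
        ring
  · refine lintegral_eLpNorm_sq_le_of_dual hUm
      (B := (ofReal (duhamelConst K) * M).toReal) (fun t x => ?_) fun Y φ hφ => ?_
    · rw [← toReal_enorm]
      exact toReal_mono hfin ((enorm_integral_le_lintegral_enorm _).trans (hone x t))
    · have hjm : Measurable (uncurry fun t s =>
          ∑ y ∈ Y, conj (φ t y) * H y t s) :=
        measurable_sum Y fun y _ => (continuous_conj.measurable.comp
          ((hφ.measurable y).comp measurable_fst)).mul (hHm y)
      have hj : Integrable (uncurry fun t s =>
          ∑ y ∈ Y, conj (φ t y) * H y t s) (volume.prod volume) := by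
        refine ⟨hjm.aestronglyMeasurable, ?_⟩
        rw [HasFiniteIntegral, lintegral_prod _ hjm.enorm.aemeasurable]
        calc _ ≤ ∫⁻ t, ∑ y ∈ Y, ‖φ t y‖ₑ * (ofReal (duhamelConst K) * M) := by
              refine lintegral_mono fun t => ?_
              refine (lintegral_mono fun s => enorm_sum_le Y
                fun y => conj (φ t y) * H y t s).trans ?_
              rw [lintegral_finsetSum _ fun y _ => ((hm y t).const_mul _).enorm]
              refine sum_le_sum fun y _ => ?_
              simp_rw [enorm_mul, RCLike.enorm_conj]
              rw [lintegral_const_mul' _ _ (by finiteness)]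
              gcongr
              exact hone y t
          _ = ∑ y ∈ Y, (∫⁻ t, ‖φ t y‖ₑ) * (ofReal (duhamelConst K) * M) := by
              rw [lintegral_finsetSum _ fun y _ => ((hφ.measurable y).enorm.mul_const _)]
              simp_rw [lintegral_mul_const' _ _ hfin]
          _ < ∞ := by
              refine ENNReal.sum_lt_top.mpr fun y _ => ENNReal.mul_lt_top ?_ hfin.lt_top
              exact (hφ.integrable y).hasFiniteIntegral
      have h1 : ∫ t, ∑ y ∈ Y, conj (φ t y) * ∫ s, H y t s =
          ∫ s, ∫ t, ∑ y ∈ Y, conj (φ t y) * H y t s := by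
        rw [← integral_integral_swap hj]
        congr with t
        rw [integral_finsetSum _ fun y _ => (hint y t).const_mul _]
        simp_rw [integral_const_mul]
      rw [h1]
      have h2 := (enorm_integral_le_lintegral_enorm _).trans
        (lintegral_enorm_test_version_le hv hv' hq hr hadm hqq hrr hF hT hHm hH hφ Y)
      refine (pow_le_pow_left₀ zero_le h2 2).trans (le_of_eq ?_)
      rw [mul_pow, mul_pow, mul_pow, ← ENNReal.rpow_two (_ ^ (1 / 2 : ℝ)), ← ENNReal.rpow_mul,
        testNormSq]
      norm_num
      ring

end Version

/-- The retarded integral of the source terms is dominated by a function obeying endpoint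
bounds, even if it depends on time in a non-measurable way. -/
theorem exists_endpointBound_duhamel (hv : DispersiveFamily v K)
    (hv' : DispersiveFamily v' K)
    (hvv : ∀ s x y, inner ℂ (v s x) (v s y) = inner ℂ (v' s x) (v' s y))
    (hq : 2 ≤ q) (hr : 2 ≤ r)
    (hadm : 1 / q ≤ 7 / 6 * (1 / 2 - 1 / r)) (hqq : 1 / q + 1 / q' = 1)
    (hrr : 1 / r + 1 / r' = 1)
    (hF : lqNorm q' (fun s => eLpNorm (F s) r' count) ≠ ∞) {P : ℝ → ℝ → ι → ℂ}
    (hP : ∀ s, eLpNorm (F s) 2 count ≠ ∞ → ∀ t x,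
      P t s x = sourcePairing v v' F s (v t x) (v' t x)) :
    ∃ U : ℝ → ι → ℂ, EndpointBound U (ofReal (duhamelConst K) *
      lqNorm q' (fun s => eLpNorm (F s) r' count)) ∧
      ∀ t, 0 < t → ∀ x, ‖∫ s in (0 : ℝ)..t, P t s x‖ ≤ ‖U t x‖ := by
  have hr'0 : r' ≠ 0 := by rintro rfl; simp at hrr
  have hq'0 : q' ≠ 0 := by rintro rfl; simp at hqq
  have hq't : q' ≠ ∞ := ne_top_of_le_ne_top (by finiteness) (exponent_le_two hq hqq)
  have hF2 : ∀ s, eLpNorm (F s) r' count ≠ ∞ → eLpNorm (F s) 2 count ≠ ∞ :=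
    fun s hs => ne_top_of_le_ne_top hs
      (eLpNorm_count_le_of_le hr'0 (exponent_le_two hr hrr) _)
  have hdiag : ∀ s, eLpNorm (F s) 2 count ≠ ∞ → ∀ x,
      sourcePairing v v' F s (v s x) (v' s x) = 0 := fun s hs x => by
    rw [sourcePairing, sub_eq_zero]
    refine (hv.hasSum_inner_sourceVec hs _).unique ?_
    simp_rw [hvv]
    exact hv'.hasSum_inner_sourceVec hs _
  set g : ι → ℝ → ℝ → ℂ := fun x t s => (Ioc 0 t).indicator (fun s => P t s x) s with hgd
  have hg : ∀ x s, eLpNorm (F s) r' count ≠ ∞ → Continuous fun t => g x t s :=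
    fun x s hs => by
    rcases le_or_gt s 0 with h | h
    · have : (fun t => g x t s) = fun _ => 0 := by
        funext t
        exact indicator_of_notMem (fun hx => hx.1.not_ge h) _
      rw [this]
      exact continuous_const
    · have : (fun t => g x t s) = fun t =>
          sourcePairing v v' F s (v (max t s) x) (v' (max t s) x) := by
        funext t
        rcases le_or_gt s t with hst | hst
        · rw [max_eq_left hst, hgd]
          simp only [indicator_of_mem (show s ∈ Ioc 0 t from ⟨h, hst⟩)]
          exact hP s (hF2 s hs) t x
        · rw [max_eq_right hst.le, hdiag s (hF2 s hs) x]
          exact indicator_of_notMem (fun hx => hx.2.not_gt hst) _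
      rw [this]
      have hc : Continuous fun t : ℝ => max t s := by fun_prop
      exact (((hv.continuous x).comp hc).inner continuous_const).sub
        (((hv'.continuous x).comp hc).inner continuous_const)
  choose T H hT hHm hHev hHle using fun x => exists_measurable_version (hg x)
    fun B hB h => measure_eq_zero_of_ae_eq_top hq'0 hq't hF hB h
  refine ⟨fun t x => ∫ s, H x t s, endpointBound_integral_version hv hv' hq hr hadm hqq hrr hF
    hT hHm ?_, fun t ht x => ?_⟩
  · filter_upwards [ae_all_iff.mpr hHev] with s hs hNs x t
    rw [hs x hNs t]
    by_cases h : t ∈ T x ∧ 0 < s ∧ s ≤ t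
    · rw [indicator_of_mem h.1, indicator_of_mem (by exact h), hgd]
      simp only [indicator_of_mem (show s ∈ Ioc 0 t from h.2)]
      exact hP s (hF2 s hNs) t x
    · have h0 : t ∉ {t | t ∈ T x ∧ 0 < s ∧ s ≤ t} := h
      rw [indicator_of_notMem h0]
      by_cases hx : t ∈ T x
      · rw [indicator_of_mem hx]
        exact indicator_of_notMem (s := Ioc 0 t) (fun h' => h ⟨hx, h'⟩) _
      · rw [indicator_of_notMem hx]
  · refine le_trans (le_of_eq ?_) (hHle x t)
    rw [integral_of_le ht.le, ← integral_indicator measurableSet_Ioc]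

end Duhamel

lemma enorm_tsum_smul_le {ι : Type*} [MeasurableSpace ι] [MeasurableSingletonClass ι]
    {𝓗 : Type*} [NormedAddCommGroup 𝓗] [InnerProductSpace ℂ 𝓗] [CompleteSpace 𝓗] {e : ι → 𝓗}
    {K : ℝ} {f : ι → ℂ}
    (he : ∀ (c : ι → ℂ) (X : Finset ι), ‖∑ x ∈ X, c x • e x‖ ^ 2 ≤ K * ∑ x ∈ X, ‖c x‖ ^ 2)
    (hK : 0 < K) (hf : eLpNorm f 2 count ≠ ∞) :
    ‖∑' x, f x • e x‖ₑ ≤ ofReal (√K) * eLpNorm f 2 count := by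
  refine (pow_le_pow_left_iff two_ne_zero).mp ((enorm_tsum_smul_sq_le he hK hf).trans ?_)
  rw [mul_pow, ← ofReal_pow (sqrt_nonneg _), sq_sqrt hK.le]

lemma exists_endpointBound_cosProp : ∃ C : ℝ≥0∞, C ≠ ∞ ∧ ∀ f : (Fin 3 → ℤ) → ℂ,
    eLpNorm f 2 count ≠ ∞ →
      EndpointBound (fun t x => cosProp 3 t f x) (C * eLpNorm f 2 count) := by
  obtain ⟨K, hK, hK'⟩ := exists_dispersiveFamily_kgWave
  have hB : (0 : ℝ) < (4 ^ |(1 / 2 : ℝ)|) ^ 2 * (2 * π) ^ 3 := by positivity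
  set B : ℝ := (4 ^ |(1 / 2 : ℝ)|) ^ 2 * (2 * π) ^ 3
  refine ⟨‖(((2 * (2 * π) ^ 3)⁻¹ : ℝ) : ℂ)‖ₑ * (ofReal (familyConst K) *
    ofReal (√B) + ofReal (familyConst K) * ofReal (√B)),
    by finiteness, fun f hf => ?_⟩
  simp_rw [cosProp_eq_inner hf]
  have h := enorm_tsum_smul_le (norm_sum_kgVec_sq_le 0 (1 / 2)) hB hf
  refine (((hK'.endpointBound_inner _).add (hK.endpointBound_inner _)).const_mul _).mono_const ?_
  rw [mul_assoc, add_mul, mul_assoc]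
  gcongr

lemma exists_endpointBound_sinProp : ∃ C : ℝ≥0∞, C ≠ ∞ ∧ ∀ f : (Fin 3 → ℤ) → ℂ,
    eLpNorm f 2 count ≠ ∞ →
      EndpointBound (fun t x => sinProp 3 t f x) (C * eLpNorm f 2 count) := by
  obtain ⟨K, hK, hK'⟩ := exists_dispersiveFamily_kgWave
  refine ⟨‖((((2 * (2 * π) ^ 3)⁻¹ : ℝ) : ℂ) * -I)‖ₑ * (ofReal (familyConst K) *
    ofReal (√K) + ofReal (familyConst K) * ofReal (√K)),
    by finiteness, fun f hf => ?_⟩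
  have e : (fun t x => sinProp 3 t f x) = fun t x => sinProp 3 (t - 0) f x := by
    simp only [sub_zero]
  rw [e]
  simp_rw [sinProp_eq_inner hf]
  have h := enorm_tsum_smul_le (hK.bessel 0) hK.pos hf
  have h' := enorm_tsum_smul_le (hK'.bessel 0) hK.pos hf
  refine (((hK'.endpointBound_inner _).sub (hK.endpointBound_inner _)).const_mul _).mono_const ?_
  rw [mul_assoc, add_mul, mul_assoc]
  gcongr

lemma sinProp_neg (t : ℝ) (f : (Fin 3 → ℤ) → ℂ) (x : Fin 3 → ℤ) :
    sinProp 3 (-t) f x = -sinProp 3 t f x := by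
  unfold sinProp multKernel
  rw [← tsum_neg]
  refine tsum_congr fun y => ?_
  simp only [neg_mul, sin_neg, neg_div, ofReal_neg, mul_neg, integral_neg]

lemma EndpointBound.ofReal_norm {ι : Type*} [MeasurableSpace ι] {w : ℝ → ι → ℂ} {D : ℝ≥0∞}
    (h : EndpointBound w D) : EndpointBound (fun t x => ((‖w t x‖ : ℝ) : ℂ)) D :=
  h.of_norm_le (fun x => measurable_ofReal.comp (h.measurable x).norm) fun t x => by simp

lemma exists_endpointBound_forced {q r q' r' : ℝ≥0∞} (hq : 2 ≤ q) (hr : 2 ≤ r)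
    (hadm : 1 / q ≤ 7 / 6 * (1 / 2 - 1 / r)) (hqq : 1 / q + 1 / q' = 1)
    (hrr : 1 / r + 1 / r' = 1) :
    ∃ C : ℝ≥0∞, C ≠ ∞ ∧ ∀ F : ℝ → (Fin 3 → ℤ) → ℂ, mixedNorm 3 q' r' F ≠ ∞ →
      ∃ U : ℝ → (Fin 3 → ℤ) → ℂ, EndpointBound U (C * mixedNorm 3 q' r' F) ∧
        ∀ t, 0 < t → ∀ x, ‖∫ s in (0 : ℝ)..t, sinProp 3 (t - s) (F s) x‖ ≤ ‖U t x‖ := by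
  obtain ⟨K, hK, hK'⟩ := exists_dispersiveFamily_kgWave
  set κ : ℂ := (((2 * (2 * π) ^ 3)⁻¹ : ℝ) : ℂ) * -I with hκ
  have hκ0 : κ ≠ 0 := by simp_all
  refine ⟨‖κ‖ₑ * ofReal (duhamelConst K), by finiteness, fun F hF => ?_⟩
  obtain ⟨U, hU, hle⟩ := exists_endpointBound_duhamel (P := fun t s x =>
    κ⁻¹ * sinProp 3 (t - s) (F s) x) hK' hK
    (fun s x y => by simp only [inner_kgWave, sub_self]) hq hr hadm hqq hrr hF
    (fun s hs t x => by
      rw [sinProp_eq_inner hs, inv_mul_cancel_left₀ hκ0]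
      rfl)
  refine ⟨fun t x => κ * U t x, (hU.const_mul κ).mono_const (mul_assoc _ _ _).ge,
    fun t ht x => ?_⟩
  have h := hle t ht x
  rw [intervalIntegral.integral_const_mul, norm_mul, norm_inv,
    inv_mul_le_iff₀ (norm_pos_iff.mpr hκ0)] at h
  rwa [norm_mul]

lemma lqNorm_mono {q : ℝ≥0∞} {g g' : ℝ → ℝ≥0∞} (h : ∀ t, g t ≤ g' t) :
    lqNorm q g ≤ lqNorm q g' := by
  unfold lqNorm
  split_ifs
  · exact essSup_mono_ae (.of_forall h)
  · gcongr
    exact h _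

lemma mixedNorm_comp_neg {q r : ℝ≥0∞} (hq : q ≠ ∞) (F : ℝ → (Fin 3 → ℤ) → ℂ) :
    mixedNorm 3 q r (fun t => F (-t)) = mixedNorm 3 q r F := by
  rw [mixedNorm, mixedNorm, lqNorm, lqNorm, if_neg hq, if_neg hq]
  congr 1
  exact (Measure.measurePreserving_neg (volume : Measure ℝ)).lintegral_comp_emb
    (MeasurableEquiv.neg ℝ).measurableEmbedding
      fun t => eLpNorm (F t) r count ^ q.toReal

lemma integral_sinProp_neg (t : ℝ) (F : ℝ → (Fin 3 → ℤ) → ℂ) (x : Fin 3 → ℤ) :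
    ∫ s in (0 : ℝ)..t, sinProp 3 (t - s) (F s) x =
      ∫ s in (0 : ℝ)..(-t), sinProp 3 (-t - s) (F (-s)) x := by
  have h := intervalIntegral.integral_comp_neg (a := 0) (b := t)
    fun s => sinProp 3 (-t - s) (F (-s)) x
  rw [neg_zero, integral_symm 0 (-t)] at h
  refine Eq.trans ?_ (neg_eq_iff_eq_neg.mpr h)
  rw [← intervalIntegral.integral_neg]
  refine integral_congr fun s _ => ?_
  simp only [neg_neg]
  rw [show -t - -s = -(t - s) by ring, sinProp_neg, neg_neg]

end

/-- Strichartz estimates for the discrete Klein--Gordon equation in dimension `d = 3`: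
for `q, r, q̄, r̄ ≥ 2` with `1/q ≤ (7/6)(1/2 − 1/r)` and `1/q̄ ≤ (7/6)(1/2 − 1/r̄)`,
the solution given by Duhamel's formula satisfies
`‖u‖_{L^q_t ℓ^r_x} ≤ C(‖f‖_{ℓ²} + ‖g‖_{ℓ²} + ‖F‖_{L^{q̄'}_t ℓ^{r̄'}_x})`. -/
theorem strichartz_d3 (q r qb rb qb' rb' : ℝ≥0∞)
    (hq : 2 ≤ q) (hr : 2 ≤ r) (hqb : 2 ≤ qb) (hrb : 2 ≤ rb)
    (hadm : 1/q ≤ 7/6 * (1/2 - 1/r))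
    (hadmb : 1/qb ≤ 7/6 * (1/2 - 1/rb))
    (hqb' : 1/qb + 1/qb' = 1) (hrb' : 1/rb + 1/rb' = 1) :
    ∃ C : ℝ, 0 < C ∧
      ∀ (f g : (Fin 3 → ℤ) → ℂ) (F : ℝ → (Fin 3 → ℤ) → ℂ),
        Memℓp f 2 → Memℓp g 2 → mixedNorm 3 qb' rb' F ≠ ∞ →
        mixedNorm 3 q r (fun t => duhamel 3 t f g F) ≤
          ENNReal.ofReal C *
            (eLpNorm f 2 Measure.count + eLpNorm g 2 Measure.count
              + mixedNorm 3 qb' rb' F) := by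
  obtain ⟨C₀, hC₀, hcos⟩ := exists_endpointBound_cosProp
  obtain ⟨C₁, hC₁, hsin⟩ := exists_endpointBound_sinProp
  obtain ⟨C₂, hC₂, hforced⟩ := exists_endpointBound_forced hqb hrb hadmb hqb' hrb'
  have hqt : qb' ≠ ∞ := ne_top_of_le_ne_top (by finiteness) (exponent_le_two hqb hqb')
  set C := C₀ + C₁ + (C₂ + C₂) with hC
  have hCt : C ≠ ∞ := by finiteness
  have hCle : C ≤ ENNReal.ofReal (C.toReal + 1) := by
    rw [ENNReal.le_ofReal_iff_toReal_le hCt (by positivity)]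
    linarith
  refine ⟨C.toReal + 1, by positivity, fun f g F _ _ hF => ?_⟩
  have hpos : ENNReal.ofReal (C.toReal + 1) ≠ 0 := by
    rw [ENNReal.ofReal_ne_zero_iff]
    positivity
  rcases eq_or_ne (eLpNorm f 2 Measure.count) ∞ with hf | hf
  · simp [hf, ENNReal.mul_top hpos]
  rcases eq_or_ne (eLpNorm g 2 Measure.count) ∞ with hg | hg
  · simp [hg, ENNReal.mul_top hpos]
  obtain ⟨U, hU, hUle⟩ := hforced F hF
  obtain ⟨V, hV, hVle⟩ := hforced (fun t => F (-t)) (by rwa [mixedNorm_comp_neg hqt])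
  rw [mixedNorm_comp_neg hqt] at hV
  have hw := ((hcos f hf).add (hsin g hg)).ofReal_norm.add
    (hU.ofReal_norm.add hV.comp_neg.ofReal_norm)
  refine (lqNorm_mono fun t => eLpNorm_mono fun x => ?_).trans
    ((hw.lqNorm_le (by finiteness) hq hr hadm).trans ?_)
  · rw [← Complex.ofReal_add, ← Complex.ofReal_add, Complex.norm_real,
      Real.norm_of_nonneg (by positivity), duhamel]
    refine (norm_add_le _ _).trans (add_le_add_right ?_ _)
    rcases lt_trichotomy t 0 with ht | rfl | ht
    · rw [integral_sinProp_neg]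
      exact (hVle (-t) (by linarith) x).trans (le_add_of_nonneg_left (norm_nonneg _))
    · rw [intervalIntegral.integral_same, norm_zero]
      positivity
    · exact (hUle t ht x).trans (le_add_of_nonneg_right (norm_nonneg _))
  · refine le_trans ?_ (mul_le_mul_left hCle _)
    generalize eLpNorm f 2 Measure.count = a
    generalize eLpNorm g 2 Measure.count = b
    generalize mixedNorm 3 qb' rb' F = M
    calc _ = C₀ * a + C₁ * b + (C₂ + C₂) * M := by ring
      _ ≤ C * a + C * b + C * M := by
          gcongr
          · rw [hC, add_assoc]; exact le_self_add
          · rw [hC, add_comm C₀, add_assoc]; exact le_self_add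
          · exact le_add_self
      _ = _ := by ring
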